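/- Assume dim R = d ≥ 2 and let u be the unmixed component of R. Then the following are equivalent: (1) R/u is generalized Cohen-Macaulay and dim u ≤ d − 2; (2) there exists an integer t ≥ 1 such that the set Ω^t_1(R) = { e_1(q :_R m, R) : q a C-parameter ideal of R contained in m^t } is finite. -/

import Mathlib

/-! Preliminary definitions: lengths, dimensions, (C-)systems of parameters, Hilbert
coefficients, irreducible multiplicities, local cohomology invariants, stable values,
unmixedness, the unmixed component, and the g-invariant. -/

open CategoryTheory CategoryTheory.Limits Opposite IsLocalRing

universe u

noncomputable section

section Definitions

variable (R : Type u) [CommRing R]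

/-- The length of an `R`-module, defined as the Krull dimension of its submodule lattice. -/
def moduleLength (M : Type u) [AddCommGroup M] [Module R M] : WithBot ℕ∞ :=
  Order.krullDim (Submodule R M)

/-- The Krull dimension of an `R`-module `M`, i.e. `dim (R / Ann M)`. -/
def moduleDim (M : Type u) [AddCommGroup M] [Module R M] : WithBot ℕ∞ :=
  ringKrullDim (R ⧸ Module.annihilator R M)

/-- The colon submodule `(N :_M I) = {x : M | I • x ⊆ N}`. -/
def modColon {M : Type u} [AddCommGroup M] [Module R M] (N : Submodule R M) (I : Ideal R) :
    Submodule R M where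
  carrier := {x | ∀ r ∈ I, r • x ∈ N}
  add_mem' := by
    intro a b ha hb r hr
    simpa [smul_add] using N.add_mem (ha r hr) (hb r hr)
  zero_mem' := by
    intro r hr
    simpa using N.zero_mem
  smul_mem' := by
    intro c a ha r hr
    rw [smul_comm]
    exact N.smul_mem c (ha r hr)

/-- `x : Fin s → R` is a system of parameters of the module `M`:
`s = dim M`, the `x i` are nonunits, and `M/(x)M` has finite length. -/
def IsSOP (M : Type u) [AddCommGroup M] [Module R M] {s : ℕ} (x : Fin s → R) : Prop :=
  moduleDim R M = (s : WithBot ℕ∞) ∧ (∀ i, x i ∈ nonunits R) ∧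
    IsFiniteLength R (M ⧸ (Ideal.span (Set.range x) • (⊤ : Submodule R M)))

/-- The ideal `b(M)`: the intersection, over all systems of parameters `x` of `M` and all `i`,
of `Ann_R ((0) :_{M/(x_1,...,x_{i-1})M} x_i)`. -/
def bIdeal (M : Type u) [AddCommGroup M] [Module R M] : Ideal R :=
  ⨅ (s : ℕ) (x : Fin s → R) (_ : IsSOP R M x) (i : Fin s),
    (Submodule.torsionBy R
      (M ⧸ (Ideal.span (x '' {j | j < i}) • (⊤ : Submodule R M))) (x i)).annihilator

/-- `x` is a C-system of parameters of `M`: a system of parameters such that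
`x i ∈ b(M/(x_{i+1},...,x_s)M)^3` for every `i` (for `i = s` the quotient is `M` itself). -/
def IsCSOP (M : Type u) [AddCommGroup M] [Module R M] {s : ℕ} (x : Fin s → R) : Prop :=
  IsSOP R M x ∧ ∀ i : Fin s,
    x i ∈ (bIdeal R (M ⧸ (Ideal.span (x '' {j | i < j}) • (⊤ : Submodule R M)))) ^ 3

/-- A parameter ideal of `R`. -/
def IsParamIdeal (q : Ideal R) : Prop :=
  ∃ (s : ℕ) (x : Fin s → R), IsSOP R R x ∧ q = Ideal.span (Set.range x)

/-- A C-parameter ideal of `R`: an ideal generated by a C-system of parameters of `R`. -/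
def IsCParamIdeal (q : Ideal R) : Prop :=
  ∃ (s : ℕ) (x : Fin s → R), IsCSOP R R x ∧ q = Ideal.span (Set.range x)

/-- A C-parameter ideal of a module `M`. -/
def IsCParamIdealMod (M : Type u) [AddCommGroup M] [Module R M] (q : Ideal R) : Prop :=
  ∃ (s : ℕ) (x : Fin s → R), IsCSOP R M x ∧ q = Ideal.span (Set.range x)

/-- `e` is the family of Hilbert coefficients of `M` (of dimension `s`) with respect to `I`:
`ℓ(M/I^{n+1}M) = ∑_{i=0}^{s} (-1)^i (e i) binom(n+s-i, s-i)` for all large `n`. -/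
def IsHilbCoeffMod (I : Ideal R) (M : Type u) [AddCommGroup M] [Module R M] (s : ℕ)
    (e : ℕ → ℤ) : Prop :=
  ∃ N : ℕ, ∀ n ≥ N, ∃ L : ℕ,
    moduleLength R (M ⧸ (I ^ (n + 1) • (⊤ : Submodule R M))) = (L : WithBot ℕ∞) ∧
    (L : ℤ) = ∑ i ∈ Finset.range (s + 1),
      (-1) ^ i * e i * ((n + s - i).choose (s - i) : ℤ)

/-- `e` is the family of Hilbert coefficients of `R` (of dimension `d`) with respect to `I`;
`e 1` is the Chern number of `I`. -/
def IsHilbCoeff (I : Ideal R) (d : ℕ) (e : ℕ → ℤ) : Prop :=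
  IsHilbCoeffMod R I R d e

variable [IsLocalRing R]

/-- The colon ideal `(q :_R m)`. -/
def colonIdeal (q : Ideal R) : Ideal R :=
  modColon R q (maximalIdeal R)

/-- The index of reducibility `ir_M(q) = ℓ((qM :_M m)/qM)`. -/
def irMod (M : Type u) [AddCommGroup M] [Module R M] (q : Ideal R) : WithBot ℕ∞ :=
  moduleLength R
    ↥(Submodule.map (q • (⊤ : Submodule R M)).mkQ
      (modColon R (q • (⊤ : Submodule R M)) (maximalIdeal R)))

/-- `NN` is the stable value `𝒩(M)` of `M`: the common index of reducibility of all
C-parameter ideals of `M`. -/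
def IsStableValueMod (M : Type u) [AddCommGroup M] [Module R M] (NN : ℕ) : Prop :=
  ∀ q : Ideal R, IsCParamIdealMod R M q → irMod R M q = (NN : WithBot ℕ∞)

/-- `NN` is the stable value `𝒩(R)` of `R`. -/
def IsStableValue (NN : ℕ) : Prop :=
  ∀ q : Ideal R, IsCParamIdeal R q → irMod R R q = (NN : WithBot ℕ∞)

/-- `f` is the family of coefficients of the polynomial giving the index of reducibility,
`ir_M(I^{n+1}) = ℓ((I^{n+1}M :_M m)/I^{n+1}M) = ∑_{i=0}^{s-1} (-1)^i (f i) binom(n+s-1-i, s-1-i)`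
for all large `n`; `f 0` is the irreducible multiplicity of `M` with respect to `I`. -/
def IsIrrCoeffMod (I : Ideal R) (M : Type u) [AddCommGroup M] [Module R M] (s : ℕ)
    (f : ℕ → ℤ) : Prop :=
  ∃ N : ℕ, ∀ n ≥ N, ∃ L : ℕ,
    irMod R M (I ^ (n + 1)) = (L : WithBot ℕ∞) ∧
    (L : ℤ) = ∑ i ∈ Finset.range s,
      (-1) ^ i * f i * ((n + s - 1 - i).choose (s - 1 - i) : ℤ)

/-- Ring version of `IsIrrCoeffMod`. -/
def IsIrrCoeff (I : Ideal R) (d : ℕ) (f : ℕ → ℤ) : Prop :=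
  IsIrrCoeffMod R I R d f

/-- The local cohomology module `H^i_m(M)`. -/
def Hmod (M : Type u) [AddCommGroup M] [Module R M] (i : ℕ) : ModuleCat.{u} R :=
  (localCohomology (maximalIdeal R) i).obj (ModuleCat.of R M)

/-- `r_i(M) = ℓ((0) :_{H^i_m(M)} m)`, the length of the socle of `H^i_m(M)`. -/
def rLengthMod (M : Type u) [AddCommGroup M] [Module R M] (i : ℕ) : WithBot ℕ∞ :=
  moduleLength R ↥(Submodule.torsionBySet R ↥(Hmod R M i) ((maximalIdeal R : Ideal R) : Set R))

/-- `r_i(R)`. -/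
def rLength (i : ℕ) : WithBot ℕ∞ := rLengthMod R R i

/-- `M` is a Cohen-Macaulay `R`-module: `H^i_m(M) = 0` for all `i < dim M`. -/
def IsCMMod (M : Type u) [AddCommGroup M] [Module R M] : Prop :=
  ∀ i : ℕ, (i : WithBot ℕ∞) < moduleDim R M → Subsingleton ↥(Hmod R M i)

/-- `R` is a Cohen-Macaulay local ring: `H^i_m(R) = 0` for all `i < dim R`. -/
def IsCMLocal : Prop :=
  ∀ i : ℕ, (i : WithBot ℕ∞) < ringKrullDim R → Subsingleton ↥(Hmod R R i)

/-- `R` is a generalized Cohen-Macaulay local ring: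
`H^i_m(R)` has finite length for all `i < dim R`. -/
def IsGeneralizedCM : Prop :=
  ∀ i : ℕ, (i : WithBot ℕ∞) < ringKrullDim R → IsFiniteLength R ↥(Hmod R R i)

/-- `R` is a Gorenstein local ring: Cohen-Macaulay of type `r_d(R) = 1`, `d = dim R`. -/
def IsGorensteinLocal : Prop :=
  IsCMLocal R ∧ ∀ d : ℕ, ringKrullDim R = (d : WithBot ℕ∞) → rLength R d = (1 : WithBot ℕ∞)

/-- `R` is unmixed: `dim R̂/p = dim R̂` for every associated prime `p` of the
`m`-adic completion `R̂` of `R`. -/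
def IsUnmixedRing : Prop :=
  ∀ p ∈ associatedPrimes (AdicCompletion (maximalIdeal R) R) (AdicCompletion (maximalIdeal R) R),
    ringKrullDim ((AdicCompletion (maximalIdeal R) R) ⧸ p) =
      ringKrullDim (AdicCompletion (maximalIdeal R) R)

/-- `M` is unmixed: `dim R̂/p = dim M̂` for every associated prime `p` of the
`m`-adic completion `M̂` of `M`, viewed over `R̂`. -/
def IsUnmixedMod (M : Type u) [AddCommGroup M] [Module R M] : Prop :=
  ∀ p ∈ associatedPrimes (AdicCompletion (maximalIdeal R) R) (AdicCompletion (maximalIdeal R) M),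
    ringKrullDim ((AdicCompletion (maximalIdeal R) R) ⧸ p) =
      moduleDim (AdicCompletion (maximalIdeal R) R) (AdicCompletion (maximalIdeal R) M)

/-- `H^0_m(M)`, described as the submodule of elements killed by a power of `m`. -/
def H0Sub (M : Type u) [AddCommGroup M] [Module R M] : Submodule R M :=
  ⨆ n : ℕ, Submodule.torsionBySet R M (((maximalIdeal R) ^ n : Ideal R) : Set R)

/-- The unmixed component `u = U_R(0)` of `R`: the largest ideal of dimension `< dim R`. -/
def unmixedComponent : Ideal R := sSup {J : Ideal R | moduleDim R ↥J < ringKrullDim R}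

end Definitions

section CMImage

/-- `R` is a homomorphic image of a Cohen-Macaulay (Noetherian) local ring. -/
def IsHomImageOfCM (R : Type u) [CommRing R] : Prop :=
  ∃ (A : Type u) (_ : CommRing A) (_ : IsLocalRing A) (_ : IsNoetherianRing A),
    IsCMLocal A ∧ ∃ f : A →+* R, Function.Surjective f

end CMImage

section GInvariant

variable (R : Type u) [CommRing R] [IsLocalRing R] [IsNoetherianRing R]

/-- The canonical homomorphism from `Ext^p(R/q, R)` (the term of the directed system indexed by
the ideal `q` with `J ≤ rad q`) into the local cohomology module `H^p_J(R)`, given by the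
structure of `H^p_J(R)` as an inductive limit. -/
def canonicalToLocalCohomology (J q : Ideal R) (h : J ≤ q.radical) (p : ℕ) :
    ((localCohomology.diagram (localCohomology.selfLERadicalDiagram J) p).obj
        (op (⟨q, h⟩ : localCohomology.SelfLERadical J))).obj (ModuleCat.of R R) ⟶
      (localCohomology J p).obj (ModuleCat.of R R) :=
  haveI := localCohomology.hasColimitDiagram.{u, u} (localCohomology.selfLERadicalDiagram J) p
  (colimit.ι (localCohomology.diagram (localCohomology.selfLERadicalDiagram J) p)
      (op (⟨q, h⟩ : localCohomology.SelfLERadical J))).app (ModuleCat.of R R) ≫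
    (localCohomology.isoSelfLERadical J p).hom.app (ModuleCat.of R R)

/-- A map of `R`-modules is surjective on socles. -/
def SurjectiveOnSocles {A B : ModuleCat.{u} R} (φ : A ⟶ B) : Prop :=
  ∀ y ∈ Submodule.torsionBySet R ↥B ((maximalIdeal R : Ideal R) : Set R),
    ∃ z ∈ Submodule.torsionBySet R ↥A ((maximalIdeal R : Ideal R) : Set R), φ z = y

/-- The defining property of the g-invariant: for every system of parameters `x` of `R`
contained in `m^(n₀)` and every `p`, the canonical homomorphism into the local cohomology
module `H^p_m(R)` is surjective on the socles. -/
def GProperty (n₀ : ℕ) : Prop :=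
  ∀ (s : ℕ) (x : Fin s → R), IsSOP R R x → (∀ i, x i ∈ maximalIdeal R ^ n₀) →
    ∀ (h : maximalIdeal R ≤ (Ideal.span (Set.range x)).radical) (p : ℕ),
      SurjectiveOnSocles R
        (canonicalToLocalCohomology R (maximalIdeal R) (Ideal.span (Set.range x)) h p)

/-- The g-invariant `g(R)`: the least `n₀` satisfying `GProperty`. -/
def gInvariant : ℕ := sInf {n₀ : ℕ | GProperty R n₀}

end GInvariant

end

set_option linter.unusedSectionVars false

noncomputable section

namespace ExtComparison
variable {R : Type u} [CommRing R] {X X' Y : ModuleCat.{u} R}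

abbrev oldExt (n : ℕ) (X Y : ModuleCat.{u} R) : ModuleCat.{u} R := ((_root_.Ext R (ModuleCat.{u} R) n).obj (op X)).obj Y

abbrev cplx (P : ProjectiveResolution X) (Y : ModuleCat.{u} R) := P.complex.linearYonedaObj R Y

def cplxMap {P : ProjectiveResolution X} {P' : ProjectiveResolution X'} {g : X' ⟶ X} (φ : P'.Hom P g) (Y : ModuleCat.{u} R) :
   cplx P Y ⟶ cplx P' Y := 
  (HomologicalComplex.unopFunctor _ _).map
    ((((linearYoneda R (ModuleCat.{u} R)).obj Y).rightOp.mapHomologicalComplex _).map φ.hom).op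

lemma isoExt_inv_naturality {P : ProjectiveResolution X} {P' : ProjectiveResolution X'} {g : X' ⟶ X} (φ : P'.Hom P g) (n : ℕ) :
    (P.isoExt n Y).inv ≫ ((_root_.Ext R (ModuleCat.{u} R) n).map g.op).app Y =
     HomologicalComplex.homologyMap (cplxMap φ Y) n ≫ (P'.isoExt n Y).inv := by
  have h1 := ProjectiveResolution.isoLeftDerivedObj_hom_naturality g P' P φ.hom
    (by simpa using φ.hom_f_zero_comp_π_f_zero) ((linearYoneda R (ModuleCat.{u} R)).obj Y).rightOp n
  have h2 := HomologicalComplex.homologyOp_hom_naturality (cplxMap φ Y) (i := n)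
  have h1' := congrArg Quiver.Hom.unop h1
  have h2' := congrArg Quiver.Hom.unop h2
  simp only [unop_comp] at h1' h2'
  rw [ProjectiveResolution.isoExt, ProjectiveResolution.isoExt]
  refine (congrArg (fun t => (HomologicalComplex.homologyUnop _ n).hom ≫ t) h1').trans ?_
  exact (Category.assoc _ _ _).symm.trans ((congrArg (fun t => t ≫ (P'.isoLeftDerivedObj ((linearYoneda R (ModuleCat.{u} R)).obj Y).rightOp n).unop.hom) h2').trans (Category.assoc _ _ _))

def spanHom {M : ModuleCat.{u} R} (m : M) : ModuleCat.of R R ⟶ M :=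
  ModuleCat.ofHom (LinearMap.toSpanSingleton R M m)

lemma spanHom_comp {M N : ModuleCat.{u} R} (m : M) (f : M ⟶ N) : spanHom m ≫ f = spanHom (f m) := by
  ext; simp [spanHom]

variable (P : ProjectiveResolution X)

def toX (n : ℕ) (f : P.complex.X n ⟶ Y) : (cplx P Y).X n := f

lemma toX_inj (n : ℕ) {f g : P.complex.X n ⟶ Y} (h : toX P n f = toX P n g) : f = g := h

lemma toX_surj (n : ℕ) (z : (cplx P Y).X n) : ∃ f : P.complex.X n ⟶ Y, toX P n f = z := ⟨z, rfl⟩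

lemma toX_add (n : ℕ) (f g : P.complex.X n ⟶ Y) : toX P n (f + g) = toX P n f + toX P n g := rfl

lemma toX_smul (n : ℕ) (r : R) (f : P.complex.X n ⟶ Y) : toX P n (r • f) = r • toX P n f := rfl

lemma toX_zero (n : ℕ) : toX P n (0 : P.complex.X n ⟶ Y) = 0 := rfl

lemma d_toX (n m : ℕ) (f : P.complex.X n ⟶ Y) :
    (cplx P Y).d n m (toX P n f) = toX P m (P.complex.d m n ≫ f) := rfl

lemma cplxMap_toX {P : ProjectiveResolution X} {P' : ProjectiveResolution X'} {g : X' ⟶ X} (φ : P'.Hom P g) (n : ℕ)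
    (f : P.complex.X n ⟶ Y) : (cplxMap φ Y).f n (toX P n f) = toX P' n (φ.hom.f n ≫ f) := rfl

lemma exists_cocyc (n : ℕ) (f : P.complex.X n ⟶ Y) (hf : P.complex.d (n+1) n ≫ f = 0) :
    ∃ z : (cplx P Y).cycles n, (cplx P Y).iCycles n z = toX P n f := by
  refine ⟨((cplx P Y).liftCycles (spanHom (toX P n f)) (n+1) (by simp) (by
    rw [spanHom_comp, d_toX, hf, toX_zero]; ext; simp [spanHom])).hom (1 : R), ?_⟩
  rw [← ModuleCat.comp_apply, HomologicalComplex.liftCycles_i]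
  simp [spanHom]

def cocyc (n : ℕ) (f : P.complex.X n ⟶ Y) (hf : P.complex.d (n+1) n ≫ f = 0) : (cplx P Y).cycles n :=
  (exists_cocyc P n f hf).choose

lemma iCycles_cocyc (n : ℕ) (f : P.complex.X n ⟶ Y) (hf : P.complex.d (n+1) n ≫ f = 0) :
    (cplx P Y).iCycles n (cocyc P n f hf) = toX P n f :=
  (exists_cocyc P n f hf).choose_spec

lemma iCycles_inj (n : ℕ) : Function.Injective ((cplx P Y).iCycles n) :=
  (ModuleCat.mono_iff_injective _).1 inferInstance

lemma cocyc_surj (n : ℕ) (z : (cplx P Y).cycles n) :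
    ∃ f hf, cocyc P n f hf = z := by
  obtain ⟨f, hf⟩ := toX_surj P n ((cplx P Y).iCycles n z)
  have h0 : P.complex.d (n+1) n ≫ f = 0 := by
    apply toX_inj P (n+1)
    rw [← d_toX, hf, ← ModuleCat.comp_apply, HomologicalComplex.iCycles_d]; rfl
  refine ⟨f, h0, ?_⟩
  apply iCycles_inj
  rw [iCycles_cocyc, hf]

def oldMk (n : ℕ) (f : P.complex.X n ⟶ Y) (hf : P.complex.d (n+1) n ≫ f = 0) : oldExt n X Y :=
  (P.isoExt n Y).inv ((cplx P Y).homologyπ n (cocyc P n f hf))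

lemma oldMk_surj (n : ℕ) (z : oldExt n X Y) : ∃ f hf, oldMk P n f hf = z := by
  have h1 : Function.Surjective ((cplx P Y).homologyπ n) := (ModuleCat.epi_iff_surjective _).1 inferInstance
  obtain ⟨w, hw⟩ := h1 ((P.isoExt n Y).hom z)
  obtain ⟨f, hf, rfl⟩ := cocyc_surj P n w
  refine ⟨f, hf, ?_⟩
  rw [oldMk, hw, ← ModuleCat.comp_apply]
  simp

lemma oldMk_map {P : ProjectiveResolution X} {P' : ProjectiveResolution X'} {g : X' ⟶ X} (φ : P'.Hom P g) (n : ℕ)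
    (f : P.complex.X n ⟶ Y) (hf : P.complex.d (n+1) n ≫ f = 0) :
    ((_root_.Ext R (ModuleCat.{u} R) n).map g.op).app Y (oldMk P n f hf) =
      oldMk P' n (φ.hom.f n ≫ f) (by rw [← φ.hom.comm_assoc, hf, comp_zero]) := by
  rw [oldMk, ← ModuleCat.comp_apply, isoExt_inv_naturality φ n, ModuleCat.comp_apply, oldMk]
  congr 1
  rw [← ModuleCat.comp_apply, HomologicalComplex.homologyπ_naturality, ModuleCat.comp_apply]
  congr 1
  apply iCycles_inj
  rw [iCycles_cocyc, ← ModuleCat.comp_apply, HomologicalComplex.cyclesMap_i, ModuleCat.comp_apply, iCycles_cocyc,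
    cplxMap_toX]

lemma oldMk_add (n : ℕ) (f f' : P.complex.X n ⟶ Y) (hf hf') :
    oldMk P n (f + f') (by rw [Preadditive.comp_add, hf, hf', add_zero]) = oldMk P n f hf + oldMk P n f' hf' := by
  rw [oldMk, oldMk, oldMk, ← map_add, ← map_add]
  congr 2
  apply iCycles_inj
  rw [map_add]
  simp only [iCycles_cocyc, toX_add]

lemma oldMk_smul (n : ℕ) (r : R) (f : P.complex.X n ⟶ Y) (hf) :
    oldMk P n (r • f) (by rw [Linear.comp_smul, hf, smul_zero]) = r • oldMk P n f hf := by
  rw [oldMk, oldMk, ← map_smul, ← map_smul]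
  congr 2
  apply iCycles_inj
  rw [map_smul]
  simp only [iCycles_cocyc, toX_smul]

lemma oldMk_eq_zero_iff (n : ℕ) (f : P.complex.X n ⟶ Y) (hf) :
    oldMk P n f hf = 0 ↔ ∃ g : P.complex.X ((ComplexShape.up ℕ).prev n) ⟶ Y, P.complex.d n _ ≫ g = f := by
  have h0 : oldMk P n f hf = 0 ↔ (cplx P Y).homologyπ n (cocyc P n f hf) = 0 := by
    rw [oldMk]
    constructor
    · intro h
      have := congrArg (P.isoExt n Y).hom h
      rw [← ModuleCat.comp_apply] at this
      simpa using this
    · intro h; rw [h, map_zero]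
  rw [h0]
  have hex := ShortComplex.exact_of_g_is_cokernel (ShortComplex.mk ((cplx P Y).toCycles ((ComplexShape.up ℕ).prev n) n)
    ((cplx P Y).homologyπ n) (by simp)) ((cplx P Y).homologyIsCokernel _ n rfl)
  rw [ShortComplex.moduleCat_exact_iff] at hex
  constructor
  · intro h
    obtain ⟨g, hg⟩ := hex _ h
    obtain ⟨g, rfl⟩ := toX_surj P _ g
    refine ⟨g, ?_⟩
    have := congrArg ((cplx P Y).iCycles n) hg
    dsimp only at this
    rw [← ModuleCat.comp_apply, HomologicalComplex.toCycles_i, iCycles_cocyc, d_toX] at this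
    exact toX_inj _ _ this
  · rintro ⟨g, rfl⟩
    have : cocyc P n _ hf = (cplx P Y).toCycles ((ComplexShape.up ℕ).prev n) n (toX P _ g) := by
      apply iCycles_inj
      rw [iCycles_cocyc, ← ModuleCat.comp_apply, HomologicalComplex.toCycles_i]
      rfl
    rw [this, ← ModuleCat.comp_apply, HomologicalComplex.toCycles_comp_homologyπ]
    rfl

lemma extMk_eq_zero_iff' (n : ℕ) (f : P.complex.X n ⟶ Y) (hf) :
    P.extMk f (n+1) rfl hf = 0 ↔ ∃ g : P.complex.X ((ComplexShape.up ℕ).prev n) ⟶ Y, P.complex.d n _ ≫ g = f := by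
  cases n with
  | zero =>
    have hd : ∀ k, P.complex.d 0 k = 0 := fun k => P.complex.shape _ _ (by simp)
    simp only [hd, zero_comp, exists_const]
    constructor
    · intro h
      rw [ProjectiveResolution.extMk, ← P.extEquivCohomologyClass_symm_zero, Equiv.apply_eq_iff_eq,
        CochainComplex.HomComplex.CohomologyClass.mk_eq_zero_iff,
        CochainComplex.HomComplex.Cocycle.toSingleMk_mem_coboundaries_iff _ _ _ _ _ 1 (by simp)] at h
      obtain ⟨g, hg⟩ := h
      have h2 : P.cochainComplex.d (-((0:ℕ):ℤ)) 1 = 0 := by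
        apply IsZero.eq_of_tgt
        exact CochainComplex.isZero_of_isStrictlyLE _ 0 1 (by simp)
      rw [h2, zero_comp] at hg
      rw [← cancel_epi (P.cochainComplexXIso (-((0:ℕ):ℤ)) 0 rfl).hom, ← hg, comp_zero]
    · rintro h; subst h; exact P.extMk_zero _ _
  | succ n =>
    have : (ComplexShape.up ℕ).prev (n+1) = n := by simp
    rw [this]
    exact P.extMk_eq_zero_iff f (n+2) rfl hf n rfl

lemma extMk_smul (n : ℕ) (r : R) (f : P.complex.X n ⟶ Y) (hf) :
    P.extMk (r • f) (n+1) rfl (by rw [Linear.comp_smul, hf, smul_zero]) = r • P.extMk f (n+1) rfl hf := by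
  rw [Abelian.Ext.smul_eq_comp_mk₀, ProjectiveResolution.extMk_comp_mk₀]
  congr 1

def cocycles (n : ℕ) (Y : ModuleCat.{u} R) : Submodule R (P.complex.X n ⟶ Y) :=
  LinearMap.ker (Linear.leftComp R Y (P.complex.d (n+1) n))

def oldMkL (n : ℕ) (Y : ModuleCat.{u} R) : cocycles P n Y →ₗ[R] oldExt n X Y where
  toFun f := oldMk P n f.1 f.2
  map_add' _ _ := oldMk_add P n _ _ _ _
  map_smul' _ _ := oldMk_smul P n _ _ _

def newMkL (n : ℕ) (Y : ModuleCat.{u} R) : cocycles P n Y →ₗ[R] Abelian.Ext X Y n where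
  toFun f := P.extMk f.1 (n+1) rfl f.2
  map_add' f g := (P.add_extMk f.1 g.1 (n+1) rfl f.2 g.2).symm
  map_smul' _ _ := extMk_smul P n _ _ _

lemma ker_oldMkL (n : ℕ) (Y : ModuleCat.{u} R) :
    LinearMap.ker (oldMkL P n Y) = LinearMap.ker (newMkL P n Y) := by
  ext f
  exact (oldMk_eq_zero_iff P n f.1 f.2).trans (extMk_eq_zero_iff' P n f.1 f.2).symm

lemma oldMkL_surj (n : ℕ) (Y : ModuleCat.{u} R) : Function.Surjective (oldMkL P n Y) := fun z => by
  obtain ⟨f, hf, rfl⟩ := oldMk_surj P n z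
  exact ⟨⟨f, hf⟩, rfl⟩

lemma newMkL_surj (n : ℕ) (Y : ModuleCat.{u} R) : Function.Surjective (newMkL P n Y) := fun z => by
  obtain ⟨f, hf, rfl⟩ := P.extMk_surjective z (n+1) rfl
  exact ⟨⟨f, hf⟩, rfl⟩

def compEquivAux (n : ℕ) (Y : ModuleCat.{u} R) : oldExt n X Y ≃ₗ[R] Abelian.Ext X Y n :=
  ((oldMkL P n Y).quotKerEquivOfSurjective (oldMkL_surj P n Y)).symm ≪≫ₗ
    Submodule.quotEquivOfEq _ _ (ker_oldMkL P n Y) ≪≫ₗ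
    (newMkL P n Y).quotKerEquivOfSurjective (newMkL_surj P n Y)

lemma compEquivAux_mk (n : ℕ) (f : P.complex.X n ⟶ Y) (hf) :
    compEquivAux P n Y (oldMk P n f hf) = P.extMk f (n+1) rfl hf := by
  have : oldMk P n f hf = (oldMkL P n Y).quotKerEquivOfSurjective (oldMkL_surj P n Y)
      (Submodule.Quotient.mk ⟨f, hf⟩) := rfl
  rw [this, compEquivAux, LinearEquiv.trans_apply, LinearEquiv.trans_apply, LinearEquiv.symm_apply_apply]
  rfl

lemma compEquivAux_nat (P : ProjectiveResolution X) (P' : ProjectiveResolution X') (g : X' ⟶ X) (n : ℕ)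
    (z : oldExt n X Y) :
    compEquivAux P' n Y (((_root_.Ext R (ModuleCat.{u} R) n).map g.op).app Y z) =
      (Abelian.Ext.mk₀ g).comp (compEquivAux P n Y z) (zero_add n) := by
  obtain ⟨f, hf, rfl⟩ := oldMk_surj P n z
  let φ : P'.Hom P g := ⟨ProjectiveResolution.lift g P' P, by
    simpa using ProjectiveResolution.lift_commutes_zero g P' P⟩
  rw [oldMk_map φ, compEquivAux_mk, compEquivAux_mk, ProjectiveResolution.mk₀_comp_extMk (φ := φ)]

def compEquiv (n : ℕ) (X Y : ModuleCat.{u} R) : oldExt n X Y ≃ₗ[R] Abelian.Ext X Y n :=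
  compEquivAux (ProjectiveResolution.of X) n Y

lemma compEquiv_nat (g : X' ⟶ X) (n : ℕ) (z : oldExt n X Y) :
    compEquiv n X' Y (((_root_.Ext R (ModuleCat.{u} R) n).map g.op).app Y z) =
      (Abelian.Ext.mk₀ g).comp (compEquiv n X Y z) (zero_add n) :=
  compEquivAux_nat _ _ _ _ _

end ExtComparison

end

noncomputable section

namespace LCoh
open ExtComparison
variable {R : Type u} [CommRing R] (J : Ideal R)

abbrev E (M : Type u) [AddCommGroup M] [Module R M] (i n : ℕ) : Type u :=
  Abelian.Ext (ModuleCat.of R (R ⧸ J ^ n)) (ModuleCat.of R M) i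

abbrev tr {m n : ℕ} (h : m ≤ n) : ModuleCat.of R (R ⧸ J ^ n) ⟶ ModuleCat.of R (R ⧸ J ^ m) :=
  ModuleCat.ofHom (Submodule.mapQ (J ^ n) (J ^ m) LinearMap.id (Ideal.pow_le_pow_right h))

variable (M : Type u) [AddCommGroup M] [Module R M] (i : ℕ)

def trE {m n : ℕ} (h : m ≤ n) : E J M i m →ₗ[R] E J M i n where
  toFun e := (Abelian.Ext.mk₀ (tr J h)).comp e (zero_add i)
  map_add' _ _ := by simp
  map_smul' _ _ := by simp

def ι (n : ℕ) : E J M i n →ₗ[R] (localCohomology J i).obj (ModuleCat.of R M) :=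
  ((colimit.ι (localCohomology.diagram (localCohomology.idealPowersDiagram J) i) (op (op n))).app (ModuleCat.of R M)).hom
   ∘ₗ (compEquiv i (ModuleCat.of R (R ⧸ J ^ n)) (ModuleCat.of R M)).symm.toLinearMap

lemma diagram_map {m n : ℕ} (f : op (op m) ⟶ op (op n)) (h : m ≤ n) (e : E J M i m) :
    ((localCohomology.diagram (localCohomology.idealPowersDiagram J) i).map f).app (ModuleCat.of R M)
      ((compEquiv i (ModuleCat.of R (R ⧸ J ^ m)) (ModuleCat.of R M)).symm e) =
    (compEquiv i (ModuleCat.of R (R ⧸ J ^ n)) (ModuleCat.of R M)).symm (trE J M i h e) := by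
  have := compEquiv_nat (tr J h) i ((compEquiv i (ModuleCat.of R (R ⧸ J ^ m)) (ModuleCat.of R M)).symm e)
  rw [LinearEquiv.apply_symm_apply] at this
  exact (LinearEquiv.eq_symm_apply _).2 this

def isColim : IsColimit (((evaluation _ _).obj (ModuleCat.of R M)).mapCocone
    (colimit.cocone (localCohomology.diagram (localCohomology.idealPowersDiagram J) i))) :=
  isColimitOfPreserves _ (colimit.isColimit _)

instance : PreservesFilteredColimitsOfSize.{0, 0} (forget (ModuleCat.{u} R)) :=
  preservesFilteredColimitsOfSize_shrink.{0, u, 0, u} _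

lemma ι_surj (z : (localCohomology J i).obj (ModuleCat.of R M)) : ∃ n e, ι J M i n e = z := by
  obtain ⟨j, y, hy⟩ := Concrete.isColimit_exists_rep _ (isColim J M i) z
  refine ⟨j.unop.unop, compEquiv i (ModuleCat.of R (R ⧸ J ^ j.unop.unop)) (ModuleCat.of R M) y, ?_⟩
  have : ι J M i j.unop.unop (compEquiv i (ModuleCat.of R (R ⧸ J ^ j.unop.unop)) (ModuleCat.of R M) y) =
      ((colimit.ι (localCohomology.diagram (localCohomology.idealPowersDiagram J) i) j).app (ModuleCat.of R M)).hom y :=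
    congrArg ((colimit.ι (localCohomology.diagram (localCohomology.idealPowersDiagram J) i) j).app (ModuleCat.of R M)).hom
      (LinearEquiv.symm_apply_apply _ y)
  exact this.trans hy

lemma ι_eq_iff {m n : ℕ} (e : E J M i m) (e' : E J M i n) : ι J M i m e = ι J M i n e' ↔
    ∃ k, ∃ (h : m ≤ k) (h' : n ≤ k), trE J M i h e = trE J M i h' e' := by
  have := Concrete.isColimit_rep_eq_iff_exists _ (isColim J M i) (i := op (op m)) (j := op (op n))
    ((compEquiv i (ModuleCat.of R (R ⧸ J ^ m)) (ModuleCat.of R M)).symm e)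
    ((compEquiv i (ModuleCat.of R (R ⧸ J ^ n)) (ModuleCat.of R M)).symm e')
  refine Iff.trans this ?_
  constructor
  · rintro ⟨k, f, g, h⟩
    refine ⟨k.unop.unop, f.unop.unop.le, g.unop.unop.le, ?_⟩
    apply (compEquiv i (ModuleCat.of R (R ⧸ J ^ k.unop.unop)) (ModuleCat.of R M)).symm.injective
    rw [← diagram_map J M i f, ← diagram_map J M i g]
    exact h
  · rintro ⟨k, h, h', e⟩
    refine ⟨op (op k), (homOfLE h).op.op, (homOfLE h').op.op, ?_⟩
    refine (diagram_map J M i _ h _).trans ?_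
    rw [e]
    exact (diagram_map J M i _ h' _).symm

lemma ι_trE {m n : ℕ} (h : m ≤ n) (e : E J M i m) : ι J M i n (trE J M i h e) = ι J M i m e := by
  rw [ι_eq_iff]
  refine ⟨n, le_rfl, h, ?_⟩
  have : tr J (le_refl n) = 𝟙 _ := by ext; rfl
  simp [trE, this]

/-- elementary model of local cohomology -/
abbrev H := Module.DirectLimit (E J M i) (fun _ _ h => trE J M i h)

def toH (n : ℕ) : E J M i n →ₗ[R] H J M i := Module.DirectLimit.of R ℕ (E J M i) (fun _ _ h => trE J M i h) n

instance : DirectedSystem (E J M i) (fun _ _ h => trE J M i h) where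
  map_self n e := by
    have : tr J (le_refl n) = 𝟙 _ := by ext; rfl
    simp [trE, this]
  map_map a b c hab hbc e := by
    have : tr J (hab.trans hbc) = tr J hbc ≫ tr J hab := by ext; rfl
    simp [trE, this, ← Abelian.Ext.mk₀_comp_mk₀_assoc]

lemma toH_surj (z : H J M i) : ∃ n e, toH J M i n e = z := Module.DirectLimit.exists_of z

lemma toH_trE {m n : ℕ} (h : m ≤ n) (e : E J M i m) : toH J M i n (trE J M i h e) = toH J M i m e :=
  Module.DirectLimit.of_f

lemma toH_eq_zero {n : ℕ} {e : E J M i n} : toH J M i n e = 0 ↔ ∃ m, ∃ h : n ≤ m, trE J M i h e = 0 := by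
  constructor
  · intro h; exact Module.DirectLimit.of.zero_exact h
  · rintro ⟨m, h, h0⟩; rw [← toH_trE J M i h, h0, map_zero]

def HEquiv : H J M i ≃ₗ[R] (localCohomology J i).obj (ModuleCat.of R M) :=
  LinearEquiv.ofBijective (Module.DirectLimit.lift R ℕ (E J M i) (fun _ _ h => trE J M i h) (ι J M i)
    (fun _ _ h e => ι_trE J M i h e)) ⟨by
      rw [← LinearMap.ker_eq_bot, eq_bot_iff]
      intro z hz
      obtain ⟨n, e, rfl⟩ := toH_surj J M i z
      rw [LinearMap.mem_ker, toH, Module.DirectLimit.lift_of, ← map_zero (ι J M i n), ι_eq_iff] at hz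
      obtain ⟨k, h, h', hh⟩ := hz
      rw [map_zero] at hh
      exact (toH_eq_zero J M i).2 ⟨k, h, hh⟩, by
      intro z
      obtain ⟨n, e, rfl⟩ := ι_surj J M i z
      exact ⟨toH J M i n e, by rw [toH, Module.DirectLimit.lift_of]⟩⟩

end LCoh

end

noncomputable section

section ExtModules
variable {R : Type u} [CommRing R]
  {X X' X'' M M' M'' : Type u} [AddCommGroup X] [Module R X] [AddCommGroup X'] [Module R X']
  [AddCommGroup X''] [Module R X'']
  [AddCommGroup M] [Module R M] [AddCommGroup M'] [Module R M'] [AddCommGroup M''] [Module R M'']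

structure SES (f : M' →ₗ[R] M) (g : M →ₗ[R] M'') : Prop where
  inj : Function.Injective f
  surj : Function.Surjective g
  exact : Function.Exact f g

namespace SES

/-- The short complex of a short exact sequence of modules. -/
abbrev sc {f : M' →ₗ[R] M} {g : M →ₗ[R] M''} (h : SES f g) : ShortComplex (ModuleCat.{u} R) :=
  ShortComplex.mk (ModuleCat.ofHom f) (ModuleCat.ofHom g) (by
    ext x; exact h.exact.apply_apply_eq_zero x)

lemma shortExact {f : M' →ₗ[R] M} {g : M →ₗ[R] M''} (h : SES f g) : h.sc.ShortExact where
  exact := (ShortComplex.ShortExact.moduleCat_exact_iff_function_exact _).2 h.exact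
  mono_f := (ModuleCat.mono_iff_injective _).2 h.inj
  epi_g := (ModuleCat.epi_iff_surjective _).2 h.surj

lemma ofSubmodule (N : Submodule R M) : SES N.subtype N.mkQ where
  inj := N.subtype_injective
  surj := N.mkQ_surjective
  exact := LinearMap.exact_subtype_mkQ N

end SES

variable (R X M) in
/-- `Ext^i_R(X, M)` for unbundled modules. -/
abbrev XT (i : ℕ) : Type u := Abelian.Ext (ModuleCat.of R X) (ModuleCat.of R M) i

namespace XT

variable (X) in
/-- Functoriality in the second variable. -/
def post (f : M' →ₗ[R] M) (i : ℕ) : XT R X M' i →ₗ[R] XT R X M i where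
  toFun e := e.comp (Abelian.Ext.mk₀ (ModuleCat.ofHom f)) (add_zero i)
  map_add' _ _ := by simp
  map_smul' _ _ := by simp

variable (M) in
/-- Functoriality in the first variable. -/
def pre (f : X' →ₗ[R] X) (i : ℕ) : XT R X M i →ₗ[R] XT R X' M i where
  toFun e := (Abelian.Ext.mk₀ (ModuleCat.ofHom f)).comp e (zero_add i)
  map_add' _ _ := by simp
  map_smul' _ _ := by simp

variable (X) in
/-- Connecting map in the second variable. -/
def δ {f : M' →ₗ[R] M} {g : M →ₗ[R] M''} (h : SES f g) (i : ℕ) :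
    XT R X M'' i →ₗ[R] XT R X M' (i + 1) where
  toFun e := e.comp h.shortExact.extClass rfl
  map_add' _ _ := by simp
  map_smul' _ _ := by simp

section
variable {f : M' →ₗ[R] M} {g : M →ₗ[R] M''} (h : SES f g) (i : ℕ)
include h

lemma exact_post (x : XT R X M i) (hx : post X g i x = 0) : ∃ y, post X f i y = x :=
  Abelian.Ext.covariant_sequence_exact₂ _ h.shortExact x hx

lemma exact_post_δ (x : XT R X M'' i) (hx : δ X h i x = 0) : ∃ y, post X g i y = x :=
  Abelian.Ext.covariant_sequence_exact₃ _ h.shortExact x rfl hx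

lemma exact_δ_post (x : XT R X M' (i + 1)) (hx : post X f (i + 1) x = 0) : ∃ y, δ X h i y = x :=
  Abelian.Ext.covariant_sequence_exact₁ _ h.shortExact x hx rfl

lemma post_inj_zero (x : XT R X M' 0) (hx : post X f 0 x = 0) : x = 0 := by
  haveI := h.shortExact.mono_f
  exact Abelian.Ext.postcomp_mk₀_injective_of_mono _ (ModuleCat.ofHom f) (hx.trans (map_zero (post X f 0)).symm)

end

section
variable {f : X' →ₗ[R] X} {g : X →ₗ[R] X''} (h : SES f g) (i : ℕ)
include h

end

variable (i : ℕ)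

lemma post_comp (f : M' →ₗ[R] M) (g : M →ₗ[R] M'') (x : XT R X M' i) :
    post X g i (post X f i x) = post X (g ∘ₗ f) i x := by
  simp only [post, LinearMap.coe_mk, AddHom.coe_mk, ModuleCat.ofHom_comp]
  rw [← Abelian.Ext.mk₀_comp_mk₀, Abelian.Ext.comp_assoc_of_third_deg_zero]

lemma pre_post (f : X' →ₗ[R] X) (g : M' →ₗ[R] M) (x : XT R X M' i) :
    pre M f i (post X g i x) = post X' g i (pre M' f i x) := by
  simp only [pre, post, LinearMap.coe_mk, AddHom.coe_mk]
  rw [Abelian.Ext.comp_assoc_of_third_deg_zero]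

lemma pre_δ (p : X' →ₗ[R] X) {f : M' →ₗ[R] M} {g : M →ₗ[R] M''} (h : SES f g) (x : XT R X M'' i) :
    pre M' p (i + 1) (δ X h i x) = δ X' h i (pre M'' p i x) := by
  simp only [pre, δ, LinearMap.coe_mk, AddHom.coe_mk]
  rw [Abelian.Ext.comp_assoc]
  simp

lemma post_smul_id (r : R) (x : XT R X M i) : post X (r • LinearMap.id) i x = r • x := by
  rw [Abelian.Ext.smul_eq_comp_mk₀]; rfl

lemma pre_smul_id (r : R) (x : XT R X M i) : pre M (r • LinearMap.id : X →ₗ[R] X) i x = r • x := by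
  have : ModuleCat.ofHom (r • LinearMap.id : X →ₗ[R] X) = r • 𝟙 (ModuleCat.of R X) := rfl
  simp only [pre, LinearMap.coe_mk, AddHom.coe_mk, this, Abelian.Ext.mk₀_smul, Abelian.Ext.smul_comp,
    Abelian.Ext.mk₀_id_comp]

lemma smul_eq_zero_left {r : R} (hr : ∀ x : X, r • x = 0) (x : XT R X M i) : r • x = 0 := by
  rw [← pre_smul_id]
  have : (r • LinearMap.id : X →ₗ[R] X) = 0 := by ext x; simp [hr x]
  rw [this]; simp only [pre, LinearMap.coe_mk, AddHom.coe_mk]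
  have h0 : ModuleCat.ofHom (0 : X →ₗ[R] X) = 0 := rfl
  rw [h0, Abelian.Ext.mk₀_zero, Abelian.Ext.zero_comp]

lemma smul_eq_zero_right {r : R} (hr : ∀ x : M, r • x = 0) (x : XT R X M i) : r • x = 0 := by
  rw [← post_smul_id]
  have : (r • LinearMap.id : M →ₗ[R] M) = 0 := by ext x; simp [hr x]
  rw [this]; simp only [post, LinearMap.coe_mk, AddHom.coe_mk]
  have h0 : ModuleCat.ofHom (0 : M →ₗ[R] M) = 0 := rfl
  rw [h0, Abelian.Ext.mk₀_zero, Abelian.Ext.comp_zero]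

variable (R X M) in
/-- `Ext^0 = Hom`. -/
def homEquiv : XT R X M 0 ≃ₗ[R] (X →ₗ[R] M) :=
  (Abelian.Ext.linearEquiv₀ (R := R)).trans ModuleCat.homLinearEquiv

lemma homEquiv_symm_post (f : M' →ₗ[R] M) (φ : X →ₗ[R] M') :
    post X f 0 ((homEquiv R X M').symm φ) = (homEquiv R X M).symm (f ∘ₗ φ) := by
  exact Abelian.Ext.mk₀_comp_mk₀ (ModuleCat.ofHom φ) (ModuleCat.ofHom f)

lemma homEquiv_symm_pre (f : X' →ₗ[R] X) (φ : X →ₗ[R] M) :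
    pre M f 0 ((homEquiv R X M).symm φ) = (homEquiv R X' M).symm (φ ∘ₗ f) := by
  exact Abelian.Ext.mk₀_comp_mk₀ (ModuleCat.ofHom f) (ModuleCat.ofHom φ)

lemma homEquiv_post (f : M' →ₗ[R] M) (x : XT R X M' 0) :
    homEquiv R X M (post X f 0 x) = f ∘ₗ homEquiv R X M' x := by
  obtain ⟨φ, rfl⟩ := (homEquiv R X M').symm.surjective x
  rw [homEquiv_symm_post, LinearEquiv.apply_symm_apply, LinearEquiv.apply_symm_apply]

lemma homEquiv_pre (f : X' →ₗ[R] X) (x : XT R X M 0) :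
    homEquiv R X' M (pre M f 0 x) = homEquiv R X M x ∘ₗ f := by
  obtain ⟨φ, rfl⟩ := (homEquiv R X M).symm.surjective x
  rw [homEquiv_symm_pre, LinearEquiv.apply_symm_apply, LinearEquiv.apply_symm_apply]

end XT
end ExtModules

end

noncomputable section

namespace LCoh
variable {R : Type u} [CommRing R] (J : Ideal R)
  {M M' M'' : Type u} 
  [AddCommGroup M] [Module R M] [AddCommGroup M'] [Module R M'] [AddCommGroup M''] [Module R M'']

lemma trE_eq_pre {m n : ℕ} (h : m ≤ n) (i : ℕ) (e : E J M i m) :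
    trE J M i h e = XT.pre M (Submodule.mapQ (J ^ n) (J ^ m) LinearMap.id (Ideal.pow_le_pow_right h)) i e := rfl

/-- Functoriality of local cohomology. -/
def hmap (f : M' →ₗ[R] M) (i : ℕ) : H J M' i →ₗ[R] H J M i :=
  Module.DirectLimit.lift R ℕ (E J M' i) (fun _ _ h => trE J M' i h)
    (fun n => toH J M i n ∘ₗ XT.post (R ⧸ J ^ n) f i) (fun m n h e => by
      rw [LinearMap.comp_apply, trE_eq_pre, ← XT.pre_post, ← trE_eq_pre J h, toH_trE]; rfl)

lemma hmap_toH (f : M' →ₗ[R] M) (i n : ℕ) (e : E J M' i n) :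
    hmap J f i (toH J M' i n e) = toH J M i n (XT.post _ f i e) :=
  Module.DirectLimit.lift_of _ _ _

/-- Connecting homomorphism of local cohomology. -/
def δ {f : M' →ₗ[R] M} {g : M →ₗ[R] M''} (h : SES f g) (i : ℕ) : H J M'' i →ₗ[R] H J M' (i + 1) :=
  Module.DirectLimit.lift R ℕ (E J M'' i) (fun _ _ h => trE J M'' i h)
    (fun n => toH J M' (i + 1) n ∘ₗ XT.δ (R ⧸ J ^ n) h i) (fun m n hmn e => by
      rw [LinearMap.comp_apply, trE_eq_pre, ← XT.pre_δ, ← trE_eq_pre J hmn, toH_trE]; rfl)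

lemma δ_toH {f : M' →ₗ[R] M} {g : M →ₗ[R] M''} (h : SES f g) (i n : ℕ) (e : E J M'' i n) :
    δ J h i (toH J M'' i n e) = toH J M' (i + 1) n (XT.δ _ h i e) :=
  Module.DirectLimit.lift_of _ _ _

lemma hmap_comp (f : M' →ₗ[R] M) (g : M →ₗ[R] M'') (i : ℕ) (z : H J M' i) :
    hmap J g i (hmap J f i z) = hmap J (g ∘ₗ f) i z := by
  obtain ⟨n, e, rfl⟩ := toH_surj J M' i z
  rw [hmap_toH, hmap_toH, hmap_toH, XT.post_comp]

lemma hmap_smul_id (r : R) (i : ℕ) (z : H J M i) : hmap J (r • LinearMap.id) i z = r • z := by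
  obtain ⟨n, e, rfl⟩ := toH_surj J M i z
  rw [hmap_toH, XT.post_smul_id, map_smul]

lemma hmap_id (i : ℕ) (z : H J M i) : hmap J LinearMap.id i z = z := by
  have := hmap_smul_id J (1 : R) i z
  rwa [one_smul, one_smul] at this

lemma δ_hmap {f : M' →ₗ[R] M} {g : M →ₗ[R] M''} (h : SES f g) (i : ℕ) (z : H J M i) :
    δ J h i (hmap J g i z) = 0 := by
  obtain ⟨n, e, rfl⟩ := toH_surj J M i z
  rw [hmap_toH, δ_toH]
  have : XT.δ (R ⧸ J ^ n) h i (XT.post _ g i e) = 0 := by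
    simp only [XT.post, XT.δ, LinearMap.coe_mk, AddHom.coe_mk]
    rw [Abelian.Ext.comp_assoc _ _ _ (add_zero i) (zero_add 1) (by omega)]
    have := h.shortExact.comp_extClass
    rw [this, Abelian.Ext.comp_zero]
  rw [this, map_zero]

section LES
variable {f : M' →ₗ[R] M} {g : M →ₗ[R] M''} (h : SES f g) (i : ℕ)
include h

lemma exact_hmap (z : H J M i) (hz : hmap J g i z = 0) : ∃ y, hmap J f i y = z := by
  obtain ⟨n, e, rfl⟩ := toH_surj J M i z
  rw [hmap_toH, toH_eq_zero] at hz
  obtain ⟨m, hm, hz⟩ := hz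
  rw [trE_eq_pre, XT.pre_post] at hz
  obtain ⟨y, hy⟩ := XT.exact_post h i _ hz
  exact ⟨toH J M' i m y, by rw [hmap_toH, hy, ← trE_eq_pre J hm, toH_trE]⟩

lemma exact_hmap_δ (z : H J M'' i) (hz : δ J h i z = 0) : ∃ y, hmap J g i y = z := by
  obtain ⟨n, e, rfl⟩ := toH_surj J M'' i z
  rw [δ_toH, toH_eq_zero] at hz
  obtain ⟨m, hm, hz⟩ := hz
  rw [trE_eq_pre, XT.pre_δ] at hz
  obtain ⟨y, hy⟩ := XT.exact_post_δ h i _ hz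
  exact ⟨toH J M i m y, by rw [hmap_toH, hy, ← trE_eq_pre J hm, toH_trE]⟩

lemma exact_δ_hmap (z : H J M' (i + 1)) (hz : hmap J f (i + 1) z = 0) : ∃ y, δ J h i y = z := by
  obtain ⟨n, e, rfl⟩ := toH_surj J M' (i + 1) z
  rw [hmap_toH, toH_eq_zero] at hz
  obtain ⟨m, hm, hz⟩ := hz
  rw [trE_eq_pre, XT.pre_post] at hz
  obtain ⟨y, hy⟩ := XT.exact_δ_post h i _ hz
  exact ⟨toH J M'' i m y, by rw [δ_toH, hy, ← trE_eq_pre J hm, toH_trE]⟩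

end LES

lemma torsion (i : ℕ) (z : H J M i) : ∃ n, ∀ r ∈ J ^ n, r • z = 0 := by
  obtain ⟨n, e, rfl⟩ := toH_surj J M i z
  refine ⟨n, fun r hr => ?_⟩
  rw [← map_smul, XT.smul_eq_zero_left, map_zero]
  intro x
  obtain ⟨x, rfl⟩ := Ideal.Quotient.mk_surjective x
  have : r • (Ideal.Quotient.mk (J ^ n) x) = Ideal.Quotient.mk _ (r * x) := rfl
  rw [this, Ideal.Quotient.eq_zero_iff_mem]
  exact Ideal.mul_mem_right _ _ hr

/-- `x` generates a copy of a quotient of `R/J^n`. -/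
def pt {n : ℕ} {x : M} (hx : ∀ r ∈ J ^ n, r • x = 0) : (R ⧸ J ^ n) →ₗ[R] M :=
  (J ^ n).liftQ (LinearMap.toSpanSingleton R M x) hx

lemma pt_ext {n : ℕ} {φ ψ : (R ⧸ J ^ n) →ₗ[R] M} (h : φ (Submodule.Quotient.mk 1) = ψ (Submodule.Quotient.mk 1)) : φ = ψ := by
  ext; exact h

variable (M) in
/-- The evaluation `H^0_J(M) → M`. -/
def ev : H J M 0 →ₗ[R] M :=
  Module.DirectLimit.lift R ℕ (E J M 0) (fun _ _ h => trE J M 0 h)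
    (fun n => LinearMap.applyₗ (Submodule.Quotient.mk 1 : R ⧸ J ^ n) ∘ₗ (XT.homEquiv R (R ⧸ J ^ n) M).toLinearMap)
    (fun m n h e => by
      simp only [LinearMap.comp_apply, LinearEquiv.coe_coe, LinearMap.applyₗ_apply_apply]
      rw [trE_eq_pre, XT.homEquiv_pre]; rfl)

lemma ev_toH (n : ℕ) (e : E J M 0 n) :
    ev J M (toH J M 0 n e) = XT.homEquiv R (R ⧸ J ^ n) M e (Submodule.Quotient.mk 1) :=
  Module.DirectLimit.lift_of _ _ _

lemma ev_injective : Function.Injective (ev J M) := by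
  rw [← LinearMap.ker_eq_bot, eq_bot_iff]
  intro z hz
  obtain ⟨n, e, rfl⟩ := toH_surj J M 0 z
  rw [LinearMap.mem_ker, ev_toH] at hz
  have : XT.homEquiv R (R ⧸ J ^ n) M e = 0 := pt_ext J hz
  rw [LinearEquiv.map_eq_zero_iff] at this
  rw [this, map_zero]; exact Submodule.zero_mem _

lemma ev_range {n : ℕ} {x : M} (hx : ∀ r ∈ J ^ n, r • x = 0) : ∃ z, ev J M z = x := by
  refine ⟨toH J M 0 n ((XT.homEquiv R _ M).symm (pt J hx)), ?_⟩
  rw [ev_toH, LinearEquiv.apply_symm_apply]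
  exact one_smul R x

lemma ev_map (f : M' →ₗ[R] M) (z : H J M' 0) : ev J M (hmap J f 0 z) = f (ev J M' z) := by
  obtain ⟨n, e, rfl⟩ := toH_surj J M' 0 z
  rw [hmap_toH, ev_toH, ev_toH, XT.homEquiv_post]; rfl

variable (M) in
/-- `M` is `J`-power torsion. -/
def IsTors : Prop := ∀ x : M, ∃ n, ∀ r ∈ J ^ n, r • x = 0

lemma subsingleton_of_injective (h : Injective (ModuleCat.of R M)) (i : ℕ) : Subsingleton (H J M (i + 1)) := by
  refine subsingleton_of_forall_eq 0 fun z => ?_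
  obtain ⟨n, e, rfl⟩ := toH_surj J M _ z
  rw [Abelian.Ext.eq_zero_of_injective e, map_zero]

variable (M) in
/-- The `J`-power torsion submodule. -/
def Γ : Submodule R M where
  carrier := {x | ∃ n, ∀ r ∈ J ^ n, r • x = 0}
  zero_mem' := ⟨0, fun r _ => smul_zero r⟩
  add_mem' := by
    rintro x y ⟨n, hn⟩ ⟨m, hm⟩
    refine ⟨max n m, fun r hr => ?_⟩
    rw [smul_add, hn r (Ideal.pow_le_pow_right (le_max_left _ _) hr), hm r (Ideal.pow_le_pow_right (le_max_right _ _) hr), add_zero]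
  smul_mem' := by
    rintro c x ⟨n, hn⟩
    exact ⟨n, fun r hr => by rw [smul_comm, hn r hr, smul_zero]⟩

lemma isTors_Γ : IsTors J (Γ J M) := by
  rintro ⟨x, n, hn⟩
  exact ⟨n, fun r hr => Subtype.ext (hn r hr)⟩

lemma injective_Γ [IsNoetherianRing R] (h : Module.Injective R M) : Module.Injective R (Γ J M) := by
  apply Module.Baer.injective
  intro I φ
  -- a power of `J` kills the image of `φ`
  have h1 : ∃ n, ∀ r ∈ J ^ n, ∀ x : I, r • φ x = 0 := by
    obtain ⟨s, hs⟩ := (IsNoetherian.noetherian I : Submodule.FG I)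
    have hs' : ∀ x ∈ s, ∃ n, ∀ r ∈ J ^ n, ∀ hx : x ∈ I, r • φ ⟨x, hx⟩ = 0 := by
      intro x hx
      have hxI : x ∈ I := hs ▸ Ideal.subset_span hx
      obtain ⟨n, hn⟩ := isTors_Γ J (φ ⟨x, hxI⟩)
      exact ⟨n, fun r hr _ => hn r hr⟩
    choose! N hN using hs'
    refine ⟨s.sup N, fun r hr => ?_⟩
    rintro ⟨x, hx⟩
    have key : ∀ y (hy : y ∈ Ideal.span (s : Set R)), ∀ hyI : y ∈ I, r • φ ⟨y, hyI⟩ = 0 := by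
      intro y hy
      induction hy using Submodule.span_induction with
      | mem y hy => exact fun hyI => hN y hy r (Ideal.pow_le_pow_right (Finset.le_sup hy) hr) hyI
      | zero => intro hyI; rw [show (⟨0, hyI⟩ : I) = 0 from rfl, map_zero, smul_zero]
      | add y z hy hz h1 h2 =>
        intro hyI
        have hyI' : y ∈ I := hs ▸ hy
        have hzI' : z ∈ I := hs ▸ hz
        rw [show (⟨y + z, hyI⟩ : I) = ⟨y, hyI'⟩ + ⟨z, hzI'⟩ from rfl, map_add, smul_add, h1, h2, add_zero]
      | smul c y hy h1 =>
        intro hyI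
        have hyI' : y ∈ I := hs ▸ hy
        rw [show (⟨c • y, hyI⟩ : I) = c • ⟨y, hyI'⟩ from rfl, map_smul, smul_comm, h1, smul_zero]
    exact key x (show x ∈ Submodule.span R (s : Set R) by rw [hs]; exact hx) hx
  obtain ⟨n, hn⟩ := h1
  -- Artin–Rees
  obtain ⟨k, hk⟩ := Ideal.exists_pow_inf_eq_pow_smul J (I : Submodule R R)
  have hAR : ∀ x : I, (x : R) ∈ J ^ (n + k) → φ x = 0 := by
    intro x hx
    have := hk (n + k) (Nat.le_add_left _ _)
    rw [Nat.add_sub_cancel] at this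
    have hx' : (x : R) ∈ (J ^ (n + k) • ⊤ ⊓ I : Submodule R R) := ⟨by simpa using hx, x.2⟩
    rw [this] at hx'
    have hx2 : (x : R) ∈ J ^ n • (I : Submodule R R) := Submodule.smul_mono le_rfl inf_le_right hx'
    have key : ∀ y (hy : y ∈ J ^ n • (I : Submodule R R)), ∀ hyI : y ∈ I, φ ⟨y, hyI⟩ = 0 := by
      intro y hy
      induction hy using Submodule.smul_induction_on' with
      | smul r hr y hy =>
        intro hyI
        rw [show (⟨r • y, hyI⟩ : I) = r • ⟨y, hy⟩ from rfl, map_smul, hn r hr]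
      | add y hy z hz h1 h2 =>
        intro hyI
        have hyI' : y ∈ I := Submodule.smul_le_right hy
        have hzI' : z ∈ I := Submodule.smul_le_right hz
        rw [show (⟨y + z, hyI⟩ : I) = ⟨y, hyI'⟩ + ⟨z, hzI'⟩ from rfl, map_add, h1, h2, add_zero]
    exact key x hx2 x.2
  -- extend to `I + J^(n+k)` by zero
  have hagree : ∀ (x : I) (y : (J ^ (n + k) : Ideal R)), (x : R) = y → (Γ J M).subtype (φ x) = (0 : _ →ₗ[R] M) y := by
    intro x y hxy
    rw [hAR x (hxy ▸ y.2)]; simp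
  let p : R →ₗ.[R] M := ⟨I, (Γ J M).subtype ∘ₗ φ⟩
  let p' : R →ₗ.[R] M := ⟨(J ^ (n + k) : Ideal R), 0⟩
  obtain ⟨ψ, hψ⟩ := Module.Baer.of_injective h (p.sup p' hagree).domain (p.sup p' hagree).toFun
  have h2 : ∀ r ∈ J ^ (n + k), ψ r = 0 := by
    intro r hr
    have hm : r ∈ (p.sup p' hagree).domain := Submodule.mem_sup_right hr
    rw [hψ r hm]
    exact LinearPMap.sup_apply hagree (0 : p.domain) (⟨r, hr⟩ : p'.domain) ⟨r, hm⟩ (zero_add _) |>.trans (by simp [p'])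
  have h3 : ∀ r ∈ J ^ (n + k), r • ψ 1 = 0 := by
    intro r hr
    rw [← map_smul, smul_eq_mul, mul_one, h2 r hr]
  refine ⟨LinearMap.toSpanSingleton R _ ⟨ψ 1, n + k, h3⟩, fun x hx => ?_⟩
  apply Subtype.ext
  have hm : x ∈ (p.sup p' hagree).domain := Submodule.mem_sup_left hx
  have h4 : ψ x = φ ⟨x, hx⟩ := by
    rw [hψ x hm]
    exact LinearPMap.sup_apply hagree (⟨x, hx⟩ : p.domain) (0 : p'.domain) ⟨x, hm⟩ (add_zero _) |>.trans (by simp [p, p'])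
  rw [← h4]
  simp [← map_smul]

lemma exists_isTors_embedding [IsNoetherianRing R] (hM : IsTors J M) :
    ∃ (Q : Type u) (_ : AddCommGroup Q) (_ : Module R Q) (f : M →ₗ[R] Q), Function.Injective f ∧
      IsTors J Q ∧ ∀ i, Subsingleton (H J Q (i + 1)) := by
  obtain ⟨⟨Q, hQ, f, hf⟩⟩ := EnoughInjectives.presentation (ModuleCat.of R M)
  rw [ModuleCat.mono_iff_injective] at hf
  have hQ' : Module.Injective R Q := by
    rw [Module.injective_iff_injective_object]; exact hQ
  have := injective_Γ J hQ'
  rw [Module.injective_iff_injective_object] at this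
  refine ⟨Γ J Q, inferInstance, inferInstance, f.hom.codRestrict (Γ J Q) ?_, ?_, isTors_Γ J, fun i => subsingleton_of_injective J this i⟩
  · intro x
    obtain ⟨n, hn⟩ := hM x
    exact ⟨n, fun r hr => by rw [← map_smul, hn r hr, map_zero]⟩
  · intro x y hxy
    exact hf (congrArg Subtype.val hxy)

lemma IsTors.quotient (hM : IsTors J M) (N : Submodule R M) : IsTors J (M ⧸ N) := by
  intro x
  obtain ⟨x, rfl⟩ := N.mkQ_surjective x
  obtain ⟨n, hn⟩ := hM x
  exact ⟨n, fun r hr => by rw [← map_smul, hn r hr, map_zero]⟩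

lemma SES_of_injective {f : M' →ₗ[R] M} (hf : Function.Injective f) : SES f (LinearMap.range f).mkQ where
  inj := hf
  surj := Submodule.mkQ_surjective _
  exact := by rw [LinearMap.exact_iff, Submodule.ker_mkQ]

lemma isTors_subsingleton [IsNoetherianRing R] (i : ℕ) :
    ∀ (M : Type u) [AddCommGroup M] [Module R M], IsTors J M → Subsingleton (H J M (i + 1)) := by
  induction i with
  | zero =>
    intro M _ _ hM
    obtain ⟨Q, _, _, f, hf, hQ, hQ0⟩ := exists_isTors_embedding J hM
    have hs := SES_of_injective hf
    refine subsingleton_of_forall_eq 0 fun z => ?_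
    obtain ⟨y, rfl⟩ := exact_δ_hmap J hs 0 z (@Subsingleton.elim _ (hQ0 0) _ _)
    obtain ⟨q, hq⟩ := Submodule.mkQ_surjective _ (ev J _ y)
    obtain ⟨n, hn⟩ := hQ q
    obtain ⟨w, hw⟩ := ev_range J hn
    have : y = hmap J (LinearMap.range f).mkQ 0 w := by
      apply ev_injective J
      rw [ev_map, hw, hq]
    rw [this, δ_hmap]
  | succ i ih =>
    intro M _ _ hM
    obtain ⟨Q, _, _, f, hf, hQ, hQ0⟩ := exists_isTors_embedding J hM
    have hs := SES_of_injective hf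
    refine subsingleton_of_forall_eq 0 fun z => ?_
    obtain ⟨y, rfl⟩ := exact_δ_hmap J hs _ z (@Subsingleton.elim _ (hQ0 _) _ _)
    rw [@Subsingleton.elim _ (ih _ (hQ.quotient J _)) y 0, map_zero]
end LCoh

end

noncomputable section

namespace LCoh
variable {R : Type u} [CommRing R] (J : Ideal R)
  {M M' M'' : Type u}
  [AddCommGroup M] [Module R M] [AddCommGroup M'] [Module R M'] [AddCommGroup M''] [Module R M'']

variable (M) in
/-- Local cohomology in degrees `< n` is killed by `J ^ k`. -/
def Hk (k n : ℕ) : Prop := ∀ i < n, ∀ r ∈ J ^ k, ∀ z : H J M i, r • z = 0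

/-- `g : M → M''` is the quotient map by `yM`. -/
structure IsQuotBy (y : R) (g : M →ₗ[R] M'') : Prop where
  surj : Function.Surjective g
  ker : ∀ m, g m = 0 ↔ ∃ m', y • m' = m

abbrev toImg (M : Type u) [AddCommGroup M] [Module R M] (y : R) :
    M →ₗ[R] LinearMap.range (LinearMap.lsmul R M y) :=
  (LinearMap.lsmul R M y).rangeRestrict

lemma SES_toImg (y : R) : SES (LinearMap.ker (LinearMap.lsmul R M y)).subtype (toImg M y) where
  inj := Submodule.subtype_injective _
  surj := LinearMap.surjective_rangeRestrict _
  exact := by rw [LinearMap.exact_iff, LinearMap.ker_rangeRestrict, Submodule.range_subtype]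

lemma IsQuotBy.ses {y : R} {g : M →ₗ[R] M''} (h : IsQuotBy y g) :
    SES (LinearMap.range (LinearMap.lsmul R M y)).subtype g where
  inj := Submodule.subtype_injective _
  surj := h.surj
  exact := by
    rw [LinearMap.exact_iff, Submodule.range_subtype]
    ext m
    rw [LinearMap.mem_ker, h.ker]; rfl

variable [IsNoetherianRing R]

lemma hmap_toImg_surj {y : R} (hW : IsTors J (LinearMap.ker (LinearMap.lsmul R M y))) (i : ℕ)
    (z : H J (LinearMap.range (LinearMap.lsmul R M y)) i) : ∃ z', hmap J (toImg M y) i z' = z := by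
  refine exact_hmap_δ J (SES_toImg y) i z ?_
  exact @Subsingleton.elim _ (isTors_subsingleton J i _ hW) _ _

lemma hmap_toImg_inj {y : R} (hW : IsTors J (LinearMap.ker (LinearMap.lsmul R M y))) (i : ℕ)
    (z : H J M (i + 1)) (hz : hmap J (toImg M y) (i + 1) z = 0) : z = 0 := by
  obtain ⟨w, rfl⟩ := exact_hmap J (SES_toImg y) (i + 1) z hz
  rw [@Subsingleton.elim _ (isTors_subsingleton J i _ hW) w 0, map_zero]

lemma hmap_subtype_toImg (y : R) (i : ℕ) (z : H J M i) :
    hmap J (LinearMap.range (LinearMap.lsmul R M y)).subtype i (hmap J (toImg M y) i z) = y • z := by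
  rw [hmap_comp, ← hmap_smul_id]; rfl

/-- An element of positive degree killed by `y` comes from the preceding degree of `M/yM`. -/
lemma exists_δ_of_smul_eq_zero {y : R} {g : M →ₗ[R] M''} (h : IsQuotBy y g) (i : ℕ)
    (z : H J M (i + 1)) (hz : y • z = 0) : ∃ w, δ J h.ses i w = hmap J (toImg M y) (i + 1) z :=
  exact_δ_hmap J h.ses i _ (by rw [hmap_subtype_toImg, hz])

lemma Hk.quot {k n : ℕ} {y : R} {g : M →ₗ[R] M''} (h : IsQuotBy y g)
    (hW : IsTors J (LinearMap.ker (LinearMap.lsmul R M y))) (hk : Hk J M k (n + 1)) :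
    Hk J M'' (2 * k) n := by
  intro i hi r hr z
  rw [two_mul, pow_add] at hr
  refine Submodule.mul_induction_on hr (fun a ha b hb => ?_) (fun a b ha hb => by rw [add_smul, ha, hb, add_zero])
  have h1 : δ J h.ses i (b • z) = 0 := by
    rw [map_smul]
    obtain ⟨w, hw⟩ := hmap_toImg_surj J hW (i + 1) (δ J h.ses i z)
    rw [← hw, ← map_smul, hk _ (by omega) b hb, map_zero]
  obtain ⟨w, hw⟩ := exact_hmap_δ J h.ses i _ h1
  rw [mul_smul, ← hw, ← map_smul, hk i (by omega) a ha, map_zero]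

lemma Hk.mono {k k' n n' : ℕ} (h : Hk J M k n) (hk : k ≤ k') (hn : n' ≤ n) : Hk J M k' n' :=
  fun i hi r hr z => h i (by omega) r (Ideal.pow_le_pow_right hk hr) z

/-- Peeling off one element: killing of colons at the front and of cohomology of quotients. -/
lemma Hk.of_quot {k n : ℕ} {w : R} (hw : w ∈ J)
    (h0 : ∀ a, ∀ r ∈ J ^ k, ∀ m : M, w ^ (a + 1) • m = 0 → r • m = 0)
    (h1 : ∀ a, Hk J (M ⧸ LinearMap.range (LinearMap.lsmul R M (w ^ (a + 1)))) k n) :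
    Hk J M k (n + 1) := by
  intro i hi r hr z
  obtain ⟨a, ha⟩ := torsion J i z
  have hwa : w ^ (a + 1) • z = 0 := by
    rw [pow_succ', mul_smul, ha _ (Ideal.pow_mem_pow hw a), smul_zero]
  cases i with
  | zero =>
    apply ev_injective J
    rw [map_smul, map_zero]
    exact h0 a r hr _ (by rw [← map_smul, hwa, map_zero])
  | succ i =>
    have hq : IsQuotBy (w ^ (a + 1)) (LinearMap.range (LinearMap.lsmul R M (w ^ (a + 1)))).mkQ :=
      ⟨Submodule.mkQ_surjective _, fun m => by
        rw [Submodule.mkQ_apply, Submodule.Quotient.mk_eq_zero]; rfl⟩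
    obtain ⟨v, hv⟩ := exists_δ_of_smul_eq_zero J hq i z hwa
    refine hmap_toImg_inj J (y := w ^ (a + 1)) ?_ i _ ?_
    · rintro ⟨m, hm⟩
      exact ⟨k, fun r hr => Subtype.ext (h0 a r hr m hm)⟩
    · rw [map_smul, ← hv, ← map_smul, h1 a i (by omega) r hr v, map_zero]

lemma isFiniteLength_of_pow_maximal [IsLocalRing R] [Module.Finite R M] {k : ℕ}
    (h : ∀ r ∈ maximalIdeal R ^ k, ∀ m : M, r • m = 0) : IsFiniteLength R M := by
  have hN : IsNoetherian R M := inferInstance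
  induction k generalizing M with
  | zero =>
    have : Subsingleton M := ⟨fun a b => by
      have := h 1 (by simp) (a - b)
      rwa [one_smul, sub_eq_zero] at this⟩
    exact IsFiniteLength.of_subsingleton
  | succ k ih =>
    set N : Submodule R M := maximalIdeal R • ⊤
    have h1 : IsFiniteLength R N := ih (fun r hr m => by
      obtain ⟨m, hm⟩ := m
      apply Subtype.ext
      change r • m = 0
      refine Submodule.smul_induction_on hm (fun a ha b _ => ?_) (fun a b ha hb => by rw [smul_add, ha, hb, add_zero])
      rw [← mul_smul]
      exact h _ (by rw [pow_succ]; exact Ideal.mul_mem_mul hr ha) b) inferInstance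
    have h2 : IsFiniteLength R (M ⧸ N) := by
      have hT : Module.IsTorsionBySet R (M ⧸ N) (maximalIdeal R) := by
        intro x r
        obtain ⟨x, rfl⟩ := N.mkQ_surjective x
        rw [← map_smul, Submodule.mkQ_apply, Submodule.Quotient.mk_eq_zero]
        exact Submodule.smul_mem_smul r.2 trivial
      letI := hT.module
      letI : Field (R ⧸ maximalIdeal R) := Ideal.Quotient.field _
      haveI : IsScalarTower R (R ⧸ maximalIdeal R) (M ⧸ N) := hT.isScalarTower
      haveI : Module.Finite (R ⧸ maximalIdeal R) (M ⧸ N) := Module.Finite.of_restrictScalars_finite R _ _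
      have : IsArtinian (R ⧸ maximalIdeal R) (M ⧸ N) := inferInstance
      rw [isFiniteLength_iff_isNoetherian_isArtinian]
      refine ⟨inferInstance, ?_⟩
      exact isArtinian_of_surjective_algebraMap (S := R) (R := R ⧸ maximalIdeal R) (M := M ⧸ N) Ideal.Quotient.mk_surjective
    rw [isFiniteLength_iff_isNoetherian_isArtinian] at *
    have := h1.2
    have := h2.2
    exact ⟨hN, isArtinian_of_range_eq_ker N.subtype N.mkQ (by simp)⟩

end LCoh

end

noncomputable section

section Dimension
variable {R : Type u} [CommRing R]

/-- `dim R/Q` for a prime `Q`. -/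
abbrev cd (Q : PrimeSpectrum R) : ℕ∞ := Order.coheight Q

/-- `dim R/𝔞 ≤ n`, expressed through primes. -/
def Dle (𝔞 : Ideal R) (n : ℕ) : Prop := ∀ Q : PrimeSpectrum R, 𝔞 ≤ Q.asIdeal → cd Q ≤ n

lemma Dle.mono {𝔞 𝔟 : Ideal R} {n m : ℕ} (h : Dle 𝔞 n) (hab : 𝔞 ≤ 𝔟) (hnm : n ≤ m) : Dle 𝔟 m :=
  fun Q hQ => (h Q (hab.trans hQ)).trans (by exact_mod_cast hnm)

lemma cd_lt {P Q : PrimeSpectrum R} (h : P.asIdeal < Q.asIdeal) : cd Q + 1 ≤ cd P :=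
  Order.coheight_add_one_le h

lemma cd_le {P Q : PrimeSpectrum R} (h : P.asIdeal ≤ Q.asIdeal) : cd Q ≤ cd P :=
  Order.coheight_anti h

lemma Dle_iff (𝔞 : Ideal R) (n : ℕ) :
    ringKrullDim (R ⧸ 𝔞) ≤ n ↔ Dle 𝔞 n := by
  rw [ringKrullDim_quotient]
  constructor
  · intro h Q hQ
    rw [Order.coheight_le_iff]
    intro p hp
    have hmem : ∀ i, p i ∈ PrimeSpectrum.zeroLocus (𝔞 : Set R) := fun i =>
      hQ.trans (show Q ≤ p i from hp.trans (LTSeries.head_le _ _))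
    let q : LTSeries (PrimeSpectrum.zeroLocus (𝔞 : Set R)) :=
      ⟨p.length, fun i => ⟨p i, hmem i⟩, fun i => p.step i⟩
    have := (Order.LTSeries.length_le_krullDim q).trans h
    exact_mod_cast this
  · intro h
    refine iSup_le fun q => ?_
    have := h q.head.1 q.head.2
    rw [Order.coheight_le_iff] at this
    have := @this (q.map Subtype.val (fun _ _ h => h)) le_rfl
    exact_mod_cast this

section Local
variable [IsLocalRing R] [IsNoetherianRing R]

lemma Dle_of_sup_span {𝔞 : Ideal R} {y : R} (hy : y ∈ maximalIdeal R) {n : ℕ}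
    (h : Dle (𝔞 ⊔ Ideal.span {y}) n) : Dle 𝔞 (n + 1) := by
  by_cases ha : 𝔞 = ⊤
  · rintro Q hQ
    exact absurd (top_le_iff.1 (ha ▸ hQ)) Q.2.ne_top
  rw [← Dle_iff] at *
  have : Nontrivial (R ⧸ 𝔞) := Ideal.Quotient.nontrivial_iff.2 ha
  have hl : IsLocalRing (R ⧸ 𝔞) := IsLocalRing.of_surjective' _ Ideal.Quotient.mk_surjective
  have h1 := ringKrullDim_le_ringKrullDim_quotient_add_card ({Ideal.Quotient.mk 𝔞 y} : Finset (R ⧸ 𝔞)) (by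
    intro z hz
    simp only [Finset.coe_singleton, Set.mem_singleton_iff] at hz
    subst hz
    rw [IsLocalRing.ringJacobson_eq_maximalIdeal]
    intro hu
    obtain ⟨z, hz⟩ := hu.exists_right_inv
    obtain ⟨z, rfl⟩ := Ideal.Quotient.mk_surjective z
    rw [← map_mul, ← map_one (Ideal.Quotient.mk 𝔞), Ideal.Quotient.eq] at hz
    have h2 := sub_mem (Ideal.mul_mem_right z _ hy) (le_maximalIdeal ha hz)
    rw [sub_sub_cancel] at h2
    exact (Ideal.ne_top_iff_one _).1 (maximalIdeal.isMaximal R).ne_top h2)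
  have e : ((R ⧸ 𝔞) ⧸ Ideal.span ((({Ideal.Quotient.mk 𝔞 y} : Finset (R ⧸ 𝔞))) : Set (R ⧸ 𝔞))) ≃+* R ⧸ (𝔞 ⊔ Ideal.span {y}) := by
    have := DoubleQuot.quotQuotEquivQuotSup 𝔞 (Ideal.span {y})
    rw [Ideal.map_span, Set.image_singleton] at this
    rw [Finset.coe_singleton]
    exact this
  rw [ringKrullDim_eq_of_ringEquiv e] at h1
  refine h1.trans ?_
  rw [Finset.card_singleton]
  push_cast
  gcongr

lemma Dle_zero_of_pow {𝔞 : Ideal R} {n : ℕ} (h : maximalIdeal R ^ n ≤ 𝔞) : Dle 𝔞 0 := by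
  intro Q hQ
  have : maximalIdeal R ≤ Q.asIdeal := by
    have := Q.2.le_of_pow_le (h.trans hQ)
    exact this
  have hmax : IsMax Q := by
    intro Q' _
    exact (le_maximalIdeal Q'.2.ne_top).trans this
  rw [cd, Order.coheight_eq_zero.2 hmax]; simp

lemma pow_le_of_Dle_zero {𝔞 : Ideal R} (h : Dle 𝔞 0) : ∃ n, maximalIdeal R ^ n ≤ 𝔞 := by
  apply Ideal.exists_pow_le_of_le_radical_of_fg
  · rw [Ideal.radical_eq_sInf]
    refine le_sInf ?_
    rintro Q ⟨hQ, hp⟩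
    have := h ⟨Q, hp⟩ hQ
    have : IsMax (⟨Q, hp⟩ : PrimeSpectrum R) := Order.coheight_eq_zero.1 (by simpa using this)
    exact this (b := ⟨maximalIdeal R, inferInstance⟩) (le_maximalIdeal hp.ne_top)
  · exact IsNoetherian.noetherian _

lemma Dle.avoid {𝔞 : Ideal R} {n : ℕ} (h : Dle 𝔞 (n + 1)) {y : R}
    (hy : ∀ Q : PrimeSpectrum R, 𝔞 ≤ Q.asIdeal → cd Q = (n + 1 : ℕ) → y ∉ Q.asIdeal) :
    Dle (𝔞 ⊔ Ideal.span {y}) n := by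
  intro Q hQ
  by_cases hc : cd Q = (n + 1 : ℕ)
  · exact absurd (hQ ((le_sup_right : _ ≤ 𝔞 ⊔ Ideal.span {y}) (Ideal.mem_span_singleton_self y))) (hy Q (le_sup_left.trans hQ) hc)
  · have := h Q (le_sup_left.trans hQ)
    have h3 := lt_of_le_of_ne this hc
    push_cast at h3
    exact Order.le_of_lt_add_one h3

/-- Primes over `𝔞` of the maximal possible dimension are minimal over `𝔞`. -/
lemma Dle.mem_minimalPrimes {𝔞 : Ideal R} {n : ℕ} (h : Dle 𝔞 n) {Q : PrimeSpectrum R}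
    (hQ : 𝔞 ≤ Q.asIdeal) (hc : cd Q = n) : Q.asIdeal ∈ 𝔞.minimalPrimes := by
  obtain ⟨P, hP, hPQ⟩ := Ideal.exists_minimalPrimes_le hQ
  have hPp := hP.1.1
  rcases hPQ.eq_or_lt with h' | h'
  · rwa [← h']
  · have h1 := cd_lt (P := ⟨P, hPp⟩) (Q := Q) h'
    have h2 := h ⟨P, hPp⟩ hP.1.2
    rw [hc] at h1
    have := h1.trans h2
    norm_cast at this
    omega

lemma cd_ne_top (Q : PrimeSpectrum R) : cd Q ≠ ⊤ := by
  have := Order.coheight_lt_top Q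
  exact this.ne

lemma cd_pos {Q : PrimeSpectrum R} (h : Q.asIdeal ≠ maximalIdeal R) : 1 ≤ cd Q := by
  have := cd_lt (P := Q) (Q := ⟨maximalIdeal R, inferInstance⟩) (lt_of_le_of_ne (le_maximalIdeal Q.2.ne_top) h)
  exact le_trans (by simp) this

end Local
end Dimension

end

noncomputable section

section SeqSub
variable {R : Type u} [CommRing R] {M : Type u} [AddCommGroup M] [Module R M]

/-- Multiplication by `y`. -/
abbrev mulM (M : Type u) [AddCommGroup M] [Module R M] (y : R) : M →ₗ[R] M := LinearMap.lsmul R M y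

variable (M) in
/-- The submodule `(x_0, …, x_{i-1}) M`. -/
def seqSub (x : ℕ → R) : ℕ → Submodule R M
  | 0 => ⊥
  | i + 1 => seqSub x i ⊔ LinearMap.range (mulM M (x i))

@[simp] lemma seqSub_zero (x : ℕ → R) : seqSub M x 0 = ⊥ := rfl

lemma seqSub_succ (x : ℕ → R) (i : ℕ) :
    seqSub M x (i + 1) = seqSub M x i ⊔ LinearMap.range (mulM M (x i)) := rfl

lemma seqSub_mono (x : ℕ → R) : Monotone (seqSub M x) :=
  monotone_nat_of_le_succ fun i => by rw [seqSub_succ]; exact le_sup_left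

variable (M) in
lemma seqSub_le_succ (x : ℕ → R) (j : ℕ) : seqSub M x j ≤ seqSub M x (j + 1) :=
  seqSub_mono x (Nat.le_succ j)

lemma mem_seqSub_succ {x : ℕ → R} {i : ℕ} {m : M} :
    m ∈ seqSub M x (i + 1) ↔ ∃ n ∈ seqSub M x i, ∃ m', n + x i • m' = m := by
  rw [seqSub_succ, Submodule.mem_sup]
  constructor
  · rintro ⟨n, hn, _, ⟨m', rfl⟩, h⟩; exact ⟨n, hn, m', h⟩
  · rintro ⟨n, hn, m', h⟩; exact ⟨n, hn, _, ⟨m', rfl⟩, h⟩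

lemma smul_mem_seqSub {x : ℕ → R} {i j : ℕ} (h : j < i) (m : M) : x j • m ∈ seqSub M x i :=
  seqSub_mono x h (mem_seqSub_succ.2 ⟨0, zero_mem _, m, zero_add _⟩)

lemma seqSub_congr {x y : ℕ → R} {i : ℕ} (h : ∀ j < i, x j = y j) : seqSub M x i = seqSub M y i := by
  induction i with
  | zero => rfl
  | succ i ih => rw [seqSub_succ, seqSub_succ, ih (fun j hj => h j (by omega)), h i (by omega)]

lemma seqSub_le {x : ℕ → R} {i : ℕ} {N : Submodule R M} (h : ∀ j < i, ∀ m : M, x j • m ∈ N) :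
    seqSub M x i ≤ N := by
  induction i with
  | zero => exact bot_le
  | succ i ih =>
    rw [seqSub_succ]
    refine sup_le (ih fun j hj => h j (by omega)) ?_
    rintro _ ⟨m, rfl⟩
    exact h i (by omega) m

lemma seqSub_eq (x : ℕ → R) (i : ℕ) :
    seqSub M x i = Ideal.span (x '' {j | j < i}) • (⊤ : Submodule R M) := by
  apply le_antisymm
  · exact seqSub_le fun j hj m => Submodule.smul_mem_smul (Ideal.subset_span ⟨j, hj, rfl⟩) trivial
  · rw [Submodule.smul_le]
    intro r hr m _
    refine Submodule.span_induction (p := fun r _ => r • m ∈ seqSub M x i) ?_ ?_ ?_ ?_ hr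
    · rintro _ ⟨j, hj, rfl⟩
      exact smul_mem_seqSub hj m
    · rw [zero_smul]; exact zero_mem _
    · intro a b _ _ ha hb; rw [add_smul]; exact add_mem ha hb
    · intro a b _ hb; rw [smul_eq_mul, mul_smul]; exact Submodule.smul_mem _ _ hb

/-- Images of sequence submodules under surjective maps. -/
lemma seqSub_map {M' : Type u} [AddCommGroup M'] [Module R M'] (g : M →ₗ[R] M')
    (hg : Function.Surjective g) (x : ℕ → R) (i : ℕ) :
    (seqSub M x i).map g = seqSub M' x i := by
  induction i with
  | zero => simp
  | succ i ih =>
    rw [seqSub_succ, Submodule.map_sup, ih, seqSub_succ]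
    congr 1
    ext m
    constructor
    · rintro ⟨_, ⟨m, rfl⟩, rfl⟩
      exact ⟨g m, by simp⟩
    · rintro ⟨m, rfl⟩
      obtain ⟨m, rfl⟩ := hg m
      exact ⟨_, ⟨m, rfl⟩, by simp⟩

lemma seqSub_succ' (x : ℕ → R) (i : ℕ) :
    seqSub M x (i + 1) = LinearMap.range (mulM M (x 0)) ⊔ seqSub M (fun j => x (j + 1)) i := by
  induction i with
  | zero => simp [seqSub_succ]
  | succ i ih =>
    conv_lhs => rw [seqSub_succ, ih]
    conv_rhs => rw [seqSub_succ]
    rw [sup_assoc]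

/-- Shifted sequence submodules on a quotient by the first element. -/
lemma seqSub_comap_shift {M' : Type u} [AddCommGroup M'] [Module R M'] (x : ℕ → R) {g : M →ₗ[R] M'}
    (hg : LCoh.IsQuotBy (x 0) g) (i : ℕ) :
    (seqSub M' (fun j => x (j + 1)) i).comap g = seqSub M x (i + 1) := by
  rw [← seqSub_map g hg.surj, Submodule.comap_map_eq, seqSub_succ', sup_comm]
  congr 1
  ext m
  rw [LinearMap.mem_ker, hg.ker]; rfl

lemma isQuotBy_range (y : R) :
    LCoh.IsQuotBy y (LinearMap.range (mulM M y)).mkQ :=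
  ⟨Submodule.mkQ_surjective _, fun m => by
    rw [Submodule.mkQ_apply, Submodule.Quotient.mk_eq_zero]; rfl⟩

lemma isQuotBy_factor (x : ℕ → R) (j : ℕ) :
    LCoh.IsQuotBy (x j) (Submodule.factor (seqSub_le_succ M x j)) := by
  refine ⟨Submodule.factor_surjective _, fun m => ?_⟩
  obtain ⟨m, rfl⟩ := Submodule.mkQ_surjective _ m
  rw [Submodule.factor_mk, Submodule.mkQ_apply, Submodule.Quotient.mk_eq_zero, mem_seqSub_succ]
  constructor
  · rintro ⟨n, hn, m', rfl⟩
    refine ⟨Submodule.Quotient.mk m', ?_⟩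
    rw [← Submodule.Quotient.mk_smul, Submodule.mkQ_apply, Submodule.Quotient.eq]
    rw [← neg_mem_iff]; simpa using hn
  · rintro ⟨m', hm'⟩
    obtain ⟨m', rfl⟩ := Submodule.mkQ_surjective _ m'
    rw [Submodule.mkQ_apply, Submodule.mkQ_apply, ← Submodule.Quotient.mk_smul, Submodule.Quotient.eq, ← neg_mem_iff] at hm'
    exact ⟨_, hm', m', by abel⟩

end SeqSub

namespace LCoh
variable {R : Type u} [CommRing R] [IsNoetherianRing R]

/-- If all colons of powers are killed by `J ^ k` then so is local cohomology. -/
lemma Hk_of_colon (J : Ideal R) (k : ℕ) : ∀ (h : ℕ) (M : Type u) [AddCommGroup M] [Module R M]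
    (w : ℕ → R), (∀ j < h, w j ∈ J) →
    (∀ n : ℕ → ℕ, ∀ j < h, ∀ r ∈ J ^ k, ∀ m : M,
      w j ^ (n j + 1) • m ∈ seqSub M (fun l => w l ^ (n l + 1)) j →
      r • m ∈ seqSub M (fun l => w l ^ (n l + 1)) j) → Hk J M k h := by
  intro h
  induction h with
  | zero => intro M _ _ w _ _ i hi; omega
  | succ h ih =>
    intro M _ _ w hw hc
    refine Hk.of_quot J (hw 0 (by omega)) (fun a r hr m hm => ?_) (fun a => ?_)
    · have := hc (fun _ => a) 0 (by omega) r hr m (by simpa using hm)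
      simpa using this
    · refine ih _ (fun j => w (j + 1)) (fun j hj => hw _ (by omega)) ?_
      intro n j hj r hr m hm
      obtain ⟨m, rfl⟩ := Submodule.mkQ_surjective _ m
      set n' : ℕ → ℕ := fun l => Nat.casesOn l a n with hn'
      have key := seqSub_comap_shift (M := M) (fun l => w l ^ (n' l + 1))
        (isQuotBy_range (M := M) (w 0 ^ (a + 1))) j
      have h1 := hc n' (j + 1) (by omega) r hr m
      rw [← key] at h1
      rw [← map_smul] at hm ⊢
      exact h1 hm

end LCoh

end

noncomputable section

section Ass
variable {R : Type u} [CommRing R] [IsNoetherianRing R] {M : Type u} [AddCommGroup M] [Module R M]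

lemma mem_ass_iff {p : Ideal R} :
    p ∈ associatedPrimes R M ↔ p.IsPrime ∧ ∃ x : M, ∀ r, r ∈ p ↔ r • x = 0 := by
  rw [AssociatedPrimes.mem_iff, isAssociatedPrime_iff]
  refine and_congr_right fun _ => exists_congr fun x => ?_
  rw [SetLike.ext_iff]
  simp [Submodule.mem_colon_singleton]

lemma exists_avoid {I : Ideal R} {s : Set (PrimeSpectrum R)} (hs : s.Finite)
    (h : ∀ Q ∈ s, ¬ I ≤ Q.asIdeal) : ∃ y ∈ I, ∀ Q ∈ s, y ∉ Q.asIdeal := by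
  by_contra hc
  push Not at hc
  rcases s.eq_empty_or_nonempty with rfl | ⟨Q₀, hQ₀⟩
  · obtain ⟨Q, hQ, _⟩ := hc 0 (zero_mem _); exact hQ
  · obtain ⟨Q, hQ, h'⟩ := (Ideal.subset_union_prime_finite hs (f := fun Q => Q.asIdeal) Q₀ Q₀
      (fun Q _ _ _ => Q.2) (I := I)).1 (fun y hy => by
        obtain ⟨Q, hQ, hy⟩ := hc y hy
        exact Set.mem_biUnion hQ hy)
    exact h Q hQ h'

variable (R M) in
/-- The associated primes as points of the spectrum. -/
def assSpec : Set (PrimeSpectrum R) := {Q | Q.asIdeal ∈ associatedPrimes R M}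

variable (R M) in
lemma assSpec_finite [Module.Finite R M] : (assSpec R M).Finite :=
  Set.Finite.preimage (fun _ _ _ _ h => PrimeSpectrum.ext h) (associatedPrimes.finite R M)

lemma exists_ass_of_ne_zero {y : R} {m : M} (hm : m ≠ 0) (h : y • m = 0) :
    ∃ Q ∈ assSpec R M, y ∈ Q.asIdeal := by
  have h1 : y ∈ ⋃ p ∈ associatedPrimes R M, (p : Set R) := by
    rw [biUnion_associatedPrimes_eq_zero_divisors]; exact ⟨m, hm, h⟩
  simp only [Set.mem_iUnion] at h1
  obtain ⟨p, hp, hy⟩ := h1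
  exact ⟨⟨p, hp.1⟩, hp, hy⟩

variable [IsLocalRing R]

local notation "𝔪" => maximalIdeal R

lemma isTors_fg [Module.Finite R M] (h : LCoh.IsTors 𝔪 M) : ∃ n, ∀ r ∈ 𝔪 ^ n, ∀ m : M, r • m = 0 := by
  obtain ⟨s, hs⟩ := Module.Finite.fg_top (R := R) (M := M)
  choose n hn using h
  refine ⟨s.sup n, fun r hr m => ?_⟩
  have hm : m ∈ Submodule.span R (s : Set M) := hs ▸ trivial
  refine Submodule.span_induction (p := fun m _ => r • m = 0) ?_ ?_ ?_ ?_ hm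
  · intro x hx
    exact hn x r (Ideal.pow_le_pow_right (Finset.le_sup (f := n) hx) hr)
  · exact smul_zero r
  · intro a b _ _ ha hb; rw [smul_add, ha, hb, add_zero]
  · intro c b _ hb; rw [smul_comm, hb, smul_zero]

lemma isTors_of_ass [Module.Finite R M] (h : ∀ Q ∈ assSpec R M, Q.asIdeal = 𝔪) :
    LCoh.IsTors 𝔪 M := by
  have h1 : 𝔪 ≤ (Module.annihilator R M).radical := by
    rw [← Ideal.sInf_minimalPrimes]
    refine le_sInf fun p hp => ?_
    have := Module.associatedPrimes.minimalPrimes_annihilator_subset_associatedPrimes R M hp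
    exact (h ⟨p, hp.1.1⟩ this).ge
  obtain ⟨n, hn⟩ := Ideal.exists_pow_le_of_le_radical_of_fg h1 (IsNoetherian.noetherian _)
  exact fun m => ⟨n, fun r hr => Module.mem_annihilator.1 (hn hr) m⟩

/-- An element avoiding the non-maximal associated primes has torsion annihilator. -/
lemma isTors_ker_of_avoid [Module.Finite R M] {y : R}
    (h : ∀ Q ∈ assSpec R M, Q.asIdeal ≠ 𝔪 → y ∉ Q.asIdeal) :
    LCoh.IsTors 𝔪 (LinearMap.ker (LinearMap.lsmul R M y)) := by
  apply isTors_of_ass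
  intro Q hQ
  by_contra hne
  have h1 := associatedPrimes.subset_of_injective (Submodule.injective_subtype (LinearMap.ker (LinearMap.lsmul R M y))) hQ
  refine h Q h1 hne ?_
  obtain ⟨_, ⟨x, hx⟩, hx'⟩ := mem_ass_iff.1 hQ
  exact (hx' y).2 (Subtype.ext hx)

lemma not_pow_le {Q : PrimeSpectrum R} (h : Q.asIdeal ≠ 𝔪) (k : ℕ) : ¬ 𝔪 ^ k ≤ Q.asIdeal := by
  intro hc
  exact h (le_antisymm (le_maximalIdeal Q.2.ne_top) (Q.2.le_of_pow_le hc))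

variable (R M) in
lemma exists_filter_regular [Module.Finite R M] (k : ℕ) :
    ∃ y ∈ 𝔪 ^ k, ∀ Q ∈ assSpec R M, Q.asIdeal ≠ 𝔪 → y ∉ Q.asIdeal := by
  obtain ⟨y, hy, h⟩ := exists_avoid (I := 𝔪 ^ k) (s := {Q ∈ assSpec R M | Q.asIdeal ≠ 𝔪})
    ((assSpec_finite R M).subset (Set.sep_subset _ _)) (fun Q hQ => not_pow_le hQ.2 k)
  exact ⟨y, hy, fun Q h1 h2 => h Q ⟨h1, h2⟩⟩

lemma isFiniteLength_of_map {M' : Type u} [AddCommGroup M'] [Module R M'] (h : IsFiniteLength R M)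
    (f : M →ₗ[R] M') (hf : Function.Surjective f) : IsFiniteLength R M' := by
  rw [← Module.length_ne_top_iff] at *
  exact ne_top_of_le_ne_top h (Module.length_le_of_surjective f hf)

lemma isFiniteLength_of_inj {M' : Type u} [AddCommGroup M'] [Module R M'] (h : IsFiniteLength R M)
    (f : M' →ₗ[R] M) (hf : Function.Injective f) : IsFiniteLength R M' := by
  rw [← Module.length_ne_top_iff] at *
  exact ne_top_of_le_ne_top h (Module.length_le_of_injective f hf)

open LCoh in
/-- Local cohomology killed by a power of the maximal ideal has finite length. -/
lemma isFiniteLength_H (i : ℕ) : ∀ (M : Type u) [AddCommGroup M] [Module R M] [Module.Finite R M] (k : ℕ),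
    Hk 𝔪 M k (i + 1) → IsFiniteLength R (H 𝔪 M i) := by
  induction i with
  | zero =>
    intro M _ _ _ k hk
    have : Module.Finite R (H 𝔪 M 0) := Module.Finite.of_injective _ (ev_injective 𝔪)
    exact isFiniteLength_of_pow_maximal (k := k) (hk 0 (by omega))
  | succ i ih =>
    intro M _ _ _ k hk
    obtain ⟨y, hy, hav⟩ := exists_filter_regular R M k
    have hT := isTors_ker_of_avoid hav
    have hq := isQuotBy_range (M := M) y
    have h1 := ih _ _ (Hk.quot 𝔪 hq hT hk)
    have h2 : IsFiniteLength R (LinearMap.range (δ 𝔪 hq.ses i)) :=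
      isFiniteLength_of_map h1 _ (LinearMap.surjective_rangeRestrict _)
    refine isFiniteLength_of_inj h2 ((hmap 𝔪 (toImg M y) (i + 1)).codRestrict _ ?_) ?_
    · intro z
      exact exists_δ_of_smul_eq_zero 𝔪 hq i z (hk _ (by omega) y hy z)
    · rw [injective_iff_map_eq_zero]
      intro z hz
      exact hmap_toImg_inj 𝔪 hT i z (congrArg Subtype.val hz)

open LCoh in
lemma Hk.mod_Γ {k n : ℕ} (hk : Hk 𝔪 M k n) : Hk 𝔪 (M ⧸ Γ 𝔪 M) k n := by
  intro i hi r hr z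
  have hs := SES.ofSubmodule (Γ 𝔪 M)
  obtain ⟨w, rfl⟩ := exact_hmap_δ 𝔪 hs i z
    (@Subsingleton.elim _ (isTors_subsingleton 𝔪 i _ (isTors_Γ 𝔪)) _ _)
  rw [← map_smul, hk i hi r hr, map_zero]

open LCoh in
lemma mem_Γ_of_maximal [Module.Finite R M] {x : M} {k : ℕ} (h : ∀ r ∈ 𝔪 ^ k, r • x ∈ Γ 𝔪 M) : x ∈ Γ 𝔪 M := by
  have : IsNoetherian R M := inferInstance
  obtain ⟨n, hn⟩ := isTors_fg (isTors_Γ 𝔪 (M := M))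
  refine ⟨n + k, fun r hr => ?_⟩
  rw [pow_add] at hr
  refine Submodule.mul_induction_on hr (fun a ha b hb => ?_) (fun a b ha hb => by rw [add_smul, ha, hb, add_zero])
  rw [mul_smul]
  exact congrArg Subtype.val (hn a ha ⟨b • x, h b hb⟩)

/-- Nontrivial elements of `⋂ y^n M` do not exist. -/
lemma eq_zero_of_forall_pow [Module.Finite R M] {y : R} (hy : y ∈ 𝔪) {m : M}
    (h : ∀ n, ∃ m', y ^ n • m' = m) : m = 0 := by
  have h1 : m ∈ (⨅ i : ℕ, 𝔪 ^ i • ⊤ : Submodule R M) := by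
    rw [Submodule.mem_iInf]
    intro n
    obtain ⟨m', rfl⟩ := h n
    exact Submodule.smul_mem_smul (Ideal.pow_mem_pow hy n) trivial
  rwa [Ideal.iInf_pow_smul_eq_bot_of_isLocalRing 𝔪 (maximalIdeal.isMaximal R).ne_top] at h1

end Ass

end

noncomputable section

section DimAss
variable {R : Type u} [CommRing R] [IsNoetherianRing R] [IsLocalRing R]

local notation "𝔪" => maximalIdeal R

open LCoh

lemma ass_mod_Γ {M : Type u} [AddCommGroup M] [Module R M] [Module.Finite R M] {Q : PrimeSpectrum R}
    (hQ : Q ∈ assSpec R M) (hm : Q.asIdeal ≠ 𝔪) : Q ∈ assSpec R (M ⧸ Γ 𝔪 M) := by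
  obtain ⟨hp, x, hx⟩ := mem_ass_iff.1 hQ
  refine mem_ass_iff.2 ⟨hp, (Γ 𝔪 M).mkQ x, fun r => ?_⟩
  rw [← map_smul, Submodule.mkQ_apply, Submodule.Quotient.mk_eq_zero, hx]
  constructor
  · intro h; rw [h]; exact zero_mem _
  · rintro ⟨n, hn⟩
    rw [← hx]
    have : ¬ 𝔪 ^ n ≤ Q.asIdeal := not_pow_le hm n
    obtain ⟨s, hs, hs'⟩ := Set.not_subset.1 this
    have h1 := hn s hs
    rw [← mul_smul, ← hx] at h1
    exact (hp.mem_or_mem h1).resolve_left hs'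

lemma maximal_not_ass_mod_Γ {M : Type u} [AddCommGroup M] [Module R M] [Module.Finite R M]
    {Q : PrimeSpectrum R} (hQ : Q ∈ assSpec R (M ⧸ Γ 𝔪 M)) : Q.asIdeal ≠ 𝔪 := by
  intro hm
  obtain ⟨hp, x, hx⟩ := mem_ass_iff.1 hQ
  obtain ⟨x, rfl⟩ := Submodule.mkQ_surjective _ x
  have h1 : x ∈ Γ 𝔪 M := mem_Γ_of_maximal (k := 1) fun r hr => by
    rw [pow_one, ← hm, hx, ← map_smul, Submodule.mkQ_apply, Submodule.Quotient.mk_eq_zero] at hr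
    exact hr
  have h2 : (1 : R) ∈ Q.asIdeal := by
    rw [hx, one_smul, Submodule.mkQ_apply, Submodule.Quotient.mk_eq_zero]; exact h1
  exact hp.ne_top ((Ideal.eq_top_iff_one _).2 h2)

/-- Passing to `M/yM` for regular `y`: an associated prime below a given prime. -/
lemma exists_ass_quot {M : Type u} [AddCommGroup M] [Module R M] [Module.Finite R M]
    {P Q : PrimeSpectrum R} (hP : P ∈ assSpec R M) {y : R} (hy : ∀ m : M, y • m = 0 → m = 0)
    (hPQ : P.asIdeal ≤ Q.asIdeal) (hyQ : y ∈ Q.asIdeal) :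
    ∃ P' ∈ assSpec R (M ⧸ LinearMap.range (mulM M y)), P.asIdeal ≤ P'.asIdeal ∧ y ∈ P'.asIdeal ∧
      P'.asIdeal ≤ Q.asIdeal := by
  obtain ⟨hp, x, hx⟩ := mem_ass_iff.1 hP
  let N : Submodule R M := Submodule.torsionBySet R M (P.asIdeal : Set R)
  have hN : ∀ {m : M}, m ∈ N ↔ ∀ r ∈ P.asIdeal, r • m = 0 := fun {m} => by
    simp [N, Submodule.mem_torsionBySet_iff]
  have hxN : x ∈ N := hN.2 fun r hr => (hx r).1 hr
  have hann : Module.annihilator R N ≤ P.asIdeal := fun r hr => by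
    rw [hx]
    exact congrArg Subtype.val (Module.mem_annihilator.1 hr ⟨x, hxN⟩)
  have hNf : Module.Finite R N := inferInstance
  have hsupp : Q ∈ Module.support R (QuotSMulTop y N) := by
    rw [Module.support_quotSMulTop]
    exact ⟨Module.mem_support_iff_of_finite.2 (hann.trans hPQ), by simpa using hyQ⟩
  have h1 := Module.mem_support_iff_of_finite.1 hsupp
  obtain ⟨p', hp', hp'Q⟩ := Ideal.exists_minimalPrimes_le h1
  have h2 := Module.associatedPrimes.minimalPrimes_annihilator_subset_associatedPrimes R (QuotSMulTop y N) hp'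
  have hp'p := hp'.1.1
  refine ⟨⟨p', hp'p⟩, ?_, ?_, ?_, hp'Q⟩
  · obtain ⟨_, z, hz⟩ := mem_ass_iff.1 h2
    obtain ⟨z, rfl⟩ := Submodule.mkQ_surjective _ z
    refine mem_ass_iff.2 ⟨hp'p, Submodule.mkQ _ z.1, fun r => ?_⟩
    rw [hz, ← map_smul, ← map_smul, Submodule.mkQ_apply, Submodule.mkQ_apply,
      Submodule.Quotient.mk_eq_zero, Submodule.Quotient.mk_eq_zero, Submodule.mem_smul_pointwise_iff_exists]
    constructor
    · rintro ⟨w, _, hw⟩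
      exact ⟨w.1, congrArg Subtype.val hw⟩
    · rintro ⟨w, hw⟩
      refine ⟨⟨w, hN.2 fun s hs => hy _ ?_⟩, trivial, Subtype.ext hw⟩
      have hw' : y • w = r • z.1 := hw
      rw [smul_comm, hw', smul_comm, hN.1 z.2 s hs, smul_zero]
  · refine le_trans ?_ hp'.1.2
    intro r hr
    rw [Module.mem_annihilator]
    intro z
    obtain ⟨z, rfl⟩ := Submodule.mkQ_surjective _ z
    rw [← map_smul, show r • z = 0 from Subtype.ext (hN.1 z.2 r hr), map_zero]
  · apply hp'.1.2
    rw [Module.mem_annihilator]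
    intro z
    obtain ⟨z, rfl⟩ := Submodule.mkQ_surjective _ z
    rw [← map_smul, Submodule.mkQ_apply, Submodule.Quotient.mk_eq_zero]
    exact (Submodule.mem_smul_pointwise_iff_exists _ _ _).2 ⟨z, trivial, rfl⟩

lemma eq_zero_of_pow_smul {M : Type u} [AddCommGroup M] [Module R M] {y : R}
    (hy : ∀ m : M, y • m = 0 → m = 0) (n : ℕ) {m : M} (h : y ^ n • m = 0) : m = 0 := by
  induction n with
  | zero => simpa using h
  | succ n ih =>
    apply ih
    apply hy
    rw [← mul_smul, ← pow_succ']; exact h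

lemma not_one_dim {M : Type u} [AddCommGroup M] [Module R M] [Module.Finite R M] {k : ℕ}
    (hk : Hk 𝔪 M k 2) {P : PrimeSpectrum R} (hP : P ∈ assSpec R M) (hm : P.asIdeal ≠ 𝔪)
    {y : R} (hym : y ∈ 𝔪) (hy : ∀ m : M, y • m = 0 → m = 0)
    (hprim : ∀ Q : PrimeSpectrum R, P.asIdeal ≤ Q.asIdeal → y ∈ Q.asIdeal → Q.asIdeal = 𝔪) : False := by
  obtain ⟨hp, x, hx⟩ := mem_ass_iff.1 hP
  let C : Submodule R M := Submodule.span R {x}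
  have hC : ∀ c : C, ∃ r : R, r • (⟨x, Submodule.mem_span_singleton_self x⟩ : C) = c := fun c => by
    obtain ⟨r, hr⟩ := Submodule.mem_span_singleton.1 c.2
    exact ⟨r, Subtype.ext hr⟩
  have hPC : ∀ r ∈ P.asIdeal, ∀ c : C, r • c = 0 := by
    intro r hr c
    obtain ⟨s, rfl⟩ := hC c
    rw [smul_comm, show r • (⟨x, Submodule.mem_span_singleton_self x⟩ : C) = 0 from Subtype.ext ((hx r).1 hr), smul_zero]
  obtain ⟨a, ha⟩ := isTors_fg (isTors_Γ 𝔪 (M := M ⧸ C))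
  have hs := SES.ofSubmodule C
  have hH1 : ∀ r ∈ 𝔪 ^ (a + k), ∀ z : H 𝔪 C 1, r • z = 0 := by
    intro r hr z
    rw [pow_add] at hr
    refine Submodule.mul_induction_on hr (fun s hs' b hb => ?_) (fun a b ha hb => by rw [add_smul, ha, hb, add_zero])
    have h1 : hmap 𝔪 C.subtype 1 (b • z) = 0 := by rw [map_smul, hk 1 (by omega) b hb]
    obtain ⟨w, hw⟩ := exact_δ_hmap 𝔪 hs 0 _ h1
    rw [mul_smul, ← hw, ← map_smul]
    have : s • w = 0 := by
      apply ev_injective 𝔪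
      rw [map_smul, map_zero]
      obtain ⟨n, hn⟩ := torsion 𝔪 0 w
      have hev : ev 𝔪 (M ⧸ C) w ∈ Γ 𝔪 (M ⧸ C) := ⟨n, fun r hr => by rw [← map_smul, hn r hr, map_zero]⟩
      exact congrArg Subtype.val (ha s hs' ⟨_, hev⟩)
    rw [this, map_zero]
  have hH0 : ∀ z : H 𝔪 C 0, z = 0 := by
    intro z
    apply ev_injective 𝔪
    rw [map_zero]
    obtain ⟨n, hn⟩ := torsion 𝔪 0 z
    obtain ⟨s, hs⟩ := hC (ev 𝔪 C z)
    obtain ⟨t, ht, ht'⟩ := Set.not_subset.1 (not_pow_le hm n)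
    have h1 : t • ev 𝔪 C z = 0 := by rw [← map_smul, hn t ht, map_zero]
    rw [← hs, ← mul_smul] at h1
    have h2 : (t * s) • x = 0 := congrArg Subtype.val h1
    rw [← hx] at h2
    have h3 := (hp.mem_or_mem h2).resolve_left ht'
    rw [← hs]
    exact Subtype.ext ((hx s).1 h3)
  have hkill : ∀ r ∈ 𝔪 ^ (a + k), ∀ c : C, r • c = 0 := by
    intro r hr c
    refine eq_zero_of_forall_pow hym fun n => ?_
    have hq := isQuotBy_range (M := C) (y ^ n)
    -- the quotient is torsion
    have hrad : 𝔪 ≤ (P.asIdeal ⊔ Ideal.span {y ^ n}).radical := by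
      rw [Ideal.radical_eq_sInf]
      refine le_sInf ?_
      rintro Q ⟨hQ, hQp⟩
      refine (hprim ⟨Q, hQp⟩ (le_sup_left.trans hQ) ?_).ge
      exact hQp.mem_of_pow_mem n (hQ ((le_sup_right : _ ≤ P.asIdeal ⊔ _) (Ideal.mem_span_singleton_self _)))
    obtain ⟨b, hb⟩ := Ideal.exists_pow_le_of_le_radical_of_fg hrad (IsNoetherian.noetherian _)
    set cbar := (LinearMap.range (mulM C (y ^ n))).mkQ c with hcbar
    have hct : ∀ s ∈ 𝔪 ^ b, s • cbar = 0 := by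
      intro s hs
      obtain ⟨p, hp', w, hw, rfl⟩ := Submodule.mem_sup.1 (hb hs)
      obtain ⟨v, rfl⟩ := Ideal.mem_span_singleton'.1 hw
      rw [hcbar, ← map_smul, add_smul, hPC p hp', zero_add, mul_comm, mul_smul, hq.ker]
      exact ⟨_, rfl⟩
    obtain ⟨z, hz⟩ := ev_range 𝔪 hct
    have hkerT : IsTors 𝔪 (LinearMap.ker (LinearMap.lsmul R C (y ^ n))) := by
      rintro ⟨c', hc'⟩
      refine ⟨0, fun r _ => ?_⟩
      have : c' = 0 := by
        apply Subtype.ext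
        exact eq_zero_of_pow_smul hy n (congrArg Subtype.val hc')
      apply Subtype.ext
      simp [this]
    have h1 : δ 𝔪 hq.ses 0 (r • z) = 0 := by
      obtain ⟨w, hw⟩ := hmap_toImg_surj 𝔪 hkerT 1 (δ 𝔪 hq.ses 0 z)
      rw [map_smul, ← hw, ← map_smul, hH1 r hr, map_zero]
    obtain ⟨v, hv⟩ := exact_hmap_δ 𝔪 hq.ses 0 _ h1
    have h2 : r • cbar = 0 := by
      rw [← hz, ← map_smul, ← hv, hH0 v, map_zero, map_zero]
    rw [hcbar, ← map_smul, hq.ker] at h2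
    exact h2
  refine not_pow_le hm (a + k) fun r hr => (hx r).2 ?_
  exact congrArg Subtype.val (hkill r hr ⟨x, Submodule.mem_span_singleton_self x⟩)

/-- Dimension of associated primes when low local cohomology is small. -/
lemma le_cd_of_Hk (n : ℕ) : ∀ (M : Type u) [AddCommGroup M] [Module R M] [Module.Finite R M] (k : ℕ),
    Hk 𝔪 M k n → ∀ P ∈ assSpec R M, P.asIdeal ≠ 𝔪 → (n : ℕ∞) ≤ cd P := by
  induction n with
  | zero => intros; simp
  | succ n ih =>
    intro M _ _ _ k hk P hP hm
    rcases Nat.eq_zero_or_pos n with rfl | hn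
    · simpa using cd_pos hm
    have hk' := _root_.Hk.mod_Γ hk
    have hP' := ass_mod_Γ hP hm
    obtain ⟨y, hy, hav⟩ := exists_filter_regular R (M ⧸ Γ 𝔪 M) 1
    rw [pow_one] at hy
    have hreg : ∀ m : M ⧸ Γ 𝔪 M, y • m = 0 → m = 0 := by
      intro m hmm
      by_contra hc
      obtain ⟨Q, hQ, hyQ⟩ := exists_ass_of_ne_zero hc hmm
      exact hav Q hQ (maximal_not_ass_mod_Γ hQ) hyQ
    by_cases hcase : ∀ Q : PrimeSpectrum R, P.asIdeal ≤ Q.asIdeal → y ∈ Q.asIdeal → Q.asIdeal = 𝔪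
    · exact (not_one_dim (hk'.mono 𝔪 le_rfl (by omega)) hP' hm hy hreg hcase).elim
    · push Not at hcase
      obtain ⟨Q, hPQ, hyQ, hQm⟩ := hcase
      obtain ⟨P', hP'', h1, h2, h3⟩ := exists_ass_quot hP' hreg hPQ hyQ
      have hP'm : P'.asIdeal ≠ 𝔪 := fun h => hQm (le_antisymm (le_maximalIdeal Q.2.ne_top) (h ▸ h3))
      have h4 := ih _ _ (Hk.quot 𝔪 (isQuotBy_range y) (isTors_ker_of_avoid hav) hk') P' hP'' hP'm
      have h5 : P.asIdeal < P'.asIdeal := by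
        refine lt_of_le_of_ne h1 fun h => ?_
        exact hav P hP' hm (h ▸ h2)
      refine le_trans ?_ (cd_lt h5)
      push_cast
      gcongr

lemma Hk.equiv {M N : Type u} [AddCommGroup M] [Module R M] [AddCommGroup N] [Module R N] {k δ : ℕ}
    (e : M ≃ₗ[R] N) (hk : Hk 𝔪 M k δ) : Hk 𝔪 N k δ := by
  intro i hi r hr z
  have h1 : hmap 𝔪 e.toLinearMap i (hmap 𝔪 e.symm.toLinearMap i z) = z := by
    rw [hmap_comp]
    have : e.toLinearMap.comp e.symm.toLinearMap = LinearMap.id := by ext; simp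
    rw [this, hmap_id]
  rw [← h1, ← map_smul, hk i hi r hr, map_zero]

lemma isTors_ker_of_Hk {M : Type u} [AddCommGroup M] [Module R M] [Module.Finite R M] {k δ : ℕ}
    (hk : Hk 𝔪 M k δ) (y : R) (hy : ∀ P : PrimeSpectrum R, Module.annihilator R M ≤ P.asIdeal →
      y ∈ P.asIdeal → cd P < (δ : ℕ∞)) :
    IsTors 𝔪 (LinearMap.ker (LinearMap.lsmul R M y)) := by
  refine isTors_ker_of_avoid fun Q hQ hm hyQ => ?_
  refine (le_cd_of_Hk δ M k hk Q hQ hm).not_gt (hy Q ?_ hyQ)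
  obtain ⟨_, x, hx⟩ := mem_ass_iff.1 hQ
  exact fun r hr => (hx r).2 (Module.mem_annihilator.1 hr x)

/-- A partial system of parameters for a module with small low cohomology: quotients keep small
low cohomology and colons are torsion. -/
lemma Hk_seqSub {M : Type u} [AddCommGroup M] [Module R M] [Module.Finite R M] {k δ : ℕ} (hk : Hk 𝔪 M k δ)
    (x : ℕ → R) (j : ℕ) (hx : ∀ l ≤ j, l < δ → ∀ P : PrimeSpectrum R, Module.annihilator R M ≤ P.asIdeal →
      (∀ i ≤ l, x i ∈ P.asIdeal) → cd P < (δ - l : ℕ)) (hj : j ≤ δ) :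
    Hk 𝔪 (M ⧸ seqSub M x j) (2 ^ j * k) (δ - j) ∧ (j < δ → 
      IsTors 𝔪 (LinearMap.ker (LinearMap.lsmul R (M ⧸ seqSub M x j) (x j)))) := by
  have key : ∀ j' ≤ j, j' ≤ δ → Hk 𝔪 (M ⧸ seqSub M x j') (2 ^ j' * k) (δ - j') → (j' < δ → 
      IsTors 𝔪 (LinearMap.ker (LinearMap.lsmul R (M ⧸ seqSub M x j') (x j')))) := by
    intro j hjj hj h hlt
    refine isTors_ker_of_Hk h _ fun P hP hxP => hx j hjj hlt P ?_ fun i hi => ?_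
    · refine le_trans (fun r hr => ?_) hP
      rw [Module.mem_annihilator]
      intro z
      obtain ⟨z, rfl⟩ := Submodule.mkQ_surjective _ z
      rw [← map_smul, Module.mem_annihilator.1 hr, map_zero]
    · rcases hi.lt_or_eq with hi | rfl
      · apply hP
        rw [Module.mem_annihilator]
        intro z
        obtain ⟨z, rfl⟩ := Submodule.mkQ_surjective _ z
        rw [← map_smul, Submodule.mkQ_apply, Submodule.Quotient.mk_eq_zero]
        exact smul_mem_seqSub hi _
      · exact hxP
  induction j with
  | zero =>
    have h0 : Hk 𝔪 (M ⧸ seqSub M x 0) (2 ^ 0 * k) (δ - 0) := by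
      rw [pow_zero, one_mul, Nat.sub_zero]
      exact Hk.equiv (Submodule.quotEquivOfEqBot _ (seqSub_zero x)).symm hk
    exact ⟨h0, key 0 le_rfl hj h0⟩
  | succ j ih =>
    obtain ⟨h1, h2⟩ := ih (fun l hl => hx l (by omega)) (by omega) (fun l hl => key l (by omega))
    have h3 : Hk 𝔪 (M ⧸ seqSub M x (j+1)) (2 ^ (j+1) * k) (δ - (j+1)) := by
      have := Hk.quot 𝔪 (isQuotBy_factor (M := M) x j) (h2 (by omega)) (k := 2 ^ j * k) (n := δ - (j+1))
        (by rw [show δ - (j+1) + 1 = δ - j by omega]; exact h1)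
      rwa [pow_succ', mul_assoc]
    exact ⟨h3, key _ le_rfl hj h3⟩

/-- Colon submodules of partial systems of parameters are uniformly killed. -/
lemma colon_of_Hk {M : Type u} [AddCommGroup M] [Module R M] [Module.Finite R M] {k δ : ℕ} (hk : Hk 𝔪 M k δ)
    (x : ℕ → R) (j : ℕ) (hx : ∀ l ≤ j, l < δ → ∀ P : PrimeSpectrum R, Module.annihilator R M ≤ P.asIdeal →
      (∀ i ≤ l, x i ∈ P.asIdeal) → cd P < (δ - l : ℕ)) (hj : j < δ) (m : M)
    (hm : x j • m ∈ seqSub M x j) (r : R) (hr : r ∈ 𝔪 ^ (2 ^ j * k)) : r • m ∈ seqSub M x j := by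
  obtain ⟨h1, h2⟩ := Hk_seqSub hk x j hx hj.le
  have h3 : (seqSub M x j).mkQ m ∈ LinearMap.ker (LinearMap.lsmul R (M ⧸ seqSub M x j) (x j)) := by
    rw [LinearMap.mem_ker, LinearMap.lsmul_apply, ← map_smul, Submodule.mkQ_apply,
      Submodule.Quotient.mk_eq_zero]
    exact hm
  obtain ⟨n, hn⟩ := h2 hj ⟨_, h3⟩
  obtain ⟨z, hz⟩ := ev_range 𝔪 (x := (seqSub M x j).mkQ m) fun r hr => congrArg Subtype.val (hn r hr)
  have h4 := h1 0 (by omega) r hr z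
  have h5 : r • (seqSub M x j).mkQ m = 0 := by rw [← hz, ← map_smul, h4, map_zero]
  rw [← map_smul, Submodule.mkQ_apply, Submodule.Quotient.mk_eq_zero] at h5
  exact h5

end DimAss

end

noncomputable section

namespace LCoh
variable {R : Type u} [CommRing R] [IsNoetherianRing R] (J : Ideal R)
  {M M'' : Type u} [AddCommGroup M] [Module R M] [AddCommGroup M''] [Module R M'']

lemma hmap_symm (e : M ≃ₗ[R] M'') (i : ℕ) (z : H J M'' i) :
    hmap J e.toLinearMap i (hmap J e.symm.toLinearMap i z) = z := by
  rw [hmap_comp, LinearEquiv.comp_symm, hmap_id]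

lemma Hk.of_equiv {k n : ℕ} (e : M ≃ₗ[R] M'') (hk : Hk J M k n) : Hk J M'' k n := by
  intro i hi r hr z
  rw [← hmap_symm J e i z, ← map_smul, hk i hi r hr, map_zero]

/-- Vanishing of `H^{i+1}(M)` when multiplication by `y` is zero and `H^i(M) → H^i(M/y)` is onto. -/
lemma eq_zero_of_hmap_surj {y : R} {g : M →ₗ[R] M''} (h : IsQuotBy y g)
    (hW : IsTors J (LinearMap.ker (LinearMap.lsmul R M y))) (i : ℕ)
    (hs : ∀ z : H J M'' i, ∃ z', hmap J g i z' = z) (z : H J M (i + 1)) (hy : y • z = 0) : z = 0 := by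
  apply hmap_toImg_inj J hW
  obtain ⟨w, hw⟩ := exists_δ_of_smul_eq_zero J h i z hy
  obtain ⟨v, rfl⟩ := hs w
  rw [← hw]
  exact δ_hmap J h.ses i v

lemma exists_smul_eq_of_quot {y : R} {g : M →ₗ[R] M''} (h : IsQuotBy y g)
    (hW : IsTors J (LinearMap.ker (LinearMap.lsmul R M y))) (i : ℕ)
    (h0 : ∀ z : H J M'' i, z = 0) (z : H J M i) : ∃ z', y • z' = z := by
  obtain ⟨w, rfl⟩ := exact_hmap J h.ses i z (h0 _)
  obtain ⟨v, rfl⟩ := hmap_toImg_surj J hW i w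
  exact ⟨v, (hmap_subtype_toImg J y i v).symm⟩

/-- If the top colons agree modulo the previous ones, the first element is regular and the
low local cohomology is small, then the low local cohomology vanishes. -/
lemma Hk_zero_of_top {K h : ℕ} (w : ℕ → R)
    (hw : ∀ j < h + 2, w j ∈ J ^ K)
    (hk : ∀ j < h + 2, Hk J (M ⧸ seqSub M w j) K (h + 2 - j))
    (hT : ∀ j < h + 2, IsTors J (LinearMap.ker (LinearMap.lsmul R (M ⧸ seqSub M w j) (w j))))
    (hcol : ∀ m : M, w (h + 1) • m ∈ seqSub M w (h + 1) → ∀ r ∈ J ^ K, r • m ∈ seqSub M w (h + 1))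
    (hreg : ∀ m : M, w 0 • m = 0 → m = 0)
    (htop : ∀ m : M, w (h + 1) • m ∈ seqSub M w (h + 1) →
      ∃ m', w h • m' ∈ seqSub M w h ∧ m - m' ∈ seqSub M w (h + 1)) :
    Hk J M 0 (h + 2) := by
  have key : ∀ l ≤ h, ∀ i, 1 ≤ i → i < h + 2 - (h - l) → ∀ z : H J (M ⧸ seqSub M w (h - l)) i, z = 0 := by
    intro l
    induction l with
    | zero =>
      intro _ i hi1 hi2 z
      obtain rfl : i = 0 + 1 := by simp at hi2; omega
      refine eq_zero_of_hmap_surj J (isQuotBy_factor (M := M) w h) (hT h (by omega)) 0 (fun z => ?_) z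
        (hk h (by omega) 1 (by omega) _ (hw h (by omega)) z)
      obtain ⟨m, hm⟩ := Submodule.mkQ_surjective _ (ev J _ z)
      have h1 : ∀ r ∈ J ^ K, r • m ∈ seqSub M w (h + 1) := by
        intro r hr
        have := congrArg (ev J _) (hk (h + 1) (by omega) 0 (by omega) r hr z)
        rw [map_smul, map_zero, ← hm, ← map_smul, Submodule.mkQ_apply, Submodule.Quotient.mk_eq_zero] at this
        exact this
      obtain ⟨m', hm', hmm⟩ := htop m (h1 _ (hw (h + 1) (by omega)))
      have h2 : (seqSub M w h).mkQ m' ∈ LinearMap.ker (LinearMap.lsmul R (M ⧸ seqSub M w h) (w h)) := by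
        rw [LinearMap.mem_ker, LinearMap.lsmul_apply, ← map_smul, Submodule.mkQ_apply,
          Submodule.Quotient.mk_eq_zero]
        exact hm'
      obtain ⟨n, hn⟩ := hT h (by omega) ⟨_, h2⟩
      obtain ⟨z', hz'⟩ := ev_range J (x := (seqSub M w h).mkQ m') fun r hr => congrArg Subtype.val (hn r hr)
      refine ⟨z', ev_injective J ?_⟩
      rw [ev_map, hz', ← hm]
      change (seqSub M w (h+1)).mkQ m' = _
      rw [← sub_eq_zero, ← map_sub, Submodule.mkQ_apply, Submodule.Quotient.mk_eq_zero]
      rw [← neg_mem_iff]; simpa using hmm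
    | succ l ih =>
      intro hl i hi1 hi2 z
      have e : h - l = h - (l + 1) + 1 := by omega
      have ih' := ih (by omega)
      rw [e] at ih'
      have hq := isQuotBy_factor (M := M) w (h - (l + 1))
      have hT' := hT (h - (l + 1)) (by omega)
      have hz0 : ∀ z : H J (M ⧸ seqSub M w (h - (l + 1))) i, w (h - (l+1)) • z = 0 :=
        hk (h - (l + 1)) (by omega) i (by omega) _ (hw _ (by omega))
      rcases (show i = 1 ∨ 2 ≤ i by omega) with rfl | hi
      · obtain ⟨z', rfl⟩ := exists_smul_eq_of_quot J hq hT' 1 (ih' 1 le_rfl (by omega)) z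
        exact hz0 z'
      · obtain ⟨i, rfl⟩ : ∃ i', i = i' + 1 := ⟨i - 1, by omega⟩
        refine eq_zero_of_hmap_surj J hq hT' i (fun z => ⟨0, ?_⟩) z (hz0 z)
        rw [map_zero, ih' i (by omega) (by omega) z]
  intro i hi r _ z
  suffices ∀ z : H J (M ⧸ seqSub M w 0) i, z = 0 by
    have e := Submodule.quotEquivOfEqBot _ (seqSub_zero (M := M) w)
    rw [← hmap_symm J e i z, this (hmap J e.symm.toLinearMap i z), map_zero, smul_zero]
  intro z
  rcases Nat.eq_zero_or_pos i with rfl | hi1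
  · apply ev_injective J
    obtain ⟨m, hm⟩ := Submodule.mkQ_surjective _ (ev J _ z)
    have := congrArg (ev J _) (hk 0 (by omega) 0 (by omega) _ (hw 0 (by omega)) z)
    rw [map_smul, map_zero, ← hm, ← map_smul, Submodule.mkQ_apply, Submodule.Quotient.mk_eq_zero] at this
    rw [map_zero, ← hm, hreg m this, map_zero]
  · have := key h le_rfl i hi1
    rw [Nat.sub_self] at this
    exact this hi z

/-- Torsion colons of a module with vanishing low cohomology are trivial. -/
lemma colon_trivial_of_Hk_zero {h : ℕ} (hk : Hk J M 0 h) (w : ℕ → R)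
    (hT : ∀ j < h, IsTors J (LinearMap.ker (LinearMap.lsmul R (M ⧸ seqSub M w j) (w j)))) (j : ℕ)
    (hj : j ≤ h) : Hk J (M ⧸ seqSub M w j) 0 (h - j) := by
  induction j with
  | zero =>
    exact Hk.of_equiv J (Submodule.quotEquivOfEqBot _ (seqSub_zero (M := M) w)).symm hk
  | succ j ih =>
    have := Hk.quot J (isQuotBy_factor (M := M) w j) (hT j (by omega)) (k := 0) (n := h - (j+1))
      (by rw [show h - (j+1) + 1 = h - j by omega]; exact ih (by omega))
    simpa using this

lemma mem_seqSub_of_tors {M : Type u} [AddCommGroup M] [Module R M] {K h : ℕ} {w : ℕ → R} {j : ℕ}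
    (hk : Hk J (M ⧸ seqSub M w j) K (h + 1))
    (hT : IsTors J (LinearMap.ker (LinearMap.lsmul R (M ⧸ seqSub M w j) (w j)))) {m : M}
    (hm : w j • m ∈ seqSub M w j) {r : R} (hr : r ∈ J ^ K) : r • m ∈ seqSub M w j := by
  have h3 : (seqSub M w j).mkQ m ∈ LinearMap.ker (LinearMap.lsmul R (M ⧸ seqSub M w j) (w j)) := by
    rw [LinearMap.mem_ker, LinearMap.lsmul_apply, ← map_smul, Submodule.mkQ_apply,
      Submodule.Quotient.mk_eq_zero]
    exact hm
  obtain ⟨n, hn⟩ := hT ⟨_, h3⟩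
  obtain ⟨z, hz⟩ := ev_range J (x := (seqSub M w j).mkQ m) fun r hr => congrArg Subtype.val (hn r hr)
  have h4 := hk 0 (by omega) r hr z
  have h5 : r • (seqSub M w j).mkQ m = 0 := by rw [← hz, ← map_smul, h4, map_zero]
  rw [← map_smul, Submodule.mkQ_apply, Submodule.Quotient.mk_eq_zero] at h5
  exact h5

/-- The conclusion on colons: if all colons of powers of `w` are killed by `J ^ K`, the first
element is regular and the top colons agree, then `w` is a regular sequence. -/
lemma regular_of_top {k h : ℕ} (w : ℕ → R)
    (hc : ∀ n : ℕ → ℕ, ∀ j < h + 2, ∀ r ∈ J ^ k, ∀ m : M,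
      w j ^ (n j + 1) • m ∈ seqSub M (fun l => w l ^ (n l + 1)) j →
      r • m ∈ seqSub M (fun l => w l ^ (n l + 1)) j)
    (hwJ : ∀ j < h + 2, w j ∈ J) (hw : ∀ j < h + 2, w j ∈ J ^ (2 ^ (h + 2) * k))
    (hreg : ∀ m : M, w 0 • m = 0 → m = 0)
    (htop : ∀ m : M, w (h + 1) • m ∈ seqSub M w (h + 1) →
      ∃ m', w h • m' ∈ seqSub M w h ∧ m - m' ∈ seqSub M w (h + 1))
    (j : ℕ) (hj : j < h + 2) (m : M) (hm : w j • m ∈ seqSub M w j) : m ∈ seqSub M w j := by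
  have hc' : ∀ j < h + 2, ∀ r ∈ J ^ k, ∀ m : M, w j • m ∈ seqSub M w j → r • m ∈ seqSub M w j := by
    intro j hj r hr m hm
    have := hc (fun _ => 0) j hj r hr m
    simp only [zero_add, pow_one] at this
    exact this hm
  have hT : ∀ j < h + 2, IsTors J (LinearMap.ker (LinearMap.lsmul R (M ⧸ seqSub M w j) (w j))) := by
    intro j hj
    rintro ⟨z, hz⟩
    obtain ⟨m, rfl⟩ := Submodule.mkQ_surjective _ z
    rw [LinearMap.mem_ker, LinearMap.lsmul_apply, ← map_smul, Submodule.mkQ_apply,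
          Submodule.Quotient.mk_eq_zero] at hz
    refine ⟨k, fun r hr => Subtype.ext ?_⟩
    change r • (seqSub M w j).mkQ m = 0
    rw [← map_smul, Submodule.mkQ_apply, Submodule.Quotient.mk_eq_zero]
    exact hc' j hj r hr m hz
  have hk0 := Hk_of_colon J k (h + 2) M w hwJ hc
  have hk : ∀ j ≤ h + 2, Hk J (M ⧸ seqSub M w j) (2 ^ j * k) (h + 2 - j) := by
    intro j hj
    induction j with
    | zero =>
      exact Hk.of_equiv J (Submodule.quotEquivOfEqBot _ (seqSub_zero (M := M) w)).symm (by simpa using hk0)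
    | succ j ih =>
      have := Hk.quot J (isQuotBy_factor (M := M) w j) (hT j (by omega)) (k := 2 ^ j * k) (n := h + 2 - (j+1))
        (by rw [show h + 2 - (j+1) + 1 = h + 2 - j by omega]; exact ih (by omega))
      rwa [pow_succ', mul_assoc]
  have hz : Hk J M 0 (h + 2) := by
    refine Hk_zero_of_top J (K := 2 ^ (h + 2) * k) w hw (fun j hj => (hk j hj.le).mono J ?_ le_rfl) hT ?_ hreg htop
    · exact Nat.mul_le_mul_right _ (Nat.pow_le_pow_right (by norm_num) hj.le)
    · intro m hm r hr
      exact hc' _ (by omega) r (Ideal.pow_le_pow_right (Nat.le_mul_of_pos_left _ (by positivity)) hr) m hm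
  have h1 := colon_trivial_of_Hk_zero J hz w hT j hj.le
  rw [show h + 2 - j = h + 1 - j + 1 by omega] at h1
  simpa using mem_seqSub_of_tors J h1 (hT j hj) hm (r := 1) (by simp)

end LCoh

end

noncomputable section

section PSeq
variable {R : Type u} [CommRing R] [IsNoetherianRing R]

lemma exists_mem_all_avoid {I : Ideal R} {s1 s2 : Set (PrimeSpectrum R)} (f1 : s1.Finite) (f2 : s2.Finite)
    (h1 : ∀ Q ∈ s1, ¬ I ≤ Q.asIdeal) (h2 : ∀ Q ∈ s2, ∀ Q' ∈ s1, ¬ Q.asIdeal ≤ Q'.asIdeal) :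
    ∃ a ∈ I, (∀ Q ∈ s1, a ∉ Q.asIdeal) ∧ ∀ Q ∈ s2, a ∈ Q.asIdeal := by
  classical
  induction s2, f2 using Set.Finite.induction_on generalizing I with
  | empty =>
    obtain ⟨a, ha, h⟩ := exists_avoid f1 h1
    exact ⟨a, ha, h, by simp⟩
  | @insert Q s2 _ _ ih =>
    obtain ⟨a, ha, h, h'⟩ := ih (I := I ⊓ Q.asIdeal) (fun Q' hQ' hle => by
      rcases Q'.2.inf_le.1 hle with h | h
      · exact h1 Q' hQ' h
      · exact h2 Q (Set.mem_insert _ _) Q' hQ' h) (fun Q' hQ' => h2 Q' (Set.mem_insert_of_mem _ hQ'))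
    refine ⟨a, ha.1, h, fun Q' hQ' => ?_⟩
    rcases hQ' with rfl | hQ'
    · exact ha.2
    · exact h' Q' hQ'

lemma exists_coset_avoid {I : Ideal R} {s : Set (PrimeSpectrum R)} (hs : s.Finite) (x : R)
    (h : ∀ Q ∈ s, x ∈ Q.asIdeal → ¬ I ≤ Q.asIdeal) : ∃ a ∈ I, ∀ Q ∈ s, x + a ∉ Q.asIdeal := by
  obtain ⟨a, ha, h1, h2⟩ := exists_mem_all_avoid (I := I) (s1 := {Q ∈ s | x ∈ Q.asIdeal})
    (s2 := {Q ∈ s | x ∉ Q.asIdeal ∧ ∀ Q' ∈ s, x ∈ Q'.asIdeal → ¬ Q.asIdeal ≤ Q'.asIdeal})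
    (hs.subset fun Q hQ => hQ.1) (hs.subset fun Q hQ => hQ.1) (fun Q hQ => h Q hQ.1 hQ.2)
    (fun Q hQ Q' hQ' => hQ.2.2 Q' hQ'.1 hQ'.2)
  refine ⟨a, ha, fun Q hQ hxa => ?_⟩
  by_cases hx : x ∈ Q.asIdeal
  · exact h1 Q ⟨hQ, hx⟩ ((Submodule.add_mem_iff_right _ hx).1 hxa)
  · by_cases hQ2 : ∀ Q' ∈ s, x ∈ Q'.asIdeal → ¬ Q.asIdeal ≤ Q'.asIdeal
    · exact hx ((Submodule.add_mem_iff_left _ (h2 Q ⟨hQ, hx, hQ2⟩)).1 hxa)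
    · push Not at hQ2
      obtain ⟨Q', hQ', hxQ', hle⟩ := hQ2
      exact h1 Q' ⟨hQ', hxQ'⟩ ((Submodule.add_mem_iff_right _ hxQ').1 (hle hxa))

variable [IsLocalRing R]

local notation "𝔪" => maximalIdeal R

/-- `y_0, …, y_{i-1}` is a partial system of parameters modulo `T`, where `dim R/T ≤ n`. -/
def PS (T : Ideal R) (n : ℕ) (y : ℕ → R) (i : ℕ) : Prop :=
  (∀ j < i, y j ∈ 𝔪) ∧ ∃ n', n = n' + i ∧ Dle (T ⊔ seqSub R y i) n'

lemma range_mulM (y : R) : LinearMap.range (mulM R y) = Ideal.span {y} := by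
  ext z
  rw [Ideal.mem_span_singleton']
  constructor
  · rintro ⟨m, rfl⟩; exact ⟨m, mul_comm _ _⟩
  · rintro ⟨m, rfl⟩; exact ⟨m, mul_comm _ _⟩

lemma seqSub_succ_span (y : ℕ → R) (i : ℕ) : seqSub R y (i + 1) = seqSub R y i ⊔ Ideal.span {y i} := by
  rw [seqSub_succ, range_mulM]

lemma mem_seqSub_self {y : ℕ → R} {i j : ℕ} (h : j < i) : y j ∈ seqSub R y i := by
  simpa using smul_mem_seqSub (M := R) (x := y) h 1

lemma seqSub_le_ideal {y : ℕ → R} {i : ℕ} {I : Ideal R} (h : ∀ j < i, y j ∈ I) : seqSub R y i ≤ I :=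
  seqSub_le fun j hj m => by rw [smul_eq_mul]; exact I.mul_mem_right _ (h j hj)

lemma PS.pred {T : Ideal R} {n : ℕ} {y : ℕ → R} {i : ℕ} (h : PS T n y (i + 1)) : PS T n y i := by
  obtain ⟨h1, n', hn, h2⟩ := h
  refine ⟨fun j hj => h1 j (by omega), n' + 1, by omega, ?_⟩
  apply Dle_of_sup_span (h1 i (by omega))
  rwa [sup_assoc, ← seqSub_succ_span]

lemma PS.prefix {T : Ideal R} {n : ℕ} {y : ℕ → R} {i j : ℕ} (h : PS T n y i) (hj : j ≤ i) : PS T n y j := by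
  induction i, hj using Nat.le_induction with
  | base => exact h
  | succ i hi ih => exact ih h.pred

lemma PS.le {T : Ideal R} {n : ℕ} {y : ℕ → R} {i : ℕ} (h : PS T n y i) : i ≤ n := by
  obtain ⟨_, n', hn, _⟩ := h; omega

lemma PS.mono {T T' : Ideal R} {n : ℕ} {y : ℕ → R} {i : ℕ} (h : PS T n y i) (hT : T ≤ T') : PS T' n y i := by
  obtain ⟨h1, n', hn, h2⟩ := h
  exact ⟨h1, n', hn, h2.mono (sup_le_sup_right hT _) le_rfl⟩

lemma PS.cd_lt {T : Ideal R} {n : ℕ} {y : ℕ → R} {i l : ℕ} (h : PS T n y i) (hl : l < i)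
    {P : PrimeSpectrum R} (hT : T ≤ P.asIdeal) (hy : ∀ j ≤ l, y j ∈ P.asIdeal) : cd P < (n - l : ℕ) := by
  obtain ⟨_, n', hn, h2⟩ := h.prefix (show l + 1 ≤ i by omega)
  have := h2 P (sup_le hT (seqSub_le_ideal fun j hj => hy j (by omega)))
  refine lt_of_le_of_lt this ?_
  exact_mod_cast (show n' < n - l by omega)

/-- Extending a partial system of parameters within a coset. -/
lemma PS.extend_coset {T : Ideal R} {n : ℕ} {y : ℕ → R} {i : ℕ} (h : PS T n y i) {x : R} (hx : x ∈ 𝔪)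
    {I : Ideal R} (hI : I ≤ 𝔪)
    (hc : ∀ Q : PrimeSpectrum R, T ⊔ seqSub R y i ≤ Q.asIdeal → x ∈ Q.asIdeal → I ≤ Q.asIdeal →
      cd Q + i < n) (hin : i < n) :
    ∃ a ∈ I, PS T n (Function.update y i (x + a)) (i + 1) := by
  obtain ⟨h1, n', hn, h2⟩ := h
  obtain ⟨n'', rfl⟩ : ∃ n'', n' = n'' + 1 := ⟨n' - 1, by omega⟩
  set 𝔞 := T ⊔ seqSub R y i
  have hfin : {Q : PrimeSpectrum R | 𝔞 ≤ Q.asIdeal ∧ cd Q = (n'' + 1 : ℕ)}.Finite := by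
    refine Set.Finite.subset (Set.Finite.preimage (f := PrimeSpectrum.asIdeal)
      (fun _ _ _ _ h => PrimeSpectrum.ext h) 𝔞.finite_minimalPrimes_of_isNoetherianRing) ?_
    rintro Q ⟨hQ, hcd⟩
    exact h2.mem_minimalPrimes hQ hcd
  obtain ⟨a, ha, hav⟩ := exists_coset_avoid hfin x (I := I) (fun Q hQ hxQ hIQ => by
    have := hc Q hQ.1 hxQ hIQ
    rw [hQ.2, hn] at this
    exact absurd this (by norm_cast; omega))
  refine ⟨a, ha, fun j hj => ?_, n'', by omega, ?_⟩
  · by_cases hji : j = i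
    · subst hji; simp only [Function.update_self]; exact add_mem hx (hI ha)
    · rw [Function.update_of_ne hji]; exact h1 j (by omega)
  · rw [seqSub_succ_span, Function.update_self,
      seqSub_congr (y := y) (fun j hj => Function.update_of_ne (by omega) _ _), ← sup_assoc]
    exact h2.avoid fun Q hQ hcd => hav Q ⟨hQ, hcd⟩

/-- A partial system of parameters of maximal length inside an ideal. -/
lemma exists_PS_in {T : Ideal R} {n m' r : ℕ} (hn : Dle T n) {I : Ideal R} (hI : I ≤ 𝔪) (hd : Dle I m')
    (hr : n = r + m') : ∃ y : ℕ → R, PS T n y r ∧ ∀ j < r, y j ∈ I := by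
  induction r generalizing m' with
  | zero => exact ⟨fun _ => 0, ⟨by simp, n, by simp, by simpa using hn⟩, by simp⟩
  | succ r ih =>
    obtain ⟨y, hy, hyI⟩ := ih (hd.mono le_rfl (Nat.le_succ m')) (by omega)
    obtain ⟨a, ha, h⟩ := hy.extend_coset (zero_mem 𝔪) hI (fun Q _ _ hIQ => by
      refine lt_of_le_of_lt (add_le_add_left (hd Q hIQ) _) ?_
      norm_cast; omega) (by omega)
    refine ⟨_, h, fun j hj => ?_⟩
    by_cases hji : j = r
    · subst hji; simpa using ha
    · rw [Function.update_of_ne hji]; exact hyI j (by omega)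

/-- Colons of a partial system of parameters in terms of `Hk`. -/
lemma colon_of_Hk_PS {M : Type u} [AddCommGroup M] [Module R M] [Module.Finite R M] {k δ : ℕ}
    (hk : LCoh.Hk 𝔪 M k δ) {T : Ideal R} (hT : T ≤ Module.annihilator R M)
    {x : ℕ → R} {j : ℕ} (hx : PS T δ x (j + 1)) (m : M)
    (hm : x j • m ∈ seqSub M x j) (r : R) (hr : r ∈ 𝔪 ^ (2 ^ j * k)) : r • m ∈ seqSub M x j :=
  colon_of_Hk hk x j (fun l hl _ P hP hxP => hx.cd_lt (by omega) (hT.trans hP) hxP) hx.le m hm r hr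

/-- In a Cohen–Macaulay local ring partial systems of parameters are regular sequences. -/
lemma IsCMLocal.regular (h : IsCMLocal R) {n : ℕ} (hn : ringKrullDim R = n)
    {x : ℕ → R} {j : ℕ} (hx : PS ⊥ n x (j + 1)) (m : R)
    (hm : x j • m ∈ seqSub R x j) : m ∈ seqSub R x j := by
  have hk : LCoh.Hk 𝔪 R 0 n := by
    intro i hi r _ z
    have := h i (by rw [hn]; exact_mod_cast hi)
    have e := LCoh.HEquiv 𝔪 R i
    apply e.injective
    exact this.elim _ _
  simpa using colon_of_Hk_PS hk bot_le hx m hm 1 (by simp)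

end PSeq

end

noncomputable section

namespace XT
variable {R : Type u} [CommRing R] {X M M' M'' : Type u} [AddCommGroup X] [Module R X]
  [AddCommGroup M] [Module R M] [AddCommGroup M'] [Module R M'] [AddCommGroup M''] [Module R M'']

lemma post_subtype_toImg (y : R) (i : ℕ) (z : XT R X M i) :
    post X (LinearMap.range (LinearMap.lsmul R M y)).subtype i (post X (LCoh.toImg M y) i z) = y • z := by
  rw [post_comp, ← post_smul_id]; rfl

lemma smul_of_toImg {y : R} {j : ℕ} (ξ : XT R X M j) {a : R} (ha : ∀ m : M, y • m = 0 → a • m = 0)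
    (h : post X (LCoh.toImg M y) j ξ = 0) : a • ξ = 0 := by
  obtain ⟨θ, rfl⟩ := exact_post (LCoh.SES_toImg y) j ξ h
  rw [← map_smul, smul_eq_zero_right j (fun m => Subtype.ext (ha m.1 m.2)), map_zero]

/-- Passing annihilators of `Ext` from `M / yM` to `M`. -/
lemma descend {y : R} {g : M →ₗ[R] M''} (hg : LCoh.IsQuotBy y g) {j : ℕ} (ξ : XT R X M j) (hy : y • ξ = 0)
    {a b : R} (ha : ∀ m : M, y • m = 0 → a • m = 0)
    (hb : ∀ i, j = i + 1 → ∀ θ : XT R X M'' i, b • θ = 0) : (a * b) • ξ = 0 := by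
  rw [mul_smul]
  apply smul_of_toImg _ ha
  rw [map_smul]
  rw [← post_subtype_toImg] at hy
  cases j with
  | zero => rw [post_inj_zero hg.ses _ hy, smul_zero]
  | succ j =>
    obtain ⟨θ, hθ⟩ := exact_δ_post hg.ses j _ hy
    rw [← hθ, ← map_smul, hb j rfl, map_zero]

/-- Passing annihilators of `Ext` from `M` to `M / yM`. -/
lemma ascend {y : R} {g : M →ₗ[R] M''} (hg : LCoh.IsQuotBy y g) {j : ℕ} (ξ : XT R X M'' j)
    {a b e : R} (he : ∀ m : M, y • m = 0 → e • m = 0) (ha : ∀ θ : XT R X M j, a • θ = 0)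
    (hb : ∀ θ : XT R X M (j + 1), b • θ = 0) : (a * (b * e)) • ξ = 0 := by
  have h1 : δ X hg.ses j ((b * e) • ξ) = 0 := by
    rw [map_smul, mul_smul]
    have : δ X (LCoh.SES_toImg y) (j + 1) (e • δ X hg.ses j ξ) = 0 := by
      rw [map_smul]
      exact smul_eq_zero_right _ (fun m => Subtype.ext (he m.1 m.2)) _
    obtain ⟨θ, hθ⟩ := exact_post_δ (LCoh.SES_toImg y) _ _ this
    rw [← hθ, ← map_smul, hb, map_zero]
  obtain ⟨θ, hθ⟩ := exact_post_δ hg.ses _ _ h1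
  rw [mul_smul, ← hθ, ← map_smul, ha, map_zero]

/-- Vanishing of `Ext` below the length of a regular sequence annihilating `X`. -/
lemma eq_zero_of_regular {w : ℕ → R} {n : ℕ} (hw : ∀ j < n, ∀ m : M, w j • m ∈ seqSub M w j → m ∈ seqSub M w j)
    (hX : ∀ j < n, ∀ x : X, w j • x = 0) (j r : ℕ) (h : j + r < n)
    (ξ : XT R X (M ⧸ seqSub M w r) j) : ξ = 0 := by
  induction j generalizing r with
  | zero =>
    have := descend (isQuotBy_factor w r) ξ (smul_eq_zero_left 0 (hX r (by omega)) ξ) (a := 1) (b := 1) ?_ (by simp)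
    · simpa using this
    · intro m hm
      obtain ⟨m, rfl⟩ := Submodule.mkQ_surjective _ m
      rw [← map_smul, Submodule.mkQ_apply, Submodule.Quotient.mk_eq_zero] at hm
      rw [one_smul, Submodule.mkQ_apply, Submodule.Quotient.mk_eq_zero]
      exact hw r (by omega) m hm
  | succ j ih =>
    have := descend (isQuotBy_factor w r) ξ (smul_eq_zero_left _ (hX r (by omega)) ξ) (a := 1) (b := 1) ?_ ?_
    · simpa using this
    · intro m hm
      obtain ⟨m, rfl⟩ := Submodule.mkQ_surjective _ m
      rw [← map_smul, Submodule.mkQ_apply, Submodule.Quotient.mk_eq_zero] at hm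
      rw [one_smul, Submodule.mkQ_apply, Submodule.Quotient.mk_eq_zero]
      exact hw r (by omega) m hm
    · intro i hi θ
      obtain rfl : j = i := by omega
      rw [one_smul, ih (r + 1) (by omega) θ]

end XT

end

noncomputable section

section Killers
variable {A : Type u} [CommRing A] [IsNoetherianRing A] [IsLocalRing A]

/-- Concatenation of sequences. -/
def seqApp (z : ℕ → A) (r : ℕ) (y : ℕ → A) (j : ℕ) : A := if j < r then z j else y (j - r)

lemma seqSub_seqApp (z : ℕ → A) (r : ℕ) (y : ℕ → A) (n : ℕ) :
    seqSub A (seqApp z r y) (r + n) = seqSub A z r ⊔ seqSub A y n := by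
  induction n with
  | zero =>
    rw [seqSub_zero, sup_bot_eq]
    exact seqSub_congr fun j hj => if_pos hj
  | succ n ih =>
    rw [← add_assoc, seqSub_succ_span, ih, seqSub_succ_span, sup_assoc]
    congr 3
    simp [seqApp]

lemma PS.app {D d r : ℕ} {z y : ℕ → A} {n : ℕ} (hz : PS ⊥ D z r) (hD : D = d + r)
    (hy : PS (seqSub A z r) d y n) : PS ⊥ D (seqApp z r y) (r + n) := by
  obtain ⟨h1, n', hn, h2⟩ := hy
  refine ⟨fun j hj => ?_, n', by omega, by rwa [bot_sup_eq, seqSub_seqApp]⟩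
  unfold seqApp
  split_ifs with h
  · exact hz.1 j h
  · exact h1 _ (by omega)

/-- A presentation of a quotient of a Cohen–Macaulay local ring of dimension `D` by a partial system
of parameters `z` of length `r`. -/
structure CMData (A : Type u) [CommRing A] [IsLocalRing A] (D d r : ℕ) (z : ℕ → A) : Prop where
  reg : ∀ x : ℕ → A, ∀ j, PS ⊥ D x (j + 1) → ∀ m : A, x j • m ∈ seqSub A x j → m ∈ seqSub A x j
  hz : PS ⊥ D z r
  hD : D = d + r

/-- `c` annihilates `Ext^j(A/(z, y_0, …, y_{n-1}), M)` for all `y`. -/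
def EK (Z : Ideal A) (d : ℕ) (M : Type u) [AddCommGroup M] [Module A M] (j n : ℕ) (c : A) : Prop :=
  ∀ y, PS Z d y n → ∀ ξ : XT A (A ⧸ (Z ⊔ seqSub A y n)) M j, c • ξ = 0

lemma EK.mul_left {Z : Ideal A} {d : ℕ} {M : Type u} [AddCommGroup M] [Module A M] {j n : ℕ} {c : A}
    (h : EK Z d M j n c) (a : A) : EK Z d M j n (a * c) := fun y hy ξ => by
  rw [mul_smul, h y hy, smul_zero]

variable {D d r : ℕ} {z : ℕ → A} 

lemma XT.eq_zero_of_ascend {X : Type u} [AddCommGroup X] [Module A X] {n : ℕ} {w : ℕ → A} {r' : ℕ}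
    (h0 : ∀ j < n, ∀ ξ : XT A X (A ⧸ seqSub A w 0) j, ξ = 0)
    (hw : ∀ j < r', ∀ m : A, w j • m ∈ seqSub A w j → m ∈ seqSub A w j)
    {j : ℕ} (hj : j + r' < n) (ξ : XT A X (A ⧸ seqSub A w r') j) : ξ = 0 := by
  induction r' generalizing j with
  | zero => exact h0 j hj ξ
  | succ r' ih =>
    have := XT.ascend (isQuotBy_factor w r') ξ (a := 1) (b := 1) (e := 1) ?_ ?_ ?_
    · simpa using this
    · intro m hm
      obtain ⟨m, rfl⟩ := Submodule.mkQ_surjective _ m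
      rw [← map_smul, Submodule.mkQ_apply, Submodule.Quotient.mk_eq_zero] at hm
      rw [one_smul, Submodule.mkQ_apply, Submodule.Quotient.mk_eq_zero]
      exact hw r' (by omega) m hm
    · intro θ; rw [ih (fun j hj => hw j (by omega)) (by omega) θ, smul_zero]
    · intro θ; rw [ih (fun j hj => hw j (by omega)) (by omega) θ, smul_zero]

lemma CMData.vanish (h : CMData A D d r z) {y : ℕ → A} {n : ℕ} (hy : PS (seqSub A z r) d y n)
    {w : ℕ → A} {r' : ℕ} (hw : PS ⊥ D w r') {j : ℕ} (hj : j + r' < r + n)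
    (ξ : XT A (A ⧸ (seqSub A z r ⊔ seqSub A y n)) (A ⧸ seqSub A w r') j) : ξ = 0 := by
  have hzy := h.hz.app h.hD hy
  refine XT.eq_zero_of_ascend (n := r + n) (fun j hj => ?_)
    (fun j hj => h.reg w j (hw.prefix hj)) hj ξ
  refine XT.eq_zero_of_regular (w := seqApp z r y) (n := r + n) (M := A)
    (fun j hj => h.reg _ j (hzy.prefix hj)) (fun j hj x => ?_) j 0 (by omega)
  obtain ⟨x, rfl⟩ := Submodule.mkQ_surjective _ x
  rw [← map_smul, Submodule.mkQ_apply, Submodule.Quotient.mk_eq_zero, ← seqSub_seqApp]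
  exact smul_mem_seqSub hj x

lemma EK.of_smul {Z : Ideal A} {M : Type u} [AddCommGroup M] [Module A M] {j n : ℕ} {c : A}
    (h : ∀ m : M, c • m = 0) : EK Z d M j n c := fun _ _ ξ => XT.smul_eq_zero_right _ h ξ

lemma EK.ses {Z : Ideal A} {M M' M'' : Type u} [AddCommGroup M] [Module A M]
    [AddCommGroup M'] [Module A M'] [AddCommGroup M''] [Module A M''] {f : M' →ₗ[A] M} {g : M →ₗ[A] M''}
    (h : SES f g) {j n : ℕ} {c c' : A} (hc : EK Z d M' j n c) (hc' : EK Z d M'' j n c') :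
    EK Z d M j n (c * c') := fun y hy ξ => by
  obtain ⟨θ, hθ⟩ := XT.exact_post h j (c' • ξ) (by rw [map_smul, hc' y hy])
  rw [mul_smul, ← hθ, ← map_smul, hc y hy, map_zero]

lemma EK.sub {Z : Ideal A} {M M' M'' : Type u} [AddCommGroup M] [Module A M]
    [AddCommGroup M'] [Module A M'] [AddCommGroup M''] [Module A M''] {f : M' →ₗ[A] M} {g : M →ₗ[A] M''}
    (h : SES f g) {j n : ℕ} {c : A} (hc : ∀ i, j = i + 1 → EK Z d M'' i n c)
    (h0 : ∀ y, PS Z d y n → ∀ ξ : XT A (A ⧸ (Z ⊔ seqSub A y n)) M j, ξ = 0) :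
    EK Z d M' j n c := fun y hy ξ => by
  cases j with
  | zero => rw [XT.post_inj_zero h ξ (h0 y hy _), smul_zero]
  | succ j =>
    obtain ⟨θ, rfl⟩ := XT.exact_δ_post h j ξ (h0 y hy _)
    rw [← map_smul, hc j rfl y hy, map_zero]

/-- Generic annihilators of `Ext`. -/
lemma CMData.exists_killer (h : CMData A D d r z) (P : PrimeSpectrum A) {n l : ℕ} (hP : cd P = n)
    (hl : n + l = d) (j0 : ℕ) (M : Type u) [AddCommGroup M] [Module A M] [hM : Module.Finite A M] :
    ∃ c ∉ P.asIdeal, ∀ j < j0, ∀ N, j + l < N → EK (seqSub A z r) d M j N c := by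
  have hone : (1 : A) ∉ P.asIdeal := (Ideal.ne_top_iff_one _).1 P.2.ne_top
  induction j0 generalizing M with
  | zero => exact ⟨1, hone, by simp⟩
  | succ j0 ih =>
    induction hM using IsNoetherianRing.induction_on_isQuotientEquivQuotientPrime A with
    | subsingleton N => exact ⟨1, hone, fun j _ _ _ => EK.of_smul fun m => Subsingleton.elim _ _⟩
    | exact N₁ N₂ N₃ f g hf hg hfg h₁ h₃ =>
      obtain ⟨c, hc, h1⟩ := h₁
      obtain ⟨c', hc', h3⟩ := h₃
      exact ⟨c * c', P.2.mul_notMem hc hc', fun j hj N hN => EK.ses ⟨hf, hg, hfg⟩ (h1 j hj N hN) (h3 j hj N hN)⟩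
    | quotient N Q e =>
      by_cases hQP : Q.asIdeal ≤ P.asIdeal
      · obtain ⟨q, hq⟩ := ENat.ne_top_iff_exists.1 (cd_ne_top Q)
        have hdim : Dle (⊥ : Ideal A) D := by
          obtain ⟨_, n', hn', h2⟩ := h.hz.prefix (Nat.zero_le _)
          exact h2.mono (by simp) (by omega)
        have hqD : q ≤ D := by
          have := hdim Q bot_le
          rw [← hq] at this; exact_mod_cast this
        have hnq : n ≤ q := by
          have := cd_le hQP
          rw [← hq, hP] at this; exact_mod_cast this
        obtain ⟨w, hw, hwQ⟩ := exists_PS_in (n := D) (r := D - q) (m' := q) hdim (I := Q.asIdeal)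
          (le_maximalIdeal Q.2.ne_top) (fun Q' hQ' => by rw [hq]; exact cd_le hQ') (by omega)
        obtain ⟨_, n', hn', h2⟩ := id hw
        have hmin := h2.mem_minimalPrimes (Q := Q) (by rw [bot_sup_eq]; exact seqSub_le_ideal hwQ)
          (by rw [← hq]; congr 1; omega)
        rw [bot_sup_eq] at hmin
        have hass : Q.asIdeal ∈ associatedPrimes A (A ⧸ seqSub A w (D - q)) :=
          Module.associatedPrimes.minimalPrimes_annihilator_subset_associatedPrimes A _
            (by rw [Ideal.annihilator_quotient]; exact hmin)
        obtain ⟨f, hf⟩ : ∃ f : (A ⧸ Q.asIdeal) →ₗ[A] (A ⧸ seqSub A w (D - q)), Function.Injective f := by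
          exact ((isAssociatedPrime_iff_exists_injective_linearMap Q.asIdeal _).1 hass).2
        obtain ⟨c, hc, h1⟩ := ih ((A ⧸ seqSub A w (D - q)) ⧸ LinearMap.range (f ∘ₗ e.toLinearMap))
        refine ⟨c, hc, fun j hj N hN => ?_⟩
        refine EK.sub (f := f ∘ₗ e.toLinearMap) (g := Submodule.mkQ _)
          ⟨hf.comp e.injective, Submodule.mkQ_surjective _, LinearMap.exact_map_mkQ_range _⟩ (fun i hi => h1 i (by omega) N (by omega))
          fun y hy ξ => h.vanish hy hw (by have := h.hD; omega) ξ
      · obtain ⟨c, hcQ, hcP⟩ := Set.not_subset.1 hQP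
        refine ⟨c, hcP, fun j _ _ _ => EK.of_smul fun m => e.injective ?_⟩
        rw [map_smul, map_zero]
        obtain ⟨m, hm⟩ := Submodule.mkQ_surjective _ (e m)
        rw [← hm, ← map_smul, Submodule.mkQ_apply, Submodule.Quotient.mk_eq_zero]
        exact Q.asIdeal.mul_mem_right m hcQ

end Killers

end

noncomputable section

section KillerIdeals
variable {A : Type u} [CommRing A] [IsNoetherianRing A] [IsLocalRing A]

/-- The annihilator of an element. -/
def annOf {M : Type u} [AddCommGroup M] [Module A M] (m : M) : Ideal A :=
  LinearMap.ker (LinearMap.toSpanSingleton A M m)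

lemma mem_annOf {M : Type u} [AddCommGroup M] [Module A M] {m : M} {a : A} : a ∈ annOf m ↔ a • m = 0 := by
  rw [annOf, LinearMap.mem_ker, LinearMap.toSpanSingleton_apply]

/-- `𝔠` annihilates the `Ext^j(A/(z, y_0, …, y_{n-1}), M)` with `j + r < n`. -/
def EKF (Z : Ideal A) (d : ℕ) (M : Type u) [AddCommGroup M] [Module A M] (r : ℕ) (𝔠 : Ideal A) : Prop :=
  ∀ c ∈ 𝔠, ∀ j n, j + r < n → EK Z d M j n c

variable (Z : Ideal A) (d : ℕ) (M : Type u) [AddCommGroup M] [Module A M]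

/-- The ideal of uniform annihilators of the low `Ext^j(A/(z, y), M)`. -/
def aE : Ideal A where
  carrier := {c | ∀ j n, j < n → EK Z d M j n c}
  add_mem' ha hb j n hj y hy ξ := by rw [add_smul, ha j n hj y hy, hb j n hj y hy, add_zero]
  zero_mem' _ _ _ _ _ _ := zero_smul _ _
  smul_mem' a c hc j n hj := (hc j n hj).mul_left a

variable {Z d M}

lemma EKF.ascend {r : ℕ} {𝔠 𝔡 : Ideal A} (h : EKF Z d M r 𝔠) {M'' : Type u} [AddCommGroup M'']
    [Module A M''] {y : A} {g : M →ₗ[A] M''} (hg : LCoh.IsQuotBy y g)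
    (hd : ∀ e ∈ 𝔡, ∀ m : M, y • m = 0 → e • m = 0) : EKF Z d M'' (r + 1) (𝔠 * (𝔠 * 𝔡)) := by
  intro c hc j n hj w hw ξ
  have : 𝔠 * (𝔠 * 𝔡) ≤ annOf ξ := Ideal.mul_le.2 fun a ha s hs => by
    have : 𝔠 * 𝔡 ≤ annOf (a • ξ) := Ideal.mul_le.2 fun b hb e he => by
      rw [mem_annOf, smul_smul, mul_comm]
      exact XT.ascend hg ξ (hd e he) (fun θ => h a ha j n (by omega) w hw θ)
        (fun θ => h b hb (j + 1) n (by omega) w hw θ)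
    rw [mem_annOf, mul_comm, mul_smul]
    exact mem_annOf.1 (this hs)
  exact mem_annOf.1 (this hc)

lemma EKF.colon (hZ : ∀ c ∈ Z, ∀ m : M, c • m = 0) {r : ℕ} {y : ℕ → A} (hy : PS Z d y (r + 1)) {𝔠 : Ideal A}
    (h : EKF Z d (M ⧸ seqSub M y r) r 𝔠) (e : A) (he : e ∈ 𝔠) (m : M ⧸ seqSub M y r) (hm : y r • m = 0) :
    e • m = 0 := by
  have hle : Z ⊔ seqSub A y (r + 1) ≤ annOf m := by
    refine sup_le (fun c hc => ?_) (seqSub_le_ideal fun j hj => ?_)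
    · obtain ⟨m, rfl⟩ := Submodule.mkQ_surjective _ m
      rw [mem_annOf, ← map_smul, hZ c hc, map_zero]
    · rw [mem_annOf]
      rcases (Nat.lt_succ_iff.1 hj).lt_or_eq with hj | rfl
      · obtain ⟨m, rfl⟩ := Submodule.mkQ_surjective _ m
        rw [← map_smul, Submodule.mkQ_apply, Submodule.Quotient.mk_eq_zero]
        exact smul_mem_seqSub hj m
      · exact hm
  let φ : (A ⧸ (Z ⊔ seqSub A y (r + 1))) →ₗ[A] (M ⧸ seqSub M y r) :=
    Submodule.liftQ _ (LinearMap.toSpanSingleton A _ m) hle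
  have h0 := h e he 0 (r + 1) (by omega) y hy ((XT.homEquiv A _ _).symm φ)
  rw [← map_smul] at h0
  have h1 := (LinearEquiv.map_eq_zero_iff _).1 h0
  have h2 := LinearMap.congr_fun h1 (Submodule.Quotient.mk 1)
  have h3 : φ (Submodule.Quotient.mk 1) = m := one_smul A m
  rw [LinearMap.smul_apply, h3] at h2
  exact h2

lemma EKF.mono {r : ℕ} {𝔠 𝔠' : Ideal A} (h : EKF Z d M r 𝔠) (hle : 𝔠' ≤ 𝔠) : EKF Z d M r 𝔠' :=
  fun c hc => h c (hle hc)

lemma mk_smul_eq_zero {N : Submodule A M} {a : A} {m : M} : a • (Submodule.mkQ N m) = 0 ↔ a • m ∈ N := by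
  rw [← map_smul, Submodule.mkQ_apply, Submodule.Quotient.mk_eq_zero]

lemma _root_.XT.post_symm_post {X M M' : Type u} [AddCommGroup X] [Module A X] [AddCommGroup M] [Module A M]
    [AddCommGroup M'] [Module A M'] (e : M ≃ₗ[A] M') (j : ℕ) (ξ : XT A X M j) :
    XT.post X e.symm.toLinearMap j (XT.post X e.toLinearMap j ξ) = ξ := by
  rw [XT.post_comp]
  have h1 := XT.post_smul_id j (1 : A) ξ
  rw [one_smul, one_smul] at h1
  rw [LinearEquiv.symm_comp]
  exact h1

lemma EK.equiv {M' : Type u} [AddCommGroup M'] [Module A M'] (e : M' ≃ₗ[A] M) {j n : ℕ} {c : A}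
    (h : EK Z d M j n c) : EK Z d M' j n c := fun y hy ξ => by
  rw [← XT.post_symm_post e j ξ, ← map_smul, h y hy, map_zero]

lemma EKF.quot_zero (y : ℕ → A) (𝔠 : Ideal A) (h : EKF Z d M 0 𝔠) : EKF Z d (M ⧸ seqSub M y 0) 0 𝔠 := by
  exact fun c hc j n hj => (h c hc j n hj).equiv (Submodule.quotEquivOfEqBot _ rfl)

lemma EKF_aE (hZ : ∀ c ∈ Z, ∀ m : M, c • m = 0) {y : ℕ → A} {r : ℕ} (hy : PS Z d y r) :
    EKF Z d (M ⧸ seqSub M y r) r (aE Z d M ^ 3 ^ r) := by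
  induction r with
  | zero => exact EKF.quot_zero y _ (by rw [pow_zero, pow_one]; exact fun c hc => hc)
  | succ r ih =>
    have := (ih hy.pred).ascend (isQuotBy_factor y r) ((ih hy.pred).colon hZ hy)
    refine this.mono (le_of_eq ?_)
    rw [← pow_add, ← pow_add]; congr 1; ring

lemma aE_colon (hZ : ∀ c ∈ Z, ∀ m : M, c • m = 0) {y : ℕ → A} {i : ℕ} (hy : PS Z d y (i + 1)) (e : A)
    (he : e ∈ aE Z d M ^ 3 ^ i) (m : M) (hm : y i • m ∈ seqSub M y i) : e • m ∈ seqSub M y i :=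
  mk_smul_eq_zero.1 ((EKF_aE hZ hy.pred).colon hZ hy e he (Submodule.mkQ _ m) (mk_smul_eq_zero.2 hm))

variable {D r : ℕ} {z : ℕ → A} [Module.Finite A M]

lemma CMData.not_aE_le (h : CMData A D d r z) (P : PrimeSpectrum A) (hP : cd P = d) :
    ¬ aE (seqSub A z r) d M ≤ P.asIdeal := by
  intro hle
  obtain ⟨c, hc, h1⟩ := h.exists_killer P hP (l := 0) (by omega) (d + 1) M
  exact hc (hle fun j n hj y hy => h1 j (by have := hy.le; omega) n hj y hy)

lemma CMData.not_aE_le_of_colon (h : CMData A D d r z) (hZ : ∀ c ∈ seqSub A z r, ∀ m : M, c • m = 0)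
    (P : PrimeSpectrum A) {n l : ℕ} (hP : cd P = n) (hl : n + l = d) {K : ℕ} {c : A} (hc : c ∉ P.asIdeal)
    (hcK : ∀ p ∈ P.asIdeal ^ K, c * p ∈ aE (seqSub A z r) d M) {w : ℕ → A}
    (hw : ∀ j < l, w j ∈ P.asIdeal ^ (2 ^ j * K))
    (hcol : ∀ j < l, ∃ c' ∉ P.asIdeal, ∀ m : M, w j • m ∈ seqSub M w j → c' • m ∈ seqSub M w j) :
    ¬ aE (seqSub A z r) d M ≤ P.asIdeal := by
  have hup : ∀ i ≤ l, ∃ c ∉ P.asIdeal, EKF (seqSub A z r) d (M ⧸ seqSub M w i) i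
      (Ideal.span {c} * P.asIdeal ^ (2 ^ i * K)) := by
    intro i hi
    induction i with
    | zero =>
      refine ⟨c, hc, EKF.quot_zero w _ ?_⟩
      intro b hb
      obtain ⟨p, hp, rfl⟩ := Ideal.mem_span_singleton_mul.1 hb
      exact hcK p (by simpa using hp)
    | succ i ih =>
      obtain ⟨c, hc, h1⟩ := ih (by omega)
      obtain ⟨c', hc', h2⟩ := hcol i (by omega)
      refine ⟨c * (c * c'), P.2.mul_notMem hc (P.2.mul_notMem hc hc'), ?_⟩
      refine (h1.ascend (isQuotBy_factor w i) (𝔡 := Ideal.span {c'}) ?_).mono (le_of_eq ?_)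
      · intro e he m hm
        obtain ⟨a, rfl⟩ := Ideal.mem_span_singleton'.1 he
        obtain ⟨m, rfl⟩ := Submodule.mkQ_surjective _ m
        rw [mul_smul, mk_smul_eq_zero.2 (h2 m (mk_smul_eq_zero.1 hm)), smul_zero]
      · rw [← Ideal.span_singleton_mul_span_singleton, ← Ideal.span_singleton_mul_span_singleton,
          show 2 ^ (i + 1) * K = 2 ^ i * K + 2 ^ i * K by ring, pow_add]
        ring
  obtain ⟨cl, hcl, hFl⟩ := h.exists_killer P hP hl (d + 1) (M ⧸ seqSub M w l)
  have hdown : ∀ i ≤ l, ∃ c ∉ P.asIdeal, EKF (seqSub A z r) d (M ⧸ seqSub M w (l - i)) (l - i) (Ideal.span {c}) := by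
    intro i hi
    induction i with
    | zero =>
      refine ⟨cl, hcl, fun b hb j n hj => ?_⟩
      obtain ⟨a, rfl⟩ := Ideal.mem_span_singleton'.1 hb
      exact fun y hy => ((hFl j (by have := hy.le; omega) n hj).mul_left a) y hy
    | succ i ih =>
      obtain ⟨c1, hc1, h1⟩ := ih (by omega)
      obtain ⟨c', hc', h2⟩ := hcol (l - (i + 1)) (by omega)
      obtain ⟨c0, hc0, h0⟩ := hup (l - (i + 1)) (by omega)
      rw [show l - i = (l - (i + 1)) + 1 by omega] at h1
      have hsl : l - (i + 1) < l := by omega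
      generalize l - (i + 1) = s at *
      refine ⟨c' * c1 * c0, P.2.mul_notMem (P.2.mul_notMem hc' hc1) hc0, fun b hb j n hj y hy ξ => ?_⟩
      obtain ⟨a, rfl⟩ := Ideal.mem_span_singleton'.1 hb
      rw [mul_smul, mul_smul (c' * c1)]
      have h3 : w s • c0 • ξ = 0 := by
        rw [smul_smul, mul_comm]
        exact h0 _ (Ideal.mul_mem_mul (Ideal.mem_span_singleton_self _) (hw s hsl)) j n hj y hy ξ
      rw [XT.descend (isQuotBy_factor w s) _ h3, smul_zero]
      · intro m hm
        obtain ⟨m, rfl⟩ := Submodule.mkQ_surjective _ m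
        exact mk_smul_eq_zero.2 (h2 m (mk_smul_eq_zero.1 hm))
      · intro i hi θ
        exact h1 c1 (Ideal.mem_span_singleton_self _) i n (by omega) y hy θ
  obtain ⟨c, hc, h1⟩ := hdown l le_rfl
  rw [Nat.sub_self] at h1
  intro hle
  exact hc (hle fun j n hj => (h1 c (Ideal.mem_span_singleton_self c) j n hj).equiv
    (Submodule.quotEquivOfEqBot _ rfl).symm)

end KillerIdeals

end

noncomputable section

section Transfer
variable {A R : Type u} [CommRing A] [CommRing R]

lemma Dle_comap {f : A →+* R} (hf : Function.Surjective f) (I : Ideal R) (n : ℕ) :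
    Dle (I.comap f) n ↔ Dle I n := by
  rw [← Dle_iff, ← Dle_iff]
  have hs : Function.Surjective ((Ideal.Quotient.mk I).comp f) := Ideal.Quotient.mk_surjective.comp hf
  have hk : RingHom.ker ((Ideal.Quotient.mk I).comp f) = I.comap f := by
    ext a; simp [RingHom.mem_ker, Ideal.Quotient.eq_zero_iff_mem]
  rw [← hk, ringKrullDim_eq_of_ringEquiv (RingHom.quotientKerEquivOfSurjective hs)]

lemma Dle_self_iff {P : PrimeSpectrum R} {n : ℕ} : Dle P.asIdeal n ↔ cd P ≤ n :=
  ⟨fun h => h P le_rfl, fun h Q hQ => (cd_le hQ).trans h⟩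

lemma cd_comap {f : A →+* R} (hf : Function.Surjective f) (P : PrimeSpectrum R) :
    cd (PrimeSpectrum.comap f P) = cd P := by
  have h : ∀ n : ℕ, cd (PrimeSpectrum.comap f P) ≤ n ↔ cd P ≤ n := fun n => by
    rw [← Dle_self_iff, ← Dle_self_iff, ← Dle_comap hf]; rfl
  have key : ∀ a b : ℕ∞, (∀ n : ℕ, a ≤ n ↔ b ≤ n) → a ≤ b := by
    intro a b h
    induction b using ENat.recTopCoe with
    | top => exact le_top
    | coe m => exact (h m).2 le_rfl
  exact le_antisymm (key _ _ h) (key _ _ fun n => (h n).symm)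

lemma mem_seqSub_transfer {M : Type u} [AddCommGroup M] [Module A M] [Module R M] {x : ℕ → A} {y : ℕ → R}
    {i : ℕ} (h : ∀ j < i, ∀ m : M, x j • m = y j • m) (m : M) : m ∈ seqSub M x i ↔ m ∈ seqSub M y i := by
  induction i generalizing m with
  | zero => exact Iff.rfl
  | succ i ih =>
    rw [mem_seqSub_succ, mem_seqSub_succ]
    refine exists_congr fun n => and_congr (ih (fun j hj => h j (by omega)) n) (exists_congr fun m' => ?_)
    rw [h i (by omega)]

variable [IsNoetherianRing A] [IsLocalRing A] [IsLocalRing R] [IsNoetherianRing R]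

lemma PS.exists_lift {f : A →+* R} (hf : Function.Surjective f) {T : Ideal R} (hT' : T ≤ maximalIdeal R) {Z : Ideal A}
    (hZ : Z ≤ T.comap f) {n : ℕ} (hZn : Dle Z n) {y : ℕ → R} {i : ℕ} (hy : PS T n y i) :
    ∃ x : ℕ → A, PS Z n x i ∧ ∀ j < i, f (x j) - y j ∈ T := by
  have hm : (maximalIdeal R).comap f = maximalIdeal A :=
    ((IsLocalRing.local_hom_TFAE f).out 0 4).1 (IsLocalHom.of_surjective f hf)
  induction i with
  | zero => exact ⟨0, ⟨by simp, n, by omega, by simpa using hZn⟩, by simp⟩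
  | succ i ih =>
    obtain ⟨x, hx, hxy⟩ := ih hy.pred
    obtain ⟨a, ha⟩ := hf (y i)
    have key : ∀ Q : PrimeSpectrum A, Z ⊔ seqSub A x i ≤ Q.asIdeal → a ∈ Q.asIdeal → T.comap f ≤ Q.asIdeal →
        cd Q + i < n := by
      intro Q hQ haQ hTQ
      obtain ⟨_, n', hn', h2⟩ := hy
      have hTm : T ≤ Q.asIdeal.map f := by
        rw [← Ideal.map_comap_of_surjective f hf T]; exact Ideal.map_mono hTQ
      have hle : T ⊔ seqSub R y (i + 1) ≤ Q.asIdeal.map f := by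
        refine sup_le hTm (seqSub_le_ideal fun j hj => ?_)
        by_cases hji : j = i
        · subst hji; rw [← ha]; exact Ideal.mem_map_of_mem _ haQ
        · have h1 := Ideal.mem_map_of_mem f (hQ (Submodule.mem_sup_right (mem_seqSub_self (y := x) (show j < i by omega))))
          have := sub_mem h1 (hTm (hxy j (by omega)))
          rwa [sub_sub_cancel] at this
      have h3 := ((Dle_comap hf _ _).2 h2) Q (by
        refine (Ideal.comap_mono hle).trans ?_
        rw [Ideal.comap_map_of_surjective f hf]
        exact sup_le le_rfl ((Ideal.comap_mono bot_le).trans hTQ))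
      refine lt_of_le_of_lt (add_le_add_left h3 _) ?_
      norm_cast; omega
    obtain ⟨b, hb, h⟩ := hx.extend_coset (x := a) (by rw [← hm, Ideal.mem_comap, ha]; exact hy.1 i (by omega))
      (I := T.comap f) (by rw [← hm]; exact Ideal.comap_mono hT') key (by have := hy.le; omega)
    refine ⟨_, h, fun j hj => ?_⟩
    by_cases hji : j = i
    · subst hji
      rw [Function.update_self, map_add, ha, add_sub_cancel_left]; exact hb
    · rw [Function.update_of_ne hji]; exact hxy j (by omega)

end Transfer

end

noncomputable section

section Interface
variable {R : Type u} [CommRing R] [IsLocalRing R] [IsNoetherianRing R]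

/-- The data of uniform annihilators of colons of a module `M` over `R / T`. -/
structure KillerData (T : Ideal R) (n : ℕ) (M : Type u) [AddCommGroup M] [Module R M] (𝔞 : Ideal R) : Prop where
  colon : ∀ (y : ℕ → R) (i : ℕ), PS T n y (i + 1) → ∀ e ∈ 𝔞 ^ 3 ^ i, ∀ m : M,
    y i • m ∈ seqSub M y i → e • m ∈ seqSub M y i
  top : ∀ P : PrimeSpectrum R, cd P = n → ¬ 𝔞 ≤ P.asIdeal
  local_colon : ∀ (P : PrimeSpectrum R) (n' l K : ℕ) (c : R) (w : ℕ → R), cd P = n' → n' + l = n →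
    c ∉ P.asIdeal → (∀ p ∈ P.asIdeal ^ K, c * p ∈ 𝔞) → (∀ j < l, w j ∈ P.asIdeal ^ (2 ^ j * K)) →
    (∀ j < l, ∃ c' ∉ P.asIdeal, ∀ m : M, w j • m ∈ seqSub M w j → c' • m ∈ seqSub M w j) →
    ¬ 𝔞 ≤ P.asIdeal

lemma exists_mem_pow_lift {A : Type u} [CommRing A] {f : A →+* R} (hf : Function.Surjective f) (I : Ideal R)
    {k : ℕ} {r : R} (hr : r ∈ I ^ k) : ∃ a ∈ (I.comap f) ^ k, f a = r := by
  rw [← Ideal.mem_map_iff_of_surjective f hf, Ideal.map_pow, Ideal.map_comap_of_surjective f hf]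
  exact hr

lemma exists_killerData_of_algebra {A : Type u} [CommRing A] [IsNoetherianRing A] [IsLocalRing A]
    (hA : IsCMLocal A) [Algebra A R] (hf : Function.Surjective (algebraMap A R))
    {T : Ideal R} (hTm : T ≤ maximalIdeal R) {n d : ℕ} (hT : Dle T n) (hd : ringKrullDim R = d) (hn : n ≤ d)
    (M : Type u) [AddCommGroup M] [Module R M] [Module.Finite R M] [Module A M] [IsScalarTower A R M]
    (hTM : ∀ c ∈ T, ∀ m : M, c • m = 0) : ∃ 𝔞, KillerData T n M 𝔞 := by
  have hfin : Module.Finite A M :=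
    haveI : Module.Finite A R := Module.Finite.of_surjective (Algebra.linearMap A R) hf
    Module.Finite.trans R M
  set f := algebraMap A R with hfdef
  have hsm : ∀ (a : A) (m : M), a • m = f a • m := fun a m => (algebraMap_smul R a m).symm
  obtain ⟨D, hD⟩ : ∃ D : ℕ, ringKrullDim A = D := by
    obtain ⟨D, hD⟩ := WithBot.ne_bot_iff_exists.1 (ringKrullDim_ne_bot (R := A))
    have hD' : D ≠ ⊤ := fun h => ringKrullDim_ne_top (R := A) (by rw [← hD, h]; rfl)
    obtain ⟨D, rfl⟩ := ENat.ne_top_iff_exists.1 hD'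
    exact ⟨D, hD.symm⟩
  have hdim : Dle (⊥ : Ideal A) D := by
    rw [← Dle_iff, ← hD]
    exact ringKrullDim_quotient_le _
  have hdD : d ≤ D := by
    have := ringKrullDim_le_of_surjective f hf
    rw [hd, hD] at this; exact_mod_cast this
  have hm : (maximalIdeal R).comap f = maximalIdeal A :=
    ((IsLocalRing.local_hom_TFAE f).out 0 4).1 (IsLocalHom.of_surjective f hf)
  obtain ⟨z, hz, hzT⟩ := exists_PS_in (n := D) (m' := n) (r := D - n) hdim (I := T.comap f)
    (by rw [← hm]; exact Ideal.comap_mono hTm) ((Dle_comap hf _ _).2 hT) (by omega)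
  have hC : CMData A D n (D - n) z := ⟨fun x j hx => hA.regular hD hx, hz, by omega⟩
  have hZT : seqSub A z (D - n) ≤ T.comap f := seqSub_le_ideal hzT
  have hZn : Dle (seqSub A z (D - n)) n := by
    obtain ⟨_, n', hn', h2⟩ := hz
    exact h2.mono (by simp) (by omega)
  have hZM : ∀ c ∈ seqSub A z (D - n), ∀ m : M, c • m = 0 := fun c hc m => by
    rw [hsm]; exact hTM _ (hZT hc) m
  have hker : ∀ a, f a = 0 → a ∈ aE (seqSub A z (D - n)) n M := fun a ha j N hj =>
    EK.of_smul fun m => by rw [hsm, ha, zero_smul]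
  have hmem : ∀ a, f a ∈ (aE (seqSub A z (D - n)) n M).map f ↔ a ∈ aE (seqSub A z (D - n)) n M := fun a => by
    rw [Ideal.mem_map_iff_of_surjective f hf]
    constructor
    · rintro ⟨b, hb, hba⟩
      have := hker (a - b) (by rw [map_sub, hba, sub_self])
      simpa using add_mem this hb
    · exact fun h => ⟨a, h, rfl⟩
  have hle : ∀ P : PrimeSpectrum R, (aE (seqSub A z (D - n)) n M).map f ≤ P.asIdeal →
      aE (seqSub A z (D - n)) n M ≤ (PrimeSpectrum.comap f P).asIdeal := fun P h => Ideal.map_le_iff_le_comap.1 h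
  refine ⟨(aE (seqSub A z (D - n)) n M).map f, ?_, fun P hP hle' => ?_, ?_⟩
  · intro y i hy e he m hm
    rw [← Ideal.map_pow, Ideal.mem_map_iff_of_surjective f hf] at he
    obtain ⟨a, ha, rfl⟩ := he
    obtain ⟨x, hx, hxy⟩ := hy.exists_lift hf hTm hZT hZn
    have hact : ∀ j < i + 1, ∀ m : M, x j • m = y j • m := fun j hj m => by
      rw [hsm, ← sub_eq_zero, ← sub_smul]; exact hTM _ (hxy j hj) m
    have := aE_colon hZM hx a ha m (by
      rw [hact i (by omega)]
      exact (mem_seqSub_transfer (fun j hj => hact j (by omega)) _).2 hm)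
    rw [← hsm]
    exact (mem_seqSub_transfer (fun j hj => hact j (by omega)) _).1 this
  · exact hC.not_aE_le _ ((cd_comap hf P).trans hP) (hle P hle')
  · intro P n' l K c w hP hl hc hcK hw hcol hle'
    obtain ⟨c, rfl⟩ := hf c
    have hw' : ∀ j, ∃ a : A, j < l → a ∈ (PrimeSpectrum.comap f P).asIdeal ^ (2 ^ j * K) ∧ f a = w j := fun j => by
      by_cases hj : j < l
      · obtain ⟨a, ha, h⟩ := exists_mem_pow_lift hf _ (hw j hj)
        exact ⟨a, fun _ => ⟨ha, h⟩⟩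
      · exact ⟨0, fun h => absurd h hj⟩
    choose x hx using hw'
    have htr : ∀ j < l, ∀ m : M, m ∈ seqSub M x j ↔ m ∈ seqSub M w j := fun j hj m =>
      mem_seqSub_transfer (fun i hi m => by rw [hsm, (hx i (by omega)).2]) m
    refine hC.not_aE_le_of_colon hZM (PrimeSpectrum.comap f P) ((cd_comap hf P).trans hP) hl (c := c) (K := K) hc (fun p hp => ?_)
      (w := x) (fun j hj => (hx j hj).1) (fun j hj => ?_) (hle P hle')
    · rw [← hmem, map_mul]
      refine hcK _ ?_
      rw [← Ideal.map_comap_of_surjective f hf P.asIdeal, ← Ideal.map_pow]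
      exact Ideal.mem_map_of_mem _ hp
    · obtain ⟨c', hc', h⟩ := hcol j hj
      obtain ⟨c', rfl⟩ := hf c'
      refine ⟨c', hc', fun m hm => ?_⟩
      rw [hsm, htr j hj]
      exact h m (by rw [← (hx j hj).2, ← hsm]; exact (htr j hj _).1 hm)

/-- Uniform annihilators exist over homomorphic images of Cohen–Macaulay local rings. -/
theorem exists_killerData (hres : IsHomImageOfCM R) {T : Ideal R} (hTm : T ≤ maximalIdeal R) {n d : ℕ}
    (hT : Dle T n) (hd : ringKrullDim R = d) (hn : n ≤ d)
    (M : Type u) [AddCommGroup M] [Module R M] [Module.Finite R M]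
    (hTM : ∀ c ∈ T, ∀ m : M, c • m = 0) : ∃ 𝔞, KillerData T n M 𝔞 := by
  obtain ⟨A, _, _, _, hA, f, hf⟩ := hres
  letI := f.toAlgebra
  letI : Module A M := Module.compHom M f
  haveI : IsScalarTower A R M := ⟨fun a r m => by
    change (f a * r) • m = f a • (r • m); rw [mul_smul]⟩
  exact exists_killerData_of_algebra hA hf hTm hT hd hn M hTM

end Interface

end

noncomputable section

section Colength
lemma ker_mapQ_comap {R M M' : Type*} [CommRing R] [AddCommGroup M] [Module R M] [AddCommGroup M'] [Module R M'] (f : M' →ₗ[R] M)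
    (N : Submodule R M) : Function.Injective ((N.comap f).mapQ N f le_rfl) := by
  rw [injective_iff_map_eq_zero]
  intro z hz
  obtain ⟨z, rfl⟩ := Submodule.mkQ_surjective _ z
  rw [Submodule.mkQ_apply, Submodule.mapQ_apply, Submodule.Quotient.mk_eq_zero] at hz
  rw [Submodule.mkQ_apply, Submodule.Quotient.mk_eq_zero]
  exact hz

variable {R : Type u} [CommRing R]
variable {M : Type u} [AddCommGroup M] [Module R M] {M' : Type u} [AddCommGroup M'] [Module R M']

def FC (N : Submodule R M) : Prop := IsFiniteLength R (M ⧸ N)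

/-- The colength of a submodule. -/
def cl (N : Submodule R M) : ℕ := (Module.length R (M ⧸ N)).toNat

lemma FC.mono {N N' : Submodule R M} (h : FC N) (hN : N ≤ N') : FC N' :=
  IsFiniteLength.of_surjective h (f := Submodule.factor hN) (Submodule.factor_surjective hN)

lemma FC.length {N : Submodule R M} (h : FC N) : Module.length R (M ⧸ N) = cl N :=
  (ENat.natCast_toNat (Module.length_ne_top_iff.2 h)).symm

lemma FC.comap {N : Submodule R M} (h : FC N) (f : M' →ₗ[R] M) : FC (N.comap f) := by
  exact IsFiniteLength.of_injective h (ker_mapQ_comap f N)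

lemma cl_eq_add {L : Submodule R M} (h : FC L) (f : M' →ₗ[R] M) :
    cl L = cl (L.comap f) + cl (L ⊔ LinearMap.range f) := by
  have hi : Function.Injective ((L.comap f).mapQ L f le_rfl) := ker_mapQ_comap f L
  have := Module.length_eq_add_of_exact ((L.comap f).mapQ L f le_rfl)
    (Submodule.factor (le_sup_left : L ≤ L ⊔ LinearMap.range f)) hi (Submodule.factor_surjective _) (by
      intro z
      obtain ⟨z, rfl⟩ := Submodule.mkQ_surjective _ z
      change (Submodule.Quotient.mk z : M ⧸ (L ⊔ LinearMap.range f)) = 0 ↔ _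
      rw [Submodule.Quotient.mk_eq_zero, Submodule.mem_sup]
      constructor
      · rintro ⟨y, hy, _, ⟨w, rfl⟩, rfl⟩
        refine ⟨Submodule.Quotient.mk w, ?_⟩
        exact (Submodule.Quotient.eq L).2 (by simpa using hy)
      · rintro ⟨w, hw⟩
        obtain ⟨w, rfl⟩ := Submodule.mkQ_surjective _ w
        simp only [Submodule.mkQ_apply, Submodule.mapQ_apply] at hw
        rw [Submodule.Quotient.eq] at hw
        exact ⟨z - f w, by simpa using neg_mem hw, f w, ⟨w, rfl⟩, by simp⟩)
  rw [h.length, (h.comap f).length, (h.mono le_sup_left).length] at this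
  exact_mod_cast this

lemma cl_mono {N N' : Submodule R M} (h : FC N) (hN : N ≤ N') : cl N' ≤ cl N := by
  have := cl_eq_add h N'.subtype
  rw [Submodule.range_subtype, sup_of_le_right hN] at this
  omega

lemma cl_eq_zero {N : Submodule R M} (h : FC N) : cl N = 0 ↔ N = ⊤ := by
  have h1 := h.length
  rw [← Submodule.Quotient.subsingleton_iff, ← Module.length_eq_zero_iff (R := R), h1]
  simp

lemma eq_of_cl_le {N N' : Submodule R M} (h : FC N) (hN : N ≤ N') (hc : cl N ≤ cl N') : N = N' := by
  have := cl_eq_add h N'.subtype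
  rw [Submodule.range_subtype, sup_of_le_right hN] at this
  have h0 : cl (N.comap N'.subtype) = 0 := by omega
  rw [cl_eq_zero (h.comap _)] at h0
  exact le_antisymm hN (Submodule.comap_subtype_eq_top.1 h0)

lemma FC.inf {N N' : Submodule R M} (h : FC N) (h' : FC N') : FC (N ⊓ N') := by
  have : Function.Injective ((N ⊓ N').liftQ (N.mkQ.prod N'.mkQ) (by
      rw [LinearMap.ker_prod]; simp)) := by
    rw [← LinearMap.ker_eq_bot, Submodule.ker_liftQ_eq_bot]
    rw [LinearMap.ker_prod]; simp
  refine IsFiniteLength.of_injective ?_ this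
  have h1 := Module.length_ne_top_iff.2 h
  have h2 := Module.length_ne_top_iff.2 h'
  rw [← Module.length_ne_top_iff, Module.length_prod]
  exact WithTop.add_ne_top.2 ⟨h1, h2⟩

lemma cl_map {L : Submodule R M} (hL : FC L) (f : M' →ₗ[R] M) {J : Submodule R M'} (hJ : FC J) :
    cl L + cl J = cl (J ⊓ L.comap f) + cl (L ⊔ J.map f) := by
  have h1 := cl_eq_add hL (f.comp J.subtype)
  have h2 := cl_eq_add (hJ.inf (hL.comap f)) J.subtype
  rw [Submodule.range_subtype, sup_of_le_right inf_le_left] at h2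
  rw [LinearMap.range_comp, Submodule.range_subtype, Submodule.comap_comp] at h1
  have : (J ⊓ L.comap f).comap J.subtype = (L.comap f).comap J.subtype := by
    ext; simp
  rw [this] at h2
  omega

lemma cl_modular {A B : Submodule R M} (hA : FC A) (hB : FC B) : cl A + cl B = cl (A ⊓ B) + cl (A ⊔ B) := by
  have := cl_map hA LinearMap.id hB
  rwa [Submodule.comap_id, Submodule.map_id, inf_comm] at this

lemma cl_colon {L : Submodule R M} (hL : FC L) (x : R) :
    cl L = cl (L.comap (mulM M x)) + cl (L ⊔ LinearMap.range (mulM M x)) := cl_eq_add hL _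

lemma cl_le_sup_span {L : Submodule R M} (hL : FC L) {𝔟 : Ideal R} (h𝔟 : FC 𝔟) {g : M}
    (h : ∀ r ∈ 𝔟, r • g ∈ L) : cl L ≤ cl (L ⊔ Submodule.span R {g}) + cl 𝔟 := by
  have h1 := cl_eq_add hL (LinearMap.toSpanSingleton R M g)
  rw [LinearMap.range_toSpanSingleton] at h1
  have := cl_mono h𝔟 (N' := L.comap (LinearMap.toSpanSingleton R M g)) (fun r hr => by simpa using h r hr)
  omega

lemma cl_le_sup_span_list {𝔟 : Ideal R} (h𝔟 : FC 𝔟) (l : List M) : ∀ {L : Submodule R M}, FC L →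
    (∀ g ∈ l, ∀ r ∈ 𝔟, r • g ∈ L) → cl L ≤ cl (L ⊔ Submodule.span R {g | g ∈ l}) + l.length * cl 𝔟 := by
  induction l with
  | nil => intro L hL h; simp
  | cons g l ih =>
    intro L hL h
    have h1 := cl_le_sup_span hL h𝔟 (h g (by simp))
    have h2 := ih (hL.mono (N' := L ⊔ Submodule.span R {g}) le_sup_left)
      (fun g' hg' r hr => Submodule.mem_sup_left (h g' (by simp [hg']) r hr))
    have h3 : L ⊔ Submodule.span R {g} ⊔ Submodule.span R {g | g ∈ l} = L ⊔ Submodule.span R {g' | g' ∈ g :: l} := by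
      rw [sup_assoc, ← Submodule.span_union]
      congr 2
      ext; simp
    rw [h3] at h2
    rw [List.length_cons, add_mul]
    omega

lemma cl_comap_surjective {f : M' →ₗ[R] M} (hf : Function.Surjective f) (N : Submodule R M) :
    cl (N.comap f) = cl N := by
  unfold cl
  have hi : Function.Injective ((N.comap f).mapQ N f le_rfl) := ker_mapQ_comap f N
  have hs : Function.Surjective ((N.comap f).mapQ N f le_rfl) := by
    intro z
    obtain ⟨z, rfl⟩ := Submodule.mkQ_surjective _ z
    obtain ⟨w, rfl⟩ := hf z
    exact ⟨Submodule.Quotient.mk w, rfl⟩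
  rw [(LinearEquiv.ofBijective _ ⟨hi, hs⟩).length_eq]

variable [IsLocalRing R] [IsNoetherianRing R]

lemma FC_of_pow [Module.Finite R M] {N : Submodule R M} {k : ℕ} (h : ∀ r ∈ maximalIdeal R ^ k, ∀ m : M, r • m ∈ N) : FC N := by
  refine LCoh.isFiniteLength_of_pow_maximal (k := k) (fun r hr m => ?_)
  obtain ⟨m, rfl⟩ := Submodule.mkQ_surjective _ m
  rw [← map_smul, Submodule.mkQ_apply, Submodule.Quotient.mk_eq_zero]
  exact h r hr m

lemma FC.exists_pow {N : Submodule R M} (h : FC N) : ∃ k, ∀ r ∈ maximalIdeal R ^ k, ∀ m : M, r • m ∈ N := by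
  obtain ⟨_, hart⟩ := isFiniteLength_iff_isNoetherian_isArtinian.1 h
  obtain ⟨k, hk⟩ := IsArtinian.monotone_stabilizes (R := R) (M := M ⧸ N)
    ⟨fun k => OrderDual.toDual (maximalIdeal R ^ k • (⊤ : Submodule R (M ⧸ N))), fun a b hab =>
      Submodule.smul_mono_left (Ideal.pow_le_pow_right hab)⟩
  have h1 : maximalIdeal R ^ k • (⊤ : Submodule R (M ⧸ N)) = maximalIdeal R ^ (k + 1) • ⊤ := hk (k + 1) (by omega)
  have h2 : maximalIdeal R ^ k • (⊤ : Submodule R (M ⧸ N)) = ⊥ := by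
    refine Submodule.eq_bot_of_le_smul_of_le_jacobson_bot (maximalIdeal R) _ (IsNoetherian.noetherian _) ?_
      (IsLocalRing.maximalIdeal_le_jacobson _)
    rw [smul_smul, ← pow_succ']
    exact h1.le
  refine ⟨k, fun r hr m => ?_⟩
  have h3 : r • (N.mkQ m) ∈ maximalIdeal R ^ k • (⊤ : Submodule R (M ⧸ N)) := Submodule.smul_mem_smul hr trivial
  rw [h2, Submodule.mem_bot, ← map_smul, Submodule.mkQ_apply, Submodule.Quotient.mk_eq_zero] at h3
  exact h3

end Colength

end

noncomputable section

section DSeq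
variable {R : Type u} [CommRing R] [IsLocalRing R] [IsNoetherianRing R] (M : Type u) [AddCommGroup M] [Module R M]

/-- `x_0, …, x_{d-1}` is a d-sequence on `M`. -/
def DSeq (x : ℕ → R) (d : ℕ) : Prop :=
  ∀ i k, i ≤ k → k < d → ∀ m : M, x i • x k • m ∈ seqSub M x i → x k • m ∈ seqSub M x i

/-- The submodule `q ^ n M` for `q = (x_0, …, x_{d-1})`. -/
def powSub (x : ℕ → R) (d n : ℕ) : Submodule R M := seqSub R x d ^ n • ⊤

/-- The colon submodule `(x_0, …, x_{i-1})M : x_i`. -/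
def colSub (x : ℕ → R) (i : ℕ) : Submodule R M := (seqSub M x i).comap (mulM M (x i))

variable {M}

lemma mem_colSub {x : ℕ → R} {i : ℕ} {m : M} : m ∈ colSub M x i ↔ x i • m ∈ seqSub M x i := Iff.rfl

lemma seqSub_eq_smul_top (x : ℕ → R) (i : ℕ) : seqSub M x i = (seqSub R x i : Ideal R) • ⊤ := by
  rw [seqSub_eq, seqSub_eq, Ideal.smul_top_eq_map]; simp

lemma mem_seqSub_smul_succ {x : ℕ → R} {i : ℕ} {L : Submodule R M} {m : M} :
    m ∈ (seqSub R x (i + 1) : Ideal R) • L ↔ ∃ a ∈ (seqSub R x i : Ideal R) • L, ∃ b ∈ L, a + x i • b = m := by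
  rw [seqSub_succ_span, Submodule.sup_smul, Submodule.mem_sup, Submodule.ideal_span_singleton_smul]
  constructor
  · rintro ⟨a, ha, b, hb, rfl⟩
    obtain ⟨b, hb', rfl⟩ := (Submodule.mem_smul_pointwise_iff_exists _ _ _).1 hb
    exact ⟨a, ha, b, hb', rfl⟩
  · rintro ⟨a, ha, b, hb, rfl⟩
    exact ⟨a, ha, _, (Submodule.mem_smul_pointwise_iff_exists _ _ _).2 ⟨b, hb, rfl⟩, rfl⟩

lemma powSub_succ (x : ℕ → R) (d n : ℕ) : powSub M x d (n + 1) = (seqSub R x d : Ideal R) • powSub M x d n := by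
  rw [powSub, powSub, pow_succ', Submodule.mul_smul]

lemma powSub_zero (x : ℕ → R) (d : ℕ) : powSub M x d 0 = ⊤ := by
  rw [powSub, pow_zero, Ideal.one_eq_top, Submodule.top_smul]

lemma powSub_one (x : ℕ → R) (d : ℕ) : powSub M x d 1 = seqSub M x d := by
  rw [powSub, pow_one, ← seqSub_eq_smul_top]

lemma powSub_anti (x : ℕ → R) (d : ℕ) : Antitone (powSub M x d) := fun _ _ hab =>
  Submodule.smul_mono_left (Ideal.pow_le_pow_right hab)

lemma smul_mem_powSub {x : ℕ → R} {d n i : ℕ} (hi : i < d) {m : M} (hm : m ∈ powSub M x d n) :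
    x i • m ∈ powSub M x d (n + 1) := by
  rw [powSub_succ]; exact Submodule.smul_mem_smul (mem_seqSub_self hi) hm

lemma seqSub_smul_le {x : ℕ → R} {i : ℕ} {L : Submodule R M} : (seqSub R x i : Ideal R) • L ≤ seqSub M x i := by
  rw [seqSub_eq_smul_top (M := M)]; exact Submodule.smul_mono le_rfl le_top

variable {x : ℕ → R} {d : ℕ} (h : DSeq M x d)
include h

lemma DSeq.inf {i j : ℕ} (hij : i ≤ j) (hj : j ≤ d) : ∀ {m : M}, m ∈ colSub M x i → m ∈ seqSub M x j →
    m ∈ seqSub M x i := by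
  induction j, hij using Nat.le_induction with
  | base => intro m _ h; exact h
  | succ j hij ih =>
    intro m hm hm'
    refine ih (by omega) hm ?_
    obtain ⟨n, hn, m', rfl⟩ := mem_seqSub_succ.1 hm'
    have h1 : x j • (n + x j • m') ∈ seqSub M x i := h i j hij (by omega) _ (by
      rw [smul_comm]; exact Submodule.smul_mem _ _ hm)
    refine add_mem hn (h j j le_rfl (by omega) m' ?_)
    have h2 := sub_mem (seqSub_mono x hij h1) (Submodule.smul_mem _ (x j) hn)
    rw [smul_add] at h2
    simpa using h2

lemma DSeq.inf_powSub (n : ℕ) : ∀ {i : ℕ}, i ≤ d → ∀ {m : M}, m ∈ seqSub M x i → m ∈ powSub M x d (n + 1) →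
    m ∈ (seqSub R x i : Ideal R) • powSub M x d n := by
  induction n with
  | zero =>
    intro i hi m hm _
    rw [powSub_zero, ← seqSub_eq_smul_top]; exact hm
  | succ n ihn =>
    intro i hi
    induction hi using Nat.decreasingInduction with
    | self => intro m _ hm; rwa [powSub_succ] at hm
    | of_succ i hi ih =>
      intro m hm hm'
      obtain ⟨a, ha, b, hb, rfl⟩ := mem_seqSub_smul_succ.1 (ih (seqSub_le_succ M x i hm) hm')
      refine add_mem ha ?_
      have h1 : b ∈ colSub M x i := by
        rw [mem_colSub]
        simpa using sub_mem hm (seqSub_smul_le ha)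
      have h2 : b ∈ seqSub M x d := by
        rw [← powSub_one]; exact powSub_anti x d (by omega) hb
      have h3 := ihn (by omega) (h.inf (by omega) le_rfl h1 h2) hb
      rw [powSub_succ, smul_smul, mul_comm, ← smul_smul]
      exact Submodule.smul_mem_smul (mem_seqSub_self hi) h3

lemma DSeq.colon {n i : ℕ} (hi : i < d) {m : M} (hm : x i • m ∈ powSub M x d (n + 1) ⊔ seqSub M x i) :
    m ∈ powSub M x d n ⊔ colSub M x i := by
  obtain ⟨a, ha, b, hb, hab⟩ := Submodule.mem_sup.1 hm
  have h1 : a ∈ seqSub M x (i + 1) := by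
    rw [mem_seqSub_succ]
    exact ⟨-b, neg_mem hb, m, by rw [← hab]; abel⟩
  obtain ⟨a', ha', c, hc, rfl⟩ := mem_seqSub_smul_succ.1 (h.inf_powSub n (by omega) h1 ha)
  refine Submodule.mem_sup.2 ⟨c, hc, m - c, ?_, by abel⟩
  rw [mem_colSub, smul_sub, ← hab]
  have := add_mem (seqSub_smul_le ha') hb
  convert this using 1; abel

lemma DSeq.colon_eq {n i : ℕ} (hi : i < d) :
    (powSub M x d (n + 1) ⊔ seqSub M x i).comap (mulM M (x i)) = powSub M x d n ⊔ colSub M x i := by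
  refine le_antisymm (fun m hm => h.colon hi hm) (sup_le (fun m hm => ?_) (fun m hm => ?_))
  · exact Submodule.mem_sup_left (smul_mem_powSub hi hm)
  · exact Submodule.mem_sup_right hm

omit h in
lemma seqSub_le_colSub (i : ℕ) : seqSub M x i ≤ colSub M x i := fun _ hm => Submodule.smul_mem _ _ hm

lemma DSeq.inf_eq {n i : ℕ} (hi : i < d) :
    powSub M x d 1 ⊓ (powSub M x d (n + 1) ⊔ colSub M x i) = powSub M x d (n + 1) ⊔ seqSub M x i := by
  refine le_antisymm ?_ (le_inf (sup_le (powSub_anti x d (by omega)) ?_) (sup_le_sup_left (seqSub_le_colSub i) _))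
  · rintro m ⟨h1, h2⟩
    obtain ⟨a, ha, b, hb, rfl⟩ := Submodule.mem_sup.1 h2
    refine add_mem (Submodule.mem_sup_left ha) (Submodule.mem_sup_right (h.inf (by omega) le_rfl hb ?_))
    rw [← powSub_one]
    simpa using sub_mem h1 (powSub_anti x d (show 1 ≤ n + 1 by omega) ha)
  · rw [powSub_one]; exact seqSub_mono x (by omega)

omit h in
lemma powSub_sup_range {n i : ℕ} : powSub M x d n ⊔ seqSub M x i ⊔ LinearMap.range (mulM M (x i)) =
    powSub M x d n ⊔ seqSub M x (i + 1) := by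
  rw [sup_assoc, ← seqSub_succ]

variable [Module.Finite R M]

omit h in
lemma FC_powSub (hq : FC (seqSub R x d : Ideal R)) (n : ℕ) : FC (powSub M x d n) := by
  obtain ⟨k, hk⟩ := hq.exists_pow
  refine FC_of_pow (k := k * n) fun r hr m => Submodule.smul_mem_smul ?_ trivial
  rw [pow_mul] at hr
  exact Ideal.pow_right_mono (fun s hs => by simpa using hk s hs 1) n hr

variable (M x d) in
/-- The colength difference `ℓ((q M + (N_i : x_i)) / qM)`. -/
def hDiff (i : ℕ) : ℤ := cl (powSub M x d 1) - cl (powSub M x d 1 ⊔ colSub M x i)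

theorem DSeq.hilbert (hq : FC (seqSub R x d : Ideal R)) (r : ℕ) : ∀ (i : ℕ), i + r = d → ∀ n : ℕ,
    (cl (powSub M x d (n + 1) ⊔ seqSub M x i) : ℤ) = cl (powSub M x d 1) * ((n + r).choose r : ℤ) -
      ∑ s ∈ Finset.range r, hDiff M x d (i + s) * ((n + s).choose (s + 1) : ℤ) := by
  have hF := fun n => FC_powSub (M := M) hq n
  induction r with
  | zero =>
    rintro i rfl n
    simp only [add_zero]
    rw [← powSub_one, sup_of_le_right (powSub_anti x i (by omega))]
    simp
  | succ r ih =>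
    intro i hi n
    induction n with
    | zero =>
      rw [sup_of_le_left (by rw [powSub_one]; exact seqSub_mono x (by omega))]
      simp
    | succ n ihn =>
      have h1 := cl_colon ((hF (n + 2)).mono (N' := powSub M x d (n + 2) ⊔ seqSub M x i) le_sup_left) (x i)
      rw [h.colon_eq (by omega), powSub_sup_range] at h1
      have h2 := cl_modular (hF 1) ((hF (n + 1)).mono (N' := powSub M x d (n + 1) ⊔ colSub M x i) le_sup_left)
      rw [h.inf_eq (by omega), ← sup_assoc,
        sup_of_le_left (powSub_anti x d (by omega) : powSub M x d (n + 1) ≤ powSub M x d 1)] at h2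
      have h3 := ih (i + 1) (by omega) (n + 1)
      have h4 : (cl (powSub M x d (n + 1 + 1) ⊔ seqSub M x i) : ℤ) = cl (powSub M x d (n + 1) ⊔ seqSub M x i) -
          hDiff M x d i + cl (powSub M x d (n + 1 + 1) ⊔ seqSub M x (i + 1)) := by
        rw [h1, hDiff]; push_cast
        zify at h2
        linarith
      rw [h4, ihn, h3, Finset.sum_range_succ', Finset.sum_range_succ' (n := r)]
      have e1 : (n + 1 + (r + 1)).choose (r + 1) = (n + (r + 1)).choose (r + 1) + (n + 1 + r).choose r := by
        rw [show n + 1 + (r + 1) = (n + 1 + r) + 1 by ring, Nat.choose_succ_succ, add_comm,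
          show n + (r + 1) = n + 1 + r by ring]
      have e2 : ∀ s, (n + 1 + (s + 1)).choose (s + 1 + 1) = (n + (s + 1)).choose (s + 1 + 1) + (n + 1 + s).choose (s + 1) := by
        intro s
        rw [show n + 1 + (s + 1) = (n + 1 + s) + 1 by ring, Nat.choose_succ_succ, add_comm,
          show n + (s + 1) = n + 1 + s by ring]
      rw [e1]
      simp only [e2, add_zero, zero_add, Nat.choose_one_right]
      push_cast
      simp only [mul_add, Finset.sum_add_distrib, ← add_assoc]
      have e3 : ∑ s ∈ Finset.range r, hDiff M x d (i + 1 + s) * ((n + 1 + s).choose (s + 1) : ℤ) =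
        ∑ s ∈ Finset.range r, hDiff M x d (i + s + 1) * ((n + 1 + s).choose (s + 1) : ℤ) :=
        Finset.sum_congr rfl fun s _ => by rw [show i + 1 + s = i + s + 1 by ring]
      rw [e3]
      ring

end DSeq

end

noncomputable section

section Binomial

lemma choose_add_mono (n : ℕ) {j k : ℕ} (h : j ≤ k) : (n + j).choose j ≤ (n + k).choose k := by
  rw [← Nat.choose_symm_add, ← Nat.choose_symm_add]
  exact Nat.choose_mono n (by omega)

lemma choose_add_succ (n k : ℕ) : (n + (k + 1)).choose (k + 1) * (k + 1) = (n + k + 1) * (n + k).choose k :=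
  (Nat.add_one_mul_choose_eq (n + k) k).symm

lemma eventually_nonneg {k : ℕ} {a b K : ℤ} (h : ∃ N : ℕ, ∀ n ≥ N,
    0 ≤ a * ((n + (k + 2)).choose (k + 2) : ℤ) + b * ((n + (k + 1)).choose (k + 1) : ℤ) + K * ((n + k).choose k : ℤ)) :
    0 ≤ a ∧ (a = 0 → 0 ≤ b) := by
  obtain ⟨N, h⟩ := h
  have key : ∀ n ≥ N, 0 ≤ a * ((n + k + 2) * (n + k + 1)) + b * (k + 2) * (n + k + 1) + K * (k + 1) * (k + 2) := by
    intro n hn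
    have h1 : (((n + (k + 2)).choose (k + 2) : ℕ) : ℤ) * (k + 2) = (n + k + 2) * ((n + (k + 1)).choose (k + 1) : ℕ) := by
      have := choose_add_succ n (k + 1)
      zify at this
      rw [show n + (k + 2) = n + (k + 1 + 1) by ring]
      linarith
    have h2 : (((n + (k + 1)).choose (k + 1) : ℕ) : ℤ) * (k + 1) = (n + k + 1) * ((n + k).choose k : ℕ) := by
      exact_mod_cast choose_add_succ n k
    have h3 : (0 : ℤ) < ((n + k).choose k : ℕ) := by exact_mod_cast Nat.choose_pos (by omega)
    have h4 := mul_nonneg (h n hn) (show (0 : ℤ) ≤ (k + 1) * (k + 2) by positivity)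
    have h5 : (a * ((n + (k + 2)).choose (k + 2) : ℤ) + b * ((n + (k + 1)).choose (k + 1) : ℤ) + K * ((n + k).choose k : ℤ)) * ((k + 1) * (k + 2))
      = (a * ((n + k + 2) * (n + k + 1)) + b * (k + 2) * (n + k + 1) + K * (k + 1) * (k + 2)) * ((n + k).choose k : ℕ) := by
      linear_combination a * (k + 1) * h1 + a * (n + k + 2) * h2 + b * (k + 2) * h2
    rw [h5] at h4
    exact nonneg_of_mul_nonneg_left h4 h3
  have lin : ∀ B C : ℤ, (∀ n : ℕ, n ≥ N → 0 ≤ B * n + C) → 0 ≤ B := by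
    intro B C hBC
    by_contra! hB
    have h1 := hBC (N + (C.natAbs + 1)) (by omega)
    have h2 := Int.le_natAbs (a := C)
    push_cast at h1 h2
    have h3 : B * (N + (|C| + 1)) ≤ -1 * (N + (|C| + 1)) :=
      mul_le_mul_of_nonneg_right (by omega) (by positivity)
    have h4 : (0 : ℤ) ≤ N := by positivity
    linarith
  constructor
  · by_contra! ha
    obtain ⟨X, hX⟩ : ∃ X : ℤ, X = |b| * (k + 2) + |K| * (k + 1) * (k + 2) := ⟨_, rfl⟩
    have hX0 : 0 ≤ X := by rw [hX]; positivity
    have h1 := key (N + X.toNat + 1) (by omega)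
    have h2 : ((X.toNat : ℕ) : ℤ) = X := Int.toNat_of_nonneg hX0
    push_cast at h1
    rw [h2] at h1
    set t : ℤ := N + X + 1 + k + 1 with ht
    have hbt : b * (k + 2) * t ≤ |b| * (k + 2) * t := by
      have := le_abs_self b
      gcongr
    have hKt : K * (k + 1) * (k + 2) ≤ |K| * (k + 1) * (k + 2) * t := by
      have h6 : K * (k + 1) * (k + 2) ≤ |K| * (k + 1) * (k + 2) := by
        have := le_abs_self K
        gcongr
      have h7 : (0 : ℤ) ≤ |K| * (k + 1) * (k + 2) := by positivity
      nlinarith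
    have hat : a * ((t + 1) * t) ≤ -((t + 1) * t) := by nlinarith [show 0 ≤ (t + 1) * t by positivity]
    have e1 : (N : ℤ) + X + 1 + k + 2 = t + 1 := by rw [ht]; ring
    rw [e1] at h1
    have h8 : 0 ≤ -((t + 1) * t) + X * t := by rw [hX]; linarith
    have ht0 : 0 < t := by positivity
    have : X < t + 1 := by rw [ht]; linarith
    nlinarith
  · rintro rfl
    have := lin (b * (k + 2)) (b * (k + 2) * (k + 1) + K * (k + 1) * (k + 2)) (fun n hn => by
      have := key n hn
      linarith)
    exact nonneg_of_mul_nonneg_left this (by positivity)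

/-- The Hilbert polynomial attached to the coefficients `e`. -/
def HP (d : ℕ) (e : ℕ → ℤ) (n : ℕ) : ℤ :=
  ∑ i ∈ Finset.range (d + 1), (-1) ^ i * e i * ((n + d - i).choose (d - i) : ℤ)

lemma HP_approx (k : ℕ) (e : ℕ → ℤ) : ∃ K : ℤ, ∀ n,
    |HP (k + 2) e n - (e 0 * ((n + (k + 2)).choose (k + 2) : ℤ) - e 1 * ((n + (k + 1)).choose (k + 1) : ℤ))| ≤
      K * ((n + k).choose k : ℤ) := by
  refine ⟨∑ i ∈ Finset.range (k + 1), |e (i + 2)|, fun n => ?_⟩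
  rw [HP, Finset.sum_range_succ', Finset.sum_range_succ']
  have e1 : n + (k + 2) - (0 + 1) = n + (k + 1) := by omega
  have e2 : k + 2 - (0 + 1) = k + 1 := by omega
  rw [e1, e2]
  simp only [pow_zero, one_mul, Nat.sub_zero, zero_add, pow_one, neg_mul, one_mul]
  rw [show ∀ A B C : ℤ, A + -B + C - (C - B) = A by intros; ring, Finset.sum_mul]
  refine (Finset.abs_sum_le_sum_abs _ _).trans (Finset.sum_le_sum fun i hi => ?_)
  rw [abs_mul, abs_mul, abs_pow, abs_neg, abs_one, one_pow, one_mul]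
  refine mul_le_mul_of_nonneg_left ?_ (abs_nonneg _)
  rw [Nat.abs_cast]
  have : i < k + 1 := Finset.mem_range.1 hi
  rw [show n + (k + 2) - (i + 1 + 1) = n + (k - i) by omega, show k + 2 - (i + 1 + 1) = k - i by omega]
  exact_mod_cast choose_add_mono n (by omega)

lemma le_of_HP_le {k : ℕ} {e : ℕ → ℤ} {a b K : ℤ} (h : ∃ N : ℕ, ∀ n ≥ N, HP (k + 2) e n ≤
    a * ((n + (k + 2)).choose (k + 2) : ℤ) + b * ((n + (k + 1)).choose (k + 1) : ℤ) + K * ((n + k).choose k : ℤ)) :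
    e 0 ≤ a ∧ (e 0 = a → - e 1 ≤ b) := by
  obtain ⟨N, h⟩ := h
  obtain ⟨K', h'⟩ := HP_approx k e
  have := eventually_nonneg (k := k) (a := a - e 0) (b := b + e 1) (K := K + K') ⟨N, fun n hn => by
    have h1 := h n hn
    have h2 := (abs_le.1 (h' n)).1
    linarith⟩
  exact ⟨by linarith [this.1], fun he => by linarith [this.2 (by linarith)]⟩

lemma le_of_le_HP {k : ℕ} {e : ℕ → ℤ} {a b K : ℤ} (h : ∃ N : ℕ, ∀ n ≥ N,
    a * ((n + (k + 2)).choose (k + 2) : ℤ) + b * ((n + (k + 1)).choose (k + 1) : ℤ) + K * ((n + k).choose k : ℤ) ≤ HP (k + 2) e n) :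
    a ≤ e 0 ∧ (e 0 = a → b ≤ - e 1) := by
  obtain ⟨N, h⟩ := h
  obtain ⟨K', h'⟩ := HP_approx k e
  have := eventually_nonneg (k := k) (a := e 0 - a) (b := -e 1 - b) (K := K' - K) ⟨N, fun n hn => by
    have h1 := h n hn
    have h2 := (abs_le.1 (h' n)).2
    linarith⟩
  exact ⟨by linarith [this.1], fun he => by linarith [this.2 (by linarith)]⟩

end Binomial

section Growth
variable {R : Type u} [CommRing R] [IsLocalRing R] [IsNoetherianRing R] {M : Type u} [AddCommGroup M] [Module R M]

lemma DSeq.hilbert_approx [Module.Finite R M] {x : ℕ → R} {k : ℕ} (h : DSeq M x (k + 2)) (hq : FC (seqSub R x (k + 2) : Ideal R)) :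
    ∃ K : ℤ, ∀ n, |(cl (powSub M x (k + 2) (n + 1)) : ℤ) -
      ((cl (powSub M x (k + 2) 1) - hDiff M x (k + 2) (k + 1)) * ((n + (k + 2)).choose (k + 2) : ℤ) +
        (hDiff M x (k + 2) (k + 1) - hDiff M x (k + 2) k) * ((n + (k + 1)).choose (k + 1) : ℤ))| ≤
        K * ((n + k).choose k : ℤ) := by
  refine ⟨∑ i ∈ Finset.range k, |hDiff M x (k + 2) i| + |hDiff M x (k + 2) k|, fun n => ?_⟩
  have h1 := h.hilbert hq (k + 2) 0 (by omega) n
  rw [seqSub_zero, sup_bot_eq] at h1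
  rw [h1, Finset.sum_range_succ, Finset.sum_range_succ]
  simp only [zero_add]
  have e1 : (((n + (k + 2)).choose (k + 2) : ℕ) : ℤ) = (n + (k + 1)).choose (k + 1 + 1) + (n + (k + 1)).choose (k + 1) := by
    rw [show n + (k + 2) = n + (k + 1) + 1 by ring, Nat.choose_succ_succ]; push_cast; ring
  have e2 : (((n + (k + 1)).choose (k + 1) : ℕ) : ℤ) = (n + k).choose (k + 1) + (n + k).choose k := by
    rw [show n + (k + 1) = n + k + 1 by ring, Nat.choose_succ_succ]; push_cast; ring
  have : ∀ (L S h1 h0 : ℤ), L * ((n + (k + 2)).choose (k + 2) : ℤ) - (S + h0 * ((n + k).choose (k + 1) : ℤ) +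
      h1 * ((n + (k + 1)).choose (k + 1 + 1) : ℤ)) - ((L - h1) * ((n + (k + 2)).choose (k + 2) : ℤ) +
      (h1 - h0) * ((n + (k + 1)).choose (k + 1) : ℤ)) = - S + h0 * ((n + k).choose k : ℤ) := by
    intro L S h1 h0
    linear_combination h1 * e1 + h0 * e2
  rw [this]
  refine (abs_add_le _ _).trans ?_
  rw [add_mul, abs_neg, abs_mul, Nat.abs_cast]
  refine add_le_add ?_ le_rfl
  rw [Finset.sum_mul]
  refine (Finset.abs_sum_le_sum_abs _ _).trans (Finset.sum_le_sum fun i hi => ?_)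
  rw [abs_mul, Nat.abs_cast]
  refine mul_le_mul_of_nonneg_left ?_ (abs_nonneg _)
  have : i < k := Finset.mem_range.1 hi
  have h3 : (n + i).choose (i + 1) ≤ (n + (i + 1)).choose (i + 1) := Nat.choose_mono (i + 1) (by omega)
  exact_mod_cast h3.trans (choose_add_mono n (by omega))

lemma FC.powSub [Module.Finite R M] {x : ℕ → R} {d : ℕ} (hq : FC (powSub M x d 1)) (n : ℕ) : FC (powSub M x d n) := by
  obtain ⟨k, hk⟩ := hq.exists_pow
  have : ∀ n, ∀ r ∈ maximalIdeal R ^ (k * n), ∀ m : M, r • m ∈ _root_.powSub M x d n := by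
    intro n
    induction n with
    | zero => intro r _ m; rw [powSub_zero]; trivial
    | succ n ih =>
      intro r hr m
      rw [mul_add, mul_one, pow_add] at hr
      refine Submodule.mul_induction_on hr (fun a ha b hb => ?_) (fun a b ha hb => by rw [add_smul]; exact add_mem ha hb)
      have h1 : b • m ∈ (seqSub R x d : Ideal R) • (⊤ : Submodule R M) := by
        have := hk b hb m
        rwa [powSub_one, seqSub_eq_smul_top] at this
      rw [mul_smul, powSub_succ]
      refine Submodule.smul_induction_on h1 (fun s hs z _ => ?_) (fun y z hy hz => by rw [smul_add]; exact add_mem hy hz)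
      rw [smul_smul, mul_comm, ← smul_smul]
      exact Submodule.smul_mem_smul hs (ih a ha z)
  exact FC_of_pow (this n)

lemma cl_powSub_le [Module.Finite R M] {x : ℕ → R} {d : ℕ} (hq : FC (powSub M x d 1)) (r : ℕ) : ∀ (i : ℕ), i + r = d → ∀ n : ℕ,
    cl (powSub M x d (n + 1) ⊔ seqSub M x i) ≤ cl (powSub M x d 1) * (n + r).choose r := by
  have hF := fun n => hq.powSub n
  induction r with
  | zero =>
    intro i hi n
    obtain rfl : i = d := by omega
    rw [← powSub_one, sup_of_le_right (powSub_anti x i (by omega))]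
    simp
  | succ r ih =>
    intro i hi n
    induction n with
    | zero =>
      rw [sup_of_le_left (by rw [powSub_one]; exact seqSub_mono x (by omega))]
      simp
    | succ n ihn =>
      have h1 := cl_colon ((hF (n + 2)).mono (N' := powSub M x d (n + 2) ⊔ seqSub M x i) le_sup_left) (x i)
      rw [powSub_sup_range] at h1
      have h2 := cl_mono ((hF (n + 1)).mono (N' := powSub M x d (n + 1) ⊔ seqSub M x i) le_sup_left)
        (N' := (powSub M x d (n + 2) ⊔ seqSub M x i).comap (mulM M (x i)))
        (sup_le (fun m hm => Submodule.mem_sup_left (smul_mem_powSub (by omega) hm))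
          (fun m hm => Submodule.mem_sup_right (Submodule.smul_mem _ _ hm)))
      have h3 := ih (i + 1) (by omega) (n + 1)
      have e1 : (n + 1 + (r + 1)).choose (r + 1) = (n + (r + 1)).choose (r + 1) + (n + 1 + r).choose r := by
        rw [show n + 1 + (r + 1) = (n + 1 + r) + 1 by ring, Nat.choose_succ_succ, add_comm,
          show n + (r + 1) = n + 1 + r by ring]
      rw [e1, mul_add]
      change cl (powSub M x d (n + 2) ⊔ seqSub M x i) ≤ _
      have h4 : cl (powSub M x d (n + 2) ⊔ seqSub M x (i + 1)) ≤ _ := h3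
      omega

lemma sup_span_pow_succ (A : Ideal R) (x : R) (n : ℕ) :
    (A ⊔ Ideal.span {x}) ^ (n + 1) = A ^ (n + 1) ⊔ Ideal.span {x} * (A ⊔ Ideal.span {x}) ^ n := by
  induction n with
  | zero => simp
  | succ n ih =>
    set B := A ⊔ Ideal.span {x} with hB
    have h1 : B ^ (n + 1 + 1) = A * B ^ (n + 1) ⊔ Ideal.span {x} * B ^ (n + 1) := by
      rw [pow_succ' B (n + 1)]
      conv_lhs => rw [hB, Ideal.sup_mul]
    rw [h1, ih, Ideal.mul_sup, ← pow_succ', ← ih, sup_assoc]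
    congr 1
    refine sup_of_le_right ?_
    rw [mul_left_comm]
    refine Ideal.mul_mono_right ?_
    rw [pow_succ']
    exact Ideal.mul_mono_left le_sup_left

lemma exists_list_span_pow (x : ℕ → R) (r : ℕ) : ∀ n, ∃ l : List R, l.length = (n + r).choose r ∧
    (seqSub R x (r + 1) : Ideal R) ^ n = Ideal.span {g | g ∈ l} := by
  induction r with
  | zero =>
    intro n
    refine ⟨[x 0 ^ n], by simp, ?_⟩
    rw [seqSub_succ_span, seqSub_zero, bot_sup_eq, Ideal.span_singleton_pow]
    simp
  | succ r ih =>
    intro n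
    induction n with
    | zero => exact ⟨[1], by simp, by simp⟩
    | succ n ihn =>
      obtain ⟨l₁, h₁, h₁'⟩ := ih (n + 1)
      obtain ⟨l₂, h₂, h₂'⟩ := ihn
      refine ⟨l₁ ++ l₂.map (x (r + 1) * ·), ?_, ?_⟩
      · rw [List.length_append, List.length_map, h₁, h₂,
          show n + 1 + (r + 1) = (n + 1 + r) + 1 by ring, Nat.choose_succ_succ,
          show n + (r + 1) = n + 1 + r by ring]
      · rw [seqSub_succ_span, sup_span_pow_succ, ← seqSub_succ_span, h₁', h₂']
        have : Ideal.span {x (r + 1)} * Ideal.span {g | g ∈ l₂} = Ideal.span {g | g ∈ l₂.map (x (r + 1) * ·)} := by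
          rw [Ideal.span_mul_span']
          congr 1
          ext; simp
        rw [this, ← Ideal.span_union]
        congr 1
        ext; simp

end Growth

end

noncomputable section

section HilbertSamuel

/-- The function is eventually a combination of the binomials `C(n + i, i)`, `i < r`. -/
def EvBin (r : ℕ) (f : ℕ → ℤ) : Prop :=
  ∃ (c : ℕ → ℤ) (N : ℕ), ∀ n ≥ N, f n = ∑ i ∈ Finset.range r, c i * ((n + i).choose i : ℤ)

lemma sum_choose_shift_succ (r : ℕ) (c : ℕ → ℤ) (n : ℕ) :
    ∑ i ∈ Finset.range (r + 1), c i * ((n + i).choose i : ℤ) =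
      ∑ i ∈ Finset.range r, (c i - c (i + 1)) * ((n + 1 + i).choose i : ℤ) + c r * ((n + 1 + r).choose r : ℤ) := by
  induction r with
  | zero => simp
  | succ r ih =>
    rw [Finset.sum_range_succ, ih, Finset.sum_range_succ]
    have e : (((n + 1 + (r + 1)).choose (r + 1) : ℕ) : ℤ) = (n + 1 + r).choose r + (n + (r + 1)).choose (r + 1) := by
      rw [show n + 1 + (r + 1) = (n + 1 + r) + 1 by ring, Nat.choose_succ_succ,
        show n + (r + 1) = n + 1 + r by ring]
      push_cast; ring
    rw [e]
    ring

lemma sum_choose_shift (r : ℕ) (c : ℕ → ℤ) : ∃ c' : ℕ → ℤ, ∀ n : ℕ,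
    ∑ i ∈ Finset.range r, c i * ((n + i).choose i : ℤ) = ∑ i ∈ Finset.range r, c' i * ((n + 1 + i).choose i : ℤ) := by
  cases r with
  | zero => exact ⟨0, by simp⟩
  | succ r =>
    refine ⟨fun i => if i = r then c r else c i - c (i + 1), fun n => ?_⟩
    rw [sum_choose_shift_succ, Finset.sum_range_succ]
    simp only [if_true]
    congr 1
    refine Finset.sum_congr rfl fun i hi => ?_
    rw [if_neg (by have := Finset.mem_range.1 hi; omega)]

lemma EvBin.antidiff {r : ℕ} {f g : ℕ → ℤ} (hg : ∃ (c : ℕ → ℤ) (N : ℕ), ∀ n ≥ N, g n = ∑ i ∈ Finset.range r, c i * ((n + 1 + i).choose i : ℤ))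
    (hf : ∀ n, f (n + 1) = f n + g n) : EvBin (r + 1) f := by
  obtain ⟨c, N, hc⟩ := hg
  obtain ⟨K, hK⟩ : ∃ K : ℤ, K = f N - ∑ i ∈ Finset.range r, c i * ((N + (i + 1)).choose (i + 1) : ℤ) := ⟨_, rfl⟩
  refine ⟨fun i => if i = 0 then K else c (i - 1), N, fun n hn => ?_⟩
  rw [Finset.sum_range_succ']
  simp only [if_true, Nat.add_eq_zero_iff, one_ne_zero, and_false, if_false, Nat.add_sub_cancel, add_zero, Nat.choose_zero_right, Nat.cast_one, mul_one]
  induction n, hn using Nat.le_induction with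
  | base => rw [hK]; ring
  | succ n hn ih =>
    rw [hf, ih, hc n hn, add_right_comm, ← Finset.sum_add_distrib]
    congr 1
    refine Finset.sum_congr rfl fun i _ => ?_
    rw [← mul_add]
    congr 1
    rw [show n + 1 + (i + 1) = (n + 1 + i) + 1 by ring, Nat.choose_succ_succ, show n + (i + 1) = n + 1 + i by ring]
    push_cast; ring

variable {R : Type u} [CommRing R] {M : Type u} [AddCommGroup M] [Module R M]

lemma mem_smul_seqSub_succ [IsLocalRing R] [IsNoetherianRing R] (x : ℕ → R) (r : ℕ) (N : Submodule R M) :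
    seqSub R x (r + 1) • N = seqSub R x r • N ⊔ N.map (mulM M (x r)) := by
  rw [seqSub_succ_span, Submodule.sup_smul]
  congr 1
  ext m
  simp only [Submodule.mem_map]
  constructor
  · intro h
    refine Submodule.smul_induction_on h (fun a ha n hn => ?_) (fun a b ha hb => ?_)
    · obtain ⟨c, rfl⟩ := Ideal.mem_span_singleton'.1 ha
      exact ⟨c • n, N.smul_mem _ hn, by rw [mulM]; simp [LinearMap.lsmul_apply, smul_smul]⟩
    · obtain ⟨a', ha', rfl⟩ := ha
      obtain ⟨b', hb', rfl⟩ := hb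
      exact ⟨a' + b', N.add_mem ha' hb', map_add _ _ _⟩
  · rintro ⟨n, hn, rfl⟩
    exact Submodule.smul_mem_smul (Ideal.mem_span_singleton_self _) hn

lemma evBin_cl_sub [IsLocalRing R] [IsNoetherianRing R] (x : ℕ → R) (r : ℕ) : ∀ J L : ℕ → Submodule R M, (∀ n, L n ≤ J n) → (∀ n, FC (L n)) →
    (∀ n, ∀ i < r, ∀ m ∈ J n, x i • m ∈ J (n + 1)) → (∀ n, ∀ i < r, ∀ m ∈ L n, x i • m ∈ L (n + 1)) →
    (∀ N : ℕ → Submodule R M, (∀ n, L n ≤ N n) → (∀ n, N n ≤ J n) → (∀ n, ∀ i < r, ∀ m ∈ N n, x i • m ∈ N (n + 1)) →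
      ∃ n₀, ∀ n ≥ n₀, N (n + 1) ≤ L (n + 1) ⊔ seqSub R x r • N n) →
    EvBin r (fun n => (cl (L n) : ℤ) - cl (J n)) := by
  induction r with
  | zero =>
    intro J L hLJ hL hJx hLx hc
    obtain ⟨n₀, hn₀⟩ := hc J hLJ (fun _ => le_rfl) hJx
    refine ⟨0, n₀ + 1, fun n hn => ?_⟩
    obtain ⟨n, rfl⟩ : ∃ k, n = k + 1 := ⟨n - 1, by omega⟩
    have h1 := hn₀ n (by omega)
    rw [seqSub_zero, Submodule.bot_smul, sup_bot_eq] at h1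
    simp only [Finset.range_zero, Finset.sum_empty]
    rw [le_antisymm h1 (hLJ (n + 1)), sub_self]
  | succ r ih =>
    intro J L hLJ hL hJx hLx hc
    have hJ : ∀ n, FC (J n) := fun n => (hL n).mono (hLJ n)
    have hr : ∀ (N : ℕ → Submodule R M) n, ∀ m ∈ seqSub R x (r + 1) • N n, m ∈ seqSub R x r • N n ⊔ (N n).map (mulM M (x r)) := by
      intro N n m hm
      rwa [mem_smul_seqSub_succ] at hm
    let K : ℕ → Submodule R M := fun n => J n ⊓ (L (n + 1)).comap (mulM M (x r))
    let L' : ℕ → Submodule R M := fun n => Nat.casesOn n (L 0) (fun n => L (n + 1) ⊔ (J n).map (mulM M (x r)))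
    have hLL' : ∀ n, L n ≤ L' n := by
      rintro (_ | n)
      · exact le_rfl
      · exact le_sup_left
    have hL'J : ∀ n, L' n ≤ J n := by
      rintro (_ | n)
      · exact hLJ 0
      · refine sup_le (hLJ _) ?_
        rintro _ ⟨m, hm, rfl⟩
        exact hJx n r (by omega) m hm
    have h1 := ih K L (fun n m (hm : m ∈ L n) => ⟨hLJ n hm, hLx n r (by omega) m hm⟩) hL
      (fun n i hi m hm => ⟨hJx n i (by omega) m hm.1, by
        have : mulM M (x r) (x i • m) = x i • mulM M (x r) m := map_smul _ _ _
        show mulM M (x r) (x i • m) ∈ L (n + 1 + 1)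
        rw [this]
        exact hLx (n + 1) i (by omega) _ hm.2⟩)
      (fun n i hi => hLx n i (by omega))
      (fun N hLN hNK hNx => by
        have hrN : ∀ n, ∀ m ∈ N n, x r • m ∈ L (n + 1) := fun n m hm => (hNK n hm).2
        obtain ⟨n₀, hn₀⟩ := hc N hLN (fun n m hm => (hNK n hm).1) (fun n i hi m hm => by
          rcases Nat.lt_succ_iff_lt_or_eq.1 hi with hi | rfl
          · exact hNx n i hi m hm
          · exact hLN _ (hrN n m hm))
        refine ⟨n₀, fun n hn => (hn₀ n hn).trans (sup_le le_sup_left ?_)⟩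
        rw [mem_smul_seqSub_succ]
        refine sup_le le_sup_right (le_trans ?_ (le_sup_left : L (n + 1) ≤ _))
        rintro _ ⟨m, hm, rfl⟩
        exact hrN n m hm)
    have h2 := ih J L' hL'J (fun n => (hL n).mono (hLL' n)) (fun n i hi => hJx n i (by omega))
      (fun n i hi m hm => by
        rcases n with _ | n
        · exact hLL' 1 (hLx 0 i (by omega) m hm)
        · obtain ⟨a, ha, b, hb, rfl⟩ := Submodule.mem_sup.1 hm
          obtain ⟨b, hb, rfl⟩ := hb
          rw [smul_add]
          refine Submodule.add_mem_sup (hLx _ i (by omega) a ha) ⟨x i • b, hJx n i (by omega) b hb, map_smul _ _ _⟩)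
      (fun N hLN hNJ hNx => by
        obtain ⟨n₀, hn₀⟩ := hc N (fun n => (hLL' n).trans (hLN n)) hNJ (fun n i hi m hm => by
          rcases Nat.lt_succ_iff_lt_or_eq.1 hi with hi | rfl
          · exact hNx n i hi m hm
          · exact hLN (n + 1) (Submodule.mem_sup_right ⟨m, hNJ n hm, rfl⟩))
        refine ⟨n₀, fun n hn => (hn₀ n hn).trans (sup_le ((hLL' _).trans le_sup_left) ?_)⟩
        rw [mem_smul_seqSub_succ]
        refine sup_le le_sup_right (le_trans ?_ le_sup_left)
        exact le_trans (Submodule.map_mono (hNJ n)) le_sup_right)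
    obtain ⟨c1, N1, h1⟩ := h1
    obtain ⟨c2, N2, h2⟩ := h2
    obtain ⟨c1', hc1⟩ := sum_choose_shift r c1
    refine EvBin.antidiff (g := fun n => ((cl (L' (n + 1)) : ℤ) - cl (J (n + 1))) - (cl (L n) - cl (K n)))
      ⟨fun i => c2 i - c1' i, max N1 N2, fun n hn => ?_⟩ (fun n => ?_)
    · have := h2 (n + 1) (le_trans (le_trans (le_max_right _ _) hn) (by omega))
      have h3 := h1 n (le_trans (le_max_left _ _) hn)
      simp only at this h3 ⊢
      rw [this, h3, hc1, ← Finset.sum_sub_distrib]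
      exact Finset.sum_congr rfl fun i _ => by ring
    · have := cl_map (hL (n + 1)) (mulM M (x r)) (hJ n)
      have e1 : K n = J n ⊓ (L (n + 1)).comap (mulM M (x r)) := rfl
      have e2 : L' (n + 1) = L (n + 1) ⊔ (J n).map (mulM M (x r)) := rfl
      rw [e1, e2]
      zify at this
      linarith

/-- Existence of the Hilbert coefficients of an ideal integral over a parameter ideal. -/
lemma exists_HP [IsLocalRing R] [IsNoetherianRing R] (x : ℕ → R) (d : ℕ) (I : Ideal R)
    (hq : FC (seqSub R x d)) (hqI : seqSub R x d ≤ I) (hI : ∀ n, I ^ (n + 1) ≤ seqSub R x d ^ n) :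
    ∃ e : ℕ → ℤ, ∃ N, ∀ n ≥ N, (cl (I ^ (n + 1)) : ℤ) = HP d e n := by
  have hF : ∀ n, FC (I ^ n : Ideal R) := fun n => by
    obtain ⟨k, hk⟩ := hq.exists_pow
    have h1 : maximalIdeal R ^ k ≤ I := fun r hr => hqI (by simpa using hk r hr 1)
    refine FC_of_pow (k := k * n) fun r hr m => Ideal.mul_mem_right _ _ ?_
    rw [pow_mul] at hr
    exact Ideal.pow_right_mono h1 n hr
  have hx : ∀ i < d, x i ∈ I := fun i hi => hqI (mem_seqSub_self hi)
  have h1 := evBin_cl_sub x d (fun n => I ^ n) (fun n => I ^ (n + 1)) (fun n => Ideal.pow_le_pow_right (by omega))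
    (fun n => hF _) (fun n i hi m hm => by rw [pow_succ']; exact Ideal.mul_mem_mul (hx i hi) hm)
    (fun n i hi m hm => by rw [pow_succ' I (n + 1)]; exact Ideal.mul_mem_mul (hx i hi) hm)
    (fun N hLN hNJ hNx => by
      obtain ⟨F', hF'⟩ : ∃ F' : Ideal.Filtration (seqSub R x d) R, F'.N = N := by
        refine ⟨⟨N, fun n => ?_, fun n => ?_⟩, rfl⟩
        · exact (hNJ (n + 1)).trans (hLN n)
        · refine Submodule.smul_le.2 fun a ha m hm => ?_
          rw [seqSub_eq] at ha
          have ha' : a ∈ Ideal.span (x '' {j | j < d}) := by simpa using ha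
          refine Submodule.span_induction (p := fun a _ => a • m ∈ N (n + 1)) ?_ ?_ ?_ ?_ ha'
          · rintro _ ⟨j, hj, rfl⟩
            exact hNx n j hj m hm
          · simp
          · intro a b _ _ h h'
            rw [add_smul]; exact add_mem h h'
          · intro c a _ h
            rw [smul_assoc]; exact (N (n + 1)).smul_mem c h
      let F : Ideal.Filtration (seqSub R x d) R := ⟨fun n => seqSub R x d ^ (n - 1), fun n => Ideal.pow_le_pow_right (by omega), fun n => by
        rw [smul_eq_mul, ← pow_succ']
        exact Ideal.pow_le_pow_right (by omega)⟩
      have hFs : F.Stable := ⟨1, fun n hn => by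
        show seqSub R x d • seqSub R x d ^ (n - 1) = seqSub R x d ^ (n + 1 - 1)
        rw [smul_eq_mul, ← pow_succ', Nat.sub_add_cancel hn, Nat.add_sub_cancel]⟩
      obtain ⟨n₀, hn₀⟩ := hFs.of_le (F' := F') (fun n => by
        show F'.N n ≤ seqSub R x d ^ (n - 1)
        rw [hF']
        rcases n with _ | n
        · simp
        · exact (hNJ _).trans (hI n))
      refine ⟨n₀, fun n hn => ?_⟩
      have := hn₀ n hn
      rw [hF'] at this
      rw [this]
      exact le_sup_right)
  obtain ⟨c0, N0, h1⟩ := h1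
  have h2 : EvBin (d + 1) (fun n => (cl (I ^ (n + 1)) : ℤ)) := EvBin.antidiff
    (g := fun n => (cl (I ^ (n + 1 + 1)) : ℤ) - cl (I ^ (n + 1)))
    ⟨c0, N0, fun n hn => h1 (n + 1) (by omega)⟩ (fun n => (add_sub_cancel _ _).symm)
  obtain ⟨c, N1, hc⟩ := h2
  refine ⟨fun i => (-1) ^ i * c (d - i), N1, fun n hn => ?_⟩
  have := hc n hn
  simp only at this
  rw [this, HP, ← Finset.sum_range_reflect]
  refine Finset.sum_congr rfl fun i hi => ?_
  have hi := Finset.mem_range.1 hi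
  have e : d + 1 - 1 - i = d - i := by omega
  rw [e, ← mul_assoc ((-1 : ℤ) ^ i), ← pow_add, ← two_mul, pow_mul]
  rw [show n + (d - i) = n + d - i by omega]
  simp

end HilbertSamuel

end

noncomputable section

section Reduction
variable {R : Type u} [CommRing R] [IsLocalRing R] [IsNoetherianRing R]
local notation "𝔪" => maximalIdeal R

lemma mem_seqSub_iff_sum {M : Type u} [AddCommGroup M] [Module R M] {x : ℕ → R} {n : ℕ} {m : M} :
    m ∈ seqSub M x n ↔ ∃ a : ℕ → M, m = ∑ j ∈ Finset.range n, x j • a j := by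
  constructor
  · induction n generalizing m with
    | zero => intro h; exact ⟨0, by simpa using (show m = 0 from h)⟩
    | succ n ih =>
      intro h
      obtain ⟨b, hb, c, rfl⟩ := mem_seqSub_succ.1 h
      obtain ⟨a, rfl⟩ := ih hb
      refine ⟨Function.update a n c, ?_⟩
      rw [Finset.sum_range_succ, Function.update_self]
      congr 1
      refine Finset.sum_congr rfl fun j hj => ?_
      rw [Function.update_of_ne (by have := Finset.mem_range.1 hj; omega)]
  · rintro ⟨a, rfl⟩
    exact Submodule.sum_mem _ fun j hj => smul_mem_seqSub (Finset.mem_range.1 hj) _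

lemma mk_mem_seqSub {M : Type u} [AddCommGroup M] [Module R M] (N : Submodule R M) (x : ℕ → R) (n : ℕ) (m : M) :
    N.mkQ m ∈ seqSub (M ⧸ N) x n ↔ m ∈ seqSub M x n ⊔ N := by
  rw [← seqSub_map N.mkQ N.mkQ_surjective, ← Submodule.mem_comap, Submodule.comap_map_mkQ, sup_comm]

/-- The properties of the unmixed component that are used. -/
structure UnmixedData (U : Ideal R) (d : ℕ) : Prop where
  dim : Dle (⊥ : Ideal R) d
  exists_top : ∃ P : PrimeSpectrum R, cd P = d
  le_top : ∀ P : PrimeSpectrum R, cd P = d → U ≤ P.asIdeal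
  ass : ∀ Q ∈ assSpec R (R ⧸ U), cd Q = d
  kill : ∀ P : PrimeSpectrum R, Module.annihilator R U ≤ P.asIdeal → cd P < d

lemma UnmixedData.not_Dle {U : Ideal R} {d : ℕ} (h : UnmixedData U d) {n : ℕ} (hn : n < d) : ¬ Dle U n := by
  intro hD
  obtain ⟨P, hP⟩ := h.exists_top
  have := hD P (h.le_top P hP)
  rw [hP] at this
  exact absurd (by exact_mod_cast this) (not_le.2 hn)

lemma PS.of_full {T : Ideal R} {d : ℕ} {x : ℕ → R} (hx : ∀ j < d, x j ∈ 𝔪) (h : Dle (T ⊔ seqSub R x d) 0) :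
    PS T d x d := ⟨hx, 0, by simp, h⟩

lemma PS.perm {T : Ideal R} {d : ℕ} {x y : ℕ → R} (h : PS T d x d) (hy : ∀ j < d, y j ∈ 𝔪)
    (hxy : ∀ j < d, ∃ i < d, y i = x j) : PS T d y d := by
  obtain ⟨h1, n', hn, h2⟩ := h
  obtain rfl : n' = 0 := by omega
  refine PS.of_full hy (h2.mono (sup_le_sup_left ?_ _) le_rfl)
  refine seqSub_le_ideal fun j hj => ?_
  obtain ⟨i, hi, e⟩ := hxy j hj
  rw [← e]
  exact mem_seqSub_self hi

lemma exists_mul_regular {U : Ideal R} {d : ℕ} (hd : 2 ≤ d) (hU : UnmixedData U d) {𝔞 : Ideal R}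
    (h𝔞 : ∀ P : PrimeSpectrum R, cd P = d → ¬ 𝔞 ≤ P.asIdeal) : ∃ w ∈ 𝔞 ⊓ 𝔪, ∀ s : R ⧸ U, w • s = 0 → s = 0 := by
  obtain ⟨w, hw, h⟩ := exists_avoid (I := 𝔞 ⊓ 𝔪) (assSpec_finite R (R ⧸ U)) (fun Q hQ hle => by
    have hQd := hU.ass Q hQ
    rcases Q.2.inf_le.1 hle with h | h
    · exact h𝔞 Q hQd h
    · have h0 : cd Q ≤ (0 : ℕ) := (Dle_zero_of_pow (n := 1) (by simpa using h)) Q le_rfl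
      rw [hQd] at h0
      have : d ≤ 0 := by exact_mod_cast h0
      omega)
  refine ⟨w, hw, fun s hs => ?_⟩
  by_contra hne
  obtain ⟨Q, hQ, hwQ⟩ := exists_ass_of_ne_zero hne hs
  exact h Q hQ hwQ

lemma exists_colon_le_sq (hres : IsHomImageOfCM R) {U : Ideal R} {d : ℕ} (hd : 2 ≤ d) (hdim : ringKrullDim R = d)
    (hU : UnmixedData U d) : ∃ t₀, 2 ≤ t₀ ∧ ∀ x : ℕ → R, PS ⊥ d x d → (∀ j < d, x j ∈ 𝔪 ^ t₀) →
      ∀ i < d, ∀ (r : R) (a : ℕ → R), r * x i = ∑ j ∈ (Finset.range d).erase i, a j * x j → r ∈ 𝔪 ^ 2 ⊔ U := by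
  have hUm : U ≤ 𝔪 := by
    obtain ⟨P, hP⟩ := hU.exists_top
    exact (hU.le_top P hP).trans (le_maximalIdeal P.2.ne_top)
  obtain ⟨𝔞, h𝔞⟩ := exists_killerData hres hUm (hU.dim.mono bot_le le_rfl) hdim le_rfl (R ⧸ U) (fun c hc m => by
    obtain ⟨r, rfl⟩ := Submodule.mkQ_surjective U m
    rw [← map_smul]
    exact (Submodule.Quotient.mk_eq_zero U).2 (U.mul_mem_right r hc))
  obtain ⟨w, hw, hreg⟩ := exists_mul_regular hd hU (𝔞 := 𝔞 ^ 3 ^ (d - 1)) (fun P hP hle =>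
    h𝔞.top P hP (P.2.le_of_pow_le hle))
  obtain ⟨s, hs⟩ := Ideal.exists_pow_inf_eq_pow_smul 𝔪 (LinearMap.range (mulM (R ⧸ U) w))
  refine ⟨s + 2, by omega, fun x hx hxm i hi r a hr => ?_⟩
  let y : ℕ → R := fun j => x (Equiv.swap i (d - 1) j)
  have hlt : ∀ j < d, Equiv.swap i (d - 1) j < d := fun j hj => by
    rw [Equiv.swap_apply_def]; split_ifs <;> omega
  have hy : PS U d y d := (hx.perm (fun j hj => hx.1 _ (hlt j hj)) fun j hj =>
    ⟨Equiv.swap i (d - 1) j, hlt j hj, by simp⟩).mono bot_le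
  have hyd : y (d - 1) = x i := by simp [y]
  obtain ⟨d', rfl⟩ : ∃ d', d = d' + 1 := ⟨d - 1, by omega⟩
  simp only [Nat.add_sub_cancel] at hyd hw hlt
  have hmem : r * x i ∈ seqSub R y d' := by
    rw [hr]
    refine Submodule.sum_mem _ fun j hj => ?_
    obtain ⟨hji, hj⟩ := Finset.mem_erase.1 hj
    have hj := Finset.mem_range.1 hj
    refine Ideal.mul_mem_left _ _ ?_
    by_cases hjd : j = d'
    · have : x j = y i := by simp [y, hjd]
      rw [this]
      exact mem_seqSub_self (by omega)
    · have : x j = y j := by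
        simp only [y, Nat.add_sub_cancel]
        rw [Equiv.swap_apply_of_ne_of_ne hji hjd]
      rw [this]
      exact mem_seqSub_self (by omega)
  have h1 := h𝔞.colon y d' hy w hw.1 (U.mkQ r) (by
    rw [← map_smul, mk_mem_seqSub, hyd, smul_eq_mul, mul_comm]
    exact Submodule.mem_sup_left hmem)
  have h2 : w • U.mkQ r ∈ 𝔪 ^ (s + 2) • (⊤ : Submodule R (R ⧸ U)) := by
    refine (seqSub_le (fun j hj m => ?_) : seqSub (R ⧸ U) y d' ≤ _) h1
    exact Submodule.smul_mem_smul (hxm _ (hlt j (by omega))) trivial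
  have h3 : w • U.mkQ r ∈ 𝔪 ^ (s + 2) • (⊤ : Submodule R (R ⧸ U)) ⊓ LinearMap.range (mulM (R ⧸ U) w) :=
    ⟨h2, U.mkQ r, rfl⟩
  rw [hs (s + 2) (by omega), Nat.add_sub_cancel_left] at h3
  have h4 : w • U.mkQ r ∈ 𝔪 ^ 2 • LinearMap.range (mulM (R ⧸ U) w) := Submodule.smul_mono le_rfl inf_le_right h3
  rw [← Submodule.map_top, ← Submodule.map_smul''] at h4
  obtain ⟨r', hr', e⟩ := h4
  have e' : w • (U.mkQ r - r') = 0 := by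
    rw [smul_sub, sub_eq_zero]; exact e.symm
  have := sub_eq_zero.1 (hreg _ e')
  rw [← this] at hr'
  have h5 : (𝔪 ^ 2 • (⊤ : Submodule R R)).map U.mkQ = 𝔪 ^ 2 • (⊤ : Submodule R (R ⧸ U)) := by
    rw [Submodule.map_smul'', Submodule.map_top, Submodule.range_mkQ]
  have h6 : r ∈ ((𝔪 ^ 2 • (⊤ : Submodule R R)).map U.mkQ).comap U.mkQ := by
    rw [h5]; exact hr'
  rw [Submodule.comap_map_mkQ, sup_comm] at h6
  simpa using h6

lemma mul_colon_le {U : Ideal R} {d : ℕ} (hd : 2 ≤ d) (hU : UnmixedData U d) (x : ℕ → R) (hUm : U ≤ 𝔪)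
    (hc : ∀ i < d, ∀ (r : R) (a : ℕ → R), r * x i = ∑ j ∈ (Finset.range d).erase i, a j * x j → r ∈ 𝔪 ^ 2 ⊔ U)
    (a : R) (ha : ∀ r ∈ 𝔪, r * a ∈ seqSub R x d) (r : R) (hr : r ∈ 𝔪) : r * a ∈ 𝔪 * seqSub R x d := by
  by_contra hne
  obtain ⟨b, hb⟩ := mem_seqSub_iff_sum.1 (ha r hr)
  obtain ⟨i, hi, hu⟩ : ∃ i < d, IsUnit (b i) := by
    by_contra! hcon
    refine hne ?_
    rw [hb]
    refine Submodule.sum_mem _ fun j hj => ?_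
    show x j * b j ∈ _
    rw [mul_comm (x j)]
    exact Ideal.mul_mem_mul ((mem_maximalIdeal _).2 (hcon j (Finset.mem_range.1 hj))) (mem_seqSub_self (Finset.mem_range.1 hj))
  have key : 𝔪 ≤ (Ideal.span {r} ⊔ U) ⊔ 𝔪 • 𝔪 := by
    intro r' hr'
    obtain ⟨c, hc'⟩ := mem_seqSub_iff_sum.1 (ha r' hr')
    have h1 : (r * c i - r' * b i) * x i = ∑ j ∈ (Finset.range d).erase i, (-(r * c j - r' * b j)) * x j := by
      have e : ∑ j ∈ Finset.range d, (r * c j - r' * b j) * x j = 0 := by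
        have : r * (r' * a) - r' * (r * a) = 0 := by ring
        rw [hb, hc', Finset.mul_sum, Finset.mul_sum, ← Finset.sum_sub_distrib] at this
        rw [← this]
        exact Finset.sum_congr rfl fun j _ => by simp only [smul_eq_mul]; ring
      rw [← Finset.add_sum_erase _ _ (Finset.mem_range.2 hi)] at e
      rw [eq_neg_of_add_eq_zero_left e, ← Finset.sum_neg_distrib]
      exact Finset.sum_congr rfl fun j _ => by ring
    have h2 := hc i hi _ _ h1
    obtain ⟨v, hv⟩ := hu
    have h3 : r' * b i ∈ (Ideal.span {r} ⊔ U) ⊔ 𝔪 • 𝔪 := by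
      have e : r' * b i = r * c i - (r * c i - r' * b i) := by ring
      rw [e]
      refine sub_mem (Submodule.mem_sup_left (Submodule.mem_sup_left (Ideal.mul_mem_right _ _ (Ideal.mem_span_singleton_self r)))) ?_
      refine (?_ : 𝔪 ^ 2 ⊔ U ≤ _) h2
      rw [pow_two]
      exact sup_le le_sup_right (le_sup_right.trans le_sup_left)
    have e : r' = (r' * b i) * (↑v⁻¹ : R) := by rw [← hv, mul_assoc, Units.mul_inv, mul_one]
    rw [e]
    exact Ideal.mul_mem_right _ _ h3
  have h4 : 𝔪 ≤ Ideal.span {r} ⊔ U :=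
    Submodule.le_of_le_smul_of_le_jacobson_bot (IsNoetherian.noetherian _) (IsLocalRing.maximalIdeal_le_jacobson _) key
  refine hU.not_Dle (n := 1) (by omega) (Dle_of_sup_span hr ?_)
  rw [sup_comm]
  exact Dle_zero_of_pow (n := 1) (by simpa using h4)

/-- For a parameter ideal `q` deep inside, the powers of `I = q : m` are close to those of `q`. -/
lemma colonIdeal_pow {U : Ideal R} {d : ℕ} (hd : 2 ≤ d) (hU : UnmixedData U d) (q : Ideal R) (hq2 : q ≤ 𝔪 ^ 2)
    (h : ∀ a : R, (∀ r ∈ 𝔪, r * a ∈ q) → ∀ r ∈ 𝔪, r * a ∈ 𝔪 * q) :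
    q ≤ colonIdeal R q ∧ (∀ n, colonIdeal R q ^ (n + 1) ≤ q ^ n) ∧ ∀ n, 𝔪 * colonIdeal R q ^ (n + 1) ≤ q ^ (n + 1) := by
  have hI : ∀ a, a ∈ colonIdeal R q ↔ ∀ r ∈ 𝔪, r * a ∈ q := fun a => Iff.rfl
  have hIm : colonIdeal R q ≤ 𝔪 := by
    by_contra hcon
    have htop : colonIdeal R q = ⊤ := by
      by_contra h'; exact hcon (le_maximalIdeal h')
    have h1 : 𝔪 ≤ 𝔪 • 𝔪 := by
      intro r hr
      have := (hI 1).1 (htop ▸ trivial) r hr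
      rw [mul_one] at this
      have := hq2 this
      rwa [pow_two] at this
    have h2 : 𝔪 = ⊥ := Submodule.eq_bot_of_le_smul_of_le_jacobson_bot _ _ (IsNoetherian.noetherian _) h1
      (IsLocalRing.maximalIdeal_le_jacobson _)
    exact hU.not_Dle (n := 0) (by omega) (Dle_zero_of_pow (n := 1) (by rw [pow_one, h2]; exact bot_le))
  have h1 : 𝔪 * colonIdeal R q ≤ 𝔪 * q := Ideal.mul_le.2 fun r hr a ha => h a ((hI a).1 ha) r hr
  have h2 : ∀ n, 𝔪 * colonIdeal R q ^ n ≤ 𝔪 * q ^ n := by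
    intro n
    induction n with
    | zero => simp
    | succ n ih =>
      calc 𝔪 * colonIdeal R q ^ (n + 1) = (𝔪 * colonIdeal R q ^ n) * colonIdeal R q := by rw [pow_succ, mul_assoc]
        _ ≤ (𝔪 * q ^ n) * colonIdeal R q := Ideal.mul_mono_left ih
        _ = q ^ n * (𝔪 * colonIdeal R q) := by ring
        _ ≤ q ^ n * (𝔪 * q) := Ideal.mul_mono_right h1
        _ = 𝔪 * q ^ (n + 1) := by ring
  refine ⟨fun a ha => (hI a).2 fun r _ => q.mul_mem_left r ha, fun n => ?_, fun n => (h2 _).trans Ideal.mul_le_right⟩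
  calc colonIdeal R q ^ (n + 1) = colonIdeal R q * colonIdeal R q ^ n := pow_succ' _ _
    _ ≤ 𝔪 * colonIdeal R q ^ n := Ideal.mul_mono_left hIm
    _ ≤ 𝔪 * q ^ n := h2 n
    _ ≤ q ^ n := Ideal.mul_le_right

lemma exists_colonIdeal_pow (hres : IsHomImageOfCM R) {U : Ideal R} {d : ℕ} (hd : 2 ≤ d) (hdim : ringKrullDim R = d)
    (hU : UnmixedData U d) : ∃ t₀, 2 ≤ t₀ ∧ ∀ x : ℕ → R, PS ⊥ d x d → (∀ j < d, x j ∈ 𝔪 ^ t₀) →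
      seqSub R x d ≤ colonIdeal R (seqSub R x d) ∧ (∀ n, colonIdeal R (seqSub R x d) ^ (n + 1) ≤ seqSub R x d ^ n) ∧
      ∀ n, 𝔪 * colonIdeal R (seqSub R x d) ^ (n + 1) ≤ seqSub R x d ^ (n + 1) := by
  obtain ⟨t₀, ht, h⟩ := exists_colon_le_sq hres hd hdim hU
  have hUm : U ≤ 𝔪 := by
    obtain ⟨P, hP⟩ := hU.exists_top
    exact (hU.le_top P hP).trans (le_maximalIdeal P.2.ne_top)
  refine ⟨t₀, ht, fun x hx hxm => colonIdeal_pow hd hU _ ?_ (mul_colon_le hd hU x hUm (h x hx hxm))⟩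
  exact seqSub_le_ideal fun j hj => Ideal.pow_le_pow_right ht (hxm j hj)

end Reduction

end

noncomputable section

section Socle
variable {R : Type u} [CommRing R] [IsLocalRing R] [IsNoetherianRing R] (M : Type u) [AddCommGroup M] [Module R M]
local notation "𝔪" => maximalIdeal R

lemma le_modColon {N : Submodule R M} : N ≤ modColon R N 𝔪 := fun _ hm r _ => N.smul_mem r hm

/-- The elements of `q ^ n M + N_i` carried by the maximal ideal into `q ^ (n + 1) M + N_i`. -/
def socZ (x : ℕ → R) (d i n : ℕ) : Submodule R M :=
  (powSub M x d n ⊔ seqSub M x i) ⊓ modColon R (powSub M x d (n + 1) ⊔ seqSub M x i) 𝔪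

variable {M}

lemma le_socZ (x : ℕ → R) (d i n : ℕ) : powSub M x d (n + 1) ⊔ seqSub M x i ≤ socZ M x d i n :=
  le_inf (sup_le_sup_right (powSub_anti x d (by omega)) _) (le_modColon M)

lemma socZ_mono (x : ℕ → R) (d i n : ℕ) : socZ M x d i n ≤ socZ M x d (i + 1) n :=
  le_inf (inf_le_left.trans (sup_le_sup_left (seqSub_le_succ M x i) _))
    (inf_le_right.trans fun _ hm r hr => sup_le_sup_left (seqSub_le_succ M x i) _ (hm r hr))

variable [Module.Finite R M] {x : ℕ → R} {d : ℕ} (h : DSeq M x d) (hq : FC (seqSub R x d : Ideal R))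
include h hq

lemma DSeq.socZ_step {i : ℕ} (hi : i < d) (n : ℕ) :
    cl (powSub M x d (n + 2) ⊔ seqSub M x i) + cl (socZ M x d (i + 1) (n + 1)) +
      cl ((powSub M x d n ⊓ modColon R (powSub M x d (n + 1) ⊔ colSub M x i) 𝔪) ⊔ (powSub M x d (n + 1) ⊔ colSub M x i)) ≤
    cl (socZ M x d i (n + 1)) + cl (powSub M x d (n + 2) ⊔ seqSub M x (i + 1)) + cl (powSub M x d (n + 1) ⊔ colSub M x i) := by
  have hF := fun n => FC_powSub (M := M) hq n
  set A := powSub M x d (n + 2) ⊔ seqSub M x i with hA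
  set A' := powSub M x d (n + 2) ⊔ seqSub M x (i + 1) with hA'
  set D := powSub M x d (n + 1) ⊔ colSub M x i with hD
  set Y := powSub M x d n ⊓ modColon R D 𝔪 with hY
  have hFA : FC A := (hF _).mono le_sup_left
  have hFA' : FC A' := (hF _).mono le_sup_left
  have hFD : FC D := (hF _).mono le_sup_left
  have hFY : FC Y := (hF n).inf (hFD.mono (le_modColon M))
  have hFZ : FC (socZ M x d i (n + 1)) := hFA.mono (le_socZ x d i (n + 1))
  have hcol : A.comap (mulM M (x i)) = D := h.colon_eq (n := n + 1) hi
  have h1 := cl_modular hFZ hFA'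
  have h2 : cl (socZ M x d (i + 1) (n + 1)) ≤ cl (socZ M x d i (n + 1) ⊔ A') :=
    cl_mono (hFZ.mono le_sup_left) (sup_le (socZ_mono x d i (n + 1)) (le_socZ x d (i + 1) (n + 1)))
  have h3 : socZ M x d i (n + 1) ⊓ A' ≤ A ⊔ Y.map (mulM M (x i)) := by
    rintro z ⟨⟨hz1, hz2⟩, hz3⟩
    have hz3' : z ∈ A ⊔ LinearMap.range (mulM M (x i)) := by
      rw [hA, powSub_sup_range]; exact hz3
    obtain ⟨a, ha, _, ⟨m, rfl⟩, rfl⟩ := Submodule.mem_sup.1 hz3'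
    have hm : m ∈ powSub M x d n ⊔ colSub M x i := by
      refine h.colon hi ?_
      have hle : A ≤ powSub M x d (n + 1) ⊔ seqSub M x i :=
        sup_le_sup_right (powSub_anti (M := M) x d (show n + 1 ≤ n + 2 by omega)) _
      have ha' := hle ha
      simpa using sub_mem hz1 ha'
    obtain ⟨y, hy, c, hc, rfl⟩ := Submodule.mem_sup.1 hm
    have hcA : x i • c ∈ A := Submodule.mem_sup_right hc
    refine add_mem (Submodule.mem_sup_left ha) ?_
    have hyY : y ∈ Y := by
      refine ⟨hy, fun r hr => ?_⟩
      rw [← hcol]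
      show x i • r • y ∈ A
      have h4 : r • (a + x i • (y + c)) ∈ A := hz2 r hr
      have h5 : x i • r • y = r • (a + x i • (y + c)) - r • a - r • x i • c := by
        simp only [smul_add, smul_comm r (x i)]; abel
      rw [h5]
      exact sub_mem (sub_mem h4 (A.smul_mem r ha)) (A.smul_mem r hcA)
    show x i • (y + c) ∈ _
    rw [smul_add]
    exact add_mem (Submodule.mem_sup_right (Submodule.mem_map_of_mem hyY)) (Submodule.mem_sup_left hcA)
  have h4 := cl_mono (hFZ.inf hFA') h3
  have h5 := cl_map hFA (mulM M (x i)) hFY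
  rw [hcol] at h5
  have h6 := cl_modular hFY hFD
  omega

lemma DSeq.socZ_drop {i : ℕ} (hi : i < d) (n : ℕ) :
    cl (powSub M x d (n + 2) ⊔ colSub M x i) + cl (socZ M x d i (n + 1)) ≤
      cl (powSub M x d (n + 2) ⊔ seqSub M x i) +
      cl ((powSub M x d (n + 1) ⊓ modColon R (powSub M x d (n + 2) ⊔ colSub M x i) 𝔪) ⊔ (powSub M x d (n + 2) ⊔ colSub M x i)) := by
  have hF := fun n => FC_powSub (M := M) hq n
  set A := powSub M x d (n + 2) ⊔ seqSub M x i with hA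
  set D := powSub M x d (n + 2) ⊔ colSub M x i with hD
  set Y := powSub M x d (n + 1) ⊓ modColon R D 𝔪 with hY
  have hFA : FC A := (hF _).mono le_sup_left
  have hFD : FC D := (hF _).mono le_sup_left
  have hAD : A ≤ D := sup_le_sup_left (seqSub_le_colSub i) _
  have hYZ : Y ≤ socZ M x d i (n + 1) := by
    rintro y ⟨hy, hy'⟩
    refine ⟨Submodule.mem_sup_left hy, fun r hr => ?_⟩
    rw [← h.inf_eq (n := n + 1) hi]
    exact ⟨powSub_anti x d (by omega) (Submodule.smul_mem _ r hy), hy' r hr⟩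
  have h1 := cl_modular hFD (hFA.mono (le_sup_right : A ≤ Y ⊔ A))
  have h2 : cl (D ⊓ (Y ⊔ A)) ≤ cl A := cl_mono hFA (le_inf hAD le_sup_right)
  have h3 : cl (socZ M x d i (n + 1)) ≤ cl (Y ⊔ A) :=
    cl_mono (hFA.mono le_sup_right) (sup_le hYZ (le_socZ x d i (n + 1)))
  have h4 : D ⊔ (Y ⊔ A) = Y ⊔ D := by
    rw [sup_left_comm, sup_eq_left.2 hAD]
  rw [h4] at h1
  omega

theorem DSeq.cl_le_socZ {σ : ℕ} (hσ : ∀ i < d, cl (powSub M x d 1 ⊔ colSub M x i) ≤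
      cl (modColon R (powSub M x d 1 ⊔ colSub M x i) 𝔪) + σ) (r : ℕ) : ∀ (i n : ℕ), i + (r + 1) = d →
    cl (powSub M x d (n + 2) ⊔ seqSub M x i) ≤ cl (socZ M x d i (n + 1)) + σ * (n + 1 + r).choose r := by
  have hF := fun n => FC_powSub (M := M) hq n
  have key : ∀ (i : ℕ), i < d → ∀ β : ℕ → ℕ,
      (∀ n, cl (powSub M x d (n + 2) ⊔ seqSub M x (i + 1)) ≤ cl (socZ M x d (i + 1) (n + 1)) + β n) → ∀ n,
      cl (powSub M x d (n + 2) ⊔ seqSub M x i) ≤ cl (socZ M x d i (n + 1)) + (σ + ∑ j ∈ Finset.range (n + 1), β j) := by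
    intro i hi β hβ n
    have hs := fun n => h.socZ_step hq hi n
    induction n with
    | zero =>
      have h0 := hs 0
      have h1 := hβ 0
      have h2 := hσ i hi
      have h3 : cl (modColon R (powSub M x d 1 ⊔ colSub M x i) 𝔪) ≤ 
          cl ((powSub M x d 0 ⊓ modColon R (powSub M x d 1 ⊔ colSub M x i) 𝔪) ⊔ (powSub M x d 1 ⊔ colSub M x i)) := by
        refine cl_mono ((hF 1).mono (le_sup_left.trans le_sup_right)) (sup_le inf_le_right (le_modColon M))
      simp only [Finset.sum_range_succ, Finset.sum_range_zero, zero_add] at *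
      omega
    | succ n ih =>
      have h0 := hs (n + 1)
      have h1 := hβ (n + 1)
      have h2 := h.socZ_drop hq hi n
      rw [Finset.sum_range_succ]
      simp only [show n + 1 + 2 = n + 3 by omega, show n + 1 + 1 = n + 2 by omega] at *
      omega
  induction r with
  | zero =>
    intro i n hin
    have := key i (by omega) (fun _ => 0) (fun n => by
      have hid : i + 1 = d := by omega
      rw [hid]
      refine cl_mono ((hF (n + 2)).mono (le_sup_left.trans (le_socZ x d d (n + 1)))) ?_
      refine inf_le_left.trans (sup_le ?_ le_sup_right)
      rw [← powSub_one (M := M) x d]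
      exact (powSub_anti x d (by omega)).trans le_sup_right) n
    simpa using this
  | succ r ih =>
    intro i n hin
    have := key i (by omega) (fun n => σ * (n + 1 + r).choose r) (fun n => ih (i + 1) n (by omega)) n
    have hc : ∀ n, σ + ∑ j ∈ Finset.range (n + 1), σ * (j + 1 + r).choose r = σ * (n + 1 + (r + 1)).choose (r + 1) := by
      intro n
      induction n with
      | zero =>
        have : (0 + 1 + (r + 1)).choose (r + 1) = (0 + 1 + r).choose r + 1 := by
          rw [show 0 + 1 + (r + 1) = (0 + 1 + r) + 1 by omega, Nat.choose_succ_succ]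
          simp [show 0 + 1 + r = r + 1 by omega]
        simp only [Finset.sum_range_succ, Finset.sum_range_zero]
        rw [this]; ring
      | succ n ihn =>
        rw [Finset.sum_range_succ, ← add_assoc, ihn, show n + 1 + 1 + (r + 1) = (n + 1 + (r + 1)) + 1 by omega,
          Nat.choose_succ_succ, show n + 1 + (r + 1) = n + 1 + 1 + r by omega]
        ring
    rw [hc] at this
    exact this

end Socle

end

noncomputable section

section Lengths
variable {R : Type u} [CommRing R]

lemma length_le_add_of_exact {A B C : Type*} [AddCommGroup A] [Module R A] [AddCommGroup B] [Module R B]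
    [AddCommGroup C] [Module R C] (f : A →ₗ[R] B) (g : B →ₗ[R] C) (h : ∀ b, g b = 0 → ∃ a, f a = b) :
    Module.length R B ≤ Module.length R A + Module.length R C := by
  rw [Module.length_eq_add_of_exact (LinearMap.ker g).subtype g.rangeRestrict (Submodule.subtype_injective _)
    (LinearMap.surjective_rangeRestrict _) (by
      intro b
      rw [Set.mem_range]
      constructor
      · intro hb; exact ⟨⟨b, congrArg Subtype.val hb⟩, rfl⟩
      · rintro ⟨⟨b, hb⟩, rfl⟩; exact Subtype.ext hb)]
  refine add_le_add ?_ (Module.length_le_of_injective (LinearMap.range g).subtype (Submodule.subtype_injective _))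
  calc Module.length R (LinearMap.ker g) ≤ Module.length R (LinearMap.range f) :=
        Module.length_le_of_injective (Submodule.inclusion (fun b hb => h b hb)) (Submodule.inclusion_injective _)
    _ ≤ Module.length R A := Module.length_le_of_surjective f.rangeRestrict (LinearMap.surjective_rangeRestrict _)

variable [IsLocalRing R]
local notation "𝔪" => maximalIdeal R

lemma length_XT_le (X : Type u) [AddCommGroup X] [Module R X] (i : ℕ) {W : Type u} [AddCommGroup W] [Module R W]
    (hW : IsFiniteLength R W) :
    Module.length R (XT R X W i) ≤ Module.length R W * Module.length R (XT R X (R ⧸ 𝔪) i) := by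
  induction hW with
  | @of_subsingleton M _ _ _ =>
    have : Subsingleton (XT R X M i) := ⟨fun a b => by
      rw [← one_smul R a, ← one_smul R b, XT.smul_eq_zero_right (X := X) i (fun x : M => Subsingleton.elim _ _) a,
        XT.smul_eq_zero_right (X := X) i (fun x : M => Subsingleton.elim _ _) b]⟩
    rw [Module.length_eq_zero]
    exact zero_le
  | @of_simple_quotient M _ _ N hs hN ih =>
    obtain ⟨I, hI, ⟨e⟩⟩ := isSimpleModule_iff_quot_maximal.1 hs
    obtain rfl := eq_maximalIdeal hI
    have hses := SES.ofSubmodule N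
    have h1 := length_le_add_of_exact (XT.post X N.subtype i) (XT.post X N.mkQ i) (XT.exact_post hses i)
    have h2 : Module.length R (XT R X (M ⧸ N) i) ≤ Module.length R (XT R X (R ⧸ 𝔪) i) := by
      refine Module.length_le_of_surjective (XT.post X (e.symm : (R ⧸ 𝔪) →ₗ[R] (M ⧸ N)) i) fun z =>
        ⟨XT.post X (e : (M ⧸ N) →ₗ[R] (R ⧸ 𝔪)) i z, ?_⟩
      rw [XT.post_comp]
      have : (e.symm : (R ⧸ 𝔪) →ₗ[R] (M ⧸ N)) ∘ₗ (e : (M ⧸ N) →ₗ[R] (R ⧸ 𝔪)) = (1 : R) • LinearMap.id := by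
        ext x; simp
      rw [this, XT.post_smul_id, one_smul]
    have h3 : Module.length R M = Module.length R N + 1 := by
      rw [Module.length_eq_add_of_exact N.subtype N.mkQ hses.inj hses.surj hses.exact, Module.length_eq_one R (M ⧸ N)]
    rw [h3, add_mul, one_mul]
    exact h1.trans (add_le_add ih h2)

variable [IsNoetherianRing R]

variable (R) in
/-- The submodule killed by `𝔪 ^ n`. -/
abbrev kil (M : Type u) [AddCommGroup M] [Module R M] (n : ℕ) : Submodule R M := modColon R ⊥ (𝔪 ^ n)

lemma mem_kil {M : Type u} [AddCommGroup M] [Module R M] {n : ℕ} {m : M} : m ∈ kil R M n ↔ ∀ r ∈ 𝔪 ^ n, r • m = 0 :=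
  Iff.rfl

variable (R) in
lemma exists_length_kil_le (n : ℕ) : ∃ K : ℕ, ∀ (M : Type u) [AddCommGroup M] [Module R M],
    Module.length R (kil R M n) ≤ K * Module.length R (kil R M 1) := by
  obtain ⟨s, hs⟩ := (isNoetherianRing_iff_ideal_fg R).1 inferInstance 𝔪
  induction n with
  | zero =>
    refine ⟨0, fun M _ _ => ?_⟩
    have : Subsingleton (kil R M 0) := ⟨fun a b => Subtype.ext (by
      rw [← one_smul R (a : M), ← one_smul R (b : M), a.2 1 (by simp), b.2 1 (by simp)])⟩
    rw [Module.length_eq_zero]; exact zero_le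
  | succ n ih =>
    obtain ⟨K, hK⟩ := ih
    refine ⟨1 + s.card * K, fun M _ _ => ?_⟩
    have hg : ∀ g : s, ∀ z ∈ kil R M (n + 1), (g : R) • z ∈ kil R M n := fun g z hz r hr => by
      rw [smul_smul]
      refine hz _ ?_
      rw [pow_succ]
      exact Ideal.mul_mem_mul hr (hs ▸ Ideal.subset_span g.2)
    let φ : kil R M (n + 1) →ₗ[R] (s → kil R M n) := LinearMap.pi fun g =>
      ((LinearMap.lsmul R M (g : R)).restrict (hg g))
    have h1 : kil R M 1 ≤ kil R M (n + 1) := fun z hz r hr =>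
      hz r (by rw [pow_one]; exact Ideal.pow_le_self (by omega) hr)
    have h2 := length_le_add_of_exact (Submodule.inclusion h1) φ (by
      intro z hz
      refine ⟨⟨z, fun r hr => ?_⟩, rfl⟩
      rw [pow_one, ← hs] at hr
      refine Submodule.span_induction (fun g hg => ?_) ?_ ?_ ?_ hr
      · have := congrArg Subtype.val (congrFun hz ⟨g, hg⟩)
        exact this
      · exact zero_smul _ _
      · intro a b _ _ ha hb
        rw [add_smul, (Submodule.mem_bot R).1 ha, (Submodule.mem_bot R).1 hb, add_zero]; exact Submodule.zero_mem _
      · intro a b _ hb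
        rw [smul_assoc, (Submodule.mem_bot R).1 hb, smul_zero]; exact Submodule.zero_mem _)
    rw [Module.length_pi_of_fintype] at h2
    simp only [Finset.sum_const, Finset.card_univ, Fintype.card_coe, nsmul_eq_mul] at h2
    refine h2.trans ?_
    push_cast
    rw [add_mul, one_mul, mul_assoc]
    exact add_le_add le_rfl (mul_le_mul_right (hK M) _)

lemma length_kil_one_le (M : Type u) [AddCommGroup M] [Module R M] :
    Module.length R (kil R M 1) ≤ Module.length R (XT R (R ⧸ 𝔪) M 0) := by
  rw [(XT.homEquiv R (R ⧸ 𝔪) M).length_eq]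
  let φ : ((R ⧸ 𝔪) →ₗ[R] M) →ₗ[R] kil R M 1 := 
    { toFun := fun f => ⟨f 1, fun r hr => by
        rw [pow_one] at hr
        rw [← map_smul, Algebra.smul_def, mul_one]
        have : algebraMap R (R ⧸ 𝔪) r = 0 := Ideal.Quotient.eq_zero_iff_mem.2 hr
        rw [this, map_zero]; exact Submodule.zero_mem _⟩
      map_add' := fun f g => rfl
      map_smul' := fun r f => rfl }
  refine Module.length_le_of_surjective φ fun z => ?_
  refine ⟨Submodule.liftQ 𝔪 (LinearMap.toSpanSingleton R M z) fun r hr => ?_, Subtype.ext ?_⟩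
  · exact z.2 r (by rwa [pow_one])
  · exact (Submodule.liftQ_apply _ _ _).trans (one_smul R (z : M))

/-- The colons of consecutive partial quotients are killed by `𝔪 ^ c`. -/
def SmallColon (M : Type u) [AddCommGroup M] [Module R M] (c d : ℕ) (x : ℕ → R) : Prop :=
  ∀ j < d, ∀ m, x j • m ∈ seqSub M x j → ∀ r ∈ 𝔪 ^ c, r • m ∈ seqSub M x j

theorem exists_length_XT_le (M : Type u) [AddCommGroup M] [Module R M] [Module.Finite R M] (c d : ℕ) :
    ∀ j ≤ d, ∀ i, ∃ B : ℕ, ∀ x : ℕ → R, SmallColon M c d x →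
      Module.length R (XT R (R ⧸ 𝔪) (M ⧸ seqSub M x j) i) ≤ B := by
  have hfin : ∀ (N : Type u) [AddCommGroup N] [Module R N] [Module.Finite R N] (i : ℕ),
      ∃ B : ℕ, Module.length R (XT R (R ⧸ 𝔪) N i) ≤ B := by
    intro N _ _ _ i
    have : Module.Finite R (XT R (R ⧸ 𝔪) N i) := ModuleCat.finite_ext R (ModuleCat.of R (R ⧸ 𝔪)) (ModuleCat.of R N) i
    have h := LCoh.isFiniteLength_of_pow_maximal (R := R) (k := 1) (M := XT R (R ⧸ 𝔪) N i) (fun r hr z => by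
      rw [pow_one] at hr
      refine XT.smul_eq_zero_left i (fun y => ?_) z
      obtain ⟨y, rfl⟩ := Ideal.Quotient.mk_surjective y
      rw [Algebra.smul_def]
      have : algebraMap R (R ⧸ 𝔪) r = 0 := Ideal.Quotient.eq_zero_iff_mem.2 hr
      rw [this, zero_mul])
    exact ⟨_, (ENat.natCast_toNat (Module.length_ne_top_iff.2 h)).symm.le⟩
  obtain ⟨K, hK⟩ := exists_length_kil_le R c
  intro j
  induction j with
  | zero =>
    intro _ i
    obtain ⟨B, hB⟩ := hfin M i
    refine ⟨B, fun x _ => (Module.length_le_of_surjective (XT.post (R ⧸ 𝔪) (seqSub M x 0).mkQ i) fun z => ?_).trans hB⟩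
    refine XT.exact_post_δ (SES.ofSubmodule (seqSub M x 0)) i z ?_
    rw [← one_smul R (XT.δ _ _ _ z)]
    refine XT.smul_eq_zero_right _ (fun m => ?_) _
    rw [one_smul]
    exact Subtype.ext ((Submodule.mem_bot R).1 ((seqSub_zero (M := M) x) ▸ m.2))
  | succ j ih =>
    intro hj i
    obtain ⟨B1, h1⟩ := ih (by omega) i
    obtain ⟨B2, h2⟩ := ih (by omega) (i + 1)
    obtain ⟨B3, h3⟩ := ih (by omega) 0
    obtain ⟨B4, h4⟩ := hfin (R ⧸ 𝔪) (i + 2)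
    refine ⟨B1 + (B2 + K * B3 * B4), fun x hx => ?_⟩
    have hq := isQuotBy_factor x j (M := M)
    have e1 := length_le_add_of_exact _ _ (XT.exact_post_δ (X := R ⧸ 𝔪) hq.ses i)
    have hs2 := LCoh.SES_toImg (M := M ⧸ seqSub M x j) (x j)
    have e2 := length_le_add_of_exact _ _ (XT.exact_post_δ (X := R ⧸ 𝔪) hs2 (i + 1))
    have hW : LinearMap.ker (LinearMap.lsmul R (M ⧸ seqSub M x j) (x j)) ≤ kil R (M ⧸ seqSub M x j) c := by
      intro z hz r hr
      obtain ⟨m, rfl⟩ := Submodule.mkQ_surjective _ z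
      have hz' : x j • (seqSub M x j).mkQ m = 0 := hz
      rw [← map_smul, Submodule.mkQ_apply, Submodule.Quotient.mk_eq_zero] at hz'
      rw [Submodule.mem_bot, ← map_smul, Submodule.mkQ_apply, Submodule.Quotient.mk_eq_zero]
      exact hx j (by omega) m hz' r hr
    have e3 : Module.length R (LinearMap.ker (LinearMap.lsmul R (M ⧸ seqSub M x j) (x j))) ≤ (K * B3 : ℕ) := by
      push_cast
      calc _ ≤ Module.length R (kil R (M ⧸ seqSub M x j) c) :=
            Module.length_le_of_injective (Submodule.inclusion hW) (Submodule.inclusion_injective _)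
        _ ≤ K * Module.length R (kil R (M ⧸ seqSub M x j) 1) := hK _
        _ ≤ K * B3 := mul_le_mul_right ((length_kil_one_le _).trans (h3 x hx)) _
    have e4 := length_XT_le (R ⧸ 𝔪) (i + 2) (W := LinearMap.ker (LinearMap.lsmul R (M ⧸ seqSub M x j) (x j)))
      (Module.length_ne_top_iff.1 (ne_top_of_le_ne_top (ENat.natCast_ne_top _) e3))
    refine e1.trans ?_
    push_cast
    refine add_le_add (h1 x hx) (e2.trans (add_le_add (h2 x hx) (e4.trans ?_)))
    exact_mod_cast mul_le_mul' e3 h4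

end Lengths

end

noncomputable section

section Bound
variable {R : Type u} [CommRing R] [IsLocalRing R] [IsNoetherianRing R]
local notation "𝔪" => maximalIdeal R

lemma PS.finite_colength {d : ℕ} {x : ℕ → R} (h : PS ⊥ d x d) : FC (seqSub R x d : Ideal R) := by
  obtain ⟨_, n', hn, h2⟩ := h
  obtain rfl : n' = 0 := by omega
  rw [bot_sup_eq] at h2
  obtain ⟨k, hk⟩ := pow_le_of_Dle_zero h2
  exact FC_of_pow (k := k) fun r hr m => Ideal.mul_mem_right _ _ (hk hr)

lemma PS.update_mul {T : Ideal R} {d : ℕ} {x : ℕ → R} (h : PS T d x d) {i k : ℕ} (hik : i ≤ k) (hk : k < d) :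
    PS T d (Function.update x i (x i * x k)) (i + 1) := by
  have h1 := h.prefix (show i + 1 ≤ d by omega)
  have h2 : PS T d (x ∘ Equiv.swap i k) (i + 1) := by
    refine PS.prefix (h.perm (fun j hj => h.1 _ ?_) fun j hj => ⟨Equiv.swap i k j, ?_, ?_⟩) (show i + 1 ≤ d by omega)
    · rw [Equiv.swap_apply_def]; split_ifs <;> omega
    · rw [Equiv.swap_apply_def]; split_ifs <;> omega
    · simp
  obtain ⟨m1, n', hn, h1⟩ := h1
  obtain ⟨m2, n'', hn', h2⟩ := h2
  obtain rfl : n' = n'' := by omega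
  rw [seqSub_succ_span] at h1 h2
  refine ⟨fun j hj => ?_, n', hn, fun Q hQ => ?_⟩
  · by_cases hji : j = i
    · subst hji; rw [Function.update_self]; exact Ideal.mul_mem_right _ _ (m1 j (by omega))
    · rw [Function.update_of_ne hji]; exact m1 j hj
  · rw [seqSub_succ_span, Function.update_self,
      seqSub_congr (y := x) (fun j hj => Function.update_of_ne (by omega) _ _)] at hQ
    have hT : T ≤ Q.asIdeal := le_sup_left.trans hQ
    have hS : seqSub R x i ≤ Q.asIdeal := (le_sup_left.trans le_sup_right).trans hQ
    have hm : x i * x k ∈ Q.asIdeal := hQ (Submodule.mem_sup_right (Submodule.mem_sup_right (Submodule.mem_span_singleton_self _)))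
    rcases Q.2.mem_or_mem hm with hm | hm
    · exact h1 Q (sup_le hT (sup_le hS ((Ideal.span_singleton_le_iff_mem _).2 hm)))
    · refine h2 Q (sup_le hT (sup_le ?_ ((Ideal.span_singleton_le_iff_mem _).2 (by simpa using hm))))
      rwa [seqSub_congr (y := x) (fun j hj => by
        simp [Equiv.swap_apply_of_ne_of_ne (show j ≠ i by omega) (show j ≠ k by omega)])]

variable {M : Type u} [AddCommGroup M] [Module R M] [Module.Finite R M]

lemma SmallColon.of_Hk {k d : ℕ} (hk : LCoh.Hk 𝔪 M k d) {T : Ideal R} (hT : T ≤ Module.annihilator R M) {x : ℕ → R}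
    (hx : PS T d x d) : SmallColon M (2 ^ d * k) d x := fun j hj m hm r hr =>
  colon_of_Hk_PS hk hT (hx.prefix (show j + 1 ≤ d by omega)) m hm r
    (Ideal.pow_le_pow_right (Nat.mul_le_mul_right k (Nat.pow_le_pow_right (by omega) hj.le)) hr)

lemma DSeq.of_Hk {k d : ℕ} (hk : LCoh.Hk 𝔪 M k d) {T : Ideal R} (hT : T ≤ Module.annihilator R M) {x : ℕ → R}
    (hx : PS T d x d) (hxm : ∀ j < d, x j ∈ 𝔪 ^ (2 ^ d * k)) : DSeq M x d := by
  intro i l hil hl m hm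
  have hc : seqSub M (Function.update x i (x i * x l)) i = seqSub M x i :=
    seqSub_congr fun j hj => Function.update_of_ne (by omega) _ _
  have := colon_of_Hk_PS hk hT (hx.update_mul hil hl) m (by
    rw [Function.update_self, hc, mul_smul]; exact hm) (x l)
    (Ideal.pow_le_pow_right (Nat.mul_le_mul_right k (Nat.pow_le_pow_right (by omega) (by omega))) (hxm l hl))
  rwa [hc] at this

omit [Module.Finite R M] in
lemma cl_le_modColon {N : Submodule R M} (hN : FC N) {n B : ℕ} (hB : Module.length R (kil R (M ⧸ N) n) ≤ B) :
    cl N ≤ cl (modColon R N (𝔪 ^ n)) + B := by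
  have hle : N ≤ modColon R N (𝔪 ^ n) := fun m hm r _ => N.smul_mem r hm
  have := length_le_add_of_exact (kil R (M ⧸ N) n).subtype (Submodule.factor hle) (by
    intro z hz
    obtain ⟨m, rfl⟩ := N.mkQ_surjective z
    refine ⟨⟨N.mkQ m, fun r hr => ?_⟩, rfl⟩
    have hz' : (modColon R N (𝔪 ^ n)).mkQ m = 0 := hz
    rw [Submodule.mkQ_apply, Submodule.Quotient.mk_eq_zero] at hz'
    rw [Submodule.mem_bot, ← map_smul, Submodule.mkQ_apply, Submodule.Quotient.mk_eq_zero]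
    exact hz' r hr)
  rw [hN.length, (hN.mono hle).length] at this
  have h2 := this.trans (add_le_add_left hB _)
  rw [add_comm]
  exact_mod_cast h2

variable (M) in
theorem exists_hDiff_bound (c d : ℕ) : ∃ σ : ℕ, ∀ x : ℕ → R, SmallColon M c d x → FC (seqSub R x d : Ideal R) →
    ∀ i < d, (0 ≤ hDiff M x d i ∧ hDiff M x d i ≤ σ) ∧
      cl (powSub M x d 1 ⊔ colSub M x i) ≤ cl (modColon R (powSub M x d 1 ⊔ colSub M x i) 𝔪) + σ := by
  obtain ⟨B, hB⟩ := exists_length_XT_le (R := R) M c d d le_rfl 0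
  obtain ⟨K1, hK1⟩ := exists_length_kil_le R c
  obtain ⟨K2, hK2⟩ := exists_length_kil_le R (c + 1)
  refine ⟨K1 * B + K2 * B, fun x hx hq i hi => ?_⟩
  have hF := FC_powSub (M := M) hq 1
  have hkil : Module.length R (kil R (M ⧸ powSub M x d 1) 1) ≤ B := by
    rw [powSub_one]; exact (length_kil_one_le _).trans (hB x hx)
  have h1 := cl_le_modColon hF (n := c) (B := K1 * B) ((hK1 _).trans (by
    push_cast; exact mul_le_mul_right hkil _))
  have h2 := cl_le_modColon hF (n := c + 1) (B := K2 * B) ((hK2 _).trans (by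
    push_cast; exact mul_le_mul_right hkil _))
  set N := powSub M x d 1
  have hC : N ⊔ colSub M x i ≤ modColon R N (𝔪 ^ c) := by
    refine sup_le (fun m hm r _ => N.smul_mem r hm) fun m hm r hr => ?_
    have : r • m ∈ seqSub M x d := seqSub_mono x hi.le (hx i hi m hm r hr)
    rwa [← powSub_one] at this
  have hC2 : modColon R (N ⊔ colSub M x i) 𝔪 ≤ modColon R N (𝔪 ^ (c + 1)) := by
    intro m hm r hr
    rw [pow_succ] at hr
    refine Submodule.mul_induction_on hr (fun a ha b hb => ?_) (fun a b ha hb => ?_)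
    · rw [mul_smul]; exact hC (hm b hb) a ha
    · rw [add_smul]; exact N.add_mem ha hb
  have hD : FC (N ⊔ colSub M x i) := hF.mono le_sup_left
  have h3 := cl_mono hD hC
  have h4 := cl_mono hF (le_sup_left : N ≤ N ⊔ colSub M x i)
  have h5 := cl_mono (hD.mono (le_modColon M)) hC2
  unfold hDiff
  refine ⟨⟨?_, ?_⟩, ?_⟩
  · have : (cl (N ⊔ colSub M x i) : ℤ) ≤ cl N := by exact_mod_cast h4
    linarith
  · push_cast
    zify at h1 h3
    have : (0 : ℤ) ≤ K2 * B := by positivity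
    linarith
  · have : 0 ≤ K1 * B := by positivity
    omega

end Bound

end

noncomputable section

section Bound
variable {R : Type u} [CommRing R] [IsLocalRing R] [IsNoetherianRing R]
local notation "𝔪" => maximalIdeal R

lemma exists_cl_powSub_le_of_Dle {N : Type u} [AddCommGroup N] [Module R N] [Module.Finite R N] {k d : ℕ} {x : ℕ → R}
    (hx : PS ⊥ d x d) (h : Dle (Module.annihilator R N) k) :
    ∃ K : ℕ, ∀ n, cl (powSub N x d (n + 1)) ≤ K * (n + k).choose k := by
  have h0 : Dle (seqSub R x d : Ideal R) 0 := by
    obtain ⟨_, n', hn, h2⟩ := hx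
    obtain rfl : n' = 0 := by omega
    rwa [bot_sup_eq] at h2
  obtain ⟨y, hy, hyq⟩ := exists_PS_in h (seqSub_le_ideal hx.1) h0 (r := k) rfl
  obtain ⟨_, n', hn, h2⟩ := hy
  obtain rfl : n' = 0 := by omega
  obtain ⟨s, hs⟩ := pow_le_of_Dle_zero h2
  have hF : FC (powSub N y k 1) := FC_of_pow (k := s) fun r hr m => by
    obtain ⟨a, ha, b, hb, rfl⟩ := Submodule.mem_sup.1 (hs hr)
    rw [add_smul, Module.mem_annihilator.1 ha, zero_add, powSub, pow_one]
    exact Submodule.smul_mem_smul hb trivial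
  refine ⟨cl (powSub N y k 1), fun n => ?_⟩
  have h3 := cl_powSub_le hF k 0 (by omega) n
  rw [seqSub_zero, sup_bot_eq] at h3
  exact (cl_mono (hF.powSub _) (Submodule.smul_mono_left (Ideal.pow_right_mono (seqSub_le_ideal hyq) _))).trans h3

lemma comap_smul_top_mkQ (U J : Ideal R) : (J • ⊤ : Submodule R (R ⧸ U)).comap U.mkQ = J ⊔ U := by
  have h : (J • ⊤ : Submodule R (R ⧸ U)) = Submodule.map U.mkQ J := by
    have h1 := Submodule.map_smul'' J (⊤ : Submodule R R) U.mkQ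
    rw [Submodule.map_top, Submodule.range_mkQ] at h1
    rw [← h1]; simp
  rw [h, Submodule.comap_map_mkQ, sup_comm]

lemma cl_smul_top_quot (U J : Ideal R) : cl (J • ⊤ : Submodule R (R ⧸ U)) = cl (J ⊔ U : Ideal R) := by
  rw [← comap_smul_top_mkQ, cl_comap_surjective U.mkQ_surjective]

theorem exists_e_one_bound (hres : IsHomImageOfCM R) {U : Ideal R} {k : ℕ} (hdim : ringKrullDim R = (k + 2 : ℕ))
    (hU : UnmixedData U (k + 2)) {a : ℕ} (hk : LCoh.Hk 𝔪 (R ⧸ U) a (k + 2)) (hann : Dle (Module.annihilator R U) k) :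
    ∃ t, 1 ≤ t ∧ ∃ B : ℤ, ∀ x : ℕ → R, PS ⊥ (k + 2) x (k + 2) → (∀ j < k + 2, x j ∈ 𝔪 ^ t) → ∀ e : ℕ → ℤ,
      (∃ N, ∀ n ≥ N, (cl (colonIdeal R (seqSub R x (k + 2)) ^ (n + 1)) : ℤ) = HP (k + 2) e n) → |e 1| ≤ B := by
  obtain ⟨t₀, ht₀, hcol⟩ := exists_colonIdeal_pow hres (by omega) hdim hU
  obtain ⟨σ, hσ⟩ := exists_hDiff_bound (R ⧸ U) (R := R) (2 ^ (k + 2) * a) (k + 2)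
  refine ⟨t₀ + 2 ^ (k + 2) * a, by omega, 2 * σ, fun x hx hxm e ⟨N, he⟩ => ?_⟩
  obtain ⟨hc1, hc2, hc3⟩ := hcol x hx fun j hj => Ideal.pow_le_pow_right (by omega) (hxm j hj)
  set I := colonIdeal R (seqSub R x (k + 2)) with hI
  set q : Ideal R := seqSub R x (k + 2) with hqd
  have hxU : PS U (k + 2) x (k + 2) := hx.mono bot_le
  have hT : U ≤ Module.annihilator R (R ⧸ U) := by rw [Ideal.annihilator_quotient]
  have hq : FC q := hx.finite_colength
  have hDS : DSeq (R ⧸ U) x (k + 2) :=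
    DSeq.of_Hk hk hT hxU fun j hj => Ideal.pow_le_pow_right (by omega) (hxm j hj)
  have hb := hσ x (SmallColon.of_Hk hk hT hxU) hq
  have hqn : ∀ n, FC (q ^ n) := fun n => by
    have := FC_powSub (M := R) hq n
    rwa [powSub, ← hqd, smul_eq_mul, Ideal.mul_top] at this
  have hle : ∀ n, q ^ n ≤ I ^ n := fun n => Ideal.pow_right_mono hc1 n
  obtain ⟨K, hK⟩ := hDS.hilbert_approx hq
  obtain ⟨L, hL⟩ := exists_cl_powSub_le_of_Dle (N := U) hx hann
  set α : ℤ := (cl (powSub (R ⧸ U) x (k + 2) 1) : ℤ) - hDiff (R ⧸ U) x (k + 2) (k + 1)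
  set β : ℤ := hDiff (R ⧸ U) x (k + 2) (k + 1) - hDiff (R ⧸ U) x (k + 2) k
  have hup := le_of_HP_le (e := e) (k := k) (a := α) (b := β) (K := K + L) ⟨N, fun n hn => by
    rw [← he n hn]
    have h1 : cl (I ^ (n + 1)) ≤ cl (q ^ (n + 1)) := cl_mono (hqn _) (hle _)
    have h2 := cl_eq_add (hqn (n + 1)) (U.subtype : U →ₗ[R] R)
    rw [Submodule.range_subtype, ← cl_smul_top_quot] at h2
    have h3 : cl (Submodule.comap (U.subtype : U →ₗ[R] R) (q ^ (n + 1))) ≤ cl (powSub U x (k + 2) (n + 1)) := by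
      refine cl_mono (FC_powSub hq _) (Submodule.smul_le.2 fun r hr m _ => ?_)
      change r * (m : R) ∈ q ^ (n + 1)
      exact Ideal.mul_mem_right _ _ hr
    have h4 := hL n
    have h5 := (abs_le.1 (hK n)).2
    have h6 : cl (q ^ (n + 1) • ⊤ : Submodule R (R ⧸ U)) = cl (powSub (R ⧸ U) x (k + 2) (n + 1)) := rfl
    rw [h6] at h2
    zify at h1 h2 h3 h4
    rw [add_mul]
    linarith⟩
  have hlo := le_of_le_HP (e := e) (k := k) (a := α) (b := β - σ) (K := -K) ⟨N + 1, fun n hn => by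
    rw [← he n (by omega)]
    obtain ⟨n, rfl⟩ : ∃ m, n = m + 1 := ⟨n - 1, by omega⟩
    have h1 := hDS.cl_le_socZ hq (fun i hi => (hb i hi).2) (k + 1) 0 n (by omega)
    rw [seqSub_zero, sup_bot_eq] at h1
    have h2 : (I ^ (n + 1 + 1) • ⊤ : Submodule R (R ⧸ U)) ≤ socZ (R ⧸ U) x (k + 2) 0 (n + 1) := by
      refine le_inf (le_sup_of_le_left (Submodule.smul_mono_left (hc2 (n + 1)))) fun z hz r hr => ?_
      refine Submodule.mem_sup_left ?_
      have h3 : r • z ∈ (𝔪 * I ^ (n + 1 + 1)) • (⊤ : Submodule R (R ⧸ U)) := by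
        rw [Submodule.mul_smul]; exact Submodule.smul_mem_smul hr hz
      exact Submodule.smul_mono_left (hc3 (n + 1)) h3
    have hFI : FC (I ^ (n + 1 + 1)) := (hqn _).mono (hle _)
    have h3 : FC (I ^ (n + 1 + 1) • ⊤ : Submodule R (R ⧸ U)) := by
      have h4 : powSub (R ⧸ U) x (k + 2) (n + 1 + 1) ≤ I ^ (n + 1 + 1) • ⊤ := Submodule.smul_mono_left (hle _)
      exact (FC_powSub hq _).mono h4
    have h4 := cl_mono h3 h2
    have h5 : cl (I ^ (n + 1 + 1) • ⊤ : Submodule R (R ⧸ U)) ≤ cl (I ^ (n + 1 + 1)) := by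
      rw [cl_smul_top_quot]; exact cl_mono hFI le_sup_left
    have h6 := (abs_le.1 (hK (n + 1))).1
    rw [show n + 1 + 1 = n + 2 by omega] at *
    zify at h1 h4 h5
    rw [sub_mul]
    linarith⟩
  have he0 : e 0 = α := le_antisymm hup.1 hlo.1
  have h1 := hup.2 he0
  have h2 := hlo.2 he0
  obtain ⟨⟨ha, hb1⟩, _⟩ := hb (k + 1) (by omega)
  obtain ⟨⟨hc, hd1⟩, _⟩ := hb k (by omega)
  rw [abs_le]
  constructor <;> simp only [β] at h1 h2 <;> linarith

end Bound

end

noncomputable section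

section Tails
variable {R : Type u} [CommRing R] [IsLocalRing R] [IsNoetherianRing R]
local notation "𝔪" => maximalIdeal R

/-- The ideal `(x_l, …, x_{d-1})`. -/
def tl (x : ℕ → R) (d l : ℕ) : Ideal R := Ideal.span (x '' {j | l ≤ j ∧ j < d})

omit [IsLocalRing R] [IsNoetherianRing R] in
lemma tl_self (x : ℕ → R) (d : ℕ) : tl x d d = ⊥ := by
  rw [tl, Ideal.span_eq_bot]
  rintro _ ⟨j, ⟨h1, h2⟩, rfl⟩
  omega

lemma tl_eq (x : ℕ → R) {d l : ℕ} (h : l < d) : tl x d l = Ideal.span {x l} ⊔ tl x d (l + 1) := by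
  rw [tl, tl, ← Ideal.span_union, ← Set.image_singleton, ← Set.image_union]
  congr 2
  ext j
  simp only [Set.mem_ofPred_eq, Set.mem_union, Set.mem_singleton_iff]
  omega

lemma tl_congr {x y : ℕ → R} {d l : ℕ} (h : ∀ j, l ≤ j → x j = y j) : tl x d l = tl y d l := by
  rw [tl, tl]
  congr 1
  exact Set.image_congr fun j hj => h j hj.1

lemma tl_zero (x : ℕ → R) (d : ℕ) : tl x d 0 = seqSub R x d := by
  rw [seqSub_eq, tl]; simp

/-- The element `c` annihilates, modulo `T M`, all colons of partial systems of parameters of `R / T`. -/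
def Kap (M : Type u) [AddCommGroup M] [Module R M] (T : Ideal R) (n : ℕ) (c : R) : Prop :=
  ∀ (y : ℕ → R) (i : ℕ), PS T n y (i + 1) → ∀ m : M, y i • m ∈ seqSub M y i ⊔ T • (⊤ : Submodule R M) →
    c • m ∈ seqSub M y i ⊔ T • (⊤ : Submodule R M)

/-- The elements `x_j, …, x_{d-1}` form the tail of a C-system of parameters inside `𝔪 ^ t` that is
also adapted to `M`. -/
structure Good (M : Type u) [AddCommGroup M] [Module R M] (t d : ℕ) (x : ℕ → R) (j : ℕ) : Prop where
  mem : ∀ l, j ≤ l → l < d → x l ∈ 𝔪 ^ t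
  dim : ∀ l, j ≤ l → l ≤ d → Dle (tl x d l) l
  csop : ∀ l, j ≤ l → l < d → x l ∈ bIdeal R (R ⧸ (tl x d (l + 1) • ⊤ : Submodule R R)) ^ 3
  kap : ∀ l, j ≤ l → l < d → Kap M (tl x d (l + 1)) (l + 1) (x l)

variable {M : Type u} [AddCommGroup M] [Module R M] {t d : ℕ} {x : ℕ → R} {j : ℕ}

lemma Good.mono (h : Good M t d x j) {i : ℕ} (hi : j ≤ i) : Good M t d x i :=
  ⟨fun l hl => h.mem l (hi.trans hl), fun l hl => h.dim l (hi.trans hl), fun l hl => h.csop l (hi.trans hl),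
    fun l hl => h.kap l (hi.trans hl)⟩

lemma Good.cons (h : Good M t d x (j + 1)) (hj : j < d) {z : R} (hm : z ∈ 𝔪 ^ t)
    (hd : Dle (Ideal.span {z} ⊔ tl x d (j + 1)) j)
    (hb : z ∈ bIdeal R (R ⧸ (tl x d (j + 1) • ⊤ : Submodule R R)) ^ 3) (hk : Kap M (tl x d (j + 1)) (j + 1) z) :
    Good M t d (Function.update x j z) j := by
  have hne : ∀ l, j + 1 ≤ l → Function.update x j z l = x l := fun l hl =>
    Function.update_of_ne (by omega) _ _
  have ht : ∀ l, j + 1 ≤ l → tl (Function.update x j z) d l = tl x d l := fun l hl =>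
    tl_congr fun i hi => hne i (by omega)
  refine ⟨fun l hl hl' => ?_, fun l hl hl' => ?_, fun l hl hl' => ?_, fun l hl hl' => ?_⟩ <;>
    rcases hl.eq_or_lt with rfl | hl
  · simpa using hm
  · rw [hne l hl]; exact h.mem l hl hl'
  · rw [tl_eq _ hj, ht _ le_rfl, Function.update_self]; exact hd
  · rw [ht l hl]; exact h.dim l hl hl'
  · rw [ht _ le_rfl, Function.update_self]; exact hb
  · rw [ht (l + 1) (by omega), hne l hl]; exact h.csop l hl hl'
  · rw [ht _ le_rfl, Function.update_self]; exact hk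
  · rw [ht (l + 1) (by omega), hne l hl]; exact h.kap l hl hl'

lemma Dle_of_pow {𝔞 : Ideal R} {z : R} {n k : ℕ} (h : Dle (Ideal.span {z} ⊔ 𝔞) n) :
    Dle (Ideal.span {z ^ k} ⊔ 𝔞) n := fun Q hQ => by
  have h1 : z ^ k ∈ Q.asIdeal := hQ (Ideal.mem_sup_left (Ideal.mem_span_singleton_self _))
  exact h Q (sup_le ((Ideal.span_singleton_le_iff_mem _).2 (Q.2.mem_of_pow_mem _ h1)) (le_sup_right.trans hQ))

lemma Good.pow (h : Good M t d x j) (hj : j < d) {k : ℕ} (hk : 1 ≤ k) :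
    Good M t d (Function.update x j (x j ^ k)) j := by
  obtain ⟨k, rfl⟩ : ∃ k', k = k' + 1 := ⟨k - 1, by omega⟩
  refine (h.mono (Nat.le_succ j)).cons hj ?_ ?_ ?_ ?_
  · rw [pow_succ]; exact Ideal.mul_mem_left _ _ (h.mem j le_rfl hj)
  · apply Dle_of_pow
    have := h.dim j le_rfl hj.le
    rwa [tl_eq _ hj] at this
  · rw [pow_succ (x j)]; exact Ideal.mul_mem_left _ _ (h.csop j le_rfl hj)
  · intro y i hy m hm
    rw [pow_succ, mul_smul]
    exact Submodule.smul_mem _ _ (h.kap j le_rfl hj y i hy m hm)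

lemma Good.last (M : Type u) [AddCommGroup M] [Module R M] (t : ℕ) (hd : Dle (⊥ : Ideal R) d) (x : ℕ → R) :
    Good M t d x d := by
  refine ⟨fun l hl hl' => ?_, fun l hl hl' => ?_, fun l hl hl' => ?_, fun l hl hl' => ?_⟩
  · omega
  · obtain rfl : l = d := by omega
    rwa [tl_self]
  · omega
  · omega

lemma Good.PS (ht : 1 ≤ t) (h : Good M t d x 0) : _root_.PS ⊥ d x d := by
  refine PS.of_full (fun j hj => Ideal.pow_le_self (by omega) (h.mem j (by omega) hj)) ?_
  have := h.dim 0 le_rfl (by omega)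
  rwa [tl_zero, ← bot_sup_eq (seqSub R x d)] at this

/-- The ideal of a `KillerData` controls the colons defining `bIdeal`. -/
lemma KillerData.pow_le_bIdeal {T 𝔞 : Ideal R} {l : ℕ} (hT : Dle T (l + 1))
    (h : KillerData T (l + 1) (R ⧸ (T • ⊤ : Submodule R R)) 𝔞) :
    𝔞 ^ 3 ^ l ≤ bIdeal R (R ⧸ (T • ⊤ : Submodule R R)) := by
  intro c hc
  rw [bIdeal]
  simp only [Submodule.mem_iInf]
  rintro s y ⟨hs, hy⟩ i
  have hTT : (T • ⊤ : Submodule R R) = T := by simp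
  have hs' : s ≤ l + 1 := by
    have h1 : moduleDim R (R ⧸ (T • ⊤ : Submodule R R)) = ringKrullDim (R ⧸ T) := by
      rw [moduleDim, Ideal.annihilator_quotient, hTT]
    have h2 := (Dle_iff T (l + 1)).2 hT
    rw [← h1, hs] at h2
    exact_mod_cast h2
  set Y : ℕ → R := fun j => if h : j < s then y ⟨j, h⟩ else 0 with hY
  have hYy : ∀ j : Fin s, Y j = y j := fun j => by simp [hY]
  have hYm : ∀ j < s, Y j ∈ 𝔪 := fun j hj => (hYy ⟨j, hj⟩) ▸ hy.1 ⟨j, hj⟩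
  have him : ∀ n ≤ s, Y '' {j | j < n} = y '' {j | (j : ℕ) < n} := fun n hn => by
    ext r
    constructor
    · rintro ⟨j, hj, rfl⟩
      exact ⟨⟨j, lt_of_lt_of_le hj hn⟩, hj, (hYy ⟨j, lt_of_lt_of_le hj hn⟩).symm⟩
    · rintro ⟨j, hj, rfl⟩
      exact ⟨j, hj, hYy j⟩
  have hD : Dle (T ⊔ seqSub R Y s) 0 := by
    have hf : FC (seqSub (R ⧸ (T • ⊤ : Submodule R R)) Y s) := by
      rw [FC, seqSub_eq, him s le_rfl]
      have : {j : Fin s | (j : ℕ) < s} = Set.univ := by ext j; simp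
      rw [this, Set.image_univ]
      exact hy.2
    obtain ⟨k, hk⟩ := hf.exists_pow
    refine Dle_zero_of_pow (n := k) fun r hr => ?_
    have h1 := hk r hr (Submodule.mkQ _ 1)
    rw [← map_smul, mk_mem_seqSub, hTT, sup_comm, show r • (1 : R) = r from mul_one r] at h1
    exact h1
  have hPS : _root_.PS T s Y s := PS.of_full hYm hD
  have hPS' : _root_.PS T (l + 1) Y (i + 1) := by
    obtain ⟨h1, n', hn, h2⟩ := hPS.prefix (show (i : ℕ) + 1 ≤ s from i.2)
    exact ⟨h1, l + 1 - (i + 1), by omega, h2.mono le_rfl (by omega)⟩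
  rw [Module.mem_annihilator]
  rintro ⟨m, hm⟩
  rw [Submodule.mem_torsionBy_iff] at hm
  obtain ⟨m, rfl⟩ := Submodule.mkQ_surjective _ m
  have e1 : seqSub (R ⧸ (T • ⊤ : Submodule R R)) Y i = Ideal.span (y '' {j | j < i}) • ⊤ := by
    rw [seqSub_eq, him i i.2.le]; rfl
  apply Subtype.ext
  change c • Submodule.mkQ _ m = 0
  rw [← map_smul, Submodule.mkQ_apply, Submodule.Quotient.mk_eq_zero, ← e1] at hm ⊢
  refine h.colon Y i hPS' c (Ideal.pow_le_pow_right (Nat.pow_le_pow_right (by omega) (by omega)) hc) m ?_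
  rwa [hYy]

/-- Good tails can be extended to the left by an element of any sufficiently large ideal. -/
lemma Good.extend (hres : IsHomImageOfCM R) [Module.Finite R M] (hdim : ringKrullDim R = d)
    (h : Good M t d x (j + 1)) (hj : j < d) (ht : 1 ≤ t) (J : Ideal R)
    (hJ : ∀ Q : PrimeSpectrum R, cd Q = (j + 1 : ℕ) → ¬ J ≤ Q.asIdeal) :
    ∃ z ∈ J, Good M t d (Function.update x j z) j := by
  set T := tl x d (j + 1) with hT
  have hTd : Dle T (j + 1) := h.dim _ le_rfl hj
  have hTm : T ≤ 𝔪 := by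
    rw [hT, tl, Ideal.span_le]
    rintro _ ⟨i, hi, rfl⟩
    exact Ideal.pow_le_self (by omega) (h.mem i hi.1 hi.2)
  have hTN : ∀ (N : Type u) [AddCommGroup N] [Module R N], ∀ c ∈ T, ∀ m : N ⧸ (T • ⊤ : Submodule R N), c • m = 0 := by
    intro N _ _ c hc m
    obtain ⟨m, rfl⟩ := Submodule.mkQ_surjective _ m
    rw [← map_smul, Submodule.mkQ_apply, Submodule.Quotient.mk_eq_zero]
    exact Submodule.smul_mem_smul hc trivial
  obtain ⟨𝔞, h𝔞⟩ := exists_killerData hres hTm hTd hdim hj (R ⧸ (T • ⊤ : Submodule R R)) (hTN R)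
  obtain ⟨𝔟, h𝔟⟩ := exists_killerData hres hTm hTd hdim hj (M ⧸ (T • ⊤ : Submodule R M)) (hTN M)
  have h0 : _root_.PS T (j + 1) (fun _ => 0) 0 := ⟨by simp, j + 1, by simp, by simpa using hTd⟩
  obtain ⟨z, hz, hPS⟩ := h0.extend_coset (zero_mem 𝔪) (I := (𝔞 ^ 3 ^ j) ^ 3 * 𝔟 ^ 3 ^ j * 𝔪 ^ t * J)
    (Ideal.mul_le_left.trans <| Ideal.mul_le_right.trans <| Ideal.pow_le_self (by omega : t ≠ 0)) (fun Q hTQ _ hQ => by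
      have h1 : cd Q ≤ (j + 1 : ℕ) := hTd Q (le_sup_left.trans hTQ)
      rw [Nat.cast_zero, add_zero]
      refine lt_of_le_of_ne h1 fun hc => ?_
      rcases Q.2.mul_le.1 hQ with hQ | hQ
      · rcases Q.2.mul_le.1 hQ with hQ | hQ
        · rcases Q.2.mul_le.1 hQ with hQ | hQ
          · exact h𝔞.top Q hc (Q.2.le_of_pow_le (Q.2.le_of_pow_le hQ))
          · exact h𝔟.top Q hc (Q.2.le_of_pow_le hQ)
        · have h2 : Q.asIdeal = 𝔪 :=
            le_antisymm (le_maximalIdeal Q.2.ne_top) (Q.2.le_of_pow_le hQ)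
          have h3 : cd Q = 0 := by
            have := Dle_zero_of_pow (R := R) (𝔞 := 𝔪) (n := 1) (by simp) Q h2.ge
            simpa using this
          rw [h3] at hc
          exact absurd hc (by norm_cast)
      · exact hJ Q hc hQ) (by omega)
  have hz1 : z ∈ J := Ideal.mul_le_right hz
  have hz2 : z ∈ 𝔪 ^ t := Ideal.mul_le_right (Ideal.mul_le_left hz)
  have hz3 : z ∈ 𝔟 ^ 3 ^ j := Ideal.mul_le_right (Ideal.mul_le_left (Ideal.mul_le_left hz))
  have hz4 : z ∈ (𝔞 ^ 3 ^ j) ^ 3 := Ideal.mul_le_left (Ideal.mul_le_left (Ideal.mul_le_left hz))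
  refine ⟨z, hz1, h.cons hj hz2 ?_ (Ideal.pow_right_mono (h𝔞.pow_le_bIdeal hTd) 3 hz4) ?_⟩
  · obtain ⟨_, n', hn, hD⟩ := hPS
    obtain rfl : n' = j := by omega
    rw [seqSub_succ_span, seqSub_zero, bot_sup_eq, Function.update_self, zero_add, sup_comm] at hD
    exact hD
  · intro y i hy m hm
    have hi := hy.le
    rw [← mk_mem_seqSub, map_smul] at hm ⊢
    exact h𝔟.colon y i hy z (Ideal.pow_le_pow_right (Nat.pow_le_pow_right (by omega) (by omega)) hz3) _ hm

end Tails

end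

noncomputable section

section TailDSeq
variable {R : Type u} [CommRing R] [IsLocalRing R] [IsNoetherianRing R]
local notation "𝔪" => maximalIdeal R
variable {M : Type u} [AddCommGroup M] [Module R M] {t d : ℕ} {x : ℕ → R} {j : ℕ}

lemma Good.PS_tl (ht : 1 ≤ t) (h : Good M t d x 0) {l : ℕ} (hl : l ≤ d) : _root_.PS (tl x d l) l x l := by
  refine PS.of_full (fun j hj => Ideal.pow_le_self (by omega) (h.mem j (by omega) (by omega)))
    ((h.dim 0 le_rfl (by omega)).mono ?_ le_rfl)
  rw [tl, Ideal.span_le]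
  rintro _ ⟨j, hj, rfl⟩
  rcases lt_or_ge j l with h | h
  · exact Ideal.mem_sup_right (mem_seqSub_self h)
  · exact Ideal.mem_sup_left (Ideal.subset_span ⟨j, ⟨h, hj.2⟩, rfl⟩)

lemma tl_smul_eq {l : ℕ} (hl : l < d) :
    tl x d l • (⊤ : Submodule R M) = LinearMap.range (mulM M (x l)) ⊔ tl x d (l + 1) • ⊤ := by
  rw [tl_eq x hl, Submodule.sup_smul, Submodule.ideal_span_singleton_smul]
  congr 1
  ext m
  rw [Submodule.mem_smul_pointwise_iff_exists]
  exact ⟨fun ⟨a, _, h⟩ => ⟨a, h⟩, fun ⟨a, h⟩ => ⟨a, trivial, h⟩⟩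

lemma Good.colon_tl (ht : 1 ≤ t) (h : Good M t d x 0) {i k : ℕ} (hik : i ≤ k) (hk : k < d) {y : R} (hy : y ∈ 𝔪)
    (hD : Dle (tl x d (k + 1) ⊔ seqSub R x i ⊔ Ideal.span {y}) (k - i)) {l : ℕ} (hl : k + 1 ≤ l) :
    l ≤ d → Dle (tl x d l ⊔ seqSub R x i ⊔ Ideal.span {y}) (l - 1 - i) ∧
      ∀ m : M, y • m ∈ seqSub M x i ⊔ tl x d l • (⊤ : Submodule R M) →
        x k • m ∈ seqSub M x i ⊔ tl x d l • (⊤ : Submodule R M) := by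
  have hup : ∀ z : R, seqSub M (Function.update x i z) i = seqSub M x i := fun z =>
    seqSub_congr fun j hj => Function.update_of_ne (by omega) _ _
  have hupR : ∀ z : R, seqSub R (Function.update x i z) i = seqSub R x i := fun z =>
    seqSub_congr fun j hj => Function.update_of_ne (by omega) _ _
  have hxm : ∀ j < d, x j ∈ 𝔪 := fun j hj => Ideal.pow_le_self (by omega) (h.mem j (by omega) hj)
  induction l, hl using Nat.le_induction with
  | base =>
    refine fun hl => ⟨hD, fun m hm => ?_⟩
    have hP : _root_.PS (tl x d (k + 1)) (k + 1) (Function.update x i y) (i + 1) := by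
      refine ⟨fun j hj => ?_, k - i, by omega, ?_⟩
      · rcases eq_or_ne j i with rfl | hj'
        · simpa using hy
        · rw [Function.update_of_ne hj']; exact hxm j (by omega)
      · rwa [seqSub_succ_span, hupR, Function.update_self, ← sup_assoc]
    have := h.kap k (by omega) hk _ i hP m
    rw [hup, Function.update_self] at this
    exact this hm
  | succ l hl ih =>
    intro hld
    obtain ⟨hDl, ih⟩ := ih (by omega)
    have hDl' : Dle (tl x d (l + 1) ⊔ seqSub R x i ⊔ Ideal.span {y}) (l - i) := by
      have : l - i = (l - 1 - i) + 1 := by omega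
      rw [this]
      refine Dle_of_sup_span (hxm l (by omega)) (hDl.mono ?_ le_rfl)
      rw [tl_eq x (show l < d by omega)]
      refine le_of_eq ?_
      ac_rfl
    refine ⟨hDl', fun m hm => ?_⟩
    have hP : _root_.PS (tl x d (l + 1)) (l + 1) (Function.update x i (x l * y)) (i + 1) := by
      refine ⟨fun j hj => ?_, l - i, by omega, ?_⟩
      · rcases eq_or_ne j i with rfl | hj'
        · rw [Function.update_self]; exact Ideal.mul_mem_left _ _ hy
        · rw [Function.update_of_ne hj']; exact hxm j (by omega)
      · rw [seqSub_succ_span, hupR, Function.update_self, ← sup_assoc]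
        intro Q hQ
        have h1 : x l * y ∈ Q.asIdeal := hQ (Ideal.mem_sup_right (Ideal.mem_span_singleton_self _))
        have h2 : tl x d (l + 1) ⊔ seqSub R x i ≤ Q.asIdeal := le_sup_left.trans hQ
        rcases Q.2.mem_or_mem h1 with h3 | h3
        · obtain ⟨_, n', hn, h4⟩ := (h.PS_tl ht (show l ≤ d by omega)).prefix (show i ≤ l by omega)
          obtain rfl : n' = l - i := by omega
          refine h4 Q ?_
          rw [tl_eq x (show l < d by omega), sup_assoc]
          exact sup_le ((Ideal.span_singleton_le_iff_mem _).2 h3) h2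
        · exact hDl' Q (sup_le h2 ((Ideal.span_singleton_le_iff_mem _).2 h3))
    have hle : tl x d (l + 1) • (⊤ : Submodule R M) ≤ tl x d l • ⊤ := by
      rw [tl_smul_eq (show l < d by omega)]; exact le_sup_right
    have h1 := ih m (sup_le_sup_left hle _ hm)
    rw [tl_smul_eq (show l < d by omega), sup_comm (LinearMap.range _), ← sup_assoc] at h1
    obtain ⟨a, ha, b, ⟨z, rfl⟩, hab⟩ := Submodule.mem_sup.1 h1
    change a + x l • z = x k • m at hab
    have h2 : (x l * y) • z ∈ seqSub M x i ⊔ tl x d (l + 1) • (⊤ : Submodule R M) := by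
      have : (x l * y) • z = x k • y • m - y • a := by
        rw [mul_comm, mul_smul, eq_sub_of_add_eq' hab, smul_sub, smul_comm y]
      rw [this]
      exact Submodule.sub_mem _ (Submodule.smul_mem _ _ hm) (Submodule.smul_mem _ _ ha)
    have h3 := h.kap l (by omega) (by omega) _ i hP z
    rw [hup, Function.update_self] at h3
    rw [← hab]
    exact Submodule.add_mem _ ha (h3 h2)

lemma Good.colon (ht : 1 ≤ t) (h : Good M t d x 0) {i k : ℕ} (hik : i ≤ k) (hk : k < d) {y : R} (hy : y ∈ 𝔪)
    (hD : Dle (tl x d (k + 1) ⊔ seqSub R x i ⊔ Ideal.span {y}) (k - i)) (m : M) (hm : y • m ∈ seqSub M x i) :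
    x k • m ∈ seqSub M x i := by
  have := (h.colon_tl ht hik hk hy hD (l := d) hk le_rfl).2 m (Submodule.mem_sup_left hm)
  rwa [tl_self, Submodule.bot_smul, sup_bot_eq] at this

lemma Good.Dle_mid (ht : 1 ≤ t) (h : Good M t d x 0) {i k : ℕ} (hik : i ≤ k) (hk : k < d) :
    Dle (tl x d (k + 1) ⊔ seqSub R x i ⊔ Ideal.span {x k}) (k - i) := by
  obtain ⟨_, n', hn, h4⟩ := (h.PS_tl ht (show k ≤ d by omega)).prefix hik
  obtain rfl : n' = k - i := by omega
  refine h4.mono ?_ le_rfl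
  rw [tl_eq x hk]
  refine le_of_eq ?_
  ac_rfl

lemma Good.dSeq (ht : 1 ≤ t) (h : Good M t d x 0) : DSeq M x d := by
  intro i k hik hk m hm
  refine h.colon ht hik hk (y := x i * x k)
    (Ideal.mul_mem_left _ _ (Ideal.pow_le_self (by omega) (h.mem k (by omega) hk))) (fun Q hQ => ?_) m
    (by rwa [mul_smul])
  have h1 : x i * x k ∈ Q.asIdeal := hQ (Ideal.mem_sup_right (Ideal.mem_span_singleton_self _))
  have h2 : tl x d (k + 1) ⊔ seqSub R x i ≤ Q.asIdeal := le_sup_left.trans hQ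
  rcases Q.2.mem_or_mem h1 with h3 | h3
  · rcases hik.eq_or_lt with rfl | hik
    · exact h.Dle_mid ht le_rfl hk Q (sup_le h2 ((Ideal.span_singleton_le_iff_mem _).2 h3))
    obtain ⟨_, n', hn, h4⟩ := (h.PS_tl ht (show k + 1 ≤ d by omega)).prefix (show i + 1 ≤ k + 1 by omega)
    obtain rfl : n' = k - i := by omega
    refine h4 Q ?_
    rw [seqSub_succ_span, ← sup_assoc]
    exact sup_le h2 ((Ideal.span_singleton_le_iff_mem _).2 h3)
  · exact h.Dle_mid ht hik hk Q (sup_le h2 ((Ideal.span_singleton_le_iff_mem _).2 h3))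

lemma Good.pow_colon (ht : 1 ≤ t) (h : Good M t d x 0) {k : ℕ} (hk : k < d) (n : ℕ) (m : M)
    (hm : x k ^ n • m = 0) : x k • m = 0 := by
  have hk' := Ideal.pow_le_self (by omega) (h.mem k (by omega) hk) 
  have := h.colon ht (Nat.zero_le k) hk (y := x k ^ (n + 1)) (by rw [pow_succ]; exact Ideal.mul_mem_left _ _ hk')
    (fun Q hQ => ?_) m (by rw [pow_succ', mul_smul, hm, smul_zero]; exact zero_mem _)
  · rw [seqSub_zero] at this; exact (Submodule.mem_bot R).1 this
  · have h1 : x k ^ (n + 1) ∈ Q.asIdeal := hQ (Ideal.mem_sup_right (Ideal.mem_span_singleton_self _))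
    exact h.Dle_mid ht (Nat.zero_le k) hk Q (sup_le (le_sup_left.trans hQ)
      ((Ideal.span_singleton_le_iff_mem _).2 (Q.2.mem_of_pow_mem _ h1)))

end TailDSeq

end

noncomputable section

section Core
variable {R : Type u} [CommRing R] [IsLocalRing R] [IsNoetherianRing R]
local notation "𝔪" => maximalIdeal R

lemma mem_of_pow_of_colon_le {M : Type u} [AddCommGroup M] [Module R M] {A B : Submodule R M}
    (h : ∀ m ∈ B, (∀ r ∈ 𝔪, r • m ∈ A) → m ∈ A) (k : ℕ) : ∀ m ∈ B, (∀ r ∈ 𝔪 ^ k, r • m ∈ A) → m ∈ A := by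
  induction k with
  | zero => intro m _ hm; simpa using hm 1 (by simp)
  | succ k ih =>
    intro m hB hm
    refine ih m hB fun r hr => h _ (B.smul_mem r hB) fun s hs => ?_
    rw [← mul_smul]
    exact hm _ (by rw [pow_succ']; exact Ideal.mul_mem_mul hs hr)

lemma pow_smul_mem_of_cl_le {M : Type u} [AddCommGroup M] [Module R M] (n : ℕ) : ∀ {A B : Submodule R M}, FC A →
    A ≤ B → cl A ≤ cl B + n → ∀ r ∈ 𝔪 ^ n, ∀ m ∈ B, r • m ∈ A := by
  induction n with
  | zero =>
    intro A B hA hAB hc r _ m hm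
    rw [eq_of_cl_le hA hAB hc]
    exact B.smul_mem r hm
  | succ n ih =>
    intro A B hA hAB hc r hr m hm
    have hA' : A ≤ B ⊓ modColon R A 𝔪 := le_inf hAB fun a ha s _ => A.smul_mem s ha
    by_cases hlt : cl A ≤ cl (B ⊓ modColon R A 𝔪)
    · have heq := eq_of_cl_le hA hA' hlt
      obtain ⟨k, hk⟩ := hA.exists_pow
      exact A.smul_mem r (mem_of_pow_of_colon_le (B := B) (fun m hm h => by rw [heq]; exact ⟨hm, h⟩) k m hm
        fun r hr => hk r hr m)
    · have h1 := ih (hA.mono hA') inf_le_left (by omega)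
      rw [pow_succ'] at hr
      refine Submodule.mul_induction_on hr (fun s hs r hr => ?_) fun r s hr hs => ?_
      · rw [mul_smul]; exact (h1 r hr m hm).2 s hs
      · rw [add_smul]; exact A.add_mem hr hs

/-- The upper bound for `-e_1` controls the last but one difference of colengths. -/
lemma hDiff_sub_le {U : Ideal R} {k : ℕ} (hann : Dle (Module.annihilator R U) (k + 1)) {x : ℕ → R}
    (hx : PS ⊥ (k + 2) x (k + 2)) (hDS : DSeq (R ⧸ U) x (k + 2)) {I : Ideal R}
    (hqI : seqSub R x (k + 2) ≤ I) (hI : ∀ n, I ^ (n + 1) ≤ seqSub R x (k + 2) ^ n)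
    (hmI : ∀ n, 𝔪 * I ^ (n + 1) ≤ seqSub R x (k + 2) ^ (n + 1)) {z : R} (hz : z ∈ 𝔪) {e : ℕ → ℤ}
    (he : ∃ N, ∀ n ≥ N, (cl (I ^ (n + 1)) : ℤ) = HP (k + 2) e n) {B : ℤ} (hB : -e 1 ≤ B) :
    hDiff (R ⧸ U) x (k + 2) (k + 1) - hDiff (R ⧸ U) x (k + 2) k ≤
      cl (Ideal.span {z} ⊔ seqSub R x (k + 2) : Ideal R) + B := by
  obtain ⟨N, he⟩ := he
  set q : Ideal R := seqSub R x (k + 2) with hqd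
  have hq : FC q := hx.finite_colength
  have hqn : ∀ n, FC (q ^ n) := fun n => by
    have := FC_powSub (M := R) hq n
    rwa [powSub, ← hqd, smul_eq_mul, Ideal.mul_top] at this
  have hle : ∀ n, q ^ n ≤ I ^ n := fun n => Ideal.pow_right_mono hqI n
  obtain ⟨K, hK⟩ := hDS.hilbert_approx hq
  obtain ⟨L, hL⟩ := exists_cl_powSub_le_of_Dle (N := U) hx hann
  set α : ℤ := (cl (powSub (R ⧸ U) x (k + 2) 1) : ℤ) - hDiff (R ⧸ U) x (k + 2) (k + 1)
  set β : ℤ := hDiff (R ⧸ U) x (k + 2) (k + 1) - hDiff (R ⧸ U) x (k + 2) k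
  set 𝔟 : Ideal R := Ideal.span {z} ⊔ q
  have h𝔟 : FC 𝔟 := hq.mono le_sup_right
  have hup := le_of_HP_le (e := e) (k := k) (a := α) (b := β + L) (K := K) ⟨N, fun n hn => by
    rw [← he n hn]
    have h1 : cl (I ^ (n + 1)) ≤ cl (q ^ (n + 1)) := cl_mono (hqn _) (hle _)
    have h2 := cl_eq_add (hqn (n + 1)) (U.subtype : U →ₗ[R] R)
    rw [Submodule.range_subtype, ← cl_smul_top_quot] at h2
    have h3 : cl (Submodule.comap (U.subtype : U →ₗ[R] R) (q ^ (n + 1))) ≤ cl (powSub U x (k + 2) (n + 1)) := by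
      refine cl_mono (FC_powSub hq _) (Submodule.smul_le.2 fun r hr m _ => ?_)
      change r * (m : R) ∈ q ^ (n + 1)
      exact Ideal.mul_mem_right _ _ hr
    have h4 := hL n
    have h5 := (abs_le.1 (hK n)).2
    have h6 : cl (q ^ (n + 1) • ⊤ : Submodule R (R ⧸ U)) = cl (powSub (R ⧸ U) x (k + 2) (n + 1)) := rfl
    rw [h6] at h2
    zify at h1 h2 h3 h4
    rw [add_mul]
    linarith⟩
  have hlo := le_of_le_HP (e := e) (k := k) (a := α) (b := β - cl 𝔟) (K := -K) ⟨N, fun n hn => by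
    rw [← he n hn]
    have h1 := cl_map (hqn (n + 1)) (mulM R z) (hqn n)
    obtain ⟨l, hl, hlq⟩ := exists_list_span_pow x (k + 1) n
    have hlq' : Submodule.span R {g | g ∈ l} = q ^ n := hlq.symm
    have hmap : Submodule.map (mulM R z) (q ^ n) ≤ q ^ n := by
      rintro _ ⟨a, ha, rfl⟩
      exact Ideal.mul_mem_left _ _ ha
    have h2 := cl_le_sup_span_list h𝔟 l (L := q ^ (n + 1) ⊔ Submodule.map (mulM R z) (q ^ n))
      ((hqn _).mono le_sup_left) (fun g hg r hr => by
        have hgq : g ∈ q ^ n := by rw [← hlq']; exact Submodule.subset_span hg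
        obtain ⟨a, ha, b, hb, rfl⟩ := Submodule.mem_sup.1 hr
        obtain ⟨c, rfl⟩ := Ideal.mem_span_singleton'.1 ha
        rw [add_smul]
        refine Submodule.add_mem _ (Submodule.mem_sup_right ?_) (Submodule.mem_sup_left ?_)
        · exact ⟨c * g, Ideal.mul_mem_left _ _ hgq, by change z * (c * g) = c * z * g; ring⟩
        · rw [pow_succ']; exact Ideal.mul_mem_mul hb hgq)
    rw [hlq', hl, sup_assoc (q ^ (n + 1)), sup_of_le_right hmap, sup_of_le_right (Ideal.pow_le_pow_right (Nat.le_succ n) : q ^ (n + 1) ≤ q ^ n)] at h2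
    have h3 : cl (q ^ n ⊓ Submodule.comap (mulM R z) (q ^ (n + 1))) ≤ cl (I ^ (n + 1)) :=
      cl_mono ((hqn _).mono (hle _)) (le_inf (hI n) fun a ha => hmI n (Ideal.mul_mem_mul hz ha))
    have h4 : cl (powSub (R ⧸ U) x (k + 2) (n + 1)) ≤ cl (q ^ (n + 1)) := by
      change cl (q ^ (n + 1) • ⊤ : Submodule R (R ⧸ U)) ≤ _
      rw [cl_smul_top_quot]; exact cl_mono (hqn _) le_sup_left
    have h5 := (abs_le.1 (hK n)).1
    zify at h1 h2 h3 h4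
    rw [sub_mul β, mul_comm (cl 𝔟 : ℤ)]
    linarith⟩
  have he0 : e 0 = α := le_antisymm hup.1 hlo.1
  have h2 := hlo.2 he0
  linarith

lemma DSeq.pow_smul_of_hDiff_le {M : Type u} [AddCommGroup M] [Module R M] [Module.Finite R M] {x : ℕ → R} {k : ℕ} (h : DSeq M x (k + 2))
    (hq : FC (seqSub R x (k + 2) : Ideal R)) {B : ℕ}
    (hB : hDiff M x (k + 2) (k + 1) - hDiff M x (k + 2) k ≤ B) {b : R} (hb : b ∈ 𝔪 ^ B) {f : M}
    (hf : x (k + 1) • f ∈ seqSub M x (k + 1)) : ∃ g, x k • b • f - x k • x k • g ∈ seqSub M x k := by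
  have hmono : colSub M x k ≤ colSub M x (k + 1) := fun m hm =>
    (seqSub_le_succ M x k) (h k (k + 1) (by omega) (by omega) m (by
      rw [smul_comm]; exact Submodule.smul_mem _ _ hm))
  have h1 := pow_smul_mem_of_cl_le B (A := powSub M x (k + 2) 1 ⊔ colSub M x k)
    (B := powSub M x (k + 2) 1 ⊔ colSub M x (k + 1)) ((FC_powSub hq 1).mono le_sup_left)
    (sup_le_sup_left hmono _) (by unfold hDiff at hB; omega) b hb f (Submodule.mem_sup_right hf)
  obtain ⟨a, ha, g, hg, hag⟩ := Submodule.mem_sup.1 h1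
  rw [powSub_one] at ha
  have ha' : a ∈ colSub M x (k + 1) := by
    rw [eq_sub_of_add_eq hag]
    exact Submodule.sub_mem _ (Submodule.smul_mem _ b hf) (hmono hg)
  have ha2 := DSeq.inf h (by omega : k + 1 ≤ k + 2) le_rfl ha' ha
  obtain ⟨a', ha3, m, rfl⟩ := mem_seqSub_succ.1 ha2
  refine ⟨m, ?_⟩
  rw [← hag, smul_add, smul_add, add_right_comm, add_sub_cancel_right]
  exact Submodule.add_mem _ (Submodule.smul_mem _ _ ha3) hg

end Core

end

noncomputable section

section Stages
variable {R : Type u} [CommRing R] [IsLocalRing R] [IsNoetherianRing R]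
local notation "𝔪" => maximalIdeal R
variable (M : Type u) [AddCommGroup M] [Module R M]

/-- Up to a multiplier in `S`, colons of `x_{k+1}` with respect to `(x_i, …, x_k)` are controlled. -/
def Stage (k : ℕ) (x : ℕ → R) (i : ℕ) (S : Set R) : Prop :=
  ∀ f : M, x (k + 1) • f ∈ tl x (k + 1) i • (⊤ : Submodule R M) →
    ∃ c ∈ S, ∃ g, x k • c • f - x k • x k • g ∈ tl x k i • (⊤ : Submodule R M)

/-- Krull's intersection theorem for powers of `z`, up to multipliers in `S`. -/
def KrullProp (S : Set R) (z : R) : Prop :=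
  ∀ (N : Type u) [AddCommGroup N] [Module R N] [Module.Finite R N] (m : N),
    (∀ j : ℕ, ∃ c ∈ S, ∃ m', c • m = z ^ j • m') → ∃ c ∈ S, c • m = 0

variable {M}

lemma krullProp_singleton (b : R) {z : R} (hz : z ∈ 𝔪) : KrullProp {b} z := by
  intro N _ _ _ m h
  refine ⟨b, rfl, eq_zero_of_forall_pow hz fun j => ?_⟩
  obtain ⟨c, rfl, m', hm⟩ := h j
  exact ⟨m', hm.symm⟩

lemma krullProp_compl (P : PrimeSpectrum R) {z : R} (hz : z ∈ P.asIdeal) : KrullProp {c | c ∉ P.asIdeal} z := by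
  intro N _ _ _ m h
  obtain ⟨j, hj⟩ := Ideal.exists_pow_inf_eq_pow_smul (Ideal.span {z}) (Submodule.span R {m})
  obtain ⟨c, hc, m', hm⟩ := h (j + 1)
  have h1 : c • m ∈ (Ideal.span {z} ^ (j + 1) • ⊤ : Submodule R N) ⊓ Submodule.span R {m} := by
    refine ⟨?_, Submodule.smul_mem _ _ (Submodule.mem_span_singleton_self m)⟩
    rw [hm, Ideal.span_singleton_pow]
    exact Submodule.smul_mem_smul (Ideal.mem_span_singleton_self _) trivial
  rw [hj (j + 1) (by omega), Nat.add_sub_cancel_left, pow_one] at h1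
  have h2 := Submodule.smul_mono (le_refl (Ideal.span {z})) inf_le_right h1
  rw [Submodule.ideal_span_singleton_smul] at h2
  obtain ⟨y, hy, hyz⟩ := (Submodule.mem_smul_pointwise_iff_exists _ _ _).1 h2
  obtain ⟨r, rfl⟩ := Submodule.mem_span_singleton.1 hy
  refine ⟨c - z * r, fun hcz => hc ?_, ?_⟩
  · have := P.asIdeal.add_mem hcz (P.asIdeal.mul_mem_right r hz)
    rwa [sub_add_cancel] at this
  · rw [sub_smul, mul_smul, hyz, sub_self]

lemma Stage.congr {k : ℕ} {x y : ℕ → R} {i : ℕ} {S S' : Set R} (h : Stage M k x i S) (hS : S ⊆ S') (hi : i ≤ k)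
    (hxy : ∀ j, i ≤ j → x j = y j) : Stage M k y i S' := by
  intro f hf
  rw [← hxy (k + 1) (by omega), ← tl_congr hxy] at hf
  obtain ⟨c, hc, g, hg⟩ := h f hf
  rw [hxy k hi, tl_congr hxy] at hg
  exact ⟨c, hS hc, g, hg⟩

lemma Stage.step [Module.Finite R M] {k : ℕ} {x : ℕ → R} {i : ℕ} {S : Set R} (hi : i < k) (hS : KrullProp S (x i))
    (h : ∀ n ≥ 1, Stage M k (Function.update x i (x i ^ n)) i S) : Stage M k x (i + 1) S := by
  intro f hf
  obtain ⟨c, hc, hcf⟩ := hS (M ⧸ (tl x k (i + 1) • (⊤ : Submodule R M) ⊔ LinearMap.range (mulM M (x k * x k))))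
    (Submodule.mkQ _ (x k • f)) fun j => by
      have hne : ∀ l, i + 1 ≤ l → Function.update x i (x i ^ (j + 1)) l = x l := fun l hl =>
        Function.update_of_ne (by omega) _ _
      obtain ⟨c, hc, g, hg⟩ := h (j + 1) (by omega) f (by
        rw [hne (k + 1) (by omega), tl_smul_eq (by omega), tl_congr hne]
        exact Submodule.mem_sup_right hf)
      rw [hne k (by omega), tl_smul_eq hi, tl_congr hne, Function.update_self] at hg
      obtain ⟨_, ⟨a, rfl⟩, b, hb, hab⟩ := Submodule.mem_sup.1 hg
      refine ⟨c, hc, Submodule.mkQ _ (x i • a), ?_⟩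
      rw [← map_smul, ← map_smul, ← sub_eq_zero, ← map_sub, Submodule.mkQ_apply, Submodule.Quotient.mk_eq_zero]
      change x i ^ (j + 1) • a + b = _ at hab
      have e1 : c • x k • f - x i ^ j • x i • a = b + (x k * x k) • g := by
        rw [smul_comm c, ← mul_smul (x i ^ j), ← pow_succ, mul_smul, eq_sub_of_add_eq' hab]
        abel
      rw [e1]
      exact Submodule.add_mem _ (Submodule.mem_sup_left hb) (Submodule.mem_sup_right ⟨g, rfl⟩)
  rw [← map_smul, Submodule.mkQ_apply, Submodule.Quotient.mk_eq_zero] at hcf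
  obtain ⟨a, ha, _, ⟨g, rfl⟩, hag⟩ := Submodule.mem_sup.1 hcf
  refine ⟨c, hc, g, ?_⟩
  change a + (x k * x k) • g = _ at hag
  rw [smul_comm (x k) c, ← hag, mul_smul, add_sub_cancel_right]
  exact ha

lemma Stage.final [Module.Finite R M] {k : ℕ} {x : ℕ → R} {S : Set R} (hS : KrullProp S (x k))
    (hx : ∀ (n : ℕ) (m : M), x k ^ n • m = 0 → x k • m = 0)
    (h : ∀ n ≥ 1, Stage M k (Function.update x k (x k ^ n)) k S) (f : M) (hf : x (k + 1) • f = 0) :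
    ∃ c ∈ S, c • x k • f = 0 := by
  refine hS M (x k • f) fun j => ?_
  obtain ⟨c, hc, g, hg⟩ := h (j + 1) (by omega) f (by
    rw [Function.update_of_ne (by omega), hf]; exact zero_mem _)
  rw [tl_self, Submodule.bot_smul, Submodule.mem_bot, Function.update_self, ← smul_sub] at hg
  have := hx _ _ hg
  rw [smul_sub, sub_eq_zero] at this
  refine ⟨c, hc, x k • x k • g, ?_⟩
  rw [smul_comm, this, pow_succ]
  simp only [← mul_smul]
  congr 1
  ring

lemma exists_le_cd_of_mem {P : PrimeSpectrum R} {i : ℕ} (h : ((i + 2 : ℕ) : ℕ∞) ≤ cd P) {z : R} (hz : z ∈ 𝔪) :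
    ∃ Q : PrimeSpectrum R, P.asIdeal ≤ Q.asIdeal ∧ z ∈ Q.asIdeal ∧ ((i + 1 : ℕ) : ℕ∞) ≤ cd Q := by
  have : ¬ Dle (P.asIdeal ⊔ Ideal.span {z}) i := fun hD => by
    have h1 := (Dle_of_sup_span hz hD) P le_rfl
    have h2 := h.trans h1
    norm_cast at h2
    omega
  unfold Dle at this
  push Not at this
  obtain ⟨Q, hQ, hlt⟩ := this
  exact ⟨Q, le_sup_left.trans hQ, hQ (Ideal.mem_sup_right (Ideal.mem_span_singleton_self _)), by
    push_cast; exact Order.add_one_le_of_lt hlt⟩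

/-- The induction over the stages. -/
lemma exists_stage (hres : IsHomImageOfCM R) [Module.Finite R M] {t k : ℕ} (ht : 1 ≤ t)
    (hdim : ringKrullDim R = (k + 2 : ℕ))
    (hbase : ∀ x : ℕ → R, Good M t (k + 2) x 0 → ∃ B : ℕ, ∀ b ∈ 𝔪 ^ B, ∀ n ≥ 1,
      Stage M k (Function.update x 0 (x 0 ^ n)) 0 {b}) (i : ℕ) : i ≤ k → ∀ x : ℕ → R, Good M t (k + 2) x i →
      ∀ P : PrimeSpectrum R, ((i + 1 : ℕ) : ℕ∞) ≤ cd P →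
        ∃ S : Set R, (∀ c ∈ S, c ∉ P.asIdeal) ∧ KrullProp S (x i) ∧ ∀ n ≥ 1, Stage M k (Function.update x i (x i ^ n)) i S := by
  induction i with
  | zero =>
    intro _ x hx P hP
    obtain ⟨B, hB⟩ := hbase x hx
    obtain ⟨b, hb, hbP⟩ : ∃ b ∈ 𝔪 ^ B, b ∉ P.asIdeal := by
      by_contra hcon
      push Not at hcon
      have h1 : 𝔪 ≤ P.asIdeal := P.2.le_of_pow_le (n := B) hcon
      have h2 : cd P ≤ (0 : ℕ) := Dle_zero_of_pow (R := R) (𝔞 := 𝔪) (n := 1) (by simp) P h1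
      have h3 := hP.trans h2
      norm_cast at h3
    exact ⟨{b}, by rintro _ rfl; exact hbP,
      krullProp_singleton b (Ideal.pow_le_self (by omega) (hx.mem 0 le_rfl (by omega))), hB b hb⟩
  | succ i ih =>
    intro hi x hx P hP
    have hxm : x (i + 1) ∈ 𝔪 := Ideal.pow_le_self (by omega) (hx.mem (i + 1) le_rfl (by omega))
    obtain ⟨P', hPP, hxP, hcd⟩ := exists_le_cd_of_mem hP hxm
    refine ⟨{c | c ∉ P'.asIdeal}, fun c hc hcP => hc (hPP hcP), krullProp_compl P' hxP, fun n hn => ?_⟩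
    obtain ⟨z, -, hz⟩ := (hx.pow (by omega) hn).extend hres hdim (by omega : i < k + 2) ht ⊤
      (fun Q _ h => Q.2.ne_top (top_le_iff.1 h))
    obtain ⟨S, hS, hK, hst⟩ := ih (by omega) _ hz P' hcd
    refine (Stage.step (by omega) hK hst).congr hS hi fun j hj => ?_
    rw [Function.update_of_ne (by omega)]

lemma Good.stage (hres : IsHomImageOfCM R) [Module.Finite R M] {t k : ℕ} (ht : 1 ≤ t)
    (hdim : ringKrullDim R = (k + 2 : ℕ))
    (hbase : ∀ x : ℕ → R, Good M t (k + 2) x 0 → ∃ B : ℕ, ∀ b ∈ 𝔪 ^ B, ∀ n ≥ 1,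
      Stage M k (Function.update x 0 (x 0 ^ n)) 0 {b}) {s : ℕ} (hs : 1 ≤ s) (hsk : s ≤ k) {x : ℕ → R}
    (hx : Good M t (k + 2) x s) (P : PrimeSpectrum R) (hP : (s : ℕ∞) ≤ cd P) : Stage M k x s {c | c ∉ P.asIdeal} := by
  obtain ⟨s, rfl⟩ : ∃ s', s = s' + 1 := ⟨s - 1, by omega⟩
  obtain ⟨z, -, hz⟩ := hx.extend hres hdim (by omega : s < k + 2) ht ⊤ (fun Q _ h => Q.2.ne_top (top_le_iff.1 h))
  obtain ⟨S, hS, hK, hst⟩ := exists_stage hres ht hdim hbase s (by omega) _ hz P hP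
  refine (Stage.step (by omega) hK hst).congr hS hsk fun j hj => ?_
  rw [Function.update_of_ne (by omega)]

end Stages

end

noncomputable section

section Base
variable {R : Type u} [CommRing R] [IsLocalRing R] [IsNoetherianRing R]
local notation "𝔪" => maximalIdeal R

/-- Powers of `(q : 𝔪)` are close to powers of `q`. -/
def ColonPow (q : Ideal R) : Prop :=
  q ≤ colonIdeal R q ∧ (∀ n, colonIdeal R q ^ (n + 1) ≤ q ^ n) ∧ ∀ n, 𝔪 * colonIdeal R q ^ (n + 1) ≤ q ^ (n + 1)

lemma exists_stage_base {T : Ideal R} {k t : ℕ} (ht : 1 ≤ t) (hann : Dle (Module.annihilator R T) (k + 1))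
    (hcol : ∀ x : ℕ → R, PS ⊥ (k + 2) x (k + 2) → (∀ j < k + 2, x j ∈ 𝔪 ^ t) → ColonPow (seqSub R x (k + 2)))
    {B : ℤ} (hB : ∀ x : ℕ → R, Good (R ⧸ T) t (k + 2) x 0 → ∀ e : ℕ → ℤ,
      (∃ N, ∀ n ≥ N, (cl (colonIdeal R (seqSub R x (k + 2)) ^ (n + 1)) : ℤ) = HP (k + 2) e n) → -e 1 ≤ B)
    (x : ℕ → R) (hx : Good (R ⧸ T) t (k + 2) x 0) :
    ∃ B : ℕ, ∀ b ∈ 𝔪 ^ B, ∀ n ≥ 1, Stage (R ⧸ T) k (Function.update x 0 (x 0 ^ n)) 0 {b} := by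
  refine ⟨((cl (seqSub R x (k + 2)) : ℤ) + B).toNat, fun b hb n hn f hf => ⟨b, rfl, ?_⟩⟩
  have hx' := hx.pow (by omega) hn
  set y := Function.update x 0 (x 0 ^ n) with hy
  have hPS := hx'.PS ht
  obtain ⟨hqI, hI, hmI⟩ := hcol y hPS fun j hj => hx'.mem j (by omega) hj
  obtain ⟨e, he⟩ := exists_HP y (k + 2) _ hPS.finite_colength hqI hI
  have hz : x 0 ∈ 𝔪 := Ideal.pow_le_self (by omega) (hx.mem 0 le_rfl (by omega))
  have h1 := hDiff_sub_le hann hPS (hx'.dSeq ht) hqI hI hmI hz he (hB y hx' e he)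
  have h2 : cl (Ideal.span {x 0} ⊔ seqSub R y (k + 2) : Ideal R) ≤ cl (seqSub R x (k + 2)) := by
    refine cl_mono (hx.PS ht).finite_colength (seqSub_le_ideal fun j hj => ?_)
    rcases Nat.eq_zero_or_pos j with rfl | hj0
    · exact Ideal.mem_sup_left (Ideal.mem_span_singleton_self _)
    · refine Ideal.mem_sup_right ?_
      have : y j = x j := Function.update_of_ne (by omega) _ _
      rw [← this]
      exact mem_seqSub_self hj
  rw [tl_zero, ← seqSub_eq_smul_top] at hf ⊢
  exact (hx'.dSeq ht).pow_smul_of_hDiff_le hPS.finite_colength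
    (by have := Int.self_le_toNat ((cl (seqSub R x (k + 2)) : ℤ) + B); zify at h2; linarith) hb hf

end Base

end

noncomputable section

section Base
variable {R : Type u} [CommRing R] [IsLocalRing R] [IsNoetherianRing R]
local notation "𝔪" => maximalIdeal R

omit [IsLocalRing R] [IsNoetherianRing R] in
lemma exists_uniform_killer (P : PrimeSpectrum R) {N : Type u} [AddCommGroup N] [Module R N] [Module.Finite R N]
    (h : ∀ m : N, ∃ c ∉ P.asIdeal, c • m = 0) : ∃ c ∉ P.asIdeal, ∀ m : N, c • m = 0 := by
  have h1 := mt Module.mem_support_iff_of_finite.2 (Module.notMem_support_iff'.2 h)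
  obtain ⟨c, hc, hcP⟩ := Set.not_subset.1 h1
  exact ⟨c, hcP, fun m => Module.mem_annihilator.1 hc m⟩

omit [IsLocalRing R] in
lemma exists_uniform_multiplier (P : PrimeSpectrum R) {M : Type u} [AddCommGroup M] [Module R M] [Module.Finite R M]
    {A B : Submodule R M} (h : ∀ m ∈ B, ∃ c ∉ P.asIdeal, c • m ∈ A) : ∃ c ∉ P.asIdeal, ∀ m ∈ B, c • m ∈ A := by
  obtain ⟨c, hc, h1⟩ := exists_uniform_killer P (N := Submodule.map A.mkQ B) (by
    rintro ⟨_, m, hm, rfl⟩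
    obtain ⟨c, hc, hcm⟩ := h m hm
    refine ⟨c, hc, Subtype.ext ?_⟩
    change c • A.mkQ m = 0
    rw [← map_smul, Submodule.mkQ_apply, Submodule.Quotient.mk_eq_zero]
    exact hcm)
  refine ⟨c, hc, fun m hm => ?_⟩
  have h2 : c • A.mkQ m = 0 := congrArg Subtype.val (h1 ⟨_, m, hm, rfl⟩)
  rwa [← map_smul, Submodule.mkQ_apply, Submodule.Quotient.mk_eq_zero] at h2

lemma Good.exists_zero (hres : IsHomImageOfCM R) {M : Type u} [AddCommGroup M] [Module R M] [Module.Finite R M]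
    {t d : ℕ} (ht : 1 ≤ t) (hdim : ringKrullDim R = d) (j : ℕ) : ∀ {x : ℕ → R}, Good M t d x j → j ≤ d →
    ∃ y : ℕ → R, Good M t d y 0 ∧ ∀ i, j ≤ i → y i = x i := by
  induction j with
  | zero => exact fun {x} hx _ => ⟨x, hx, fun _ _ => rfl⟩
  | succ j ih =>
    intro x hx hj
    obtain ⟨z, -, hz⟩ := hx.extend hres hdim hj ht ⊤ fun Q _ h => Q.2.ne_top (top_le_iff.1 h)
    obtain ⟨y, hy, hyx⟩ := ih hz (by omega)
    exact ⟨y, hy, fun i hi => by rw [hyx i (by omega), Function.update_of_ne (by omega)]⟩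

/-- If the Chern numbers are bounded below, the unmixed component has dimension at most `d - 2`. -/
lemma Dle_annihilator_of_stage (hres : IsHomImageOfCM R) {U : Ideal R} {k t : ℕ} (ht : 1 ≤ t)
    (hdim : ringKrullDim R = (k + 2 : ℕ)) (hU : UnmixedData U (k + 2))
    (hbase : ∀ x : ℕ → R, Good (R ⧸ (⊥ : Ideal R)) t (k + 2) x 0 → ∃ B : ℕ, ∀ b ∈ 𝔪 ^ B, ∀ n ≥ 1,
      Stage (R ⧸ (⊥ : Ideal R)) k (Function.update x 0 (x 0 ^ n)) 0 {b}) : Dle (Module.annihilator R U) k := by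
  intro P hP
  by_contra hcon
  have hcd : ((k + 1 : ℕ) : ℕ∞) ≤ cd P := by
    push_cast; exact Order.add_one_le_of_lt (not_le.1 hcon)
  obtain ⟨z, hz, h1⟩ := (Good.last (R ⧸ (⊥ : Ideal R)) t hU.dim (fun _ => 0)).extend hres hdim
    (by omega : k + 1 < k + 2) ht (Module.annihilator R U) fun Q hQ h => (hU.kill Q h).ne hQ
  obtain ⟨z', -, h2⟩ := h1.extend hres hdim (by omega : k < k + 2) ht ⊤ fun Q _ h => Q.2.ne_top (top_le_iff.1 h)
  set x := Function.update (Function.update (fun _ => (0 : R)) (k + 1) z) k z' with hx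
  have hx1 : x (k + 1) = z := by
    rw [hx, Function.update_of_ne (by omega), Function.update_self]
  obtain ⟨y, hy, hyx⟩ := h2.exists_zero hres ht hdim k (by omega)
  have hxk : x k ∉ P.asIdeal := fun hmem => by
    refine hcon (h2.dim k le_rfl (by omega) P ?_)
    rw [tl_eq _ (by omega), tl_eq _ (by omega), tl_self, hx1]
    refine sup_le ?_ (sup_le ?_ bot_le)
    · exact (Ideal.span_singleton_le_iff_mem _).2 hmem
    · exact (Ideal.span_singleton_le_iff_mem _).2 (hP hz)
  obtain ⟨S, hS, hK, hst⟩ := exists_stage hres ht hdim hbase k le_rfl x h2 P hcd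
  obtain ⟨c, hc, hcU⟩ := exists_uniform_killer P (N := U) fun f => by
    obtain ⟨c, hc, h⟩ := Stage.final hK (fun n m hm => by
      rw [← hyx k le_rfl] at hm ⊢
      exact hy.pow_colon ht (by omega) n m hm) hst (Submodule.mkQ (⊥ : Ideal R) (f : R)) (by
        rw [← map_smul, hx1]
        have : z • (f : R) = 0 := congrArg Subtype.val (Module.mem_annihilator.1 hz f)
        rw [this, map_zero])
    rw [← map_smul, ← map_smul, Submodule.mkQ_apply, Submodule.Quotient.mk_eq_zero, Submodule.mem_bot] at h
    refine ⟨c * x k, fun hh => (P.2.mem_or_mem hh).elim (hS c hc) hxk, Subtype.ext ?_⟩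
    change (c * x k) • (f : R) = 0
    rw [mul_smul, h]
  exact hc (hP (Module.mem_annihilator.2 hcU))

end Base

end

noncomputable section

section Localized
variable {R : Type u} [CommRing R] (P : PrimeSpectrum R) {M : Type u} [AddCommGroup M] [Module R M]

lemma mem_seqSub_of_smul_mem (x : ℕ → R) {c : R} (hc : c ∉ P.asIdeal) (i : ℕ) :
    ∀ n : LocalizedModule P.asIdeal.primeCompl M, c • n ∈ seqSub (LocalizedModule P.asIdeal.primeCompl M) x i →
      n ∈ seqSub (LocalizedModule P.asIdeal.primeCompl M) x i := by
  have hinj : ∀ a b : LocalizedModule P.asIdeal.primeCompl M, c • a = c • b → a = b := fun a b h =>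
    IsLocalizedModule.smul_injective (S := P.asIdeal.primeCompl) (LocalizedModule.mkLinearMap P.asIdeal.primeCompl M)
      ⟨c, show c ∈ P.asIdeal.primeCompl from hc⟩ h
  have hsurj : ∀ a : LocalizedModule P.asIdeal.primeCompl M, ∃ b, c • b = a := fun a =>
    ((Module.End.isUnit_iff _).1 (IsLocalizedModule.map_units
      (LocalizedModule.mkLinearMap P.asIdeal.primeCompl M) ⟨c, show c ∈ P.asIdeal.primeCompl from hc⟩)).2 a
  induction i with
  | zero =>
    intro n hn
    rw [seqSub_zero] at hn ⊢
    exact (Submodule.mem_bot R).2 (hinj _ _ (by rw [(Submodule.mem_bot R).1 hn, smul_zero]))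
  | succ i ih =>
    intro n hn
    obtain ⟨a, ha, b, hab⟩ := mem_seqSub_succ.1 hn
    obtain ⟨a, rfl⟩ := hsurj a
    obtain ⟨b, rfl⟩ := hsurj b
    refine mem_seqSub_succ.2 ⟨a, ih a ha, b, hinj _ _ ?_⟩
    rw [← hab, smul_add, smul_comm c]

lemma smul_mk_self (m : M) (s : P.asIdeal.primeCompl) :
    (s : R) • LocalizedModule.mk m s = LocalizedModule.mkLinearMap P.asIdeal.primeCompl M m := by
  rw [LocalizedModule.smul'_mk, LocalizedModule.mkLinearMap_apply, LocalizedModule.mk_eq]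
  exact ⟨1, by simp [Submonoid.smul_def]⟩

lemma mkLinearMap_mem_seqSub {x : ℕ → R} (i : ℕ) : ∀ {m : M}, m ∈ seqSub M x i →
    LocalizedModule.mkLinearMap P.asIdeal.primeCompl M m ∈ seqSub (LocalizedModule P.asIdeal.primeCompl M) x i := by
  induction i with
  | zero =>
    intro m hm
    rw [seqSub_zero] at hm ⊢
    rw [(Submodule.mem_bot R).1 hm, map_zero]
    exact zero_mem _
  | succ i ih =>
    intro m hm
    obtain ⟨a, ha, b, rfl⟩ := mem_seqSub_succ.1 hm
    rw [map_add, map_smul]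
    exact mem_seqSub_succ.2 ⟨_, ih ha, _, rfl⟩

lemma mk_mem_seqSub_iff {x : ℕ → R} (i : ℕ) : ∀ {m : M} {s : P.asIdeal.primeCompl},
    (LocalizedModule.mk m s ∈ seqSub (LocalizedModule P.asIdeal.primeCompl M) x i ↔
      ∃ c ∉ P.asIdeal, c • m ∈ seqSub M x i) := by
  have hback : ∀ {m : M} {s : P.asIdeal.primeCompl}, (∃ c ∉ P.asIdeal, c • m ∈ seqSub M x i) →
      LocalizedModule.mk m s ∈ seqSub (LocalizedModule P.asIdeal.primeCompl M) x i := by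
    rintro m s ⟨c, hc, hm⟩
    refine mem_seqSub_of_smul_mem P x s.2 i _ ?_
    rw [smul_mk_self P]
    refine mem_seqSub_of_smul_mem P x hc i _ ?_
    rw [← map_smul]
    exact mkLinearMap_mem_seqSub P i hm
  intro m s
  refine ⟨?_, hback⟩
  clear hback
  intro hm
  suffices H : ∀ n ∈ seqSub (LocalizedModule P.asIdeal.primeCompl M) x i, ∃ a ∈ seqSub M x i,
      ∃ s : P.asIdeal.primeCompl, n = LocalizedModule.mk a s by
    obtain ⟨a, ha, t, hat⟩ := H _ hm
    obtain ⟨u, hu⟩ := LocalizedModule.mk_eq.1 hat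
    refine ⟨u * t, (u * t).2, ?_⟩
    rw [mul_smul]
    change u • t • m ∈ _
    rw [hu]
    exact Submodule.smul_mem _ (u : R) (Submodule.smul_mem _ (_ : R) ha)
  clear hm
  induction i with
  | zero =>
    intro n hn
    rw [seqSub_zero] at hn
    refine ⟨0, zero_mem _, 1, ?_⟩
    rw [(Submodule.mem_bot R).1 hn, LocalizedModule.zero_mk]
  | succ i ih =>
    intro n hn
    obtain ⟨a, ha, b, rfl⟩ := mem_seqSub_succ.1 hn
    obtain ⟨a, ha', s, rfl⟩ := ih a ha
    induction b using LocalizedModule.induction_on with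
    | _ b t =>
      refine ⟨t • a + s • x i • b, mem_seqSub_succ.2 ⟨t • a, Submodule.smul_mem _ (t : R) ha', s • b, ?_⟩, s * t, ?_⟩
      · rw [smul_comm]
      · rw [LocalizedModule.smul'_mk, LocalizedModule.mk_add_mk]

end Localized

end

noncomputable section

section Quot
variable {R : Type u} [CommRing R] [IsLocalRing R] [IsNoetherianRing R]
local notation "𝔪" => maximalIdeal R

omit [IsLocalRing R] in
lemma exists_mul_pow_mem_of_minimalPrimes {𝔞 P : Ideal R} (hP : P ∈ 𝔞.minimalPrimes) :
    ∃ c ∉ P, ∃ K : ℕ, 1 ≤ K ∧ ∀ p ∈ P ^ K, c * p ∈ 𝔞 := by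
  haveI := hP.1.1
  have hfin := 𝔞.finite_minimalPrimes_of_isNoetherianRing
  obtain ⟨c, hc, hcP⟩ : ∃ c ∈ sInf (𝔞.minimalPrimes \ {P}), c ∉ P := by
    by_contra hcon
    push Not at hcon
    have h1 : (hfin.sdiff (t := {P})).toFinset.inf id ≤ P := by
      refine le_trans (le_sInf fun Q hQ => ?_) (show sInf (𝔞.minimalPrimes \ {P}) ≤ P from hcon)
      exact Finset.inf_le (f := id) ((hfin.sdiff (t := {P})).mem_toFinset.2 hQ)
    obtain ⟨Q, hQ, hQP⟩ := (Ideal.IsPrime.inf_le' inferInstance).1 h1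
    have hQ' := (hfin.sdiff (t := {P})).mem_toFinset.1 hQ
    exact hQ'.2 (le_antisymm hQP (hP.2 hQ'.1.1 hQP))
  obtain ⟨n, hn⟩ := 𝔞.exists_radical_pow_le_of_fg (IsNoetherian.noetherian _)
  have h1 : Ideal.span {c} * P ≤ 𝔞.radical := by
    rw [← Ideal.sInf_minimalPrimes]
    refine le_sInf fun Q hQ => ?_
    by_cases hQP : Q = P
    · rw [hQP]; exact Ideal.mul_le_right
    · refine (Ideal.mul_le_left (I := Ideal.span {c}) (J := P)).trans ((Ideal.span_singleton_le_iff_mem _).2 ?_)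
      exact (Submodule.mem_sInf.1 hc) Q ⟨hQ, hQP⟩
  refine ⟨c ^ (n + 1), fun h => hcP (Ideal.IsPrime.mem_of_pow_mem inferInstance _ h), n + 1, by omega, fun p hp => ?_⟩
  refine (Ideal.pow_le_pow_right (Nat.le_succ n)).trans hn (Ideal.pow_right_mono h1 (n + 1) ?_)
  rw [mul_pow, Ideal.span_singleton_pow]
  exact Ideal.mul_mem_mul (Ideal.mem_span_singleton_self _) hp

lemma tl_add (x : ℕ → R) (s l : ℕ) : tl x (s + l) s = seqSub R (fun j => x (s + j)) l := by
  rw [tl, seqSub_eq, smul_eq_mul, Ideal.mul_top]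
  congr 1
  ext r
  constructor
  · rintro ⟨j, ⟨h1, h2⟩, rfl⟩
    exact ⟨j - s, by simp; omega, by simp [h1]⟩
  · rintro ⟨j, hj, rfl⟩
    exact ⟨s + j, ⟨by omega, by simpa using hj⟩, rfl⟩

/-- Good tails inside a given ideal. -/
lemma exists_good_tail (hres : IsHomImageOfCM R) (M : Type u) [AddCommGroup M] [Module R M] [Module.Finite R M] {t d : ℕ} (ht : 1 ≤ t)
    (hdim : ringKrullDim R = d) (hd : Dle (⊥ : Ideal R) d) (J : Ideal R) {s : ℕ}
    (hJ : ∀ Q : PrimeSpectrum R, (s : ℕ∞) < cd Q → ¬ J ≤ Q.asIdeal) (l : ℕ) (hl : s + l = d) :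
    ∀ i, i ≤ l → ∃ x : ℕ → R, Good M t d x (d - i) ∧ ∀ j, d - i ≤ j → j < d → x j ∈ J := by
  intro i
  induction i with
  | zero => exact fun _ => ⟨fun _ => 0, Good.last M t hd _, fun j h1 h2 => by omega⟩
  | succ i ih =>
    intro hi
    obtain ⟨x, hx, hxJ⟩ := ih (by omega)
    obtain ⟨j, hj⟩ : ∃ j, d - i = j + 1 := ⟨d - i - 1, by omega⟩
    have hj' : d - (i + 1) = j := by omega
    rw [hj] at hx hxJ
    obtain ⟨z, hz, h⟩ := hx.extend hres hdim (by omega) ht J fun Q hQ => hJ Q (by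
      rw [hQ]; exact_mod_cast (show s < j + 1 by omega))
    refine ⟨_, by rw [hj']; exact h, fun l h1 h2 => ?_⟩
    rcases eq_or_ne l j with rfl | hne
    · rwa [Function.update_self]
    · rw [Function.update_of_ne hne]; exact hxJ l (by omega) h2

lemma exists_pow_le_killer (hres : IsHomImageOfCM R) {U 𝔞 : Ideal R} {k t : ℕ} (ht : 1 ≤ t)
    (hdim : ringKrullDim R = (k + 2 : ℕ)) (hU : UnmixedData U (k + 2)) (h𝔞 : KillerData U (k + 2) (R ⧸ U) 𝔞)
    (hbase : ∀ x : ℕ → R, Good (R ⧸ U) t (k + 2) x 0 → ∃ B : ℕ, ∀ b ∈ 𝔪 ^ B, ∀ n ≥ 1,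
      Stage (R ⧸ U) k (Function.update x 0 (x 0 ^ n)) 0 {b}) : ∃ n, 𝔪 ^ n ≤ 𝔞 := by
  refine pow_le_of_Dle_zero fun Q hQ => ?_
  by_contra hQ0
  obtain ⟨P', hP', hPQ⟩ := Ideal.exists_minimalPrimes_le hQ
  obtain ⟨P, rfl⟩ : ∃ P : PrimeSpectrum R, P.asIdeal = P' := ⟨⟨P', hP'.1.1⟩, rfl⟩
  have h𝔞P : 𝔞 ≤ P.asIdeal := hP'.1.2
  obtain ⟨s, hs⟩ := ENat.ne_top_iff_exists.1 (cd_ne_top P)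
  have hcd : cd P = (s : ℕ) := hs.symm
  have hs1 : 1 ≤ s := by
    have h1 : ((0 : ℕ) : ℕ∞) < cd P := lt_of_lt_of_le (not_le.1 hQ0) (cd_le hPQ)
    rw [hcd] at h1
    exact_mod_cast h1
  have hs2 : s < k + 2 := by
    have h1 := hU.dim P bot_le
    rw [hcd] at h1
    have h2 : s ≤ k + 2 := by exact_mod_cast h1
    refine lt_of_le_of_ne h2 ?_
    rintro rfl
    exact h𝔞.top P hcd h𝔞P
  obtain ⟨l, hl⟩ : ∃ l, s + (l + 1) = k + 2 := ⟨k + 1 - s, by omega⟩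
  obtain ⟨c, hc, K, hK1, hcK⟩ := exists_mul_pow_mem_of_minimalPrimes hP'
  set K' := K * 3 ^ (l + 1) with hK'
  set E := 2 ^ (l + 1) * K' with hE
  have hK'1 : K ≤ K' := Nat.le_mul_of_pos_right _ (by positivity)
  have hEK : ∀ j < l + 1, 2 ^ j * K ≤ E := fun j hj =>
    Nat.mul_le_mul (Nat.pow_le_pow_right (by omega) hj.le) hK'1
  obtain ⟨y, hy, hyP⟩ := exists_good_tail hres (R ⧸ U) ht hdim hU.dim (P.asIdeal ^ E) (s := s)
    (fun Q hQ h => by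
      have h1 := cd_le (P := P) (Q := Q) (Q.2.le_of_pow_le h)
      rw [hcd] at h1
      exact absurd hQ (not_lt.2 h1)) (l + 1) hl (l + 1) le_rfl
  rw [← hl, Nat.add_sub_cancel, hl] at hy hyP
  set w : ℕ → R := fun j => y (s + j) with hw
  have hwE : ∀ j < l + 1, w j ∈ P.asIdeal ^ E := fun j hj => hyP _ (by omega) (by omega)
  have hE0 : E ≠ 0 := by
    have := hEK 0 (by omega)
    simp at this; omega
  have hwP : ∀ j < l + 1, w j ∈ P.asIdeal := fun j hj => Ideal.pow_le_self hE0 (hwE j hj)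
  have hPm : P.asIdeal ≤ 𝔪 := le_maximalIdeal P.2.ne_top
  have hPS : ∀ n : ℕ → ℕ, PS U (k + 2) (fun j => w j ^ (n j + 1)) (l + 1) := fun n => by
    refine ⟨fun j hj => Ideal.pow_mem_of_mem _ (hPm (hwP j hj)) _ (by omega), s, hl.symm, fun Q hQ => ?_⟩
    refine hy.dim s le_rfl (by omega) Q ?_
    rw [← hl, tl_add]
    refine seqSub_le_ideal fun j hj => Q.2.mem_of_pow_mem (n j + 1) ?_
    have h1 := mem_seqSub_self (y := fun j => w j ^ (n j + 1)) hj
    exact hQ (Ideal.mem_sup_right h1)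
  have hreg : ∀ m : R ⧸ U, w 0 • m = 0 → m = 0 := fun m hm => by
    by_contra hne
    obtain ⟨Q, hQ, hwQ⟩ := exists_ass_of_ne_zero hne hm
    have h1 := (hPS fun _ => 0).cd_lt (l := 0) (by omega) (hU.le_top Q (hU.ass Q hQ)) (fun j hj => by
      obtain rfl : j = 0 := by omega
      simpa using hwQ)
    rw [hU.ass Q hQ] at h1
    exact absurd h1 (by simp)
  have hcolon : ∀ j < l + 1, ∀ m : R ⧸ U, w j • m ∈ seqSub (R ⧸ U) w j → ∃ c' ∉ P.asIdeal, c' • m ∈ seqSub (R ⧸ U) w j := by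
    rcases Nat.eq_zero_or_pos l with rfl | hl0
    · intro j hj m hm
      obtain rfl : j = 0 := by omega
      rw [seqSub_zero] at hm
      refine ⟨1, fun h => P.2.ne_top ((Ideal.eq_top_iff_one _).2 h), ?_⟩
      rw [hreg m ((Submodule.mem_bot R).1 hm), smul_zero]
      exact zero_mem _
    obtain ⟨h, rfl⟩ : ∃ h, l = h + 1 := ⟨l - 1, by omega⟩
    have hstage := hy.stage hres ht hdim hbase hs1 (by omega) P (by rw [hcd])
    have htl : ∀ i, tl y (s + i) s • (⊤ : Submodule R (R ⧸ U)) = seqSub (R ⧸ U) w i := fun i => by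
      rw [tl_add, ← seqSub_eq_smul_top]
    have hmain := LCoh.regular_of_top P.asIdeal (M := LocalizedModule P.asIdeal.primeCompl (R ⧸ U)) (k := K') (h := h) w
      (fun n j hj r hr m hm => by
        induction m using LocalizedModule.induction_on with
        | _ m a =>
          rw [LocalizedModule.smul'_mk, mk_mem_seqSub_iff] at hm ⊢
          obtain ⟨c₁, hc₁, hm⟩ := hm
          rw [smul_comm] at hm
          refine ⟨c ^ 3 ^ (h + 2) * c₁, fun hh => (P.2.mem_or_mem hh).elim (fun hh => hc (P.2.mem_of_pow_mem _ hh)) hc₁, ?_⟩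
          have h1 : c ^ 3 ^ (h + 2) * r ∈ 𝔞 ^ 3 ^ j := by
            have h2 : Ideal.span {c} * P.asIdeal ^ K ≤ 𝔞 := by
              rw [Ideal.span_singleton_mul_le_iff]
              exact hcK
            refine Ideal.pow_le_pow_right (Nat.pow_le_pow_right (by omega) hj.le) (Ideal.pow_right_mono h2 _ ?_)
            rw [mul_pow, Ideal.span_singleton_pow, ← pow_mul]
            exact Ideal.mul_mem_mul (Ideal.mem_span_singleton_self _) hr
          have h3 := h𝔞.colon _ j ((hPS n).prefix (show j + 1 ≤ h + 1 + 1 by omega)) _ h1 _ hm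
          convert h3 using 1
          simp only [← mul_smul]
          congr 1
          ring)
      hwP hwE
      (fun m hm => by
        induction m using LocalizedModule.induction_on with
        | _ m a =>
          have h1 : LocalizedModule.mk (w 0 • m) a ∈ seqSub (LocalizedModule P.asIdeal.primeCompl (R ⧸ U)) w 0 := by
            rw [← LocalizedModule.smul'_mk, hm]; exact zero_mem _
          obtain ⟨c₁, hc₁, h2⟩ := (mk_mem_seqSub_iff P 0).1 h1
          rw [seqSub_zero, Submodule.mem_bot, smul_comm] at h2
          have h3 : LocalizedModule.mk m a ∈ seqSub (LocalizedModule P.asIdeal.primeCompl (R ⧸ U)) w 0 :=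
            (mk_mem_seqSub_iff P 0).2 ⟨c₁, hc₁, by rw [hreg _ h2]; exact zero_mem _⟩
          rw [seqSub_zero] at h3
          exact (Submodule.mem_bot R).1 h3)
      (fun m hm => by
        induction m using LocalizedModule.induction_on with
        | _ m a =>
          rw [LocalizedModule.smul'_mk, mk_mem_seqSub_iff] at hm
          obtain ⟨c₁, hc₁, hm⟩ := hm
          rw [smul_comm] at hm
          have hwk : w (h + 1) = y (k + 1) := congrArg y (show s + (h + 1) = k + 1 by omega)
          have hwk' : w h = y k := congrArg y (show s + h = k by omega)
          obtain ⟨c₂, hc₂, g, hg⟩ := hstage (c₁ • m) (by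
            rw [← hwk, show k + 1 = s + (h + 1) by omega, htl]; exact hm)
          rw [← hwk', show k = s + h by omega, htl, ← smul_sub] at hg
          have hu : c₂ * c₁ ∉ P.asIdeal := fun hh => (P.2.mem_or_mem hh).elim hc₂ hc₁
          refine ⟨LocalizedModule.mk (c₂ • c₁ • m - w h • g) (⟨c₂ * c₁, hu⟩ * a), ?_, ?_⟩
          · rw [LocalizedModule.smul'_mk, mk_mem_seqSub_iff]
            exact ⟨1, fun hh => P.2.ne_top ((Ideal.eq_top_iff_one _).2 hh), by rwa [one_smul]⟩
          · have h5 : LocalizedModule.mk m a - LocalizedModule.mk (c₂ • c₁ • m - w h • g) (⟨c₂ * c₁, hu⟩ * a) =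
                LocalizedModule.mk (w h • g) ((⟨c₂ * c₁, hu⟩ : P.asIdeal.primeCompl) * a) := by
              rw [sub_eq_iff_eq_add, IsLocalizedModule.mk_eq_mk', IsLocalizedModule.mk_eq_mk', IsLocalizedModule.mk_eq_mk',
                ← IsLocalizedModule.mk'_add, add_sub_cancel, ← IsLocalizedModule.mk_eq_mk', ← IsLocalizedModule.mk_eq_mk',
                LocalizedModule.mk_eq]
              refine ⟨1, ?_⟩
              simp only [Submonoid.smul_def, ← mul_smul]
              congr 1
              simp
              ring
            rw [h5, mk_mem_seqSub_iff]
            exact ⟨1, fun hh => P.2.ne_top ((Ideal.eq_top_iff_one _).2 hh), by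
              rw [one_smul]; exact smul_mem_seqSub (by omega) g⟩)
    intro j hj m hm
    have h1 := hmain j hj (LocalizedModule.mk m 1) (by
      rw [LocalizedModule.smul'_mk, mk_mem_seqSub_iff]
      exact ⟨1, fun hh => P.2.ne_top ((Ideal.eq_top_iff_one _).2 hh), by rwa [one_smul]⟩)
    exact (mk_mem_seqSub_iff P j).1 h1
  refine h𝔞.local_colon P s (l + 1) K c w hcd hl hc hcK
    (fun j hj => Ideal.pow_le_pow_right (hEK j hj) (hwE j hj)) (fun j hj => ?_) h𝔞P
  exact exists_uniform_multiplier P (A := seqSub (R ⧸ U) w j)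
    (B := Submodule.comap (mulM (R ⧸ U) (w j)) (seqSub (R ⧸ U) w j)) (hcolon j hj)

end Quot

end

noncomputable section

section Unmixed
variable {R : Type u} [CommRing R]

lemma moduleDim_le_iff (M : Type u) [AddCommGroup M] [Module R M] (n : ℕ) :
    moduleDim R M ≤ n ↔ Dle (Module.annihilator R M) n := Dle_iff _ _

lemma moduleDim_lt_iff (M : Type u) [AddCommGroup M] [Module R M] (n : ℕ) :
    moduleDim R M < (n + 1 : ℕ) ↔ Dle (Module.annihilator R M) n := by
  rw [← moduleDim_le_iff]
  push_cast
  exact ENat.WithBot.lt_add_one_iff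

lemma mul_annihilator_le_of_sup {I J K : Ideal R} {𝔞 𝔟 : Ideal R} (hI : ∀ a ∈ 𝔞, ∀ i ∈ I, a * i = 0)
    (hJ : ∀ b ∈ 𝔟, ∀ j ∈ J, ∀ a ∈ 𝔞, a * (b * j) = 0) (hK : K ≤ I ⊔ J) :
    𝔞 * 𝔟 ≤ Module.annihilator R K := by
  rw [Ideal.mul_le]
  intro a ha b hb
  refine Module.mem_annihilator.2 fun z => Subtype.ext ?_
  obtain ⟨i, hi, j, hj, hij⟩ := Submodule.mem_sup.1 (hK z.2)
  change a * b * (z : R) = 0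
  rw [← hij, mul_add, mul_right_comm, hI a ha i hi, mul_assoc, hJ b hb j hj a ha]
  simp

variable [IsLocalRing R] [IsNoetherianRing R]

lemma Dle_bot_of_dim {d : ℕ} (hdim : ringKrullDim R = d) : Dle (⊥ : Ideal R) d := by
  rw [← Dle_iff, ← hdim]
  exact ringKrullDim_quotient_le _

lemma unmixedComponent_mem {n : ℕ} (hdim : ringKrullDim R = (n + 1 : ℕ)) :
    Dle (Module.annihilator R (unmixedComponent R)) n ∧
      ∀ J : Ideal R, Dle (Module.annihilator R J) n → J ≤ unmixedComponent R := by
  have hset : ∀ J : Ideal R, J ∈ {J : Ideal R | moduleDim R ↥J < ringKrullDim R} ↔ Dle (Module.annihilator R J) n :=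
    fun J => by rw [Set.mem_ofPred_eq, hdim, moduleDim_lt_iff]
  refine ⟨?_, fun J hJ => le_sSup ((hset J).2 hJ)⟩
  rw [← hset]
  refine CompleteLattice.WellFoundedGT.isSupClosedCompact (Ideal R) inferInstance _ ⟨⊥, (hset _).2 ?_⟩ ?_
  · intro P hP
    refine absurd (top_le_iff.1 (le_trans ?_ hP)) P.2.ne_top
    intro r _
    exact Module.mem_annihilator.2 fun z => Subsingleton.elim _ _
  · intro I hI J hJ
    rw [hset] at hI hJ ⊢
    intro P hP
    have h1 := mul_annihilator_le_of_sup (K := I ⊔ J) (I := I) (J := J) (𝔞 := Module.annihilator R I)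
      (𝔟 := Module.annihilator R J) (fun a ha i hi => congrArg Subtype.val (Module.mem_annihilator.1 ha ⟨i, hi⟩))
      (fun b hb j hj a _ => by
        have : b * j = 0 := congrArg Subtype.val (Module.mem_annihilator.1 hb ⟨j, hj⟩)
        rw [this, mul_zero]) le_rfl
    rcases P.2.mul_le.1 (h1.trans hP) with h | h
    · exact hI P h
    · exact hJ P h

lemma unmixedData {n : ℕ} (hdim : ringKrullDim R = (n + 1 : ℕ)) : UnmixedData (unmixedComponent R) (n + 1) := by
  have hD := Dle_bot_of_dim hdim
  obtain ⟨hU, hmax⟩ := unmixedComponent_mem hdim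
  have hlt : ∀ P : PrimeSpectrum R, cd P ≤ n → cd P < (n + 1 : ℕ) := fun P h =>
    lt_of_le_of_lt h (by exact_mod_cast Nat.lt_succ_self n)
  refine ⟨hD, ?_, fun P hP r hr => ?_, fun Q hQ => ?_, fun P hP => hlt P (hU P hP)⟩
  · by_contra hcon
    push Not at hcon
    have h1 : Dle (⊥ : Ideal R) n := fun P hP => by
      have h2 := lt_of_le_of_ne (hD P hP) (hcon P)
      push_cast at h2
      exact Order.le_of_lt_add_one h2
    rw [← Dle_iff, ringKrullDim_eq_of_ringEquiv (RingEquiv.quotientBot R), hdim] at h1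
    have h2 : n + 1 ≤ n := by exact_mod_cast h1
    omega
  · by_contra hrP
    have h1 : Module.annihilator R (unmixedComponent R) ≤ P.asIdeal := fun a ha =>
      (P.2.mem_or_mem (show a * r ∈ P.asIdeal by
        have : a * r = 0 := congrArg Subtype.val (Module.mem_annihilator.1 ha ⟨r, hr⟩)
        rw [this]; exact zero_mem _)).resolve_right hrP
    exact absurd hP (hlt P (hU P h1)).ne
  · obtain ⟨_, a, ha⟩ := mem_ass_iff.1 hQ
    obtain ⟨a, rfl⟩ := Ideal.Quotient.mk_surjective a
    have haQ : ∀ q ∈ Q.asIdeal, q * a ∈ unmixedComponent R := fun q hq => by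
      have := (ha q).1 hq
      rw [← Ideal.Quotient.eq_zero_iff_mem]
      exact this
    by_contra hne
    have hQn : cd Q ≤ n := by
      have h2 := lt_of_le_of_ne (hD Q bot_le) hne
      push_cast at h2
      exact Order.le_of_lt_add_one h2
    have h1 := mul_annihilator_le_of_sup (K := unmixedComponent R ⊔ Ideal.span {a}) (I := unmixedComponent R)
      (J := Ideal.span {a}) (𝔞 := Module.annihilator R (unmixedComponent R)) (𝔟 := Q.asIdeal)
      (fun a ha i hi => congrArg Subtype.val (Module.mem_annihilator.1 ha ⟨i, hi⟩))
      (fun q hq j hj b hb => by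
        obtain ⟨c, rfl⟩ := Ideal.mem_span_singleton'.1 hj
        exact congrArg Subtype.val (Module.mem_annihilator.1 hb ⟨q * (c * a), by
          rw [mul_left_comm]; exact Ideal.mul_mem_left _ _ (haQ q hq)⟩)) le_rfl
    have h2 := hmax _ (fun P hP => by
      rcases P.2.mul_le.1 (h1.trans hP) with h | h
      · exact hU P h
      · exact (cd_le h).trans hQn)
    have h3 : a ∈ unmixedComponent R := h2 (Ideal.mem_sup_right (Ideal.mem_span_singleton_self _))
    have h4 : (1 : R) ∈ Q.asIdeal := (ha 1).2 (by
      rw [one_smul]; exact Ideal.Quotient.eq_zero_iff_mem.2 h3)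
    exact Q.2.ne_top ((Ideal.eq_top_iff_one _).2 h4)

end Unmixed

end

noncomputable section

section GeneralizedCM
variable {R : Type u} [CommRing R] [IsLocalRing R] [IsNoetherianRing R]
local notation "𝔪" => maximalIdeal R

lemma PS.pow_full {T : Ideal R} {d : ℕ} {x : ℕ → R} (h : PS T d x d) (n : ℕ → ℕ) :
    PS T d (fun l => x l ^ (n l + 1)) d := by
  obtain ⟨hx, n', hn, hD⟩ := h
  obtain rfl : n' = 0 := by omega
  refine PS.of_full (fun j hj => Ideal.pow_mem_of_mem _ (hx j hj) _ (Nat.succ_pos _)) fun P hP => hD P ?_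
  refine sup_le (le_sup_left.trans hP) (seqSub_le_ideal fun j hj => P.2.mem_of_pow_mem (n j + 1) ?_)
  exact hP (Ideal.mem_sup_right (mem_seqSub_self (y := fun l => x l ^ (n l + 1)) hj))

lemma PS.map_full {S : Type u} [CommRing S] [IsLocalRing S] [IsNoetherianRing S] {f : R →+* S} (hf : Function.Surjective f)
    {d : ℕ} {x : ℕ → R} (h : PS ⊥ d x d) : PS ⊥ d (fun l => f (x l)) d := by
  have hm : (maximalIdeal S).comap f = maximalIdeal R :=
    ((IsLocalRing.local_hom_TFAE f).out 0 4).1 (IsLocalHom.of_surjective f hf)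
  obtain ⟨hx, n', hn, hD⟩ := h
  obtain rfl : n' = 0 := by omega
  refine PS.of_full (fun j hj => ?_) ?_
  · rw [← hm] at hx
    exact hx j hj
  · rw [← Dle_comap hf]
    refine hD.mono (sup_le bot_le (seqSub_le_ideal fun j hj => ?_)) le_rfl
    exact Ideal.mem_sup_right (mem_seqSub_self (y := fun l => f (x l)) hj)

lemma Dle_maximalIdeal : Dle 𝔪 0 := Dle_zero_of_pow (n := 1) (by rw [pow_one])

lemma exists_PS_full {d : ℕ} (h : Dle (⊥ : Ideal R) d) : ∃ x : ℕ → R, PS ⊥ d x d :=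
  (exists_PS_in h le_rfl Dle_maximalIdeal (add_zero d).symm).imp fun _ hx => hx.1

lemma UnmixedData.ringKrullDim_quotient {U : Ideal R} {n : ℕ} (hU : UnmixedData U (n + 1)) :
    ringKrullDim (R ⧸ U) = (n + 1 : ℕ) := by
  refine le_antisymm ((Dle_iff U (n + 1)).2 (hU.dim.mono bot_le le_rfl)) (not_lt.1 fun h => ?_)
  push_cast at h
  exact hU.not_Dle (Nat.lt_succ_self n) ((Dle_iff U n).1 (ENat.WithBot.lt_add_one_iff.1 h))

lemma exists_Hk_of_isGeneralizedCM (h : IsGeneralizedCM R) {d : ℕ} (hd : ringKrullDim R = d) :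
    ∃ k, LCoh.Hk 𝔪 R k d := by
  have h1 : ∀ i, ∃ k, i < d → ∀ r ∈ 𝔪 ^ k, ∀ z : LCoh.H 𝔪 R i, r • z = 0 := by
    intro i
    by_cases hi : i < d
    · have hfin : IsFiniteLength R (Hmod R R i) := h i (by rw [hd]; exact_mod_cast hi)
      have hfin' : IsFiniteLength R (LCoh.H 𝔪 R i) :=
        hfin.of_surjective (f := (LCoh.HEquiv 𝔪 R i).symm.toLinearMap) (LCoh.HEquiv 𝔪 R i).symm.surjective
      have hb : FC (⊥ : Submodule R (LCoh.H 𝔪 R i)) :=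
        hfin'.of_surjective (f := Submodule.mkQ _) (Submodule.mkQ_surjective _)
      obtain ⟨k, hk⟩ := hb.exists_pow
      exact ⟨k, fun _ r hr z => (Submodule.mem_bot R).1 (hk r hr z)⟩
    · exact ⟨0, fun h => absurd h hi⟩
  choose k hk using h1
  refine ⟨(Finset.range d).sup k, fun i hi r hr z => hk i hi r ?_ z⟩
  exact Ideal.pow_le_pow_right (Finset.le_sup (Finset.mem_range.2 hi)) hr

lemma exists_Hk_quotient {U : Ideal R} [IsLocalRing (R ⧸ U)] {n : ℕ} (hU : UnmixedData U (n + 1))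
    (h : IsGeneralizedCM (R ⧸ U)) : ∃ a, LCoh.Hk 𝔪 (R ⧸ U) a (n + 1) := by
  obtain ⟨k, hk⟩ := exists_Hk_of_isGeneralizedCM h hU.ringKrullDim_quotient
  have hf : Function.Surjective (Ideal.Quotient.mk U) := Ideal.Quotient.mk_surjective
  have hm : (maximalIdeal (R ⧸ U)).comap (Ideal.Quotient.mk U) = 𝔪 :=
    ((IsLocalRing.local_hom_TFAE _).out 0 4).1 (IsLocalHom.of_surjective _ hf)
  obtain ⟨x, hx⟩ := exists_PS_full hU.dim
  refine ⟨2 ^ (n + 1) * k, LCoh.Hk_of_colon 𝔪 _ (n + 1) (R ⧸ U) x hx.1 fun p j hj r hr m hmem => ?_⟩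
  have hy := (hx.pow_full p).map_full hf
  have htr : ∀ m : R ⧸ U, m ∈ seqSub (R ⧸ U) (fun l => x l ^ (p l + 1)) j ↔
      m ∈ seqSub (R ⧸ U) (fun l => Ideal.Quotient.mk U (x l ^ (p l + 1))) j :=
    fun m => mem_seqSub_transfer (x := fun l => x l ^ (p l + 1))
      (y := fun l => Ideal.Quotient.mk U (x l ^ (p l + 1))) (fun _ _ _ => rfl) m
  rw [htr] at hmem ⊢
  refine colon_of_Hk_PS hk bot_le (hy.prefix (show j + 1 ≤ n + 1 from hj)) m hmem (Ideal.Quotient.mk U r) ?_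
  have h2 : (𝔪 ^ (2 ^ (n + 1) * k)).map (Ideal.Quotient.mk U) ≤ maximalIdeal (R ⧸ U) ^ (2 ^ j * k) := by
    rw [Ideal.map_pow]
    refine (Ideal.pow_right_mono ?_ _).trans (Ideal.pow_le_pow_right
      (Nat.mul_le_mul_right _ (Nat.pow_le_pow_right (by omega) hj.le)))
    rw [Ideal.map_le_iff_le_comap, hm]
  exact h2 (Ideal.mem_map_of_mem _ hr)

lemma isGeneralizedCM_quotient {U 𝔞 : Ideal R} [IsLocalRing (R ⧸ U)] {n : ℕ} (hU : UnmixedData U (n + 1))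
    (h𝔞 : KillerData U (n + 1) (R ⧸ U) 𝔞) {N : ℕ} (hN : 𝔪 ^ N ≤ 𝔞) : IsGeneralizedCM (R ⧸ U) := by
  have hf : Function.Surjective (Ideal.Quotient.mk U) := Ideal.Quotient.mk_surjective
  have hm : (maximalIdeal (R ⧸ U)).comap (Ideal.Quotient.mk U) = 𝔪 :=
    ((IsLocalRing.local_hom_TFAE _).out 0 4).1 (IsLocalHom.of_surjective _ hf)
  obtain ⟨x, hx⟩ := exists_PS_full hU.dim
  have hk : LCoh.Hk (maximalIdeal (R ⧸ U)) (R ⧸ U) (N * 3 ^ (n + 1)) (n + 1) := by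
    refine LCoh.Hk_of_colon _ _ (n + 1) (R ⧸ U) _ (hx.map_full hf).1 fun p j hj r hr m hmem => ?_
    have htr : ∀ m : R ⧸ U, m ∈ seqSub (R ⧸ U) (fun l => x l ^ (p l + 1)) j ↔
        m ∈ seqSub (R ⧸ U) (fun l => Ideal.Quotient.mk U (x l) ^ (p l + 1)) j :=
      fun m => mem_seqSub_transfer (fun l _ m => by
        change Ideal.Quotient.mk U (x l ^ (p l + 1)) * m = _
        rw [map_pow]; rfl) m
    obtain ⟨a, ha, rfl⟩ := exists_mem_pow_lift hf _ hr
    rw [hm] at ha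
    rw [← htr] at hmem ⊢
    refine h𝔞.colon _ j (((hx.mono bot_le).pow_full p).prefix hj) a ?_ m ?_
    · rw [pow_mul] at ha
      exact Ideal.pow_le_pow_right (Nat.pow_le_pow_right (by omega) hj.le) (Ideal.pow_right_mono hN _ ha)
    · have e : Ideal.Quotient.mk U (x j) ^ (p j + 1) • m = x j ^ (p j + 1) • m := by
        change _ = Ideal.Quotient.mk U (x j ^ (p j + 1)) * m
        rw [map_pow]; rfl
      rw [← e]
      exact hmem
  intro i hi
  rw [hU.ringKrullDim_quotient] at hi
  have hi' : i < n + 1 := by exact_mod_cast hi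
  have hfin := isFiniteLength_H (R := R ⧸ U) i (R ⧸ U) _ (LCoh.Hk.mono _ hk le_rfl (by omega))
  exact hfin.of_surjective (f := (LCoh.HEquiv (maximalIdeal (R ⧸ U)) (R ⧸ U) i).toLinearMap)
    (LCoh.HEquiv (maximalIdeal (R ⧸ U)) (R ⧸ U) i).surjective

end GeneralizedCM

end

noncomputable section

section ParameterIdeals
variable {R : Type u} [CommRing R]

lemma seqSub_eq_span (x : ℕ → R) (d : ℕ) : seqSub R x d = Ideal.span (Set.range fun i : Fin d => x i) := by
  rw [seqSub_eq, smul_eq_mul, Ideal.mul_top]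
  congr 1
  ext r
  constructor
  · rintro ⟨j, hj, rfl⟩
    exact ⟨⟨j, hj⟩, rfl⟩
  · rintro ⟨j, rfl⟩
    exact ⟨j, j.2, rfl⟩

lemma moduleDim_self : moduleDim R R = ringKrullDim R := by
  have h : Module.annihilator R R = ⊥ := by
    refine eq_bot_iff.2 fun r hr => ?_
    simpa using Module.mem_annihilator.1 hr 1
  rw [moduleDim, h, ringKrullDim_eq_of_ringEquiv (RingEquiv.quotientBot R)]

lemma moduleLength_quotient_iff {I : Ideal R} {L : ℕ} :
    moduleLength R (R ⧸ (I • (⊤ : Submodule R R))) = (L : WithBot ℕ∞) ↔ FC I ∧ cl I = L := by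
  have h1 : moduleLength R (R ⧸ (I • (⊤ : Submodule R R))) = ((Module.length R (R ⧸ I) : ℕ∞) : WithBot ℕ∞) := by
    have : (I • ⊤ : Submodule R R) = I := by simp
    rw [this, moduleLength, Module.coe_length]
  rw [h1]
  constructor
  · intro h
    have h2 : Module.length R (R ⧸ I) = (L : ℕ∞) := by exact_mod_cast h
    refine ⟨Module.length_ne_top_iff.1 (by rw [h2]; exact ENat.natCast_ne_top L), ?_⟩
    change (Module.length R (R ⧸ I)).toNat = L
    rw [h2]; rfl
  · rintro ⟨h, rfl⟩
    rw [h.length]; rfl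

lemma IsHilbCoeff.exists_cl_eq {I : Ideal R} {d : ℕ} {e : ℕ → ℤ} (h : IsHilbCoeff R I d e) :
    ∃ N, ∀ n ≥ N, (cl (I ^ (n + 1)) : ℤ) = HP d e n := by
  obtain ⟨N, h⟩ := h
  refine ⟨N, fun n hn => ?_⟩
  obtain ⟨L, h1, h2⟩ := h n hn
  rw [(moduleLength_quotient_iff.1 h1).2, h2, HP]

variable [IsLocalRing R] [IsNoetherianRing R]
local notation "𝔪" => maximalIdeal R

lemma FC.ideal_pow {I : Ideal R} (h : FC I) (n : ℕ) : FC (I ^ n : Ideal R) := by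
  obtain ⟨k, hk⟩ := h.exists_pow
  refine FC_of_pow (k := k * n) fun r hr m => Ideal.mul_mem_right _ _ ?_
  rw [pow_mul] at hr
  exact Ideal.pow_right_mono (fun r hr => by simpa using hk r hr 1) n hr

lemma isHilbCoeff_of_cl_eq {I : Ideal R} (hI : FC I) {d : ℕ} {e : ℕ → ℤ}
    (h : ∃ N, ∀ n ≥ N, (cl (I ^ (n + 1)) : ℤ) = HP d e n) : IsHilbCoeff R I d e := by
  obtain ⟨N, h⟩ := h
  exact ⟨N, fun n hn => ⟨_, moduleLength_quotient_iff.2 ⟨hI.ideal_pow _, rfl⟩, h n hn⟩⟩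

lemma Good.isCParamIdeal {M : Type u} [AddCommGroup M] [Module R M] {t d : ℕ} {x : ℕ → R} (ht : 1 ≤ t)
    (hdim : ringKrullDim R = d) (h : Good M t d x 0) : IsCParamIdeal R (seqSub R x d) := by
  have hPS := h.PS ht
  refine ⟨d, fun i => x i, ⟨⟨moduleDim_self.trans hdim, fun i => ?_, ?_⟩, fun i => ?_⟩, seqSub_eq_span x d⟩
  · exact (mem_maximalIdeal _).1 (hPS.1 i i.2)
  · rw [← seqSub_eq_span, smul_eq_mul, Ideal.mul_top]
    exact hPS.finite_colength
  · have e : (fun i : Fin d => x i) '' {j | i < j} = x '' {j | (i : ℕ) + 1 ≤ j ∧ j < d} := by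
      ext r
      constructor
      · rintro ⟨j, hj, rfl⟩
        exact ⟨j, ⟨hj, j.2⟩, rfl⟩
      · rintro ⟨j, ⟨hj, hjd⟩, rfl⟩
        exact ⟨⟨j, hjd⟩, hj, rfl⟩
    rw [e]
    exact h.csop i (Nat.zero_le _) i.2

lemma IsCParamIdeal.exists_PS {d t : ℕ} (hdim : ringKrullDim R = d) {q : Ideal R} (h : IsCParamIdeal R q)
    (hq : q ≤ 𝔪 ^ t) : ∃ x : ℕ → R, PS ⊥ d x d ∧ (∀ j < d, x j ∈ 𝔪 ^ t) ∧ q = seqSub R x d := by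
  obtain ⟨s, y, ⟨⟨hs, hy, hfin⟩, -⟩, rfl⟩ := h
  rw [moduleDim_self, hdim] at hs
  obtain rfl : d = s := by exact_mod_cast hs
  set x : ℕ → R := fun j => if h : j < d then y ⟨j, h⟩ else 0 with hx
  have hxy : ∀ j : Fin d, x j = y j := fun j => by simp [hx]
  have e : seqSub R x d = Ideal.span (Set.range y) := by
    rw [seqSub_eq_span]; simp_rw [hxy]
  rw [smul_eq_mul, Ideal.mul_top] at hfin
  refine ⟨x, PS.of_full (fun j hj => ?_) ?_, fun j hj => ?_, e.symm⟩
  · rw [show x j = y ⟨j, hj⟩ from hxy ⟨j, hj⟩]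
    exact (mem_maximalIdeal _).2 (hy _)
  · rw [bot_sup_eq, e]
    obtain ⟨k, hk⟩ := FC.exists_pow (N := Ideal.span (Set.range y)) hfin
    exact Dle_zero_of_pow (n := k) fun r hr => by simpa using hk r hr 1
  · rw [show x j = y ⟨j, hj⟩ from hxy ⟨j, hj⟩]
    exact hq (Ideal.subset_span ⟨_, rfl⟩)

lemma exists_neg_e_one_le {k t : ℕ} (ht : 1 ≤ t) (hdim : ringKrullDim R = (k + 2 : ℕ))
    (hcol : ∀ x : ℕ → R, PS ⊥ (k + 2) x (k + 2) → (∀ j < k + 2, x j ∈ 𝔪 ^ t) → ColonPow (seqSub R x (k + 2)))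
    (hfin : {z : ℤ | ∃ q : Ideal R, IsCParamIdeal R q ∧ q ≤ 𝔪 ^ t ∧
      ∃ e : ℕ → ℤ, IsHilbCoeff R (colonIdeal R q) (k + 2) e ∧ z = e 1}.Finite) :
    ∃ B : ℤ, ∀ (M : Type u) [AddCommGroup M] [Module R M] (x : ℕ → R), Good M t (k + 2) x 0 → ∀ e : ℕ → ℤ,
      (∃ N, ∀ n ≥ N, (cl (colonIdeal R (seqSub R x (k + 2)) ^ (n + 1)) : ℤ) = HP (k + 2) e n) → -e 1 ≤ B := by
  obtain ⟨B, hB⟩ := hfin.bddBelow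
  refine ⟨-B, fun M _ _ x hx e he => neg_le_neg (hB ⟨_, hx.isCParamIdeal ht hdim, ?_, e, ?_, rfl⟩)⟩
  · exact seqSub_le_ideal fun j hj => hx.mem j (Nat.zero_le _) hj
  · refine isHilbCoeff_of_cl_eq ((hx.PS ht).finite_colength.mono ?_) he
    exact (hcol x (hx.PS ht) fun j hj => hx.mem j (Nat.zero_le _) hj).1

end ParameterIdeals

end

/-- For `dim R = d ≥ 2` and `u` the unmixed component of `R`, TFAE:
(1) `R/u` is generalized Cohen-Macaulay and `dim u ≤ d - 2`;
(2) there is `t ≥ 1` such that `Ω^t_1(R) = {e_1(q :_R m, R) : q C-parameter ideal ⊆ m^t}`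
is finite. -/
theorem statement_11 {R : Type u} [CommRing R] [IsLocalRing R] [IsNoetherianRing R]
    [IsLocalRing (R ⧸ unmixedComponent R)]
    (hres : IsHomImageOfCM R)
    (d : ℕ) (hd : 2 ≤ d) (hdim : ringKrullDim R = (d : WithBot ℕ∞)) :
    (IsGeneralizedCM (R ⧸ unmixedComponent R) ∧
        moduleDim R ↥(unmixedComponent R) ≤ ((d - 2 : ℕ) : WithBot ℕ∞)) ↔
      ∃ t : ℕ, 1 ≤ t ∧
        {z : ℤ | ∃ q : Ideal R, IsCParamIdeal R q ∧ q ≤ maximalIdeal R ^ t ∧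
          ∃ e : ℕ → ℤ, IsHilbCoeff R (colonIdeal R q) d e ∧ z = e 1}.Finite := by
  obtain ⟨k, rfl⟩ := Nat.exists_eq_add_of_le' hd
  have hU : UnmixedData (unmixedComponent R) (k + 2) := unmixedData hdim
  rw [Nat.add_sub_cancel, moduleDim_le_iff]
  constructor
  · rintro ⟨hgcm, hann⟩
    obtain ⟨a, ha⟩ := exists_Hk_quotient hU hgcm
    obtain ⟨t, ht, B, hB⟩ := exists_e_one_bound hres hdim hU ha hann
    refine ⟨t, ht, (Set.finite_Icc (-B) B).subset ?_⟩
    rintro _ ⟨q, hq, hqt, e, he, rfl⟩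
    obtain ⟨x, hx, hxt, rfl⟩ := hq.exists_PS hdim hqt
    exact abs_le.1 (hB x hx hxt e he.exists_cl_eq)
  · rintro ⟨t₁, ht₁, hfin⟩
    obtain ⟨t₀, ht₀, hcol₀⟩ := exists_colonIdeal_pow hres (by omega) hdim hU
    obtain ⟨t, ht⟩ : ∃ t, t = max t₀ t₁ := ⟨_, rfl⟩
    have h1 : 1 ≤ t := by omega
    have hcol : ∀ x : ℕ → R, PS ⊥ (k + 2) x (k + 2) → (∀ j < k + 2, x j ∈ maximalIdeal R ^ t) →
        ColonPow (seqSub R x (k + 2)) := fun x hx hxt =>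
      hcol₀ x hx fun j hj => Ideal.pow_le_pow_right (by omega) (hxt j hj)
    obtain ⟨B, hB⟩ := exists_neg_e_one_le h1 hdim hcol (hfin.subset (by
      rintro _ ⟨q, hq, hqt, h⟩
      exact ⟨q, hq, hqt.trans (Ideal.pow_le_pow_right (by omega)), h⟩))
    have hann₀ : Dle (Module.annihilator R (⊥ : Ideal R)) (k + 1) := fun P hP =>
      absurd (top_le_iff.1 (le_trans (fun r _ => Module.mem_annihilator.2 fun z => Subsingleton.elim _ _) hP)) P.2.ne_top
    have hannU := (unmixedComponent_mem (n := k + 1) hdim).1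
    obtain ⟨P, hP⟩ := hU.exists_top
    have hUm := (hU.le_top P hP).trans (le_maximalIdeal P.2.ne_top)
    obtain ⟨𝔞, h𝔞⟩ := exists_killerData hres hUm (hU.dim.mono bot_le le_rfl) hdim le_rfl (R ⧸ unmixedComponent R)
      (by
        intro c hc m
        obtain ⟨m, rfl⟩ := Ideal.Quotient.mk_surjective m
        exact Ideal.Quotient.eq_zero_iff_mem.2 (Ideal.mul_mem_right _ _ hc))
    obtain ⟨N, hN⟩ := exists_pow_le_killer hres h1 hdim hU h𝔞 fun x hx =>
      exists_stage_base h1 hannU hcol (hB _) x hx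
    exact ⟨isGeneralizedCM_quotient hU h𝔞 hN, Dle_annihilator_of_stage hres h1 hdim hU fun x hx =>
      exists_stage_base h1 hann₀ hcol (hB _) x hx⟩
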